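/- Let Y ⊆ ℙ^r (over ℂ) be a smooth, non-projectable subvariety with dim(Y) > (2/3)(r − 1). Then Y has the irreducible secant cone (ISC) property: a generic fibre of the natural map f : I_Y → ℙ^r is irreducible. -/

import Mathlib

/- Background for [Lopez-Ran, "On the irreducibility of secant cones, and an application
to linear normality"]: a concrete model of complex projective geometry.  Projective space
`ℙ^r(ℂ)` is the projectivization of `ℂ^{r+1}`, equipped with the Zariski topology;
subvarieties are (closed, irreducible) subsets; tangent spaces, smoothness, the invariant
`σ(Y)`, secant varieties/cones, generic linear projections and their double loci, and
linear normality are all defined from first principles below. -/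

open MvPolynomial Set

noncomputable section

/-- Complex projective space of lines in `ℂⁿ` (so of projective dimension `n - 1`). -/
abbrev PrV (n : ℕ) : Type := Projectivization ℂ (Fin n → ℂ)

/-- `ℙ^r` over `ℂ`. -/
abbrev Pr (r : ℕ) : Type := PrV (r + 1)

/-- The vanishing locus in projective space of a polynomial, defined via all nonzero lifts
(for a homogeneous polynomial this is the usual projective zero locus). -/
def pZero {n : ℕ} (f : MvPolynomial (Fin n) ℂ) : Set (PrV n) :=
  {x | ∀ v : Fin n → ℂ, ∀ hv : v ≠ 0, Projectivization.mk ℂ v hv = x → eval v f = 0}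

/-- The Zariski topology on complex projective space. -/
instance prTop (n : ℕ) : TopologicalSpace (PrV n) :=
  TopologicalSpace.generateFrom {U | ∃ f : MvPolynomial (Fin n) ℂ, U = (pZero f)ᶜ}

/-- The Zariski topology on the affine space `ℂ^σ`. -/
def affTop (σ : Type) : TopologicalSpace (σ → ℂ) :=
  TopologicalSpace.generateFrom {U | ∃ f : MvPolynomial σ ℂ, U = {v | eval v f ≠ 0}}

/-- A property holds generically (on a dense Zariski-open set) on the affine space `ℂ^σ`. -/
def GenericAff {σ : Type} (P : (σ → ℂ) → Prop) : Prop :=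
  ∃ U : Set (σ → ℂ), @IsOpen _ (affTop σ) U ∧ @Dense _ (affTop σ) U ∧ ∀ v ∈ U, P v

/-- The projective line through two points (their linear span); for `x = y` this is `{x}`. -/
def lineThrough {n : ℕ} (x y : PrV n) : Set (PrV n) :=
  {z | z.rep ∈ Submodule.span ℂ ({x.rep, y.rep} : Set (Fin n → ℂ))}

/-- The projective linear subspace associated to a linear subspace `W ⊆ ℂⁿ`. -/
def projSub {n : ℕ} (W : Submodule ℂ (Fin n → ℂ)) : Set (PrV n) := {x | x.rep ∈ W}

/-- The secant variety of `Y`: the (closure of the) union of all lines spanned by pairs of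
distinct points of `Y`, i.e. the union of all secant lines of `Y`. -/
def secantVariety {n : ℕ} (Y : Set (PrV n)) : Set (PrV n) :=
  closure (⋃ x ∈ Y, ⋃ y ∈ Y, ⋃ _ : x ≠ y, lineThrough x y)

/-- `Y` is projectable if its secant variety is not all of projective space. -/
def Projectable {n : ℕ} (Y : Set (PrV n)) : Prop := secantVariety Y ≠ Set.univ

/-- Hyperplanes in projective space. -/
def IsHyperplane {n : ℕ} (H : Set (PrV n)) : Prop :=
  ∃ φ : (Fin n → ℂ) →ₗ[ℂ] ℂ, φ ≠ 0 ∧ H = {x | φ x.rep = 0}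

/-- A set in projective space is nondegenerate if it is contained in no hyperplane. -/
def NondegenerateSet {n : ℕ} (Y : Set (PrV n)) : Prop :=
  ∀ H : Set (PrV n), IsHyperplane H → ¬ Y ⊆ H

/-- Dimension of a subset of projective space: the Krull dimension of the subspace
topology. -/
def pdim {n : ℕ} (S : Set (PrV n)) : WithBot ℕ∞ := topologicalKrullDim S

/-- The homogeneous ideal of `Y` (as a set): all polynomials all of whose lifts vanish on
the affine cone of `Y`. -/
def homIdeal {n : ℕ} (Y : Set (PrV n)) : Set (MvPolynomial (Fin n) ℂ) := {f | Y ⊆ pZero f}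

/-- The differential of a polynomial at a point of `ℂⁿ`, as a linear form. -/
def jacLin {n : ℕ} (f : MvPolynomial (Fin n) ℂ) (v : Fin n → ℂ) : (Fin n → ℂ) →ₗ[ℂ] ℂ :=
  ∑ i, eval v (pderiv i f) • LinearMap.proj i

/-- The affine tangent space of the cone over `Y` at `v`: the common kernel of the
differentials of all elements of the homogeneous ideal of `Y`. -/
def affTangent {n : ℕ} (Y : Set (PrV n)) (v : Fin n → ℂ) : Submodule ℂ (Fin n → ℂ) :=
  ⨅ f ∈ homIdeal Y, LinearMap.ker (jacLin f v)

/-- The embedded projective tangent space `T_x Y ⊆ ℙⁿ⁻¹`. -/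
def projTangent {n : ℕ} (Y : Set (PrV n)) (x : PrV n) : Set (PrV n) :=
  projSub (affTangent Y x.rep)

/-- `x` is a smooth point of `Y` if the affine tangent space of the cone has the expected
dimension `dim Y + 1`. -/
def IsSmoothPt {n : ℕ} (Y : Set (PrV n)) (x : PrV n) : Prop :=
  ((Module.finrank ℂ (affTangent Y x.rep) : ℕ∞) : WithBot ℕ∞) = pdim Y + 1

/-- The smooth locus `Y_smooth` of `Y`. -/
def smoothLocus {n : ℕ} (Y : Set (PrV n)) : Set (PrV n) := {x ∈ Y | IsSmoothPt Y x}

/-- The singular locus of `Y`. -/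
def singLocus {n : ℕ} (Y : Set (PrV n)) : Set (PrV n) := Y \ smoothLocus Y

/-- `Y` is smooth if every point of `Y` is a smooth point. -/
def IsSmoothSet {n : ℕ} (Y : Set (PrV n)) : Prop := ∀ x ∈ Y, IsSmoothPt Y x

/-- A divisor on `Y`: an irreducible closed subvariety of `Y` of codimension one. -/
def IsDivisorOn {n : ℕ} (W Y : Set (PrV n)) : Prop :=
  W ⊆ Y ∧ IsIrreducible W ∧ closure W ∩ Y = W ∧ pdim W + 1 = pdim Y

/-- `σ(Y)`: the maximal dimension of a subvariety `Z` of the smooth locus of `Y` which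
contains a generic point of some divisor on `Y` (i.e. is dense in some divisor), and such
that all embedded tangent spaces `T_y Y`, `y ∈ Z`, lie in a fixed hyperplane. -/
def sigmaY {n : ℕ} (Y : Set (PrV n)) : WithBot ℕ∞ :=
  sSup { d | ∃ Z : Set (PrV n), Z ⊆ smoothLocus Y ∧ IsIrreducible Z ∧
      (∃ W, IsDivisorOn W Y ∧ W ⊆ closure (Z ∩ W)) ∧
      (∃ H, IsHyperplane H ∧ ∀ y ∈ Z, projTangent Y y ⊆ H) ∧ pdim Z = d }

/-- The ideal of polynomials vanishing (in all lifts) on the affine cone over `Y`. -/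
def idealOf {n : ℕ} (Y : Set (PrV n)) : Ideal (MvPolynomial (Fin n) ℂ) where
  carrier := homIdeal Y
  add_mem' := by
    intro f g hf hg x hx v hv hvx
    have h1 := hf hx v hv hvx
    have h2 := hg hx v hv hvx
    simp [map_add, h1, h2]
  zero_mem' := by intro x hx v hv hvx; simp
  smul_mem' := by
    intro c f hf x hx v hv hvx
    have h1 := hf hx v hv hvx
    simp [smul_eq_mul, map_mul, h1]

instance kerEvalPrime {n : ℕ} (v : Fin n → ℂ) :
    (RingHom.ker ((aeval v : MvPolynomial (Fin n) ℂ →ₐ[ℂ] ℂ) :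
      MvPolynomial (Fin n) ℂ →+* ℂ)).IsPrime :=
  RingHom.ker_isPrime _

/-- The local ring of the affine space `ℂⁿ` at the point `v`. -/
abbrev polyAtPoint {n : ℕ} (v : Fin n → ℂ) : Type :=
  Localization.AtPrime (RingHom.ker ((aeval v : MvPolynomial (Fin n) ℂ →ₐ[ℂ] ℂ) :
    MvPolynomial (Fin n) ℂ →+* ℂ))

/-- The local ring of the affine cone over `Y` at a (nonzero) point `v` of the cone. -/
abbrev coneLocalRing {n : ℕ} (Y : Set (PrV n)) (v : Fin n → ℂ) : Type :=
  polyAtPoint v ⧸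
    (Ideal.map (algebraMap (MvPolynomial (Fin n) ℂ) (polyAtPoint v)) (idealOf Y))

/-- A normal (irreducible, closed) subvariety of projective space: all local rings of its
affine cone at points of the punctured cone are integrally closed domains. -/
def IsNormalVariety {n : ℕ} (Y : Set (PrV n)) : Prop :=
  IsClosed Y ∧ IsIrreducible Y ∧
    ∀ x ∈ Y, IsDomain (coneLocalRing Y x.rep) ∧ IsIntegrallyClosed (coneLocalRing Y x.rep)

/-- The scheme-theoretic double locus of the projection of `Y` away from the projective
linear subspace `ℙ(W)`: points `y ∈ Y` such that the fibre of the projection through `y`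
(the span of `ℙ(W)` and `y`) meets `Y` in a subscheme different from the single reduced
point `y`: either it contains a second point of `Y`, or it is tangent to `Y` at `y`. -/
def doubleLocus {r : ℕ} (Y : Set (Pr r)) (W : Submodule ℂ (Fin (r+1) → ℂ)) : Set (Pr r) :=
  {y | y ∈ Y ∧
    ((∃ y' ∈ Y, y' ≠ y ∧ y'.rep ∈ W ⊔ Submodule.span ℂ {y.rep}) ∨
      affTangent Y y.rep ⊓ (W ⊔ Submodule.span ℂ {y.rep}) ≠ Submodule.span ℂ {y.rep})}

/-- The linear subspace spanned by a `(k+1)`-tuple of vectors of `ℂ^{r+1}` (used to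
parametrize generic linear subspaces of projective dimension `k`). -/
def spanOfTuple {r k : ℕ} (v : Fin (k+1) × Fin (r+1) → ℂ) :
    Submodule ℂ (Fin (r+1) → ℂ) :=
  Submodule.span ℂ (Set.range fun i : Fin (k+1) => fun j => v (i, j))

/-- The secant cone of `Y` at `z`: the closure of the union of all secant lines of `Y`
passing through `z`. -/
def secantCone {r : ℕ} (Y : Set (Pr r)) (z : Pr r) : Set (Pr r) :=
  closure (⋃ x ∈ Y, ⋃ y ∈ Y, ⋃ _ : x ≠ y, ⋃ _ : z ∈ lineThrough x y, lineThrough x y)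

/-- `Y` has the irreducible secant cone (ISC) property: the secant cone of `Y` at a generic
point of `ℙ^r` (equivalently, the generic fibre of `f : I_Y → ℙ^r`) is irreducible. -/
def ISC {r : ℕ} (Y : Set (Pr r)) : Prop :=
  ∃ U : Set (Pr r), IsOpen U ∧ Dense U ∧ ∀ z ∈ U, IsIrreducible (secantCone Y z)

/-- The outer (Segre) product of two vectors. -/
def outerVec {a b : ℕ} (v : Fin a → ℂ) (w : Fin b → ℂ) : Fin (a * b) → ℂ :=
  fun k => v (finProdFinEquiv.symm k).1 * w (finProdFinEquiv.symm k).2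

lemma outerVec_ne_zero {a b : ℕ} {v : Fin a → ℂ} {w : Fin b → ℂ}
    (hv : v ≠ 0) (hw : w ≠ 0) : outerVec v w ≠ 0 := by
  obtain ⟨i, hi⟩ := Function.ne_iff.mp hv
  obtain ⟨j, hj⟩ := Function.ne_iff.mp hw
  intro h
  have h2 := congrFun h (finProdFinEquiv (i, j))
  simp only [outerVec, Equiv.symm_apply_apply, Pi.zero_apply] at h2
  rcases mul_eq_zero.mp h2 with h3 | h3
  · exact hi h3
  · exact hj h3

/-- The Segre embedding of a product of projective spaces. -/
def segre {a b : ℕ} (p : PrV a × PrV b) : PrV (a * b) :=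
  Projectivization.mk ℂ (outerVec p.1.rep p.2.rep)
    (outerVec_ne_zero p.1.rep_nonzero p.2.rep_nonzero)

/-- The Zariski topology on a product of two projective spaces (induced via the Segre
embedding). -/
def pairTop (r : ℕ) : TopologicalSpace (Pr r × Pr r) :=
  TopologicalSpace.induced segre (prTop ((r+1) * (r+1)))

/-- Zariski closure in the product of two projective spaces. -/
def closureP {r : ℕ} (S : Set (Pr r × Pr r)) : Set (Pr r × Pr r) :=
  segre ⁻¹' closure (segre '' S)

/-- Zariski irreducibility of a subset of the product of two projective spaces. -/
def IsIrreducibleP {r : ℕ} (S : Set (Pr r × Pr r)) : Prop :=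
  IsIrreducible (closure (segre '' S))

/-- Zariski connectedness of a subset of the product of two projective spaces. -/
def IsConnectedP {r : ℕ} (S : Set (Pr r × Pr r)) : Prop :=
  IsConnected (segre '' S)

/-- Dimension of a subset of the product of two projective spaces. -/
def pdimP {r : ℕ} (S : Set (Pr r × Pr r)) : WithBot ℕ∞ := pdim (segre '' S)

/-- The (ordered-pairs model of the) fibre of `f : I_Y → ℙ^r` over `z ∈ ℙ^r`: pairs of
distinct points of `Y` whose secant line passes through `z`, together with limits of such
(the secant cone of `Y` at `z`, upstairs). -/
def secPairs {r : ℕ} (Y : Set (Pr r)) (z : Pr r) : Set (Pr r × Pr r) :=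
  {p | p.1 ∈ Y ∧ p.2 ∈ Y ∧ p.1 ≠ p.2 ∧ z ∈ lineThrough p.1 p.2}

/-- The fibre of `f : I_Y → ℙ^r` over `z` (with its limit points). -/
def secFiber {r : ℕ} (Y : Set (Pr r)) (z : Pr r) : Set (Pr r × Pr r) :=
  closureP (secPairs Y z)

/-- The linear map `ℂ^b → ℂ^a` given by a matrix of coefficients. -/
def matLin {a b : ℕ} (w : Fin a × Fin b → ℂ) : (Fin b → ℂ) →ₗ[ℂ] (Fin a → ℂ) :=
  Matrix.mulVecLin (Matrix.of fun i j => w (i, j))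

/-- The image of a subset of `ℙ^{b-1}` under the linear projection `ℙ^{b-1} ⇢ ℙ^{a-1}`
given by a matrix. -/
def projImage {a b : ℕ} (w : Fin a × Fin b → ℂ) (Z : Set (PrV b)) : Set (PrV a) :=
  {z | ∃ x ∈ Z, ∃ c : ℂ, c ≠ 0 ∧ z.rep = c • matLin w x.rep}

/-- `X ⊆ ℙ^N` is the image of `X̃ ⊆ ℙ^{N+1}` under a bijective projection from a point
`Q ∉ X̃` (the centre `Q` being the projectivized kernel of the surjective linear map `L`). -/
def IsBijectiveProjectionOf {N : ℕ} (X : Set (Pr N)) (Xt : Set (Pr (N+1))) : Prop :=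
  ∃ L : (Fin (N+2) → ℂ) →ₗ[ℂ] (Fin (N+1) → ℂ), Function.Surjective L ∧
    (∀ x ∈ Xt, L x.rep ≠ 0) ∧
    X = {z | ∃ x ∈ Xt, ∃ c : ℂ, c ≠ 0 ∧ z.rep = c • L x.rep} ∧
    (∀ x ∈ Xt, ∀ y ∈ Xt, (∃ c : ℂ, L x.rep = c • L y.rep) → x = y)

/-- `X ⊆ ℙ^N` is linearly normal if it is not the image, under a bijective projection from
a point, of a nondegenerate subvariety of `ℙ^{N+1}`. -/
def LinearlyNormal {N : ℕ} (X : Set (Pr N)) : Prop :=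
  ¬ ∃ Xt : Set (Pr (N+1)), IsClosed Xt ∧ IsIrreducible Xt ∧ NondegenerateSet Xt ∧
      IsBijectiveProjectionOf X Xt

/-- Extension by zero `ℂ^a → ℂ^b` (for `a ≤ b`). -/
def padMap (a b : ℕ) : (Fin a → ℂ) →ₗ[ℂ] (Fin b → ℂ) where
  toFun v := fun j => if h : (j : ℕ) < a then v ⟨j, h⟩ else 0
  map_add' v w := by funext j; by_cases h : (j : ℕ) < a <;> simp [h]
  map_smul' c v := by funext j; by_cases h : (j : ℕ) < a <;> simp [h]

lemma padMap_ne_zero {a b : ℕ} (hab : a ≤ b) {v : Fin a → ℂ} (hv : v ≠ 0) :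
    padMap a b v ≠ 0 := by
  obtain ⟨i, hi⟩ := Function.ne_iff.mp hv
  intro h
  have h2 := congrFun h ⟨i, lt_of_lt_of_le i.isLt hab⟩
  simp only [padMap, LinearMap.coe_mk, AddHom.coe_mk, Pi.zero_apply] at h2
  rw [dif_pos i.isLt] at h2
  exact hi (by simpa using h2)

/-- A point of `ℙ^{a-1}` viewed in `ℙ^{b-1}` via the inclusion of the first `a`
coordinates. -/
def embPt {a b : ℕ} (hab : a ≤ b) (x : PrV a) : PrV b :=
  Projectivization.mk ℂ (padMap a b x.rep) (padMap_ne_zero hab x.rep_nonzero)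

/-- The join of two subsets of projective space: the union of all lines joining a point of
`A` to a point of `B`. -/
def joinSets {n : ℕ} (A B : Set (PrV n)) : Set (PrV n) :=
  ⋃ x ∈ A, ⋃ y ∈ B, lineThrough x y

section Dimension

variable {k : Type} [Field k]

theorem le_trdeg_iff {S : Type} [CommRing S] [IsDomain S] [Algebra k S] {n : ℕ} :
    (n : Cardinal) ≤ Algebra.trdeg k S ↔ ∃ x : Fin n → S, AlgebraicIndependent k x := by
  constructor
  · intro h
    obtain ⟨s, hs⟩ := exists_isTranscendenceBasis k S
    rw [← hs.cardinalMk_eq_trdeg] at h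
    have h2 : Cardinal.mk (Fin n) ≤ Cardinal.mk s := by simpa using h
    obtain ⟨f⟩ := h2
    exact ⟨fun i => (f i : S), hs.1.comp f f.injective⟩
  · rintro ⟨x, hx⟩
    simpa using hx.cardinalMk_le_trdeg

theorem card_le_trdeg {S : Type} [CommRing S] [IsDomain S] [Algebra k S]
    {ι : Type} [Fintype ι] {x : ι → S} (hx : AlgebraicIndependent k x) :
    (Fintype.card ι : Cardinal) ≤ Algebra.trdeg k S := by
  simpa using hx.cardinalMk_le_trdeg

/-- A proper integral quotient of a domain has smaller transcendence degree. -/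
theorem succ_le_trdeg_of_le_trdeg_quotient {S : Type} [CommRing S] [IsDomain S] [Algebra k S]
    {q : Ideal S} [q.IsPrime] (hq : q ≠ ⊥) {n : ℕ}
    (h : (n : Cardinal) ≤ Algebra.trdeg k (S ⧸ q)) :
    ((n + 1 : ℕ) : Cardinal) ≤ Algebra.trdeg k S := by
  obtain ⟨x, hx⟩ := le_trdeg_iff.1 h
  choose y hy using fun i => Ideal.Quotient.mk_surjective (x i)
  have hxy : x = Ideal.Quotient.mkₐ k q ∘ y := by
    funext i; exact (hy i).symm
  rw [hxy] at hx
  have hyi : AlgebraicIndependent k y := hx.of_comp _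
  obtain ⟨a, haq, ha⟩ := Submodule.exists_mem_ne_zero_of_ne_bot hq
  have htr : Transcendental (Algebra.adjoin k (range y)) a := by
    intro halg
    obtain ⟨p, hp0, hp⟩ :=
      halg.exists_nonzero_coeff_and_aeval_eq_zero (mem_nonZeroDivisors_of_ne_zero ha)
    apply hp0
    have h1 : ((p.coeff 0 : Algebra.adjoin k (range y)) : S) ∈ q := by
      have h2 : Polynomial.aeval a p = Polynomial.aeval a p.divX * a + (p.coeff 0 : S) := by
        conv_lhs => rw [← Polynomial.divX_mul_X_add p]
        simp [Algebra.algebraMap_eq_smul_one, Subalgebra.smul_def]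
      rw [hp] at h2
      have h3 : (p.coeff 0 : S) = - (Polynomial.aeval a p.divX * a) := by
        linear_combination -h2
      rw [h3]
      exact q.neg_mem (q.mul_mem_left _ haq)
    obtain ⟨f, hf⟩ := (AlgHom.mem_range _).1
      ((Algebra.adjoin_range_eq_range_aeval k y).le (p.coeff 0).2)
    have h4 : MvPolynomial.aeval (Ideal.Quotient.mkₐ k q ∘ y) f = 0 := by
      have h6 := MvPolynomial.comp_aeval_apply (f := y) (Ideal.Quotient.mkₐ k q) f
      rw [hf] at h6
      refine h6.symm.trans ?_
      exact Ideal.Quotient.eq_zero_iff_mem.2 h1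
    have h5 : f = 0 := hx (by rw [h4, map_zero])
    apply Subtype.ext
    rw [← hf, h5, map_zero]; rfl
  have := (hyi.option_iff_transcendental a).2 htr
  simpa using card_le_trdeg this

theorem MvPolynomial.algebraicIndependent_mod_of_mem_vars {σ : Type} [DecidableEq σ]
    {b : MvPolynomial σ k} {i : σ} (hi : i ∈ b.vars) {p : MvPolynomial {j // j ≠ i} k}
    (h : b ∣ rename Subtype.val p) : p = 0 := by
  by_contra hp
  have hr : rename Subtype.val p ≠ 0 := by
    intro h0
    exact hp (rename_injective _ Subtype.val_injective (by rw [h0, map_zero]))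
  obtain ⟨c, hc⟩ := h
  have hb : b ≠ 0 := by rintro rfl; simp at hi
  have hc0 : c ≠ 0 := by rintro rfl; exact hr (by rw [hc, mul_zero])
  have h1 : degreeOf i (rename Subtype.val p) = degreeOf i b + degreeOf i c := by
    rw [hc, degreeOf_mul_eq hb hc0]
  have h2 : degreeOf i (rename Subtype.val p) = 0 := by
    by_contra h3
    obtain ⟨j, _, hj⟩ := mem_vars_rename _ _ (mem_vars_iff_degreeOf_ne_zero.2 h3)
    exact j.2 hj
  have h3 : degreeOf i b ≠ 0 := mem_vars_iff_degreeOf_ne_zero.1 hi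
  omega

/-- Krull's principal ideal theorem in terms of transcendence degrees. -/
theorem exists_prime_le_trdeg_quotient {S : Type} [CommRing S] [IsDomain S] [Algebra k S]
    [Algebra.FiniteType k S] {f : S} {P : Ideal S} [P.IsPrime] (hf : f ∈ P) {n : ℕ}
    (hn : ((n + 1 : ℕ) : Cardinal) ≤ Algebra.trdeg k S) :
    ∃ q : Ideal S, q.IsPrime ∧ f ∈ q ∧ q ≤ P ∧ (n : Cardinal) ≤ Algebra.trdeg k (S ⧸ q) := by
  classical
  by_cases hf0 : f = 0
  · refine ⟨⊥, Ideal.isPrime_bot, by simp [hf0], bot_le, ?_⟩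
    have e : Algebra.trdeg k (S ⧸ (⊥ : Ideal S)) = Algebra.trdeg k S :=
      (AlgEquiv.quotientBot k S).trdeg_eq
    rw [e]
    exact le_trans (by exact_mod_cast Nat.le_succ n) hn
  obtain ⟨s, g, hginj, hgint⟩ := exists_integral_inj_algHom_of_fg k S
  let := g.toRingHom.toAlgebra
  have : IsScalarTower k (MvPolynomial (Fin s) k) S :=
    IsScalarTower.of_algebraMap_eq fun x => (g.commutes x).symm
  have : Algebra.IsIntegral (MvPolynomial (Fin s) k) S := ⟨hgint⟩
  have : FaithfulSMul (MvPolynomial (Fin s) k) S :=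
    (faithfulSMul_iff_algebraMap_injective _ _).2 hginj
  have : IsNoetherianRing S := Algebra.FiniteType.isNoetherianRing k S
  have hs : n + 1 ≤ s := by
    have h1 : Algebra.trdeg k S = s := by
      have h2 := trdeg_add_eq k (MvPolynomial (Fin s) k) (A := S)
      rw [trdeg_eq_zero (R := MvPolynomial (Fin s) k) (A := S), add_zero, MvPolynomial.trdeg_of_isDomain] at h2
      simpa using h2.symm
    rw [h1] at hn
    exact_mod_cast hn
  obtain ⟨q, hq, hqP⟩ := Ideal.exists_minimalPrimes_le
    (I := Ideal.span {f}) (J := P) ((Ideal.span_singleton_le_iff_mem _).2 hf)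
  have : q.IsPrime := hq.1.1
  have hfq : f ∈ q := hq.1.2 (Ideal.mem_span_singleton_self f)
  refine ⟨q, hq.1.1, hfq, hqP, ?_⟩
  have hht := Ideal.height_le_one_of_isPrincipal_of_mem_minimalPrimes _ q hq
  have hpb : q.under (MvPolynomial (Fin s) k) ≠ ⊥ :=
    Ideal.comap_ne_bot_of_integral_mem hf0 hfq (Algebra.IsIntegral.isIntegral f)
  obtain ⟨b, hbq, hb⟩ := Ideal.IsPrime.exists_mem_prime_of_ne_bot
    (inferInstanceAs (q.under (MvPolynomial (Fin s) k)).IsPrime) hpb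
  have : (Ideal.span {b}).IsPrime := (Ideal.span_singleton_prime hb.ne_zero).2 hb
  have hbeq : Ideal.span {b} = q.under (MvPolynomial (Fin s) k) := by
    by_contra hne
    have hlt : Ideal.span {b} < q.under (MvPolynomial (Fin s) k) :=
      lt_of_le_of_ne ((Ideal.span_singleton_le_iff_mem _).2 hbq) hne
    obtain ⟨q', hq'q, hq'p, hq'o⟩ := Ideal.exists_ideal_lt_liesOver_of_lt q hlt
    have hq'0 : (⊥ : Ideal S) < q' := by
      rw [bot_lt_iff_ne_bot]
      rintro rfl
      have h1 : b ∈ (⊥ : Ideal S).under (MvPolynomial (Fin s) k) := by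
        rw [← hq'o.over]; exact Ideal.mem_span_singleton_self b
      exact hb.ne_zero (by simpa [Ideal.mem_comap] using h1)
    have h1 := Ideal.height_add_one_le_of_lt_of_isPrime hq'0
    have h2 := Ideal.height_add_one_le_of_lt_of_isPrime hq'q
    have h3 : (1 : ℕ∞) + 1 ≤ 1 := by
      calc (1 : ℕ∞) + 1 ≤ q'.height + 1 := by
            gcongr; exact le_trans (by simp) h1
        _ ≤ 1 := h2.trans hht
    exact absurd h3 (by decide)
  have hbv : ∃ i, i ∈ b.vars := by
    by_contra hcon
    push Not at hcon
    have h1 : b.vars = ∅ := Finset.eq_empty_of_forall_notMem hcon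
    rw [vars_eq_empty_iff_eq_C] at h1
    refine hb.not_isUnit ?_
    rw [h1]
    refine (isUnit_iff_ne_zero.2 ?_).map C
    intro h2
    rw [h2, C_0] at h1
    exact hb.ne_zero h1
  obtain ⟨i, hi⟩ := hbv
  have hind : AlgebraicIndependent k
      (fun j : {j : Fin s // j ≠ i} => Ideal.Quotient.mkₐ k q (g (X j.1))) := by
    rw [algebraicIndependent_iff]
    intro p hp
    apply MvPolynomial.algebraicIndependent_mod_of_mem_vars hi
    rw [← Ideal.mem_span_singleton, hbeq, Ideal.mem_comap, ← Ideal.Quotient.eq_zero_iff_mem]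
    rw [← hp]
    change ((Ideal.Quotient.mkₐ k q).comp g) (rename Subtype.val p) = _
    rw [aeval_unique ((Ideal.Quotient.mkₐ k q).comp g), aeval_rename]
    rfl
  have h1 := card_le_trdeg hind
  refine le_trans ?_ h1
  have h2 : Fintype.card {j : Fin s // j ≠ i} = s - 1 := by
    simp [Fintype.card_subtype_compl]
  rw [h2]
  exact_mod_cast (by omega : n ≤ s - 1)

/-- Several successive applications of Krull's principal ideal theorem. -/
theorem exists_prime_le_trdeg_quotient_of_finset {S : Type} [CommRing S] [IsDomain S]
    [Algebra k S] [Algebra.FiniteType k S] {ι : Type} [DecidableEq ι] (e : ι → S) (s : Finset ι)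
    {P : Ideal S} [P.IsPrime] (hf : ∀ i ∈ s, e i ∈ P) {n : ℕ}
    (hn : ((n + s.card : ℕ) : Cardinal) ≤ Algebra.trdeg k S) :
    ∃ q : Ideal S, q.IsPrime ∧ (∀ i ∈ s, e i ∈ q) ∧ q ≤ P ∧
      (n : Cardinal) ≤ Algebra.trdeg k (S ⧸ q) := by
  induction s using Finset.induction_on generalizing n with
  | empty =>
    refine ⟨⊥, Ideal.isPrime_bot, by simp, bot_le, ?_⟩
    rw [(AlgEquiv.quotientBot k S).trdeg_eq]
    simpa using hn
  | insert a s ha ih =>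
    obtain ⟨q, hq, hqs, hqP, hqn⟩ := ih (n := n + 1) (fun i hi => hf i (Finset.mem_insert_of_mem hi))
      (by rw [Finset.card_insert_of_notMem ha] at hn
          rwa [show n + 1 + s.card = n + (s.card + 1) by ring])
    have := hq
    have : (P.map (Ideal.Quotient.mk q)).IsPrime :=
      Ideal.map_isPrime_of_surjective Ideal.Quotient.mk_surjective (by simpa using hqP)
    obtain ⟨q', hq', haq', hq'P, hq'n⟩ := exists_prime_le_trdeg_quotient
      (P := P.map (Ideal.Quotient.mk q)) (S := S ⧸ q) (f := Ideal.Quotient.mk q (e a))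
      (Ideal.mem_map_of_mem _ (hf a (Finset.mem_insert_self a s))) hqn
    have hle : q ≤ q'.comap (Ideal.Quotient.mk q) := by
      intro x hx
      rw [Ideal.mem_comap, Ideal.Quotient.eq_zero_iff_mem.2 hx]
      exact q'.zero_mem
    refine ⟨q'.comap (Ideal.Quotient.mk q), inferInstance, ?_, ?_, ?_⟩
    · intro i hi
      rcases Finset.mem_insert.1 hi with rfl | hi
      · exact haq'
      · exact hle (hqs i hi)
    · intro x hx
      have h1 : Ideal.Quotient.mk q x ∈ P.map (Ideal.Quotient.mk q) := hq'P hx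
      have h2 : x ∈ (P.map (Ideal.Quotient.mk q)).comap (Ideal.Quotient.mk q) := h1
      rw [Ideal.comap_map_of_surjective _ Ideal.Quotient.mk_surjective] at h2
      have h3 : (⊥ : Ideal (S ⧸ q)).comap (Ideal.Quotient.mk q) = q := by
        rw [← RingHom.ker_eq_comap_bot, Ideal.mk_ker]
      rw [h3, sup_eq_left.2 hqP] at h2
      exact h2
    · refine le_trans hq'n (trdeg_le_of_surjective
        (Ideal.quotientMapₐ (I := q'.comap (Ideal.Quotient.mkₐ k q)) q'
          (Ideal.Quotient.mkₐ k q) le_rfl) ?_)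
      exact Ideal.quotientMap_surjective (H := le_rfl) Ideal.Quotient.mk_surjective

theorem exists_algHom_apply_ne_zero [IsAlgClosed k] {S : Type} [CommRing S] [IsDomain S]
    [Algebra k S] [Algebra.FiniteType k S] {f : S} (hf : f ≠ 0) : ∃ φ : S →ₐ[k] k, φ f ≠ 0 := by
  have : Nontrivial (Localization.Away f) :=
    (IsLocalization.injective (Localization.Away f)
      (powers_le_nonZeroDivisors_of_noZeroDivisors hf)).nontrivial
  obtain ⟨M, hM⟩ := Ideal.exists_maximal (Localization.Away f)
  let := Ideal.Quotient.field M
  have : Algebra.FiniteType S (Localization.Away f) := IsLocalization.finiteType_of_monoid_fg (Submonoid.powers f) _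
  have : Algebra.FiniteType k (Localization.Away f) := Algebra.FiniteType.trans (S := S) ‹_› ‹_›
  have : Algebra.FiniteType k (Localization.Away f ⧸ M) := inferInstance
  have : Module.Finite k (Localization.Away f ⧸ M) := finite_of_finite_type_of_isJacobsonRing _ _
  let e : k ≃ₐ[k] (Localization.Away f ⧸ M) :=
    AlgEquiv.ofBijective (Algebra.ofId k _) (IsAlgClosed.algebraMap_bijective_of_isIntegral)
  refine ⟨(e.symm : _ →ₐ[k] k).comp ((Ideal.Quotient.mkₐ k M).comp
    (IsScalarTower.toAlgHom k S (Localization.Away f))), ?_⟩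
  have hu : IsUnit (algebraMap S (Localization.Away f) f) :=
    IsLocalization.Away.algebraMap_isUnit f
  exact (((hu.map (Ideal.Quotient.mkₐ k M)).map e.symm)).ne_zero

open TensorProduct in
/-- Evaluation of the left factor of a tensor product at a point. -/
def TensorProduct.evalLeft {A B : Type} [CommRing A] [CommRing B] [Algebra k A]
    [Algebra k B] (φ : A →ₐ[k] k) : A ⊗[k] B →ₐ[k] B :=
  (Algebra.TensorProduct.lid k B).toAlgHom.comp
    (Algebra.TensorProduct.map φ (AlgHom.id k B))

open TensorProduct in
theorem TensorProduct.evalLeft_tmul {A B : Type} [CommRing A] [CommRing B] [Algebra k A]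
    [Algebra k B] (φ : A →ₐ[k] k) (a : A) (b : B) :
    TensorProduct.evalLeft φ (a ⊗ₜ b) = φ a • b := by
  simp [TensorProduct.evalLeft]

open TensorProduct in
theorem TensorProduct.exists_evalLeft_ne_zero [IsAlgClosed k] {A B : Type} [CommRing A]
    [IsDomain A] [CommRing B] [Algebra k A] [Algebra k B] (z : A ⊗[k] B) (hz : z ≠ 0) :
    ∃ a : A, a ≠ 0 ∧ ∀ φ : A →ₐ[k] k, φ a ≠ 0 → TensorProduct.evalLeft φ z ≠ 0 := by
  let β := Module.Basis.ofVectorSpace k B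
  let γ := Algebra.TensorProduct.basis A β
  have h1 : γ.repr z ≠ 0 := by simpa using hz
  obtain ⟨i, hi⟩ := Finsupp.ne_iff.1 h1
  refine ⟨γ.repr z i, by simpa using hi, fun φ hφ h0 => hφ ?_⟩
  have h2 : ∀ w : A ⊗[k] B, β.repr (TensorProduct.evalLeft φ w) i = φ (γ.repr w i) := by
    intro w
    induction w with
    | zero => simp
    | tmul a b =>
      simp [TensorProduct.evalLeft_tmul, γ, Algebra.TensorProduct.basis_repr_tmul]
    | add x y hx hy => simp [map_add, hx, hy]
  rw [← h2, h0]; simp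

open TensorProduct in
theorem TensorProduct.isDomain_of_isAlgClosed [IsAlgClosed k] {A B : Type} [CommRing A]
    [IsDomain A] [CommRing B] [IsDomain B] [Algebra k A] [Algebra k B]
    [Algebra.FiniteType k A] : IsDomain (A ⊗[k] B) := by
  have : Nontrivial (A ⊗[k] B) := by
    obtain ⟨φ, -⟩ := exists_algHom_apply_ne_zero (k := k) (one_ne_zero : (1 : A) ≠ 0)
    exact (TensorProduct.evalLeft (B := B) φ).toRingHom.domain_nontrivial
  have : NoZeroDivisors (A ⊗[k] B) := by
    refine ⟨fun {z w} h => ?_⟩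
    by_contra hcon
    push Not at hcon
    obtain ⟨a, ha, ha'⟩ := TensorProduct.exists_evalLeft_ne_zero z hcon.1
    obtain ⟨b, hb, hb'⟩ := TensorProduct.exists_evalLeft_ne_zero w hcon.2
    obtain ⟨φ, hφ⟩ := exists_algHom_apply_ne_zero (k := k) (mul_ne_zero ha hb)
    rw [map_mul] at hφ
    have h1 := mul_ne_zero (ha' φ (left_ne_zero_of_mul hφ)) (hb' φ (right_ne_zero_of_mul hφ))
    rw [← map_mul, h, map_zero] at h1
    exact h1 rfl
  exact NoZeroDivisors.to_isDomain _

open TensorProduct in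
theorem TensorProduct.add_le_trdeg [IsAlgClosed k] {A B : Type} [CommRing A]
    [IsDomain A] [CommRing B] [IsDomain B] [Algebra k A] [Algebra k B]
    [Algebra.FiniteType k A] {a b : ℕ} (ha : (a : Cardinal) ≤ Algebra.trdeg k A)
    (hb : (b : Cardinal) ≤ Algebra.trdeg k B) :
    ((a + b : ℕ) : Cardinal) ≤ Algebra.trdeg k (A ⊗[k] B) := by
  have : IsDomain (A ⊗[k] B) := TensorProduct.isDomain_of_isAlgClosed
  obtain ⟨x, hx⟩ := le_trdeg_iff.1 ha
  obtain ⟨y, hy⟩ := le_trdeg_iff.1 hb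
  have hy' : AlgebraicIndependent A (fun i => (1 : A) ⊗ₜ[k] y i) := by
    rw [algebraicIndependent_iff]
    intro p hp
    by_contra hp0
    obtain ⟨m, hm⟩ := MvPolynomial.ne_zero_iff.1 hp0
    obtain ⟨φ, hφ⟩ := exists_algHom_apply_ne_zero (k := k) hm
    have h1 : MvPolynomial.aeval y (MvPolynomial.map φ.toRingHom p)
        = TensorProduct.evalLeft φ (MvPolynomial.aeval (fun i => (1 : A) ⊗ₜ[k] y i) p) := by
      clear hp hp0 hm hφ m
      induction p using MvPolynomial.induction_on with
      | C c =>
        rw [MvPolynomial.map_C, MvPolynomial.aeval_C, MvPolynomial.aeval_C,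
          Algebra.TensorProduct.algebraMap_apply, TensorProduct.evalLeft_tmul,
          Algebra.algebraMap_eq_smul_one]
        rfl
      | add p q hp hq => simp only [map_add, hp, hq]
      | mul_X p i hp =>
        simp only [map_mul, hp, MvPolynomial.map_X, MvPolynomial.aeval_X]
        rw [TensorProduct.evalLeft_tmul, map_one, one_smul]
    rw [hp, map_zero] at h1
    have h2 : MvPolynomial.map φ.toRingHom p = 0 := hy (by rw [h1, map_zero])
    apply hφ
    have h3 := congrArg (MvPolynomial.coeff m) h2
    simpa [MvPolynomial.coeff_map] using h3
  have : FaithfulSMul A (A ⊗[k] B) := (faithfulSMul_iff_algebraMap_injective _ _).2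
    (by simpa using hy'.algebraMap_injective)
  have := AlgebraicIndependent.sumElim_comp hx hy'
  simpa [add_comm] using card_le_trdeg this

end Dimension

section TangencyLemma

/-- The tuple `u` is a zero of all elements of the ideal `I`. -/
def IsZeroOf {n : ℕ} (I : Ideal (MvPolynomial (Fin n) ℂ)) {B : Type} [CommRing B] [Algebra ℂ B]
    (u : Fin n → B) : Prop := ∀ F ∈ I, aeval u F = 0

/-- The directional derivative of `F` at `u` in direction `p`. -/
def dirDeriv {n : ℕ} (F : MvPolynomial (Fin n) ℂ) {B : Type} [CommRing B] [Algebra ℂ B]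
    (u p : Fin n → B) : B := ∑ i, aeval u (pderiv i F) * p i

/-- Closedness of an ideal under taking homogeneous components. -/
def IsConical {n : ℕ} (I : Ideal (MvPolynomial (Fin n) ℂ)) : Prop :=
  ∀ F ∈ I, ∀ d, homogeneousComponent d F ∈ I

variable {n : ℕ} {B : Type} [CommRing B] [Algebra ℂ B]

theorem IsZeroOf.map {I : Ideal (MvPolynomial (Fin n) ℂ)} {B' : Type} [CommRing B'] [Algebra ℂ B']
    {u : Fin n → B} (hu : IsZeroOf I u) (φ : B →ₐ[ℂ] B') : IsZeroOf I (fun i => φ (u i)) := by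
  intro F hF
  rw [← comp_aeval_apply, hu F hF, map_zero]

theorem map_dirDeriv {B' : Type} [CommRing B'] [Algebra ℂ B'] (φ : B →ₐ[ℂ] B')
    (F : MvPolynomial (Fin n) ℂ) (u p : Fin n → B) :
    φ (dirDeriv F u p) = dirDeriv F (fun i => φ (u i)) (fun i => φ (p i)) := by
  simp [dirDeriv, map_sum, map_mul, comp_aeval_apply]

theorem aeval_smul_homogeneous {F : MvPolynomial (Fin n) ℂ} {d : ℕ} (hF : F.IsHomogeneous d)
    (t : B) (u : Fin n → B) : aeval (fun i => t * u i) F = t ^ d * aeval u F := by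
  rw [aeval_def, aeval_def, eval₂_eq, eval₂_eq, Finset.mul_sum]
  refine Finset.sum_congr rfl fun m hm => ?_
  have h1 : ∑ i ∈ m.support, m i = d := by
    have := hF (mem_support_iff.1 hm)
    rw [Finsupp.weight_apply, Finsupp.sum] at this
    simpa using this
  simp_rw [mul_pow]
  rw [Finset.prod_mul_distrib, Finset.prod_pow_eq_pow_sum, h1]
  ring

theorem IsZeroOf.smul {I : Ideal (MvPolynomial (Fin n) ℂ)} (hI : IsConical I) {u : Fin n → B}
    (hu : IsZeroOf I u) (t : B) : IsZeroOf I (fun i => t * u i) := by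
  intro F hF
  rw [← sum_homogeneousComponent F, map_sum]
  refine Finset.sum_eq_zero fun d _ => ?_
  rw [aeval_smul_homogeneous (homogeneousComponent_isHomogeneous d F), hu _ (hI F hF d), mul_zero]

theorem exists_taylor (F : MvPolynomial (Fin n) ℂ) (u q : Fin n → B) (c : B) :
    ∃ G : B, aeval (fun i => u i + c * q i) F = aeval u F + c * dirDeriv F u q + c ^ 2 * G := by
  induction F using MvPolynomial.induction_on with
  | C a => exact ⟨0, by simp [dirDeriv]⟩
  | add f g hf hg =>
    obtain ⟨G, hG⟩ := hf
    obtain ⟨G', hG'⟩ := hg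
    refine ⟨G + G', ?_⟩
    have : dirDeriv (f + g) u q = dirDeriv f u q + dirDeriv g u q := by
      simp [dirDeriv, add_mul, Finset.sum_add_distrib]
    rw [map_add, hG, hG', map_add, this]; ring
  | mul_X f j hf =>
    obtain ⟨G, hG⟩ := hf
    refine ⟨G * (u j + c * q j) + dirDeriv f u q * q j, ?_⟩
    have : dirDeriv (f * X j) u q = dirDeriv f u q * u j + aeval u f * q j := by
      simp only [dirDeriv, Derivation.leibniz, pderiv_X, smul_eq_mul, map_add, map_mul, aeval_X,
        add_mul, Finset.sum_add_distrib, Finset.sum_mul]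
      rw [add_comm]
      congr 1
      · exact Finset.sum_congr rfl fun i _ => by ring
      · rw [Finset.sum_eq_single j]
        · simp
        · intro i _ hij; simp [hij]
        · simp
    rw [map_mul, hG, map_mul, this, aeval_X, aeval_X]; ring

open TensorProduct in
theorem exists_tangent_point_aux {I : Ideal (MvPolynomial (Fin n) ℂ)} (hI : IsConical I)
    {RY : Type} [CommRing RY] [IsDomain RY] [Algebra ℂ RY] [Algebra.FiniteType ℂ RY]
    {x' : Fin n → RY} (hx' : IsZeroOf I x') (hadj : Algebra.adjoin ℂ (range x') = ⊤)
    (hlift : ∀ v : Fin n → Polynomial ℂ, IsZeroOf I v →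
      ∃ f : RY →ₐ[ℂ] Polynomial ℂ, ∀ i, f (x' i) = v i)
    {d : ℕ} (hd : (d : Cardinal) ≤ Algebra.trdeg ℂ RY)
    {Γ : Type} [CommRing Γ] [IsDomain Γ] [Algebra ℂ Γ] [Algebra.FiniteType ℂ Γ]
    (Z : Subalgebra ℂ Γ) (u : Fin n → Γ)
    (hgen : Algebra.adjoin ℂ ((Z : Set Γ) ∪ range u) = ⊤) (hu : IsZeroOf I u)
    (s : Γ →ₐ[ℂ] Polynomial Γ)
    (hsu : ∀ i, s (u i) = Polynomial.C (u i) * Polynomial.X)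
    {ρ N : ℕ} (hZ : ¬ ((ρ + 1 : ℕ) : Cardinal) ≤ Algebra.trdeg ℂ Z)
    (hN : (N : Cardinal) ≤ Algebra.trdeg ℂ Γ) (hnum : ρ + 1 + n ≤ N + d)
    (φ : Γ →ₐ[ℂ] ℂ) {y : Fin n → ℂ} (hy : IsZeroOf I y)
    {k : Fin n} (hk : φ (u k) - y k ≠ 0)
    {g : Γ} (hsg : s g = Polynomial.C g) (hφg : φ g ≠ 0) :
    ∃ ψ : Γ →ₐ[ℂ] ℂ, (∃ i, ψ (u i) ≠ 0) ∧ ψ g ≠ 0 ∧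
      ∀ F ∈ I, dirDeriv F (fun i => ψ (u i)) (fun i => φ (u i) - y i) = 0 := by
  have : IsDomain (Γ ⊗[ℂ] RY) := TensorProduct.isDomain_of_isAlgClosed
  have : Algebra.FiniteType ℂ (Γ ⊗[ℂ] RY) :=
    Algebra.FiniteType.trans (S := Γ) inferInstance inferInstance
  let ι₁ : Γ →ₐ[ℂ] Γ ⊗[ℂ] RY := Algebra.TensorProduct.includeLeft
  let ι₂ : RY →ₐ[ℂ] Γ ⊗[ℂ] RY := Algebra.TensorProduct.includeRight
  have hyX : IsZeroOf I (fun i => (Polynomial.X : Polynomial ℂ) * Polynomial.C (y i)) :=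
    (hy.map (Algebra.ofId ℂ (Polynomial ℂ))).smul hI Polynomial.X
  obtain ⟨fy, hfy⟩ := hlift _ hyX
  let Φ : Γ ⊗[ℂ] RY →ₐ[ℂ] Polynomial ℂ := Algebra.TensorProduct.productMap
    ((Polynomial.mapAlgHom φ).comp s) fy
  have hΦu : ∀ i, Φ (ι₁ (u i)) = Polynomial.C (φ (u i)) * Polynomial.X := by
    intro i; simp [Φ, ι₁, hsu]
  have hΦy : ∀ i, Φ (ι₂ (x' i)) = Polynomial.C (y i) * Polynomial.X := by
    intro i
    simp only [Φ, ι₂, Algebra.TensorProduct.includeRight_apply,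
      Algebra.TensorProduct.productMap_apply_tmul, map_one, one_mul, hfy]
    rw [mul_comm]
  set p : Fin n → ℂ := fun i => φ (u i) - y i with hp
  let q : Fin n → ℂ := fun i => p i / p k
  let c : Γ ⊗[ℂ] RY := ι₁ (u k) - ι₂ (x' k)
  let e : Fin n → Γ ⊗[ℂ] RY := fun i => ι₁ (u i) - ι₂ (x' i) - q i • c
  have hΦc : Φ c = Polynomial.C (p k) * Polynomial.X := by
    simp only [c, map_sub, hΦu, hΦy, hp]; ring
  have hΦe : ∀ i, Φ (e i) = 0 := by
    intro i
    have h1 : q i * p k = p i := div_mul_cancel₀ _ hk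
    have h2 : (Polynomial.C (p i) : Polynomial ℂ) = Polynomial.C (q i) * Polynomial.C (p k) := by
      rw [← Polynomial.C_mul, h1]
    simp only [e, map_sub, map_smul, hΦu, hΦy, hΦc]
    rw [Polynomial.smul_eq_C_mul, ← mul_assoc, ← h2, hp]; simp only [map_sub]; ring
  have hdim := TensorProduct.add_le_trdeg hN hd
  have hn0 : 0 < n := k.pos
  have hP1 : (RingHom.ker Φ).IsPrime := RingHom.ker_isPrime _
  obtain ⟨Q, hQ, hQe, hQP, hQn⟩ := exists_prime_le_trdeg_quotient_of_finset e
    (Finset.univ.erase k) (P := RingHom.ker Φ) (n := ρ + 1 + 1) (fun i _ => hΦe i)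
    (le_trans (by
      rw [Finset.card_erase_of_mem (Finset.mem_univ k), Finset.card_univ, Fintype.card_fin]
      exact_mod_cast (by omega)) hdim)
  set T := (Γ ⊗[ℂ] RY) ⧸ Q
  let π : Γ ⊗[ℂ] RY →ₐ[ℂ] T := Ideal.Quotient.mkₐ ℂ Q
  have hπ : Function.Surjective π := Ideal.Quotient.mk_surjective
  have hQ0 : ∀ a ∈ Q, (Polynomial.aeval (0 : ℂ)).comp Φ a = 0 := by
    intro a ha
    have : Φ a = 0 := hQP ha
    simp [this]
  let Φ₀ : T →ₐ[ℂ] ℂ := Ideal.Quotient.liftₐ Q ((Polynomial.aeval (0 : ℂ)).comp Φ) hQ0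
  have hcT : π c ≠ 0 := by
    intro h0
    have h1 : c ∈ Q := Ideal.Quotient.eq_zero_iff_mem.1 h0
    have h2 : Φ c = 0 := hQP h1
    rw [hΦc] at h2
    simp at h2
    exact hk h2
  have hP2 : (RingHom.ker Φ₀).IsPrime := RingHom.ker_isPrime _
  have hcΦ₀ : π c ∈ RingHom.ker Φ₀ := by
    change Polynomial.aeval (0 : ℂ) (Φ c) = 0
    rw [hΦc]; simp
  obtain ⟨Q', hQ', hcQ', hQ'Φ₀, hQ'n⟩ := exists_prime_le_trdeg_quotient hcΦ₀ hQn
  set U := T ⧸ Q'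
  let π' : T →ₐ[ℂ] U := Ideal.Quotient.mkₐ ℂ Q'
  have hπ' : Function.Surjective π' := Ideal.Quotient.mk_surjective
  have hc0 : π' (π c) = 0 := Ideal.Quotient.eq_zero_iff_mem.2 hcQ'
  have hyT : ∀ i, π (ι₂ (x' i)) = π (ι₁ (u i)) + π c * algebraMap ℂ T (- q i) := by
    intro i
    have h1 : π (e i) = 0 := by
      by_cases hik : i = k
      · subst hik
        have h2 : e i = 0 := by
          simp only [e, q]
          rw [div_self hk, one_smul, sub_self]
        rw [h2, map_zero]
      · exact Ideal.Quotient.eq_zero_iff_mem.2 (hQe i (by simp [hik]))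
    simp only [e, map_sub, map_smul] at h1
    rw [Algebra.smul_def] at h1
    rw [map_neg]
    linear_combination -h1
  have htan : ∀ F ∈ I, dirDeriv F (fun i => π' (π (ι₁ (u i)))) (fun i => algebraMap ℂ U (- q i)) = 0 := by
    intro F hF
    obtain ⟨G, hG⟩ := exists_taylor F (fun i => π (ι₁ (u i))) (fun i => algebraMap ℂ T (- q i)) (π c)
    have h1 : aeval (fun i => π (ι₁ (u i)) + π c * algebraMap ℂ T (- q i)) F = 0 := by
      simp_rw [← hyT]
      exact (hx'.map (π.comp ι₂)) F hF
    have h2 : aeval (fun i => π (ι₁ (u i))) F = 0 := (hu.map (π.comp ι₁)) F hF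
    rw [h1, h2, zero_add] at hG
    have h3 : π c * (dirDeriv F (fun i => π (ι₁ (u i))) (fun i => algebraMap ℂ T (- q i)) + π c * G)
        = 0 := by rw [hG]; ring
    have h4 := (mul_eq_zero.1 h3).resolve_left hcT
    have h5 := congrArg π' h4
    rw [map_add, map_mul, hc0, zero_mul, add_zero, map_zero, map_dirDeriv] at h5
    simpa using h5
  have hex : ∃ i, π' (π (ι₁ (u i))) ≠ 0 := by
    by_contra hcon
    push Not at hcon
    let f : Z →ₐ[ℂ] U := (π'.comp (π.comp ι₁)).comp Z.val
    have hyU : ∀ i, π' (π (ι₂ (x' i))) = 0 := by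
      intro i; rw [hyT, map_add, map_mul, hc0, hcon]; simp
    have hf1 : ∀ g : Γ, π' (π (ι₁ g)) ∈ f.range := by
      have h1 : (⊤ : Subalgebra ℂ Γ) ≤ f.range.comap (π'.comp (π.comp ι₁)) := by
        rw [← hgen, Algebra.adjoin_le_iff]
        rintro g (hg | ⟨i, rfl⟩)
        · exact ⟨⟨g, hg⟩, rfl⟩
        · change π' (π (ι₁ (u i))) ∈ f.range
          rw [hcon]; exact zero_mem _
      intro g
      exact h1 trivial
    have hf2 : ∀ g : RY, π' (π (ι₂ g)) ∈ f.range := by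
      have h1 : (⊤ : Subalgebra ℂ RY) ≤ f.range.comap (π'.comp (π.comp ι₂)) := by
        rw [← hadj, Algebra.adjoin_le_iff]
        rintro g ⟨i, rfl⟩
        change π' (π (ι₂ (x' i))) ∈ f.range
        rw [hyU]; exact zero_mem _
      intro g
      exact h1 trivial
    have hfs : Function.Surjective f := by
      intro w
      obtain ⟨t, rfl⟩ := hπ' w
      obtain ⟨z, rfl⟩ := hπ t
      have : π' (π z) ∈ f.range := by
        induction z with
        | zero => simp only [map_zero]; exact zero_mem _
        | add a b ha hb => simp only [map_add]; exact add_mem ha hb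
        | tmul a b =>
          have h1 : a ⊗ₜ[ℂ] b = ι₁ a * ι₂ b := by simp [ι₁, ι₂]
          rw [h1, map_mul, map_mul]
          exact mul_mem (hf1 a) (hf2 b)
      exact this
    exact hZ (hQ'n.trans (trdeg_le_of_surjective f hfs))
  obtain ⟨i, hi⟩ := hex
  have hg0 : π' (π (ι₁ g)) ≠ 0 := by
    intro h0
    have h1 : Polynomial.aeval (0 : ℂ) (Φ (ι₁ g)) = 0 :=
      hQ'Φ₀ (Ideal.Quotient.eq_zero_iff_mem.1 h0)
    have h2 : Φ (ι₁ g) = Polynomial.C (φ g) := by simp [Φ, ι₁, hsg]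
    rw [h2, Polynomial.aeval_C] at h1
    exact hφg h1
  obtain ⟨χ, hχ⟩ := exists_algHom_apply_ne_zero (k := ℂ) (mul_ne_zero hi hg0)
  rw [map_mul] at hχ
  refine ⟨χ.comp (π'.comp (π.comp ι₁)), ⟨i, left_ne_zero_of_mul hχ⟩, right_ne_zero_of_mul hχ,
    fun F hF => ?_⟩
  have h1 := congrArg χ (htan F hF)
  rw [map_zero, map_dirDeriv] at h1
  have h2 : dirDeriv F (fun i => (χ.comp (π'.comp (π.comp ι₁))) (u i)) p
      = - p k * dirDeriv F (fun i => χ (π' (π (ι₁ (u i))))) (fun i => χ (algebraMap ℂ U (- q i))) := by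
    simp only [dirDeriv, Finset.mul_sum]
    refine Finset.sum_congr rfl fun j _ => ?_
    have h3 : q j * p k = p j := div_mul_cancel₀ _ hk
    simp only [AlgHom.commutes, Algebra.algebraMap_self, RingHom.id_apply, AlgHom.comp_apply]
    rw [← h3]; ring
  rw [h2, h1, mul_zero]

/-- The coordinate functions on the zero set of `I`. -/
def coordFun (I : Ideal (MvPolynomial (Fin n) ℂ)) (i : Fin n) : MvPolynomial (Fin n) ℂ ⧸ I :=
  Ideal.Quotient.mk I (X i)

theorem aeval_coordFun (I : Ideal (MvPolynomial (Fin n) ℂ)) (F : MvPolynomial (Fin n) ℂ) :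
    aeval (coordFun I) F = Ideal.Quotient.mk I F := by
  have h1 := comp_aeval_apply (f := X) (Ideal.Quotient.mkₐ ℂ I) F
  rw [aeval_X_left_apply] at h1
  exact h1.symm

theorem isZeroOf_coordFun (I : Ideal (MvPolynomial (Fin n) ℂ)) : IsZeroOf I (coordFun I) := by
  intro F hF
  rw [aeval_coordFun]
  exact Ideal.Quotient.eq_zero_iff_mem.2 hF

theorem adjoin_range_coordFun (I : Ideal (MvPolynomial (Fin n) ℂ)) :
    Algebra.adjoin ℂ (range (coordFun I)) = ⊤ := by
  rw [Algebra.adjoin_range_eq_range_aeval, eq_top_iff]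
  intro g _
  obtain ⟨F, rfl⟩ := Ideal.Quotient.mk_surjective g
  exact ⟨F, aeval_coordFun I F⟩

/-- The homomorphism from the coordinate ring determined by a zero of `I`. -/
def IsZeroOf.lift {I : Ideal (MvPolynomial (Fin n) ℂ)} {v : Fin n → B} (hv : IsZeroOf I v) :
    (MvPolynomial (Fin n) ℂ ⧸ I) →ₐ[ℂ] B :=
  Ideal.Quotient.liftₐ I (aeval v) hv

theorem IsZeroOf.lift_coordFun {I : Ideal (MvPolynomial (Fin n) ℂ)} {v : Fin n → B}
    (hv : IsZeroOf I v) (i : Fin n) : hv.lift (coordFun I i) = v i := by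
  change aeval v (X i) = v i
  rw [aeval_X]

/-- The cone argument behind the theorem on tangencies: a family of cones of large total dimension
contained in the zero set of `I`, one member of which has a point `u₀` with
`u₀ - y₀ = p`, `y₀` a zero of `I`, contains a nonzero point with `p` in its tangent space. -/
theorem exists_tangent_point {I : Ideal (MvPolynomial (Fin n) ℂ)} [I.IsPrime] (hI : IsConical I)
    {d : ℕ} (hd : (d : Cardinal) ≤ Algebra.trdeg ℂ (MvPolynomial (Fin n) ℂ ⧸ I))
    {Γ : Type} [CommRing Γ] [IsDomain Γ] [Algebra ℂ Γ] [Algebra.FiniteType ℂ Γ]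
    (Z : Subalgebra ℂ Γ) (u : Fin n → Γ)
    (hgen : Algebra.adjoin ℂ ((Z : Set Γ) ∪ range u) = ⊤) (hu : IsZeroOf I u)
    (s : Γ →ₐ[ℂ] Polynomial Γ)
    (hsu : ∀ i, s (u i) = Polynomial.C (u i) * Polynomial.X)
    {ρ N : ℕ} (hZ : ¬ ((ρ + 1 : ℕ) : Cardinal) ≤ Algebra.trdeg ℂ Z)
    (hN : (N : Cardinal) ≤ Algebra.trdeg ℂ Γ) (hnum : ρ + 1 + n ≤ N + d)
    (φ : Γ →ₐ[ℂ] ℂ) {y : Fin n → ℂ} (hy : IsZeroOf I y)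
    {k : Fin n} (hk : φ (u k) - y k ≠ 0)
    {g : Γ} (hsg : s g = Polynomial.C g) (hφg : φ g ≠ 0) :
    ∃ ψ : Γ →ₐ[ℂ] ℂ, (∃ i, ψ (u i) ≠ 0) ∧ ψ g ≠ 0 ∧
      ∀ F ∈ I, dirDeriv F (fun i => ψ (u i)) (fun i => φ (u i) - y i) = 0 :=
  exists_tangent_point_aux hI (isZeroOf_coordFun I) (adjoin_range_coordFun I)
    (fun _ hv => ⟨hv.lift, hv.lift_coordFun⟩) hd Z u hgen hu s hsu hZ hN hnum φ hy hk hsg hφg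

end TangencyLemma

section SmoothCones

variable {n : ℕ}

/-- The space of tangent vectors at `v` to the zero set of `I`. -/
def tangentSpace (I : Ideal (MvPolynomial (Fin n) ℂ)) (v : Fin n → ℂ) :
    Submodule ℂ (Fin n → ℂ) where
  carrier := {p | ∀ F ∈ I, dirDeriv F v p = 0}
  add_mem' := by
    intro p q hp hq F hF
    have : dirDeriv F v (p + q) = dirDeriv F v p + dirDeriv F v q := by
      simp [dirDeriv, mul_add, Finset.sum_add_distrib]
    rw [this, hp F hF, hq F hF, add_zero]
  zero_mem' := by intro F _; simp [dirDeriv]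
  smul_mem' := by
    intro c p hp F hF
    have : dirDeriv F v (c • p) = c * dirDeriv F v p := by
      simp only [dirDeriv, Finset.mul_sum, Pi.smul_apply, smul_eq_mul]
      exact Finset.sum_congr rfl fun i _ => by ring
    rw [this, hp F hF, mul_zero]

/-- A prime conical ideal which is the full ideal of its nonzero zeros, and whose zero set is
smooth of dimension `m + 1` away from the origin. -/
structure IsSmoothCone (I : Ideal (MvPolynomial (Fin n) ℂ)) (m : ℕ) : Prop where
  prime : I.IsPrime
  conical : IsConical I
  mem_of_vanish : ∀ F, (∀ v : Fin n → ℂ, v ≠ 0 → IsZeroOf I v → aeval v F = 0) → F ∈ I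
  finrank_tangentSpace : ∀ v : Fin n → ℂ, v ≠ 0 → IsZeroOf I v →
    Module.finrank ℂ (tangentSpace I v) = m + 1

/-- The span of the gradients at `v` of elements of `I`. -/
def gradSpace (I : Ideal (MvPolynomial (Fin n) ℂ)) (v : Fin n → ℂ) :
    Submodule ℂ (Fin n → ℂ) where
  carrier := {g | ∃ F ∈ I, ∀ l, aeval v (pderiv l F) = g l}
  add_mem' := by
    rintro g h ⟨F, hF, hFg⟩ ⟨H, hH, hHh⟩
    exact ⟨F + H, I.add_mem hF hH, fun l => by rw [map_add, map_add, hFg, hHh]; rfl⟩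
  zero_mem' := ⟨0, I.zero_mem, fun l => by simp⟩
  smul_mem' := by
    rintro c g ⟨F, hF, hFg⟩
    exact ⟨C c * F, I.mul_mem_left _ hF, fun l => by simp [← hFg]⟩

theorem finrank_gradSpace_add (I : Ideal (MvPolynomial (Fin n) ℂ)) (v : Fin n → ℂ) :
    Module.finrank ℂ (gradSpace I v) + Module.finrank ℂ (tangentSpace I v) = n := by
  let e := dotProductEquiv ℂ (Fin n)
  have h1 : tangentSpace I v =
      ((gradSpace I v).map (e : (Fin n → ℂ) →ₗ[ℂ] Module.Dual ℂ (Fin n → ℂ))).dualCoannihilator := by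
    ext p
    rw [Submodule.mem_dualCoannihilator]
    constructor
    · rintro hp _ ⟨g, ⟨F, hF, hFg⟩, rfl⟩
      have := hp F hF
      simp only [dirDeriv, hFg] at this
      exact this
    · intro hp F hF
      exact hp _ ⟨fun l => aeval v (pderiv l F), ⟨F, hF, fun l => rfl⟩, rfl⟩
  rw [h1, ← LinearEquiv.finrank_map_eq e (gradSpace I v)]
  have := Subspace.finrank_add_finrank_dualCoannihilator_eq
    ((gradSpace I v).map (e : (Fin n → ℂ) →ₗ[ℂ] Module.Dual ℂ (Fin n → ℂ)))
  simpa using this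

/-- A matrix of polynomials whose rows indexed by `J` are gradients of elements of `I`, and whose
other rows are constant, with `J` of cardinality the codimension. -/
structure IsFrame (I : Ideal (MvPolynomial (Fin n) ℂ)) (m : ℕ)
    (G : Matrix (Fin n) (Fin n) (MvPolynomial (Fin n) ℂ)) (J : Finset (Fin n)) : Prop where
  grad : ∀ i ∈ J, ∃ F ∈ I, ∀ l, G i l = pderiv l F
  const : ∀ i ∉ J, ∃ c : Fin n → ℂ, ∀ l, G i l = C (c l)
  card : J.card + (m + 1) = n

theorem IsSmoothCone.exists_frame {I : Ideal (MvPolynomial (Fin n) ℂ)} {m : ℕ}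
    (h : IsSmoothCone I m) {v : Fin n → ℂ} (hv : v ≠ 0) (hz : IsZeroOf I v) :
    ∃ G J, IsFrame I m G J ∧ aeval v G.det ≠ 0 := by
  classical
  have hd := finrank_gradSpace_add I v
  rw [h.finrank_tangentSpace v hv hz] at hd
  obtain ⟨S', hS'⟩ := (gradSpace I v).exists_isCompl
  have hd' : Module.finrank ℂ S' = m + 1 := by
    have := Submodule.finrank_add_eq_of_isCompl hS'
    simp at this
    omega
  let b₁ := Module.finBasis ℂ (gradSpace I v)
  let b₂ := Module.finBasisOfFinrankEq ℂ S' hd'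
  let b := (b₁.prod b₂).map (Submodule.prodEquivOfIsCompl _ _ hS')
  let e : Fin (Module.finrank ℂ (gradSpace I v)) ⊕ Fin (m + 1) ≃ Fin n :=
    (finSumFinEquiv).trans (finCongr hd)
  have hb₁ : ∀ j, ∃ F ∈ I, ∀ l, aeval v (pderiv l F) = b (Sum.inl j) l := by
    intro j
    have : b (Sum.inl j) = (b₁ j : Fin n → ℂ) := by simp [b]
    rw [this]; exact (b₁ j).2
  choose F hF hFb using hb₁
  let G : Matrix (Fin n) (Fin n) (MvPolynomial (Fin n) ℂ) := Matrix.of fun i l =>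
    Sum.elim (fun j => pderiv l (F j)) (fun k => C (b (Sum.inr k) l)) (e.symm i)
  have hG : (aeval v).mapMatrix G = Matrix.of fun i => b (e.symm i) := by
    ext i l
    simp only [AlgHom.mapMatrix_apply, Matrix.map_apply, G, Matrix.of_apply]
    rcases e.symm i with j | k
    · simpa using hFb j l
    · simp
  refine ⟨G, Finset.univ.filter (fun i => (e.symm i).isLeft), ⟨?_, ?_, ?_⟩, ?_⟩
  · intro i hi
    simp only [Finset.mem_filter, Finset.mem_univ, true_and, Sum.isLeft_iff] at hi
    obtain ⟨j, hj⟩ := hi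
    exact ⟨F j, hF j, fun l => by simp [G, hj]⟩
  · intro i hi
    simp only [Finset.mem_filter, Finset.mem_univ, true_and, Bool.not_eq_true,
      Sum.isLeft_eq_false, Sum.isRight_iff] at hi
    obtain ⟨k, hk⟩ := hi
    exact ⟨b (Sum.inr k), fun l => by simp [G, hk]⟩
  · have : Finset.univ.filter (fun i => (e.symm i).isLeft) =
        (Finset.univ : Finset (Fin (Module.finrank ℂ (gradSpace I v)))).map
          (Function.Embedding.inl.trans e.toEmbedding) := by
      ext i
      simp only [Finset.mem_filter, Finset.mem_univ, true_and, Sum.isLeft_iff, Finset.mem_map,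
        Function.Embedding.trans_apply, Function.Embedding.inl_apply, Equiv.coe_toEmbedding]
      exact exists_congr fun j => by rw [Equiv.symm_apply_eq, eq_comm]
    rw [this, Finset.card_map, Finset.card_univ, Fintype.card_fin, hd]
  · rw [AlgHom.map_det, hG]
    have h1 : LinearIndependent ℂ (Matrix.of fun i => b (e.symm i)).row :=
      b.linearIndependent.comp _ e.symm.injective
    rw [Matrix.linearIndependent_rows_iff_isUnit, Matrix.isUnit_iff_isUnit_det] at h1
    exact h1.ne_zero

/-- The columns of the adjugate of a frame matrix with index outside `J` are vector fields
tangent to the zero set. -/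
theorem IsSmoothCone.sum_pderiv_mul_adjugate_mem {I : Ideal (MvPolynomial (Fin n) ℂ)} {m : ℕ}
    (h : IsSmoothCone I m) {G : Matrix (Fin n) (Fin n) (MvPolynomial (Fin n) ℂ)}
    {J : Finset (Fin n)} (hG : IsFrame I m G J) (hdet : G.det ∉ I) {i : Fin n} (hi : i ∉ J)
    {F : MvPolynomial (Fin n) ℂ} (hF : F ∈ I) :
    ∑ l, pderiv l F * G.adjugate l i ∈ I := by
  classical
  refine (h.prime.mem_or_mem (x := G.det) ?_).resolve_left hdet
  refine h.mem_of_vanish _ fun w hw hz => ?_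
  rw [map_mul]
  by_cases hD : aeval w G.det = 0
  · rw [hD, zero_mul]
  refine mul_eq_zero_of_right _ ?_
  have hD' : ((aeval w).mapMatrix G).det ≠ 0 := by rwa [← AlgHom.map_det]
  set N := (aeval w : _ →ₐ[ℂ] ℂ).mapMatrix G with hN
  have hli : LinearIndependent ℂ N.row := by
    rw [Matrix.linearIndependent_rows_iff_isUnit, Matrix.isUnit_iff_isUnit_det]
    exact isUnit_iff_ne_zero.2 hD'
  have hspan : Submodule.span ℂ (range fun j : J => N.row j) = gradSpace I w := by
    refine Submodule.eq_of_le_of_finrank_eq ?_ ?_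
    · rw [Submodule.span_le]
      rintro _ ⟨j, rfl⟩
      obtain ⟨F', hF', hj⟩ := hG.grad j j.2
      exact ⟨F', hF', fun l => by simp [N, hj]⟩
    · have h1 := finrank_span_eq_card (hli.comp _ (Subtype.val_injective (p := (· ∈ J))))
      have h2 := finrank_gradSpace_add I w
      rw [h.finrank_tangentSpace w hw hz] at h2
      have h3 := hG.card
      rw [Fintype.card_coe] at h1
      change Module.finrank ℂ (Submodule.span ℂ (range (N.row ∘ Subtype.val))) = _
      rw [h1]; omega
  let ℓ : (Fin n → ℂ) →ₗ[ℂ] ℂ := ∑ l, N.adjugate l i • LinearMap.proj l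
  have hℓ : ∀ g, ℓ g = ∑ l, g l * N.adjugate l i := by
    intro g; simp [ℓ, mul_comm]
  have hle : gradSpace I w ≤ LinearMap.ker ℓ := by
    rw [← hspan, Submodule.span_le]
    rintro _ ⟨j, rfl⟩
    change ℓ _ = 0
    rw [hℓ]
    have h1 := congrFun (congrFun (Matrix.mul_adjugate N) j) i
    rw [Matrix.mul_apply] at h1
    have hji : (j : Fin n) ≠ i := fun h => hi (h ▸ j.2)
    simpa [Matrix.one_apply, hji] using h1
  have h2 : ℓ (fun l => aeval w (pderiv l F)) = 0 := hle ⟨F, hF, fun l => rfl⟩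
  rw [hℓ] at h2
  have h3 : ∀ l, aeval w (G.adjugate l i) = N.adjugate l i := by
    intro l
    have := AlgHom.map_adjugate (aeval w : _ →ₐ[ℂ] ℂ) G
    rw [← hN] at this
    rw [← this]; rfl
  rw [map_sum, ← h2]
  exact Finset.sum_congr rfl fun l _ => by rw [map_mul, h3]

/-- Tangent vectors extend, up to a scalar, to polynomial vector fields. -/
theorem IsSmoothCone.exists_vectorField {I : Ideal (MvPolynomial (Fin n) ℂ)} {m : ℕ}
    (h : IsSmoothCone I m) {v : Fin n → ℂ} (hv : v ≠ 0) (hz : IsZeroOf I v) {p : Fin n → ℂ}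
    (hp : p ∈ tangentSpace I v) :
    ∃ W : Fin n → MvPolynomial (Fin n) ℂ, (∀ F ∈ I, ∑ l, pderiv l F * W l ∈ I) ∧
      ∀ l, aeval v (W l) = p l := by
  classical
  obtain ⟨G, J, hG, hD⟩ := h.exists_frame hv hz
  have hdet : G.det ∉ I := fun hm => hD (hz _ hm)
  set N := (aeval v : _ →ₐ[ℂ] ℂ).mapMatrix G with hN
  have hND : aeval v G.det = N.det := AlgHom.map_det _ _
  let t : Fin n → ℂ := fun i => ∑ l, N i l * p l
  have ht : ∀ i ∈ J, t i = 0 := by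
    intro i hi
    obtain ⟨F, hF, hi'⟩ := hG.grad i hi
    have := hp F hF
    simp only [dirDeriv, ← hi'] at this
    exact this
  refine ⟨fun l => ∑ i ∈ Jᶜ, C (N.det⁻¹ * t i) * G.adjugate l i, ?_, ?_⟩
  · intro F hF
    have : ∑ l, pderiv l F * ∑ i ∈ Jᶜ, C (N.det⁻¹ * t i) * G.adjugate l i =
        ∑ i ∈ Jᶜ, C (N.det⁻¹ * t i) * ∑ l, pderiv l F * G.adjugate l i := by
      simp_rw [Finset.mul_sum]
      rw [Finset.sum_comm]
      exact Finset.sum_congr rfl fun i _ => Finset.sum_congr rfl fun l _ => by ring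
    rw [this]
    exact Ideal.sum_mem _ fun i hi => Ideal.mul_mem_left _ _
      (h.sum_pderiv_mul_adjugate_mem hG hdet (Finset.mem_compl.1 hi) hF)
  · intro l
    have h3 : ∀ i, aeval v (G.adjugate l i) = N.adjugate l i := by
      intro i
      have := AlgHom.map_adjugate (aeval v : _ →ₐ[ℂ] ℂ) G
      rw [← hN] at this
      rw [← this]; rfl
    simp only [map_sum, map_mul, h3]
    have h4 : ∑ i ∈ Jᶜ, aeval v (C (N.det⁻¹ * t i)) * N.adjugate l i =
        ∑ i, N.det⁻¹ * (N.adjugate l i * t i) := by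
      rw [← Finset.sum_subset (Finset.subset_univ Jᶜ)]
      · exact Finset.sum_congr rfl fun i _ => by simp; ring
      · intro i _ hi
        rw [ht i (by simpa using hi)]; simp
    simp only [map_mul] at h4
    rw [h4, ← Finset.mul_sum]
    have h5 : N.adjugate.mulVec (N.mulVec p) = N.det • p := by
      rw [Matrix.mulVec_mulVec, Matrix.adjugate_mul, Matrix.smul_mulVec, Matrix.one_mulVec]
    have h6 : ∑ i, N.adjugate l i * t i = N.det * p l := congrFun h5 l
    rw [h6, ← mul_assoc, inv_mul_cancel₀ (hND ▸ hD), one_mul]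

end SmoothCones

section Derivations

theorem formallyEtale_of_isAlgebraic (A L : Type) [CommRing A] [IsDomain A] [CharZero A] [Field L]
    [Algebra A L] [FaithfulSMul A L] [Algebra.IsAlgebraic A L] : Algebra.FormallyEtale A L := by
  let _ := FractionRing.liftAlgebra A L
  have : IsScalarTower A (FractionRing A) L := FractionRing.isScalarTower_liftAlgebra A L
  have : Algebra.IsAlgebraic (FractionRing A) L :=
    (IsFractionRing.comap_isAlgebraic_iff (A := A)).1 inferInstance
  have : CharZero (FractionRing A) :=
    charZero_of_injective_algebraMap (IsFractionRing.injective A (FractionRing A))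
  have : Algebra.FormallyEtale A (FractionRing A) :=
    Algebra.FormallyEtale.of_isLocalization (nonZeroDivisors A)
  have : Algebra.FormallyEtale (FractionRing A) L := Algebra.FormallyEtale.of_isSeparable _ _
  exact Algebra.FormallyEtale.comp A (FractionRing A) L

variable {A L : Type} [CommRing A] [IsDomain A] [Algebra ℂ A] [Field L] [Algebra ℂ L]
    [Algebra A L] [IsScalarTower ℂ A L] [FaithfulSMul A L] [Algebra.IsAlgebraic A L]

/-- Derivations extend to algebraic field extensions. -/
theorem Derivation.exists_extend (D : Derivation ℂ A L) :
    ∃ D' : Derivation ℂ L L, ∀ a, D' (algebraMap A L a) = D a := by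
  have : CharZero A := charZero_of_injective_algebraMap (algebraMap ℂ A).injective
  have := formallyEtale_of_isAlgebraic A L
  let e := KaehlerDifferential.tensorKaehlerEquivOfFormallyEtale ℂ A L
  let f : TensorProduct A L (KaehlerDifferential ℂ A) →ₗ[L] L :=
    LinearMap.liftBaseChange L D.liftKaehlerDifferential
  refine ⟨(f ∘ₗ e.symm.toLinearMap).compDer (KaehlerDifferential.D ℂ L), fun a => ?_⟩
  have h := KaehlerDifferential.tensorKaehlerEquivOfFormallyEtale_symm_D_algebraMap ℂ A L a
  change f (e.symm (KaehlerDifferential.D ℂ L (algebraMap A L a))) = D a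
  rw [h]
  simp [f]

theorem Derivation.ext_of_isAlgebraic {D₁ D₂ : Derivation ℂ L L}
    (h : ∀ a, D₁ (algebraMap A L a) = D₂ (algebraMap A L a)) : D₁ = D₂ := by
  have : CharZero A := charZero_of_injective_algebraMap (algebraMap ℂ A).injective
  have := formallyEtale_of_isAlgebraic A L
  let e := KaehlerDifferential.tensorKaehlerEquivOfFormallyEtale ℂ A L
  have h1 : D₁.liftKaehlerDifferential ∘ₗ e.toLinearMap =
      D₂.liftKaehlerDifferential ∘ₗ e.toLinearMap := by
    apply TensorProduct.AlgebraTensorModule.curry_injective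
    apply LinearMap.ext_ring
    refine LinearMap.ext fun ω => ?_
    have hω : ω ∈ Submodule.span A (range (KaehlerDifferential.D ℂ A)) := by
      rw [KaehlerDifferential.span_range_derivation]; trivial
    induction hω using Submodule.span_induction with
    | mem x hx =>
      obtain ⟨a, rfl⟩ := hx
      simpa [e] using h a
    | zero => simp
    | add x y _ _ hx hy => rw [map_add, map_add, hx, hy]
    | smul a x _ hx => rw [LinearMap.map_smul_of_tower, LinearMap.map_smul_of_tower, hx]
  ext a
  have h2 := LinearMap.congr_fun h1 (e.symm (KaehlerDifferential.D ℂ L a))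
  simpa using h2

/-- The derivation given by a homomorphism into the dual numbers. -/
def Derivation.ofDualNumber {S B : Type} [CommRing S] [CommRing B] [Algebra ℂ S] [Algebra ℂ B]
    [Algebra S B] [IsScalarTower ℂ S B] (f : S →ₐ[ℂ] DualNumber B)
    (hf : ∀ a, TrivSqZeroExt.fst (f a) = algebraMap S B a) : Derivation ℂ S B :=
  Derivation.mk' ((TrivSqZeroExt.sndHom B B).restrictScalars ℂ ∘ₗ f.toLinearMap) (by
    intro a b
    simp [hf, Algebra.smul_def, mul_comm])

theorem IsZeroOf.dual {n : ℕ} {I : Ideal (MvPolynomial (Fin n) ℂ)} {B : Type} [CommRing B]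
    [Algebra ℂ B] {u w : Fin n → B} (hu : IsZeroOf I u) (hw : ∀ F ∈ I, dirDeriv F u w = 0) :
    IsZeroOf I (fun i => (TrivSqZeroExt.inl (u i) + TrivSqZeroExt.inr (w i) : DualNumber B)) := by
  intro F hF
  have h1 : (fun i => (TrivSqZeroExt.inl (u i) + TrivSqZeroExt.inr (w i) : DualNumber B)) =
      fun i => TrivSqZeroExt.inlAlgHom ℂ B B (u i) +
        DualNumber.eps * TrivSqZeroExt.inlAlgHom ℂ B B (w i) := by
    funext i
    ext <;> simp
  obtain ⟨G, hG⟩ := exists_taylor F (fun i => TrivSqZeroExt.inlAlgHom ℂ B B (u i))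
    (fun i => TrivSqZeroExt.inlAlgHom ℂ B B (w i)) (DualNumber.eps)
  rw [h1, hG, ← map_dirDeriv, hw F hF, (hu.map (TrivSqZeroExt.inlAlgHom ℂ B B)) F hF, pow_two,
    DualNumber.eps_mul_eps]
  simp

theorem Derivation.apply_aeval {n : ℕ} {S B : Type} [CommRing S] [CommRing B] [Algebra ℂ S]
    [Algebra ℂ B] [Algebra S B] [IsScalarTower ℂ S B] (D : Derivation ℂ S B) (u : Fin n → S)
    (F : MvPolynomial (Fin n) ℂ) :
    D (aeval u F) = dirDeriv F (fun i => algebraMap S B (u i)) (fun i => D (u i)) := by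
  induction F using MvPolynomial.induction_on with
  | C a => simp [dirDeriv]
  | add f g hf hg => rw [map_add, map_add, hf, hg]; simp [dirDeriv, add_mul, Finset.sum_add_distrib]
  | mul_X f j hf =>
    have h0 : ∀ g : MvPolynomial (Fin n) ℂ, aeval (fun i => algebraMap S B (u i)) g =
        algebraMap S B (aeval u g) := fun g => by
      rw [← IsScalarTower.toAlgHom_apply ℂ S B, comp_aeval_apply]; rfl
    rw [map_mul, Derivation.leibniz, hf, aeval_X]
    simp only [dirDeriv, Derivation.leibniz, pderiv_X, smul_eq_mul, map_add, map_mul, aeval_X,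
        add_mul, Finset.sum_add_distrib, Algebra.smul_def, h0, Finset.mul_sum]
    congr 1
    · rw [Finset.sum_eq_single j]
      · simp
      · intro i _ hij; simp [hij]
      · simp
    · exact Finset.sum_congr rfl fun i _ => by ring

/-- A tangent vector field defines a derivation of the coordinate ring. -/
theorem exists_derivation_coordFun {n : ℕ} {I : Ideal (MvPolynomial (Fin n) ℂ)} {B : Type}
    [CommRing B] [Algebra ℂ B] [Algebra (MvPolynomial (Fin n) ℂ ⧸ I) B]
    [IsScalarTower ℂ (MvPolynomial (Fin n) ℂ ⧸ I) B] (w : Fin n → B)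
    (hw : ∀ F ∈ I, dirDeriv F (fun i => algebraMap _ B (coordFun I i)) w = 0) :
    ∃ D : Derivation ℂ (MvPolynomial (Fin n) ℂ ⧸ I) B, ∀ i, D (coordFun I i) = w i := by
  have h1 : IsZeroOf I (fun i => algebraMap _ B (coordFun I i)) :=
    (isZeroOf_coordFun I).map (IsScalarTower.toAlgHom ℂ _ B)
  have h2 := h1.dual hw
  have h3 : (TrivSqZeroExt.fstHom ℂ B B).comp h2.lift = IsScalarTower.toAlgHom ℂ _ B := by
    refine AlgHom.ext_of_adjoin_eq_top (adjoin_range_coordFun I) ?_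
    rintro _ ⟨i, rfl⟩
    simp [IsZeroOf.lift_coordFun]
  refine ⟨Derivation.ofDualNumber h2.lift fun a => DFunLike.congr_fun h3 a, fun i => ?_⟩
  change TrivSqZeroExt.snd (h2.lift (coordFun I i)) = w i
  rw [IsZeroOf.lift_coordFun]
  simp

end Derivations

section TranscendenceDegree

theorem Algebra.IsAlgebraic.mvPolynomial_of_isTranscendenceBasis {ι K : Type} [Field K]
    [Algebra ℂ K] {x : ι → K} (hx : IsTranscendenceBasis ℂ x) :
    @Algebra.IsAlgebraic (MvPolynomial ι ℂ) K _ _ (aeval x).toAlgebra := by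
  let _ : Algebra (MvPolynomial ι ℂ) K := (aeval x).toAlgebra
  have := hx.isAlgebraic
  refine Algebra.IsAlgebraic.of_ringHom_of_comp_eq (S := Algebra.adjoin ℂ (range x)) (B := K)
    hx.1.aevalEquiv (RingHom.id K) hx.1.aevalEquiv.surjective Function.injective_id ?_
  ext a
  · simp [RingHom.algebraMap_toAlgebra]
  · simp [RingHom.algebraMap_toAlgebra]

/-- Derivations are determined by, and freely prescribed on, a transcendence basis. -/
theorem IsTranscendenceBasis.exists_derivation_equiv {ι K : Type} [Field K] [Algebra ℂ K]
    {x : ι → K} (hx : IsTranscendenceBasis ℂ x) :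
    Nonempty (Derivation ℂ K K ≃ₗ[K] (ι → K)) := by
  let _ : Algebra (MvPolynomial ι ℂ) K := (aeval x).toAlgebra
  have := Algebra.IsAlgebraic.mvPolynomial_of_isTranscendenceBasis hx
  have : IsScalarTower ℂ (MvPolynomial ι ℂ) K := IsScalarTower.of_algHom (aeval x)
  have : FaithfulSMul (MvPolynomial ι ℂ) K := (faithfulSMul_iff_algebraMap_injective _ _).2 hx.1
  let f : Derivation ℂ K K →ₗ[K] (ι → K) :=
    { toFun := fun D i => D (x i), map_add' := fun _ _ => rfl, map_smul' := fun _ _ => rfl }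
  refine ⟨LinearEquiv.ofBijective f ⟨?_, ?_⟩⟩
  · intro D₁ D₂ h
    refine Derivation.ext_of_isAlgebraic (A := MvPolynomial ι ℂ) fun a => ?_
    have h1 : D₁.compAlgebraMap (MvPolynomial ι ℂ) = D₂.compAlgebraMap (MvPolynomial ι ℂ) := by
      refine MvPolynomial.derivation_ext fun i => ?_
      have h2 : algebraMap (MvPolynomial ι ℂ) K (X i) = x i := aeval_X _ _
      change D₁ (algebraMap (MvPolynomial ι ℂ) K (X i)) = D₂ (algebraMap (MvPolynomial ι ℂ) K (X i))
      rw [h2]; exact congrFun h i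
    exact DFunLike.congr_fun h1 a
  · intro w
    obtain ⟨D, hD⟩ := Derivation.exists_extend (L := K) (mkDerivation ℂ w)
    refine ⟨D, ?_⟩
    funext i
    have h2 : algebraMap (MvPolynomial ι ℂ) K (X i) = x i := aeval_X _ _
    have h3 := hD (X i)
    rw [h2, mkDerivation_X] at h3
    exact h3

theorem trdeg_eq_finrank_derivation {K : Type} [Field K] [Algebra ℂ K] {d : ℕ}
    (hd : Nonempty (Derivation ℂ K K ≃ₗ[K] (Fin d → K)))  :
    Algebra.trdeg ℂ K = d := by
  classical
  obtain ⟨s, hs⟩ := exists_isTranscendenceBasis ℂ K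
  obtain ⟨e⟩ := hs.exists_derivation_equiv
  obtain ⟨e'⟩ := hd
  have e'' : (s → K) ≃ₗ[K] (Fin d → K) := e.symm.trans e'
  have hfin : Finite s := by
    have : Module.Finite K (s → K) := Module.Finite.equiv e''.symm
    have h1 : LinearIndependent K (fun i : s => (Pi.single i 1 : s → K)) := by
      exact Pi.linearIndependent_single_one s K
    exact h1.finite
  have := Fintype.ofFinite s
  have h2 := e''.finrank_eq
  rw [Module.finrank_fintype_fun_eq_card, Module.finrank_fintype_fun_eq_card, Fintype.card_fin] at h2
  rw [← hs.cardinalMk_eq_trdeg, Cardinal.mk_fintype, h2]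

theorem IsSmoothCone.exists_ne_zero {n : ℕ} {I : Ideal (MvPolynomial (Fin n) ℂ)} {m : ℕ}
    (h : IsSmoothCone I m) : ∃ v : Fin n → ℂ, v ≠ 0 ∧ IsZeroOf I v := by
  by_contra! hcon
  exact h.prime.ne_top ((Ideal.eq_top_iff_one I).2
    (h.mem_of_vanish 1 fun v hv hz => absurd hz (hcon v hv)))

theorem IsSmoothCone.trdeg_eq_aux {n : ℕ} {I : Ideal (MvPolynomial (Fin n) ℂ)} {m : ℕ}
    (h : IsSmoothCone I m) {R K : Type} [CommRing R] [IsDomain R] [Algebra ℂ R] [Field K]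
    [Algebra ℂ K] [Algebra R K] [IsScalarTower ℂ R K] [IsFractionRing R K] {x' : Fin n → R}
    (hadj : Algebra.adjoin ℂ (range x') = ⊤) (hker : ∀ F, aeval x' F = 0 ↔ F ∈ I)
    (hder : ∀ w : Fin n → K, (∀ F ∈ I, dirDeriv F (fun i => algebraMap R K (x' i)) w = 0) →
      ∃ D : Derivation ℂ R K, ∀ i, D (x' i) = w i) :
    Algebra.trdeg ℂ R = (m + 1 : ℕ) := by
  classical
  obtain ⟨v, hv, hz⟩ := h.exists_ne_zero
  obtain ⟨G, J, hG, hD⟩ := h.exists_frame hv hz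
  have hdet : G.det ∉ I := fun hm => hD (hz _ hm)
  have : Algebra.IsAlgebraic R K := IsLocalization.isAlgebraic K (nonZeroDivisors R)
  let x : Fin n → K := fun i => algebraMap R K (x' i)
  have hx : ∀ F, aeval x F = algebraMap R K (aeval x' F) := fun F => by
    rw [← IsScalarTower.toAlgHom_apply ℂ R K, comp_aeval_apply]; rfl
  have hx0 : ∀ F ∈ I, aeval x F = 0 := fun F hF => by
    rw [hx, (hker F).2 hF, map_zero]
  set N := (aeval x : _ →ₐ[ℂ] K).mapMatrix G with hN
  have hND : N.det ≠ 0 := by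
    rw [hN, ← AlgHom.map_det, hx]
    intro h0
    rw [map_eq_zero_iff _ (IsFractionRing.injective R K)] at h0
    exact hdet ((hker _).1 h0)
  have hcard : Fintype.card {i // i ∉ J} = m + 1 := by
    have := hG.card
    have h2 := Fintype.card_subtype_compl (· ∈ J)
    simp at h2 ⊢
    omega
  let f : Derivation ℂ K K →ₗ[K] ({i // i ∉ J} → K) :=
    { toFun := fun D i => ∑ l, N i l * D (x l)
      map_add' := fun D E => by
        funext i; simp [mul_add, Finset.sum_add_distrib]
      map_smul' := fun c D => by
        funext i
        simp only [Derivation.smul_apply, Pi.smul_apply, smul_eq_mul, RingHom.id_apply,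
          Finset.mul_sum]
        exact Finset.sum_congr rfl fun l _ => by ring }
  have hDJ : ∀ D : Derivation ℂ K K, ∀ i ∈ J, ∑ l, N i l * D (x l) = 0 := by
    intro D i hi
    obtain ⟨F, hF, hFi⟩ := hG.grad i hi
    have h1 := D.apply_aeval x F
    rw [hx0 F hF, map_zero] at h1
    rw [h1]
    exact Finset.sum_congr rfl fun l _ => by simp [N, hFi]
  have hf : Function.Bijective f := by
    constructor
    · rw [← LinearMap.ker_eq_bot, LinearMap.ker_eq_bot']
      intro D hDf
      have h1 : N.mulVec (fun l => D (x l)) = 0 := by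
        funext i
        by_cases hi : i ∈ J
        · exact hDJ D i hi
        · exact congrFun hDf ⟨i, hi⟩
      have h2 := Matrix.eq_zero_of_mulVec_eq_zero hND h1
      refine Derivation.ext_of_isAlgebraic (A := R) fun a => ?_
      have h3 : D.compAlgebraMap R = 0 := by
        refine Derivation.ext_of_adjoin_eq_top _ hadj ?_
        rintro _ ⟨i, rfl⟩
        exact congrFun h2 i
      exact DFunLike.congr_fun h3 a
    · intro s
      let s' : Fin n → K := fun i => if hi : i ∈ J then 0 else s ⟨i, hi⟩
      let w : Fin n → K := N.det⁻¹ • N.adjugate.mulVec s'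
      have hNw : N.mulVec w = s' := by
        rw [Matrix.mulVec_smul, Matrix.mulVec_mulVec, Matrix.mul_adjugate, Matrix.smul_mulVec,
          Matrix.one_mulVec, smul_smul, inv_mul_cancel₀ hND, one_smul]
      have hw : ∀ F ∈ I, dirDeriv F x w = 0 := by
        intro F hF
        have h1 : ∀ i ∉ J, ∑ l, aeval x (pderiv l F) * N.adjugate l i = 0 := by
          intro i hi
          have h2 := hx0 _ (h.sum_pderiv_mul_adjugate_mem hG hdet hi hF)
          have h3 : ∀ l, aeval x (G.adjugate l i) = N.adjugate l i := by
            intro l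
            have := AlgHom.map_adjugate (aeval x : _ →ₐ[ℂ] K) G
            rw [← hN] at this
            rw [← this]; rfl
          simpa only [map_sum, map_mul, h3] using h2
        have h4 : dirDeriv F x w = N.det⁻¹ * ∑ i, (∑ l, aeval x (pderiv l F) * N.adjugate l i) * s' i := by
          simp only [dirDeriv, w, Pi.smul_apply, smul_eq_mul, Matrix.mulVec, dotProduct,
            Finset.mul_sum, Finset.sum_mul]
          rw [Finset.sum_comm]
          exact Finset.sum_congr rfl fun i _ => Finset.sum_congr rfl fun l _ => by ring
        rw [h4, Finset.sum_eq_zero, mul_zero]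
        intro i _
        by_cases hi : i ∈ J
        · simp [s', hi]
        · rw [h1 i hi, zero_mul]
      obtain ⟨D, hD⟩ := hder w hw
      obtain ⟨D', hD'⟩ := D.exists_extend
      refine ⟨D', ?_⟩
      funext i
      have h5 := congrFun hNw i
      simp only [s', i.2, dite_false] at h5
      rw [← h5]
      change ∑ l, N i l * D' (x l) = ∑ l, N i l * w l
      refine Finset.sum_congr rfl fun l _ => ?_
      rw [hD', hD]
  have he : ({i // i ∉ J} → K) ≃ₗ[K] (Fin (m + 1) → K) :=
    LinearEquiv.funCongrLeft K K (Fintype.equivFinOfCardEq hcard).symm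
  have h7 := trdeg_eq_finrank_derivation ⟨(LinearEquiv.ofBijective f hf).trans he⟩
  rw [← h7, ← trdeg_add_eq ℂ R (A := K), trdeg_eq_zero_iff (R := R) |>.2 ‹_›, add_zero]

theorem IsSmoothCone.trdeg_eq {n : ℕ} {I : Ideal (MvPolynomial (Fin n) ℂ)} {m : ℕ}
    (h : IsSmoothCone I m) : Algebra.trdeg ℂ (MvPolynomial (Fin n) ℂ ⧸ I) = (m + 1 : ℕ) := by
  have := h.prime
  refine h.trdeg_eq_aux (K := FractionRing (MvPolynomial (Fin n) ℂ ⧸ I))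
    (adjoin_range_coordFun I) (fun F => ?_) fun w hw => exists_derivation_coordFun w hw
  rw [aeval_coordFun, Ideal.Quotient.eq_zero_iff_mem]

end TranscendenceDegree

section IntegralDerivations

theorem iterate_commutator_mul {E : Type} [Ring E] {a g c : E} (h : a * g - g * a = c)
    (hc : c * g = g * c) (n : ℕ) (x : E) :
    (fun y => y * g - g * y)^[n + 1] (a * x) = a * (fun y => y * g - g * y)^[n + 1] x +
      (n + 1) • (c * (fun y => y * g - g * y)^[n] x) := by
  have hag : a * g = g * a + c := by rw [← h]; abel
  have h1 : ∀ y, (a * y) * g - g * (a * y) = a * (y * g - g * y) + c * y := by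
    intro y
    rw [← mul_assoc g a y, ← h]; noncomm_ring
  have h2 : ∀ y, (c * y) * g - g * (c * y) = c * (y * g - g * y) := by
    intro y
    rw [← mul_assoc g c y, ← hc]; noncomm_ring
  induction n with
  | zero => simp [h1]
  | succ n ih =>
    rw [Function.iterate_succ_apply', ih]
    simp only [add_mul, mul_add, smul_mul_assoc, mul_smul_comm, Function.iterate_succ_apply']
    have h3 := h1 ((fun y => y * g - g * y)^[n] x * g - g * (fun y => y * g - g * y)^[n] x)
    have h4 := h2 ((fun y => y * g - g * y)^[n] x)
    rw [add_sub_add_comm, h3, ← smul_sub, h4, add_smul (n + 1) 1, one_smul]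
    abel

theorem iterate_commutator_pow {E : Type} [Ring E] {a g c : E} (h : a * g - g * a = c)
    (hc : c * g = g * c) (N : ℕ) : (∀ n, N < n → (fun y => y * g - g * y)^[n] (a ^ N) = 0) ∧
      (fun y => y * g - g * y)^[N] (a ^ N) = N.factorial • c ^ N := by
  have h0 : ∀ n, (fun y => y * g - g * y)^[n] (0 : E) = 0 := fun n => by
    induction n with
    | zero => rfl
    | succ n ih => rw [Function.iterate_succ_apply', ih]; simp
  induction N with
  | zero =>
    refine ⟨fun n hn => ?_, by simp⟩
    obtain ⟨k, rfl⟩ := Nat.exists_eq_add_of_lt hn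
    rw [zero_add, Function.iterate_succ_apply]
    simpa using h0 k
  | succ N ih =>
    refine ⟨fun n hn => ?_, ?_⟩
    · obtain ⟨k, rfl⟩ := Nat.exists_eq_add_of_lt hn
      rw [pow_succ', iterate_commutator_mul h hc, ih.1 _ (by omega), ih.1 _ (by omega)]
      simp
    · rw [pow_succ', iterate_commutator_mul h hc, ih.1 _ (by omega), ih.2]
      rw [mul_zero, zero_add, mul_smul_comm, smul_smul, ← pow_succ', Nat.factorial_succ]

/-- Seidenberg's theorem: a derivation preserving a Noetherian domain preserves its integral
closure. -/
theorem Derivation.isIntegral_apply {R L : Type} [CommRing R] [IsDomain R] [IsNoetherianRing R]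
    [Algebra ℂ R] [Field L] [Algebra ℂ L] [Algebra R L] [IsScalarTower ℂ R L] [IsFractionRing R L]
    (D : Derivation ℂ L L) (hD : ∀ a : R, D (algebraMap R L a) ∈ (algebraMap R L).range) {g : L}
    (hg : IsIntegral R g) : IsIntegral R (D g) := by
  obtain ⟨d, hd, hdg⟩ := hg.isAlmostIntegral
  set S := (algebraMap R L).range with hS
  let δ : L := algebraMap R L d
  have hδ : ∀ k, δ * g ^ k ∈ S := fun k => by
    have := hdg k; rwa [Algebra.smul_def] at this
  let a : Module.End ℂ L := D.toLinearMap
  let G : Module.End ℂ L := LinearMap.mulLeft ℂ g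
  let c : Module.End ℂ L := LinearMap.mulLeft ℂ (D g)
  have h1 : a * G - G * a = c := by
    ext x
    simp [a, G, c, mul_comm]
  have h2 : c * G = G * c := by
    ext x
    simp only [G, c, Module.End.mul_apply, LinearMap.mulLeft_apply]; ring
  have hDS : ∀ x ∈ S, D x ∈ S := by
    rintro _ ⟨x, rfl⟩; exact hD x
  have ha : ∀ n, ∀ x ∈ S, (a ^ n) x ∈ S := by
    intro n
    induction n with
    | zero => intro x hx; simpa using hx
    | succ n ih =>
      intro x hx
      rw [pow_succ', Module.End.mul_apply]
      exact hDS _ (ih x hx)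
  have hgood : ∀ n N i j, δ * g ^ j * ((fun y => y * G - G * y)^[n] (a ^ N)) (g ^ i * δ) ∈ S := by
    intro n N
    induction n with
    | zero =>
      intro i j
      exact S.mul_mem (hδ j) (ha N _ (by rw [mul_comm]; exact hδ i))
    | succ n ih =>
      intro i j
      rw [Function.iterate_succ_apply']
      have h3 := S.sub_mem (ih (i + 1) j) (ih i (j + 1))
      convert h3 using 1
      simp only [LinearMap.sub_apply, Module.End.mul_apply, G, LinearMap.mulLeft_apply]
      rw [pow_succ' g i, mul_assoc g, mul_sub]
      ring
  refine IsAlmostIntegral.isIntegral (R := R) ⟨d * d, mul_mem hd hd, fun n => ?_⟩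
  have h4 := hgood n n 0 0
  rw [(iterate_commutator_pow h1 h2 n).2] at h4
  have h5 : ∀ k, (c ^ k) δ = (D g) ^ k * δ := by
    intro k
    induction k with
    | zero => simp
    | succ k ih => rw [pow_succ', Module.End.mul_apply, ih]; simp only [c, LinearMap.mulLeft_apply]; ring
  have h6 : algebraMap ℂ L ((n.factorial : ℂ)⁻¹) ∈ S := by
    rw [IsScalarTower.algebraMap_apply ℂ R L]; exact ⟨_, rfl⟩
  have h7 := S.mul_mem h6 h4
  have hne : (n.factorial : L) ≠ 0 := by
    have : CharZero L := charZero_of_injective_algebraMap (algebraMap ℂ L).injective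
    exact_mod_cast n.factorial_ne_zero
  convert h7 using 1
  rw [Algebra.smul_def, map_mul]
  have h8 : algebraMap ℂ L ((n.factorial : ℂ)⁻¹) = (n.factorial : L)⁻¹ := by
    rw [map_inv₀, _root_.map_natCast]
  rw [pow_zero, one_mul, mul_one, LinearMap.smul_apply, h5, h8, nsmul_eq_mul]
  change δ * δ * D g ^ n = _
  field_simp

theorem minpoly.squarefree_of_isReduced {κ S : Type} [Field κ] [CommRing S] [IsReduced S]
    [Algebra κ S] {x : S} (hx : IsIntegral κ x) : Squarefree (minpoly κ x) := by
  intro p hp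
  obtain ⟨q, hq⟩ := hp
  have h1 : Polynomial.aeval x (p * q) = 0 := by
    have h2 : Polynomial.aeval x (p * q) ^ 2 = 0 := by
      have h3 : (p * q) ^ 2 = minpoly κ x * q := by rw [hq]; ring
      rw [← map_pow, h3, map_mul, minpoly.aeval, zero_mul]
    exact pow_eq_zero_iff (two_ne_zero) |>.1 h2
  have h4 := minpoly.dvd κ x h1
  have hne := minpoly.ne_zero hx
  rw [hq, mul_assoc] at h4
  have hpq : p * q ≠ 0 := by
    intro h0; rw [hq, mul_assoc, h0, mul_zero] at hne; exact hne rfl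
  obtain ⟨r, hr⟩ := h4
  refine isUnit_iff_exists_inv.2 ⟨r, ?_⟩
  have h5 : (p * q) * (p * r) = (p * q) * 1 := by linear_combination -hr
  exact mul_left_cancel₀ hpq h5

/-- Over a base with perfect residue field, a reduced fibre satisfies equations with invertible
derivative. -/
theorem exists_aeval_derivative_unit {O B : Type} [CommRing O] [CommRing B] [Algebra O B]
    [Algebra.IsIntegral O B] (P : Ideal O) [P.IsMaximal] [CharZero (O ⧸ P)]
    (hP : (P.map (algebraMap O B)).IsRadical) (a : B) :
    ∃ (g : Polynomial O) (u : B), Polynomial.aeval a g ∈ P.map (algebraMap O B) ∧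
      Polynomial.aeval a (Polynomial.derivative g) * u - 1 ∈ P.map (algebraMap O B) := by
  let _ : Field (O ⧸ P) := Ideal.Quotient.field P
  set Q := P.map (algebraMap O B)
  let _ : Algebra (O ⧸ P) (B ⧸ Q) := Ideal.Quotient.algebraQuotientOfLEComap Ideal.le_comap_map
  have : IsScalarTower O (O ⧸ P) (B ⧸ Q) := IsScalarTower.of_algebraMap_eq fun x => rfl
  have : IsReduced (B ⧸ Q) := (Ideal.isRadical_iff_quotient_reduced Q).1 hP
  have hintg : IsIntegral (O ⧸ P) (Ideal.Quotient.mk Q a) := by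
    have h1 : IsIntegral O (Ideal.Quotient.mkₐ O Q a) :=
      (Algebra.IsIntegral.isIntegral (R := O) a).map (Ideal.Quotient.mkₐ O Q)
    exact h1.tower_top
  have hsep := PerfectField.separable_iff_squarefree.2 (minpoly.squarefree_of_isReduced hintg)
  obtain ⟨p, q, hpq⟩ := hsep
  have hsurj : Function.Surjective (Polynomial.map (Ideal.Quotient.mk P)) :=
    Polynomial.map_surjective _ Ideal.Quotient.mk_surjective
  obtain ⟨g, hg⟩ := hsurj (minpoly (O ⧸ P) (Ideal.Quotient.mk Q a))
  obtain ⟨q', hq'⟩ := hsurj q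
  have hev : ∀ f : Polynomial O, Ideal.Quotient.mk Q (Polynomial.aeval a f) =
      Polynomial.aeval (Ideal.Quotient.mk Q a) (f.map (Ideal.Quotient.mk P)) := by
    intro f
    have h2 := Polynomial.aeval_map_algebraMap (O ⧸ P) (Ideal.Quotient.mk Q a) f
    have h3 := Polynomial.aeval_algHom_apply (Ideal.Quotient.mkₐ O Q) a f
    rw [Ideal.Quotient.algebraMap_eq] at h2
    rw [h2]; exact h3.symm
  refine ⟨g, Polynomial.aeval a q', ?_, ?_⟩
  · rw [← Ideal.Quotient.eq_zero_iff_mem, hev, hg, minpoly.aeval]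
  · rw [← Ideal.Quotient.eq_zero_iff_mem, map_sub, map_mul, hev, hev, ← Polynomial.derivative_map,
      hg, hq', map_one]
    have h4 := congrArg (Polynomial.aeval (Ideal.Quotient.mk Q a)) hpq
    rw [map_add, map_mul, map_mul, minpoly.aeval, mul_zero, zero_add, map_one] at h4
    rw [mul_comm, h4, sub_self]

theorem Derivation.exists_apply_aeval_polynomial {O B L : Type} [CommRing O] [CommRing B]
    [Field L] [Algebra ℂ L] [Algebra O B] [Algebra B L] [Algebra O L] [IsScalarTower O B L]
    (D : Derivation ℂ L L) (hD : ∀ o : O, D (algebraMap O L o) ∈ (algebraMap O L).range) (a : B)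
    (g : Polynomial O) : ∃ h : B, D (algebraMap B L (Polynomial.aeval a g)) = algebraMap B L h +
      algebraMap B L (Polynomial.aeval a (Polynomial.derivative g)) * D (algebraMap B L a) := by
  induction g using Polynomial.induction_on' with
  | add p q hp hq =>
    obtain ⟨h, hh⟩ := hp
    obtain ⟨h', hh'⟩ := hq
    refine ⟨h + h', ?_⟩
    simp only [map_add, hh, hh']; ring
  | monomial k o =>
    obtain ⟨o', ho'⟩ := hD o
    refine ⟨algebraMap O B o' * a ^ k, ?_⟩
    rw [Polynomial.aeval_monomial, Polynomial.derivative_monomial, Polynomial.aeval_monomial]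
    simp only [map_mul, map_pow, ← IsScalarTower.algebraMap_apply O B L, Derivation.leibniz,
      Derivation.leibniz_pow, ← ho', smul_eq_mul, _root_.map_natCast, nsmul_eq_mul]
    ring

theorem Ideal.map_le_jacobson_bot_of_isIntegral {O B : Type} [CommRing O] [IsLocalRing O]
    [CommRing B] [Algebra O B] [Algebra.IsIntegral O B] :
    (IsLocalRing.maximalIdeal O).map (algebraMap O B) ≤ Ideal.jacobson ⊥ := by
  rw [Ideal.jacobson]
  refine le_sInf fun M hM => ?_
  have := hM.2
  have h1 : (M.comap (algebraMap O B)).IsMaximal := Ideal.isMaximal_comap_of_isIntegral_of_isMaximal M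
  rw [Ideal.map_le_iff_le_comap, IsLocalRing.eq_maximalIdeal h1]

/-- A derivation preserving a discrete valuation ring preserves its integral closure in a finite
extension whose closed fibre is reduced. -/
theorem Derivation.exists_algebraMap_eq_of_isRadical {O K B L : Type} [CommRing O] [IsDomain O]
    [IsLocalRing O] [IsNoetherianRing O] [IsIntegrallyClosed O] [Field K] [Field L] [CommRing B]
    [Algebra O K] [IsFractionRing O K] [CharZero (O ⧸ IsLocalRing.maximalIdeal O)]
    [Algebra ℂ L] [Algebra O B] [Algebra B L] [Algebra O L] [IsScalarTower O B L]
    [Algebra K L] [IsScalarTower O K L] [FiniteDimensional K L] [CharZero K]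
    [IsIntegralClosure B O L] {ϖ : O} (hϖ : IsLocalRing.maximalIdeal O = Ideal.span {ϖ})
    (D : Derivation ℂ L L) (hD : ∀ o : O, D (algebraMap O L o) ∈ (algebraMap O L).range)
    (hrad : ((IsLocalRing.maximalIdeal O).map (algebraMap O B)).IsRadical) (a : B) :
    D (algebraMap B L a) ∈ (algebraMap B L).range := by
  have : Algebra.IsIntegral O B := IsIntegralClosure.isIntegral_algebra O L
  have : Module.Finite O B := IsIntegralClosure.finite O K L B
  let N : Submodule B L := LinearMap.range (Algebra.linearMap B L)
  let M : Submodule B L := Submodule.span B (range fun a : B => D (algebraMap B L a))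
  have hfg : (N ⊔ M).FG := by
    obtain ⟨s, hs⟩ := (Module.Finite.fg_top : (⊤ : Submodule O B).FG)
    have hN : N.FG := by
      have : N = Submodule.span B {1} := by
        ext x
        simp [N, Submodule.mem_span_singleton, Algebra.smul_def]
      rw [this]; exact Submodule.fg_span_singleton 1
    have h1 : N ⊔ M = N ⊔ Submodule.span B ((fun a : B => D (algebraMap B L a)) '' s) := by
      refine le_antisymm (sup_le le_sup_left ?_)
        (sup_le_sup_left (Submodule.span_mono (image_subset_range _ _)) _)
      rw [Submodule.span_le]
      rintro _ ⟨a, rfl⟩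
      have ha : a ∈ Submodule.span O (s : Set B) := by rw [hs]; trivial
      simp only [SetLike.mem_coe]
      induction ha using Submodule.span_induction with
      | mem x hx => exact Submodule.mem_sup_right (Submodule.subset_span ⟨x, hx, rfl⟩)
      | zero => simp
      | add x y _ _ hx hy => rw [map_add, map_add]; exact add_mem hx hy
      | smul o x _ hx =>
        rw [Algebra.smul_def, map_mul, Derivation.leibniz]
        refine add_mem ?_ (Submodule.mem_sup_left ?_)
        · rw [smul_eq_mul, ← Algebra.smul_def]; exact Submodule.smul_mem _ _ hx
        · obtain ⟨o', ho'⟩ := hD o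
          refine ⟨x * algebraMap O B o', ?_⟩
          rw [← IsScalarTower.algebraMap_apply, ← ho', IsScalarTower.algebraMap_apply O B L]
          simp
    rw [h1]
    exact hN.sup (Submodule.fg_span (s.finite_toSet.image _))
  have hle : N ⊔ M ≤ N ⊔ ((IsLocalRing.maximalIdeal O).map (algebraMap O B)) • (N ⊔ M) := by
    refine sup_le le_sup_left ?_
    rw [Submodule.span_le]
    rintro _ ⟨a, rfl⟩
    obtain ⟨g, u, hg, hu⟩ := exists_aeval_derivative_unit (IsLocalRing.maximalIdeal O) hrad a
    obtain ⟨h, hh⟩ := D.exists_apply_aeval_polynomial hD a g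
    set Q := (IsLocalRing.maximalIdeal O).map (algebraMap O B) with hQ
    have hQ' : Q = Ideal.span {algebraMap O B ϖ} := by
      rw [hQ, hϖ, Ideal.map_span, image_singleton]
    rw [hQ', Ideal.mem_span_singleton] at hg hu
    obtain ⟨c, hc⟩ := hg
    obtain ⟨e, he⟩ := hu
    obtain ⟨o', ho'⟩ := hD ϖ
    rw [hc, map_mul, Derivation.leibniz, ← IsScalarTower.algebraMap_apply, ← ho',
      IsScalarTower.algebraMap_apply O B L, IsScalarTower.algebraMap_apply O B L] at hh
    have he' := congrArg (algebraMap B L) he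
    simp only [map_mul, map_sub, map_one] at he'
    simp only [smul_eq_mul] at hh
    set b := algebraMap O B ϖ
    have key : D (algebraMap B L a) = algebraMap B L (u * (c * algebraMap O B o' - h)) +
        b • (u • D (algebraMap B L c) - e • D (algebraMap B L a)) := by
      simp only [Algebra.smul_def, map_mul, map_sub]
      linear_combination -(algebraMap B L u) * hh - D (algebraMap B L a) * he'
    simp only [SetLike.mem_coe]
    rw [key]
    refine add_mem (Submodule.mem_sup_left ⟨_, rfl⟩) (Submodule.mem_sup_right ?_)
    refine Submodule.smul_mem_smul ?_ (Submodule.mem_sup_right ?_)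
    · rw [hQ']; exact Ideal.mem_span_singleton_self b
    · exact sub_mem (Submodule.smul_mem _ _ (Submodule.subset_span ⟨c, rfl⟩))
        (Submodule.smul_mem _ _ (Submodule.subset_span ⟨a, rfl⟩))
  have h := Submodule.le_of_le_smul_of_le_jacobson_bot hfg
    Ideal.map_le_jacobson_bot_of_isIntegral hle
  obtain ⟨x, hx⟩ := h (Submodule.mem_sup_right (Submodule.subset_span ⟨a, rfl⟩))
  exact ⟨x, hx⟩

end IntegralDerivations

section Ramification

/-- A finite extension of a semilocal principal ideal domain has principal integral closure. -/
theorem isPrincipalIdealRing_of_isIntegralClosure (O K B L : Type) [CommRing O]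
    [IsLocalRing O] [IsDedekindDomain O] [Field K] [Field L] [CommRing B] [IsDomain B]
    [Algebra O K] [IsFractionRing O K] [Algebra O B] [Algebra B L] [Algebra O L]
    [IsScalarTower O B L] [Algebra K L] [IsScalarTower O K L] [FiniteDimensional K L]
    [CharZero K] [IsIntegralClosure B O L] : IsPrincipalIdealRing B := by
  have : IsDedekindDomain B := IsIntegralClosure.isDedekindDomain O K L B
  have : Algebra.IsIntegral O B := IsIntegralClosure.isIntegral_algebra O L
  have hinj : Function.Injective (algebraMap O B) := by
    have h1 : Function.Injective (algebraMap O L) := by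
      rw [IsScalarTower.algebraMap_eq O K L]
      exact (algebraMap K L).injective.comp (IsFractionRing.injective O K)
    rw [IsScalarTower.algebraMap_eq O B L, RingHom.coe_comp] at h1
    exact h1.of_comp
  have : Module.IsTorsionFree O B := Module.isTorsionFree_iff_algebraMap_injective.2 hinj
  refine IsPrincipalIdealRing.of_finite_maximals
    ((IsDedekindDomain.primesOver_finite (IsLocalRing.maximalIdeal O) B).subset ?_)
  intro M hM
  have : M.IsMaximal := hM
  have h1 : (M.comap (algebraMap O B)).IsMaximal := Ideal.isMaximal_comap_of_isIntegral_of_isMaximal M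
  exact ⟨hM.isPrime, ⟨(IsLocalRing.eq_maximalIdeal h1).symm⟩⟩

/-- Integrality over a factorial domain can be checked in codimension one. -/
theorem exists_prime_not_isIntegral_mul {A : Type} (K : Type) {L : Type} [CommRing A] [IsDomain A]
    [UniqueFactorizationMonoid A] [Field K] [Field L] [Algebra A K] [IsFractionRing A K]
    [Algebra A L] [Algebra K L] [IsScalarTower A K L] [FiniteDimensional K L] {x : L}
    (hx : ¬ IsIntegral A x) :
    ∃ b : A, Prime b ∧ ∀ t, ¬ b ∣ t → ¬ IsIntegral A (algebraMap A L t * x) := by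
  have hxK : IsIntegral K x := Algebra.IsIntegral.isIntegral x
  obtain ⟨i, hi⟩ : ∃ i, (minpoly K x).coeff i ∉ (algebraMap A K).range := by
    by_contra! hcon
    have h1 : minpoly K x ∈ Polynomial.lifts (algebraMap A K) := by
      rw [Polynomial.lifts_iff_coeff_lifts]
      exact hcon
    obtain ⟨q, hq, -, hqm⟩ := Polynomial.lifts_and_natDegree_eq_and_monic h1 (minpoly.monic hxK)
    refine hx ⟨q, hqm, ?_⟩
    have h2 := minpoly.aeval K x
    rw [← hq, Polynomial.aeval_map_algebraMap] at h2
    exact h2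
  set c := (minpoly K x).coeff i with hc
  have hden : ¬ IsUnit (IsFractionRing.den A c : A) := fun hu =>
    hi (IsFractionRing.isInteger_of_isUnit_den hu)
  obtain ⟨b, hb, hbd⟩ := WfDvdMonoid.exists_irreducible_factor hden
    (nonZeroDivisors.ne_zero (IsFractionRing.den A c).2)
  have hbp := UniqueFactorizationMonoid.irreducible_iff_prime.1 hb
  refine ⟨b, hbp, fun t ht hintg => ?_⟩
  have ht0 : t ≠ 0 := fun h => ht (h ▸ dvd_zero b)
  have htK : algebraMap A K t ≠ 0 := by simpa using ht0
  have h1 := minpoly.isIntegrallyClosed_eq_field_fractions' K hintg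
  have h2 : algebraMap A L t * x = algebraMap A K t • x := by
    rw [Algebra.smul_def, ← IsScalarTower.algebraMap_apply]
  rw [h2, IsIntegrallyClosed.minpoly_smul htK hxK] at h1
  have h3 := congrArg (fun p => Polynomial.coeff p i) h1
  simp only [Polynomial.coeff_scaleRoots, Polynomial.coeff_map, ← hc] at h3
  set k := (minpoly K x).natDegree - i
  set a := (minpoly A (algebraMap A K t • x)).coeff i
  have h4 : IsFractionRing.num A c * t ^ k = a * IsFractionRing.den A c := by
    apply IsFractionRing.injective A K
    have h5 := IsFractionRing.mk'_num_den' A c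
    rw [map_mul, map_mul, ← h3, map_pow]
    rw [div_eq_iff (by simp)] at h5
    rw [h5]; ring
  have h6 : b ∣ IsFractionRing.num A c * t ^ k := h4 ▸ Dvd.dvd.mul_left hbd a
  have h7 : b ∣ IsFractionRing.num A c :=
    (hbp.dvd_or_dvd h6).resolve_right fun h => ht (hbp.dvd_of_dvd_pow h)
  exact hb.not_isUnit (IsFractionRing.num_den_reduced A c h7 hbd)

theorem exists_sq_dvd_aux {A O K L : Type} [CommRing A] [IsDomain A] [IsNoetherianRing A]
    [Algebra ℂ A] [Field K] [Field L] [Algebra A K] [IsFractionRing A K]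
    [Algebra ℂ L] [Algebra A L] [Algebra K L] [IsScalarTower A K L] [IsScalarTower ℂ A L]
    [FiniteDimensional K L] [CommRing O] [IsDomain O] [Algebra A O] [Algebra O K]
    [IsScalarTower A O K] [Algebra O L] [IsScalarTower O K L] [IsScalarTower A O L]
    {b : A} (hb : Prime b) (hP : (Ideal.span {b}).IsPrime)
    [IsLocalization.AtPrime O (Ideal.span {b})] (D : Derivation ℂ L L)
    (hD : ∀ a : A, D (algebraMap A L a) ∈ (algebraMap A L).range) {α : L} (hα : IsIntegral A α)
    (hDα : ∀ t, ¬ b ∣ t → ¬ IsIntegral A (algebraMap A L t * D α)) :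
    ∃ s : A, ¬ b ∣ s ∧ ∃ π w : L, IsIntegral A π ∧ IsIntegral A w ∧
      π ^ 2 * w = algebraMap A L (s ^ 3 * b) ∧
      ∀ t, ¬ b ∣ t → ∀ c, IsIntegral A c → π * c ≠ algebraMap A L t := by
  have : IsFractionRing O K := IsFractionRing.isFractionRing_of_isDomain_of_isLocalization
    (Ideal.span {b}).primeCompl O K
  have : IsLocalRing O := IsLocalization.AtPrime.isLocalRing O (Ideal.span {b})
  have : IsNoetherianRing O := IsLocalization.isNoetherianRing (Ideal.span {b}).primeCompl O ‹_›
  have hmax : IsLocalRing.maximalIdeal O = Ideal.span {algebraMap A O b} := by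
    rw [← IsLocalization.AtPrime.map_eq_maximalIdeal (Ideal.span {b}) O, Ideal.map_span,
      image_singleton]
  have : IsDedekindDomain O :=
    ((tfae_of_isNoetherianRing_of_isLocalRing_of_isDomain O).out 2 4).2
      (⟨⟨_, hmax⟩⟩ : (IsLocalRing.maximalIdeal O).IsPrincipal)
  have hbt : ∀ t, ¬ b ∣ t ↔ t ∈ (Ideal.span {b}).primeCompl := fun t => by
    rw [Ideal.mem_primeCompl_iff, Ideal.mem_span_singleton]
  have hinjA : Function.Injective (algebraMap A L) := by
    rw [IsScalarTower.algebraMap_eq A K L]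
    exact (algebraMap K L).injective.comp (IsFractionRing.injective A K)
  have : CharZero A := charZero_of_injective_algebraMap (algebraMap ℂ A).injective
  have : CharZero K := charZero_of_injective_algebraMap (IsFractionRing.injective A K)
  have : CharZero (O ⧸ IsLocalRing.maximalIdeal O) := by
    have hnt : Nontrivial (O ⧸ IsLocalRing.maximalIdeal O) := inferInstance
    exact charZero_of_injective_ringHom
      (((Ideal.Quotient.mk _).comp (algebraMap A O)).comp (algebraMap ℂ A)).injective
  let B := integralClosure O L
  have hunit : ∀ t, ¬ b ∣ t → IsUnit (algebraMap A O t) := fun t ht =>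
    IsLocalization.map_units O (⟨t, (hbt t).1 ht⟩ : (Ideal.span {b}).primeCompl)
  have hAO : ∀ c : L, IsIntegral A c → IsIntegral O c := fun c hc => hc.tower_top
  have hOA : ∀ c : L, IsIntegral O c → ∃ t, ¬ b ∣ t ∧ IsIntegral A (algebraMap A L t * c) := by
    intro c hc
    obtain ⟨t, ht⟩ := hc.exists_multiple_integral_of_isLocalization (Ideal.span {b}).primeCompl
    refine ⟨t, (hbt t).2 t.2, ?_⟩
    rwa [Submonoid.smul_def, Algebra.smul_def] at ht
  have hDO : ∀ o : O, D (algebraMap O L o) ∈ (algebraMap O L).range := by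
    intro o
    obtain ⟨⟨a, t⟩, hat⟩ := IsLocalization.surj (Ideal.span {b}).primeCompl o
    simp only at hat
    obtain ⟨u, hu⟩ := IsLocalization.map_units O t
    obtain ⟨a', ha'⟩ := hD a
    obtain ⟨t', ht'⟩ := hD t
    have h1 := congrArg (fun z => D (algebraMap O L z)) hat
    simp only [map_mul, ← IsScalarTower.algebraMap_apply, Derivation.leibniz, smul_eq_mul,
      ← ha', ← ht'] at h1
    refine ⟨(algebraMap A O a' - o * algebraMap A O t') * ↑u⁻¹, ?_⟩
    have h2 : algebraMap O L (↑u⁻¹ : O) * algebraMap A L t = 1 := by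
      rw [IsScalarTower.algebraMap_apply A O L, ← map_mul, ← hu, Units.inv_mul, map_one]
    simp only [map_mul, map_sub, ← IsScalarTower.algebraMap_apply]
    linear_combination (- algebraMap O L (↑u⁻¹ : O)) * h1 + D (algebraMap O L o) * h2
  have : IsPrincipalIdealRing B := isPrincipalIdealRing_of_isIntegralClosure O K B L
  have hbB : (algebraMap O B (algebraMap A O b)) ≠ 0 := by
    intro h0
    have h1 := congrArg (algebraMap B L) h0
    rw [← IsScalarTower.algebraMap_apply, ← IsScalarTower.algebraMap_apply, map_zero] at h1
    exact hb.ne_zero (hinjA (by rw [h1, map_zero]))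
  have hsq : ¬ Squarefree (algebraMap O B (algebraMap A O b)) := by
    intro hsq
    have hrad : ((IsLocalRing.maximalIdeal O).map (algebraMap O B)).IsRadical := by
      rw [hmax, Ideal.map_span, image_singleton, ← isRadical_iff_span_singleton]
      exact hsq.isRadical
    obtain ⟨x, hx⟩ := Derivation.exists_algebraMap_eq_of_isRadical (K := K) (B := B) hmax D hDO hrad
      (⟨α, hAO α hα⟩ : B)
    obtain ⟨t, ht, hti⟩ := hOA (D α) (by
      change algebraMap B L x = D α at hx
      rw [← hx]; exact x.2)
    exact hDα t ht hti
  rw [Squarefree] at hsq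
  push Not at hsq
  obtain ⟨π, ⟨w, hw⟩, hπ⟩ := hsq
  obtain ⟨t₁, ht₁, hi₁⟩ := hOA π π.2
  obtain ⟨t₂, ht₂, hi₂⟩ := hOA w w.2
  have hIA : ∀ t : A, IsIntegral A (algebraMap A L t) := fun t => isIntegral_algebraMap
  refine ⟨t₁ * t₂, fun h => (hb.dvd_or_dvd h).elim ht₁ ht₂,
    algebraMap A L (t₁ * t₂) * π, algebraMap A L (t₁ * t₂) * w, ?_, ?_, ?_, ?_⟩
  · rw [map_mul, mul_comm (algebraMap A L t₁), mul_assoc]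
    exact (hIA t₂).mul hi₁
  · rw [map_mul, mul_assoc]
    exact (hIA t₁).mul hi₂
  · have h1 := congrArg (algebraMap B L) hw
    rw [← IsScalarTower.algebraMap_apply, ← IsScalarTower.algebraMap_apply, map_mul, map_mul] at h1
    change _ = (π : L) * (π : L) * (w : L) at h1
    rw [map_mul _ (_ ^ 3), map_pow, h1]; ring
  · intro t ht c hc heq
    apply hπ
    have hu : IsUnit (algebraMap A O t) := hunit t ht
    obtain ⟨u, hu⟩ := hu
    have hcB : IsIntegral O c := hAO c hc
    let e : B := ⟨c, hcB⟩ * algebraMap O B (algebraMap A O (t₁ * t₂) * ↑u⁻¹)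
    refine isUnit_iff_exists_inv.2 ⟨e, ?_⟩
    apply Subtype.val_injective
    change (π : L) * (c * algebraMap O L (algebraMap A O (t₁ * t₂) * ↑u⁻¹)) = 1
    have h2 : algebraMap O L (↑u⁻¹ : O) * algebraMap A L t = 1 := by
      rw [IsScalarTower.algebraMap_apply A O L, ← map_mul, ← hu, Units.inv_mul, map_one]
    rw [map_mul, ← IsScalarTower.algebraMap_apply]
    linear_combination (algebraMap O L (↑u⁻¹ : O)) * heq + h2

/-- If a derivation of a finite extension preserves a factorial domain `A` but not its integral
closure, then the extension is ramified along some prime of `A`. -/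
theorem exists_ramified_prime {A : Type} (K : Type) {L : Type} [CommRing A] [IsDomain A]
    [UniqueFactorizationMonoid A] [IsNoetherianRing A]
    [Algebra ℂ A] [Field K] [Field L] [Algebra A K] [IsFractionRing A K]
    [Algebra ℂ L] [Algebra A L] [Algebra K L] [IsScalarTower A K L] [IsScalarTower ℂ A L]
    [FiniteDimensional K L] (D : Derivation ℂ L L)
    (hD : ∀ a : A, D (algebraMap A L a) ∈ (algebraMap A L).range) {α : L} (hα : IsIntegral A α)
    (hDα : ¬ IsIntegral A (D α)) :
    ∃ b : A, Prime b ∧ ∃ s : A, ¬ b ∣ s ∧ ∃ π w : L, IsIntegral A π ∧ IsIntegral A w ∧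
      π ^ 2 * w = algebraMap A L (s ^ 3 * b) ∧
      ∀ t, ¬ b ∣ t → ∀ c, IsIntegral A c → π * c ≠ algebraMap A L t := by
  obtain ⟨b, hb, hbt⟩ := exists_prime_not_isIntegral_mul K hDα
  have hP : (Ideal.span {b}).IsPrime := (Ideal.span_singleton_prime hb.ne_zero).2 hb
  let O := Localization.subalgebra.ofField K (Ideal.span {b}).primeCompl
    (Ideal.primeCompl_le_nonZeroDivisors _)
  have : IsLocalization.AtPrime O (Ideal.span {b}) :=
    Localization.subalgebra.isLocalization_ofField K _ _
  have : IsScalarTower A O L := IsScalarTower.of_algebraMap_eq fun a => by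
    rw [IsScalarTower.algebraMap_apply A K L]; rfl
  exact ⟨b, hb, exists_sq_dvd_aux (O := O) (K := K) hb hP D hD hα hbt⟩

end Ramification

section AlgebraicSubalgebras

/-- An algebra generated by elements algebraic over a subalgebra is algebraic over it. -/
theorem Subalgebra.isAlgebraic_of_adjoin_eq_top {k T : Type} [Field k] [CommRing T] [IsDomain T]
    [Algebra k T] (S : Subalgebra k T) {s : Set T} (hs : Algebra.adjoin k s = ⊤)
    (h : ∀ t ∈ s, IsAlgebraic S t) : Algebra.IsAlgebraic S T := by
  have h1 : (⊤ : Subalgebra k T) ≤ (Subalgebra.algebraicClosure S T).restrictScalars k := by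
    rw [← hs, Algebra.adjoin_le_iff]
    exact h
  exact ⟨fun t => h1 trivial⟩

theorem Subalgebra.trdeg_eq_of_isAlgebraic {k T : Type} [Field k] [CommRing T] [IsDomain T]
    [Algebra k T] (S : Subalgebra k T) [Algebra.IsAlgebraic S T] :
    Algebra.trdeg k S = Algebra.trdeg k T := by
  rw [← trdeg_add_eq k S (A := T), trdeg_eq_zero (R := S) (A := T), add_zero]

/-- Algebraicity over a subalgebra is preserved by injective homomorphisms. -/
theorem Subalgebra.isAlgebraic_map {k T T' : Type} [Field k] [CommRing T] [Algebra k T]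
    [CommRing T'] [Algebra k T'] (f : T →ₐ[k] T') (hf : Function.Injective f)
    {S : Subalgebra k T} {S' : Subalgebra k T'} (hS : ∀ t ∈ S, f t ∈ S') {t : T}
    (ht : IsAlgebraic S t) : IsAlgebraic S' (f t) := by
  let g : S →ₐ[k] S' := (f.comp S.val).codRestrict S' fun t => hS t t.2
  refine ht.ringHom_of_comp_eq g (f : T →+* T') (fun a b hab => ?_) ?_
  · exact Subtype.val_injective (hf (congrArg Subtype.val hab))
  · ext t; rfl

theorem succ_le_trdeg_polynomial {D : Type} [CommRing D] [IsDomain D] [Algebra ℂ D] {d : ℕ}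
    (h : (d : Cardinal) ≤ Algebra.trdeg ℂ D) :
    ((d + 1 : ℕ) : Cardinal) ≤ Algebra.trdeg ℂ (Polynomial D) := by
  rw [← trdeg_add_eq ℂ D (A := Polynomial D), Polynomial.trdeg_of_isDomain]
  push_cast
  gcongr

/-- A nontrivial algebraic relation bounds the transcendence degree. -/
theorem not_le_trdeg_adjoin_range {n : ℕ} {T : Type} [CommRing T] [IsDomain T] [Algebra ℂ T]
    {z : Fin n → T} {b : MvPolynomial (Fin n) ℂ} (hb : b ≠ 0) (hbz : aeval z b = 0) :
    ¬ (n : Cardinal) ≤ Algebra.trdeg ℂ (Algebra.adjoin ℂ (range z)) := by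
  intro hn
  let f : MvPolynomial (Fin n) ℂ →ₐ[ℂ] T := aeval z
  have hP : (RingHom.ker f).IsPrime := RingHom.ker_isPrime _
  have hne : RingHom.ker f ≠ ⊥ := fun h0 => hb (by
    have : b ∈ RingHom.ker f := hbz
    rwa [h0] at this)
  have e : (MvPolynomial (Fin n) ℂ ⧸ RingHom.ker f) ≃ₐ[ℂ] f.range :=
    Ideal.quotientKerEquivRange f
  have h1 : (n : Cardinal) ≤ Algebra.trdeg ℂ (MvPolynomial (Fin n) ℂ ⧸ RingHom.ker f) := by
    rw [e.trdeg_eq]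
    rw [Algebra.adjoin_range_eq_range_aeval] at hn
    exact hn
  have h2 := succ_le_trdeg_of_le_trdeg_quotient hne h1
  rw [MvPolynomial.trdeg_of_isDomain] at h2
  simp at h2

end AlgebraicSubalgebras

section TangentFields

variable {n : ℕ}

/-- A polynomial vector field tangent to the zero set of `I`. -/
def IsTangentField (I : Ideal (MvPolynomial (Fin n) ℂ)) (W : Fin n → MvPolynomial (Fin n) ℂ) :
    Prop := ∀ F ∈ I, ∑ l, pderiv l F * W l ∈ I

theorem dirDeriv_sum {ι : Type} {B : Type} [CommRing B] [Algebra ℂ B] (s : Finset ι)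
    (F : ι → MvPolynomial (Fin n) ℂ) (u p : Fin n → B) :
    dirDeriv (∑ j ∈ s, F j) u p = ∑ j ∈ s, dirDeriv (F j) u p := by
  simp only [dirDeriv, map_sum, Finset.sum_mul]
  rw [Finset.sum_comm]

theorem isTangentField_euler {I : Ideal (MvPolynomial (Fin n) ℂ)} (hI : IsConical I) :
    IsTangentField I X := by
  intro F hF
  rw [← sum_homogeneousComponent F]
  simp only [map_sum, Finset.sum_mul]
  rw [Finset.sum_comm]
  refine Ideal.sum_mem _ fun d _ => ?_
  have h := (homogeneousComponent_isHomogeneous d F).sum_X_mul_pderiv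
  simp_rw [mul_comm (X _)] at h
  rw [h]
  exact nsmul_mem (hI F hF d) d

/-- The tangent space is constant along rays. -/
theorem mem_tangentSpace_of_smul {I : Ideal (MvPolynomial (Fin n) ℂ)} (hI : IsConical I)
    {v p : Fin n → ℂ} {c : ℂ} (hc : c ≠ 0) (hp : p ∈ tangentSpace I (fun i => c * v i)) :
    p ∈ tangentSpace I v := by
  intro F hF
  rw [← sum_homogeneousComponent F, dirDeriv_sum]
  refine Finset.sum_eq_zero fun d _ => ?_
  have h1 := hp _ (hI F hF d)
  have h2 : dirDeriv (homogeneousComponent d F) (fun i => c * v i) p =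
      c ^ (d - 1) * dirDeriv (homogeneousComponent d F) v p := by
    simp only [dirDeriv, Finset.mul_sum]
    refine Finset.sum_congr rfl fun i _ => ?_
    rw [aeval_smul_homogeneous (homogeneousComponent_isHomogeneous d F).pderiv, mul_assoc]
  rw [h2] at h1
  exact (mul_eq_zero.1 h1).resolve_left (pow_ne_zero _ hc)

theorem IsTangentField.mem_tangentSpace {I : Ideal (MvPolynomial (Fin n) ℂ)}
    {W : Fin n → MvPolynomial (Fin n) ℂ} (hW : IsTangentField I W) {v : Fin n → ℂ}
    (hv : IsZeroOf I v) : (fun l => aeval v (W l)) ∈ tangentSpace I v := by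
  intro F hF
  have := hv _ (hW F hF)
  simp only [map_sum, map_mul] at this
  exact this

theorem IsSmoothCone.isTangentField_scale {I : Ideal (MvPolynomial (Fin n) ℂ)} {m : ℕ}
    (h : IsSmoothCone I m) {W : Fin n → MvPolynomial (Fin n) ℂ} (hW : IsTangentField I W)
    {c : ℂ} (hc : c ≠ 0) :
    IsTangentField I (fun l => aeval (fun i => C c * X i) (W l)) := by
  intro F hF
  refine h.mem_of_vanish _ fun v hv hz => ?_
  have hz' : IsZeroOf I (fun i => c * v i) := hz.smul h.conical c
  have h1 := mem_tangentSpace_of_smul h.conical hc (hW.mem_tangentSpace hz') F hF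
  simp only [map_sum, map_mul]
  rw [← h1]
  refine Finset.sum_congr rfl fun l _ => ?_
  rw [comp_aeval_apply]
  simp

/-- A relation linear in all tangent fields persists under scaling by an indeterminate. -/
theorem IsSmoothCone.sum_mul_aeval_scale_eq_zero {I : Ideal (MvPolynomial (Fin n) ℂ)} {m : ℕ}
    (h : IsSmoothCone I m) {D : Type} [CommRing D] [IsDomain D] [Algebra ℂ D] {x c : Fin n → D}
    (hstar : ∀ W, IsTangentField I W → ∑ j, c j * aeval x (W j) = 0)
    {W : Fin n → MvPolynomial (Fin n) ℂ} (hW : IsTangentField I W) :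
    ∑ j, Polynomial.C (c j) * aeval (fun i => Polynomial.C (x i) * Polynomial.X) (W j) = 0 := by
  set P := ∑ j, Polynomial.C (c j) * aeval (fun i => Polynomial.C (x i) * Polynomial.X) (W j)
  refine Polynomial.eq_zero_of_infinite_isRoot P ?_
  refine Set.Infinite.mono (s := (fun t : ℂ => algebraMap ℂ D t) '' {0}ᶜ) ?_
    ((Set.finite_singleton (0 : ℂ)).infinite_compl.image
      ((algebraMap ℂ D).injective.injOn))
  rintro _ ⟨t, ht, rfl⟩
  have h1 := hstar _ (h.isTangentField_scale hW (c := t) (by simpa using ht))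
  simp only [Set.mem_ofPred_eq, Polynomial.IsRoot.def, P]
  rw [← h1, Polynomial.eval_finsetSum]
  refine Finset.sum_congr rfl fun j _ => ?_
  rw [Polynomial.eval_mul, Polynomial.eval_C, comp_aeval_apply]
  congr 1
  have h2 := comp_aeval_apply (R := ℂ) (f := fun i => Polynomial.C (x i) * Polynomial.X)
    ((Polynomial.aeval (R := D) (algebraMap ℂ D t)).restrictScalars ℂ) (W j)
  simp only [AlgHom.coe_restrictScalars', Polynomial.coe_aeval_eq_eval] at h2
  rw [h2]
  congr 2
  funext i
  rw [Polynomial.eval_mul, Polynomial.eval_C, Polynomial.eval_X, map_mul, ← algebraMap_eq,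
    AlgHom.commutes, aeval_X, mul_comm]

end TangentFields

section RamificationOverFinitePoints

variable {n : ℕ}

/-- The subalgebra generated by `z` and `τ x` in the polynomial ring `D[τ]`. -/
def coneSubalgebra {D : Type} [CommRing D] [Algebra ℂ D] (x z : Fin n → D) :
    Subalgebra ℂ (Polynomial D) :=
  Algebra.adjoin ℂ (range (fun i => Polynomial.C (z i)) ∪
    range (fun i => Polynomial.C (x i) * Polynomial.X))

variable {D : Type} [CommRing D] [Algebra ℂ D] (x z : Fin n → D)

/-- The elements `z i` of `coneSubalgebra x z`. -/
def coneSubalgebra.base (i : Fin n) : coneSubalgebra x z :=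
  ⟨Polynomial.C (z i), Algebra.subset_adjoin (Or.inl ⟨i, rfl⟩)⟩

/-- The elements `τ x i` of `coneSubalgebra x z`. -/
def coneSubalgebra.coord (i : Fin n) : coneSubalgebra x z :=
  ⟨Polynomial.C (x i) * Polynomial.X, Algebra.subset_adjoin (Or.inr ⟨i, rfl⟩)⟩

theorem coneSubalgebra.finiteType : Algebra.FiniteType ℂ (coneSubalgebra x z) := by
  rw [← Subalgebra.fg_iff_finiteType]
  exact Subalgebra.fg_def.2 ⟨_, (finite_range _).union (finite_range _), rfl⟩

theorem coneSubalgebra.adjoin_eq_top :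
    Algebra.adjoin ℂ (range (coneSubalgebra.base x z) ∪ range (coneSubalgebra.coord x z)) = ⊤ := by
  apply Subalgebra.map_injective (f := (coneSubalgebra x z).val) Subtype.val_injective
  rw [AlgHom.map_adjoin, image_union, ← range_comp, ← range_comp, Algebra.map_top,
    Subalgebra.range_val]
  rfl

/-- The action `τ x ↦ τ x X` on `coneSubalgebra x z`. -/
theorem coneSubalgebra.exists_scale : ∃ s : coneSubalgebra x z →ₐ[ℂ] Polynomial (coneSubalgebra x z),
    (∀ i, s (coneSubalgebra.base x z i) = Polynomial.C (coneSubalgebra.base x z i)) ∧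
    ∀ i, s (coneSubalgebra.coord x z i) = Polynomial.C (coneSubalgebra.coord x z i) * Polynomial.X := by
  set Γ := coneSubalgebra x z with hΓ
  let σ : Polynomial D →ₐ[ℂ] Polynomial (Polynomial D) :=
    (Polynomial.aeval (R := D) (Polynomial.C Polynomial.X * Polynomial.X)).restrictScalars ℂ
  let ι : Polynomial Γ →ₐ[ℂ] Polynomial (Polynomial D) := Polynomial.mapAlgHom Γ.val
  have hι : Function.Injective ι := Polynomial.map_injective _ Subtype.val_injective
  have hσz : ∀ i, σ (Polynomial.C (z i)) = ι (Polynomial.C (coneSubalgebra.base x z i)) := by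
    intro i
    simp only [σ, ι, AlgHom.coe_restrictScalars', Polynomial.aeval_C, Polynomial.coe_mapAlgHom,
      Polynomial.map_C]
    rfl
  have hσu : ∀ i, σ (Polynomial.C (x i) * Polynomial.X) =
      ι (Polynomial.C (coneSubalgebra.coord x z i) * Polynomial.X) := by
    intro i
    simp only [σ, ι, AlgHom.coe_restrictScalars', Polynomial.aeval_C, map_mul, Polynomial.aeval_X,
      Polynomial.coe_mapAlgHom, Polynomial.map_C, Polynomial.map_X]
    rw [← mul_assoc]
    congr 1
    change Polynomial.C (Polynomial.C (x i)) * Polynomial.C Polynomial.X =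
      Polynomial.C (Polynomial.C (x i) * Polynomial.X)
    rw [Polynomial.C_mul]
  have hmem : ∀ γ : Γ, (σ.comp Γ.val) γ ∈ ι.range := by
    have h1 : Γ ≤ ι.range.comap σ := by
      refine Algebra.adjoin_le ?_
      rintro _ (⟨i, rfl⟩ | ⟨i, rfl⟩)
      · exact ⟨_, (hσz i).symm⟩
      · exact ⟨_, (hσu i).symm⟩
    exact fun γ => h1 γ.2
  let s : Γ →ₐ[ℂ] Polynomial Γ := ((AlgEquiv.ofInjective ι hι).symm : _ →ₐ[ℂ] Polynomial Γ).comp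
    ((σ.comp Γ.val).codRestrict ι.range hmem)
  have hs : ∀ γ : Γ, ι (s γ) = σ γ := fun γ =>
    congrArg Subtype.val ((AlgEquiv.ofInjective ι hι).apply_symm_apply ⟨σ γ, hmem γ⟩)
  exact ⟨s, fun i => hι (by rw [hs]; exact hσz i), fun i => hι (by rw [hs]; exact hσu i)⟩

/-- `coneSubalgebra x z` has the same transcendence degree as `D[τ]`. -/
theorem coneSubalgebra.isAlgebraic [IsDomain D] {I : Ideal (MvPolynomial (Fin n) ℂ)} (hI : IsConical I)
    (hy : IsZeroOf I (fun i => z i - x i)) {Ω : Set D}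
    (hΩ : Algebra.adjoin ℂ (range x ∪ range z ∪ Ω) = ⊤)
    (hΩalg : ∀ q ∈ Ω, IsAlgebraic (Algebra.adjoin ℂ (range z)) q)
    {F : MvPolynomial (Fin n) ℂ} (hF : F ∈ I) {e : ℕ} (hFe : F.IsHomogeneous e)
    (hFz : aeval z F ≠ 0) : Algebra.IsAlgebraic (coneSubalgebra x z) (Polynomial D) := by
  have hX : IsAlgebraic (coneSubalgebra x z) (Polynomial.X : Polynomial D) := by
    let P : Polynomial (coneSubalgebra x z) := aeval (fun i => Polynomial.X * Polynomial.C (coneSubalgebra.base x z i)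
      + Polynomial.C (-coneSubalgebra.coord x z i)) F
    refine ⟨P, fun hP => ?_, ?_⟩
    · let ε : coneSubalgebra x z →ₐ[ℂ] D := ((Polynomial.aeval (R := D) (0 : D)).restrictScalars ℂ).comp (coneSubalgebra x z).val
      have h1 := congrArg (Polynomial.mapAlgHom ε) hP
      rw [map_zero, comp_aeval_apply] at h1
      have h2 : (fun i => (Polynomial.mapAlgHom ε) (Polynomial.X *
          Polynomial.C (coneSubalgebra.base x z i) + Polynomial.C (-coneSubalgebra.coord x z i))) =
          fun i => Polynomial.X * (Polynomial.CAlgHom (R := ℂ) (z i)) := by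
        funext i
        have h3 : ε (coneSubalgebra.base x z i) = z i := by
          change Polynomial.aeval (0 : D) (Polynomial.C (z i)) = z i
          simp
        have h4 : ε (coneSubalgebra.coord x z i) = 0 := by
          change Polynomial.aeval (0 : D) (Polynomial.C (x i) * Polynomial.X) = 0
          simp
        simp only [Polynomial.coe_mapAlgHom, Polynomial.map_add, Polynomial.map_mul,
          Polynomial.map_X, Polynomial.map_C, RingHom.coe_coe, map_neg, h3]
        simpa using h4
      rw [h2, aeval_smul_homogeneous hFe, ← comp_aeval_apply] at h1
      have h5 := (mul_eq_zero.1 h1).resolve_left (pow_ne_zero _ Polynomial.X_ne_zero)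
      exact hFz (Polynomial.C_eq_zero.1 h5)
    · let f : Polynomial (coneSubalgebra x z) →ₐ[ℂ] Polynomial D :=
        (Polynomial.aeval (R := (coneSubalgebra x z)) (Polynomial.X : Polynomial D)).restrictScalars ℂ
      have hfX : f Polynomial.X = Polynomial.X := Polynomial.aeval_X _
      have hfC : ∀ γ : coneSubalgebra x z, f (Polynomial.C γ) = (γ : Polynomial D) := fun γ => Polynomial.aeval_C _ _
      change f P = 0
      rw [comp_aeval_apply]
      have h1 := (hy.map (Polynomial.CAlgHom (R := ℂ) (A := D))).smul hI Polynomial.X F hF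
      rw [← h1]
      congr 2
      funext i
      rw [map_add, map_mul, hfX, hfC, hfC, map_sub]
      change Polynomial.X * Polynomial.C (z i) + -(Polynomial.C (x i) * Polynomial.X) =
        Polynomial.X * (Polynomial.C (z i) - Polynomial.C (x i))
      ring
  have hgen : Algebra.adjoin ℂ
      ((Polynomial.CAlgHom (R := ℂ) (A := D)) '' (range x ∪ range z ∪ Ω) ∪ {Polynomial.X}) = ⊤ := by
    rw [eq_top_iff]
    have hC : ∀ d : D, Polynomial.C d ∈ Algebra.adjoin ℂ
      ((Polynomial.CAlgHom (R := ℂ) (A := D)) '' (range x ∪ range z ∪ Ω) ∪ {Polynomial.X}) := by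
      intro d
      have h1 : Polynomial.CAlgHom (R := ℂ) d ∈ (⊤ : Subalgebra ℂ D).map (Polynomial.CAlgHom (R := ℂ)) :=
        ⟨d, trivial, rfl⟩
      rw [← hΩ, AlgHom.map_adjoin] at h1
      exact Algebra.adjoin_mono subset_union_left h1
    intro t _
    induction t using Polynomial.induction_on' with
    | add p q hp hq => exact add_mem (hp trivial) (hq trivial)
    | monomial k d =>
      rw [← Polynomial.C_mul_X_pow_eq_monomial]
      exact mul_mem (hC d) (pow_mem (Algebra.subset_adjoin
        (Set.mem_union_right _ (Set.mem_singleton _))) k)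
  refine Subalgebra.isAlgebraic_of_adjoin_eq_top (coneSubalgebra x z) hgen ?_
  rintro _ (⟨_, (⟨i, rfl⟩ | ⟨i, rfl⟩) | hq, rfl⟩ | rfl)
  · refine IsAlgebraic.of_mul (y := (Polynomial.X : Polynomial D)) ?_ hX ?_
    · exact mem_nonZeroDivisors_of_ne_zero Polynomial.X_ne_zero
    · have h1 := isAlgebraic_algebraMap (A := Polynomial D) (coneSubalgebra.coord x z i)
      rw [mul_comm]; exact h1
  · exact isAlgebraic_algebraMap (A := Polynomial D) (coneSubalgebra.base x z i)
  · refine Subalgebra.isAlgebraic_map (Polynomial.CAlgHom (R := ℂ) (A := D)) Polynomial.C_injective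
      (S' := (coneSubalgebra x z)) ?_ (hΩalg _ hq)
    intro t ht
    have h1 : Algebra.adjoin ℂ (range z) ≤ (coneSubalgebra x z).comap (Polynomial.CAlgHom (R := ℂ) (A := D)) := by
      rw [Algebra.adjoin_le_iff]
      rintro _ ⟨i, rfl⟩
      exact (coneSubalgebra.base x z i).2
    exact h1 ht
  · exact hX

variable {x z}

/-- The zero set of a polynomial `b` cannot be tangent to a large family of translated cones. -/
theorem IsSmoothCone.false_of_sum_pderiv_mul_eq_zero [IsDomain D] [Algebra.FiniteType ℂ D]
    {I : Ideal (MvPolynomial (Fin n) ℂ)} {m : ℕ} (h : IsSmoothCone I m)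
    (hnd : ∀ ℓ : Fin n → ℂ, (∀ v, IsZeroOf I v → ∑ i, ℓ i * v i = 0) → ℓ = 0)
    (hnum : 2 * n ≤ 3 * m + 3) (hx : IsZeroOf I x) (hy : IsZeroOf I (fun i => z i - x i))
    {Ω : Set D} (hΩ : Algebra.adjoin ℂ (range x ∪ range z ∪ Ω) = ⊤)
    (hΩalg : ∀ q ∈ Ω, IsAlgebraic (Algebra.adjoin ℂ (range z)) q)
    (htr : ((2 * m + 1 : ℕ) : Cardinal) ≤ Algebra.trdeg ℂ D)
    {b : MvPolynomial (Fin n) ℂ} (hb : b ≠ 0) (hbz : aeval z b = 0) {j : Fin n}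
    (hj : aeval z (pderiv j b) ≠ 0)
    {F : MvPolynomial (Fin n) ℂ} (hF : F ∈ I) {e : ℕ} (hFe : F.IsHomogeneous e)
    (hFz : aeval z F ≠ 0)
    (hstar : ∀ W, IsTangentField I W → ∑ l, aeval z (pderiv l b) * aeval x (W l) = 0) : False := by
  have := h.prime
  obtain ⟨ψ, hψ⟩ := exists_algHom_apply_ne_zero (k := ℂ) hj
  obtain ⟨y, hy0, hyne⟩ : ∃ y : Fin n → ℂ, IsZeroOf I y ∧ ∑ i, ψ (aeval z (pderiv i b)) * y i ≠ 0 := by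
    by_contra! hcon
    exact hψ (congrFun (hnd (fun i => ψ (aeval z (pderiv i b))) hcon) j)
  have heul := congrArg ψ (hstar _ (isTangentField_euler h.conical))
  simp only [map_sum, map_mul, aeval_X, map_zero] at heul
  set p : Fin n → ℂ := fun i => ψ (x i) - y i with hp
  have hpne : ∑ i, ψ (aeval z (pderiv i b)) * p i ≠ 0 := by
    simp only [hp, mul_sub, Finset.sum_sub_distrib, heul, zero_sub]
    exact neg_ne_zero.2 hyne
  obtain ⟨k, hk⟩ : ∃ k, p k ≠ 0 := by
    by_contra! hcon
    exact hpne (by simp [hcon])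
  let Γ := coneSubalgebra x z
  have := coneSubalgebra.finiteType x z
  have hinj : Function.Injective Γ.val := Subtype.val_injective
  let zΓ := coneSubalgebra.base x z
  let u := coneSubalgebra.coord x z
  have hvz : ∀ f, Γ.val (aeval zΓ f) = Polynomial.C (aeval z f) := fun f => by
    rw [comp_aeval_apply]
    exact (comp_aeval_apply z (Polynomial.CAlgHom (R := ℂ) (A := D)) f).symm
  have hvu : ∀ f, Γ.val (aeval u f) = aeval (fun i => Polynomial.C (x i) * Polynomial.X) f :=
    fun f => by rw [comp_aeval_apply]; rfl
  obtain ⟨s, hsz, hsu⟩ := coneSubalgebra.exists_scale x z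
  let Z : Subalgebra ℂ Γ := Algebra.adjoin ℂ (range zΓ)
  have hgen : Algebra.adjoin ℂ ((Z : Set Γ) ∪ range u) = ⊤ := by
    rw [eq_top_iff, ← coneSubalgebra.adjoin_eq_top x z]
    exact Algebra.adjoin_mono (union_subset_union_left _ Algebra.subset_adjoin)
  have hu : IsZeroOf I u := by
    intro f hf
    apply hinj
    rw [hvu, map_zero]
    have h1 := (hx.map (Polynomial.CAlgHom (R := ℂ) (A := D))).smul h.conical Polynomial.X f hf
    simp_rw [mul_comm (Polynomial.X)] at h1
    exact h1
  let φ : Γ →ₐ[ℂ] ℂ := (Polynomial.eval₂AlgHom ψ (1 : ℂ) (fun _ => Commute.all _ _)).comp Γ.val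
  have hφu : ∀ i, φ (u i) = ψ (x i) := by
    intro i
    change Polynomial.eval₂ (ψ : D →+* ℂ) 1 (Polynomial.C (x i) * Polynomial.X) = _
    simp
  have hφz : ∀ f : MvPolynomial (Fin n) ℂ, φ (aeval zΓ f) = ψ (aeval z f) := by
    intro f
    change (Polynomial.eval₂AlgHom ψ (1 : ℂ) (fun _ => Commute.all _ _)) (Γ.val (aeval zΓ f)) = _
    rw [hvz]
    exact Polynomial.eval₂_C (ψ : D →+* ℂ) 1
  let G : MvPolynomial (Fin n) ℂ := ∑ i, pderiv i b * C (p i)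
  have hG : ∀ {B : Type} [CommRing B] [Algebra ℂ B] (w : Fin n → B),
      aeval w G = ∑ i, aeval w (pderiv i b) * algebraMap ℂ B (p i) := by
    intro B _ _ w
    simp only [G, map_sum, map_mul, ← algebraMap_eq, AlgHom.commutes]
  have hsg : s (aeval zΓ G) = Polynomial.C (aeval zΓ G) := by
    rw [comp_aeval_apply]
    simp only [zΓ, hsz]
    exact (comp_aeval_apply zΓ (Polynomial.CAlgHom (R := ℂ) (A := Γ)) G).symm
  have hφg : φ (aeval zΓ G) ≠ 0 := by
    rw [hφz, hG, map_sum]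
    simp only [map_mul, AlgHom.commutes]
    exact hpne
  have hn0 : 0 < n := j.pos
  have hZ : ¬ ((n - 1 + 1 : ℕ) : Cardinal) ≤ Algebra.trdeg ℂ Z := by
    rw [Nat.sub_add_cancel hn0]
    refine not_le_trdeg_adjoin_range hb (hinj ?_)
    rw [hvz, hbz, map_zero, map_zero]
  have hN : ((2 * m + 1 + 1 : ℕ) : Cardinal) ≤ Algebra.trdeg ℂ Γ := by
    have := coneSubalgebra.isAlgebraic x z h.conical hy hΩ hΩalg hF hFe hFz
    rw [Subalgebra.trdeg_eq_of_isAlgebraic (coneSubalgebra x z)]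
    exact succ_le_trdeg_polynomial htr
  obtain ⟨ψ', ⟨i, hi⟩, hψg, htan⟩ := exists_tangent_point h.conical (d := m + 1) h.trdeg_eq.ge Z u
    hgen hu s hsu hZ hN (by omega) φ hy0 (k := k) (by rw [hφu]; exact hk) hsg hφg
  simp only [hφu] at htan
  obtain ⟨W, hW, hWp⟩ := h.exists_vectorField (v := fun i => ψ' (u i))
    (fun h0 => hi (congrFun h0 i)) (hu.map ψ') (p := p) htan
  apply hψg
  have h2 := h.sum_mul_aeval_scale_eq_zero hstar hW
  have h3 : ∑ l, aeval zΓ (pderiv l b) * aeval u (W l) = 0 := by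
    apply hinj
    rw [map_zero, ← h2, map_sum]
    exact Finset.sum_congr rfl fun l _ => by rw [map_mul, hvz, hvu]
  have h4 := congrArg ψ' h3
  rw [map_zero, map_sum] at h4
  rw [hG, map_sum, ← h4]
  refine Finset.sum_congr rfl fun l _ => ?_
  rw [map_mul, map_mul, comp_aeval_apply u ψ' (W l), hWp, AlgHom.commutes]
  rfl

end RamificationOverFinitePoints

section RamificationAtInfinity

variable {n : ℕ} {I : Ideal (MvPolynomial (Fin n) ℂ)} {m : ℕ}

/-- Every nonzero difference of zeros of `I` is tangent to the zero set at some nonzero point. -/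
theorem IsSmoothCone.exists_sub_mem_tangentSpace (h : IsSmoothCone I m)
    (hnum : n + 1 ≤ 2 * m + 2) {x y : Fin n → ℂ} (hx : IsZeroOf I x) (hy : IsZeroOf I y)
    (hxy : x ≠ y) :
    ∃ v : Fin n → ℂ, v ≠ 0 ∧ IsZeroOf I v ∧ (fun i => x i - y i) ∈ tangentSpace I v := by
  have := h.prime
  obtain ⟨k, hk⟩ := Function.ne_iff.1 hxy
  have hz : IsZeroOf I (fun i => Polynomial.C (coordFun I i) * Polynomial.X) := by
    have h1 := ((isZeroOf_coordFun I).map (Polynomial.CAlgHom (R := ℂ))).smul h.conical Polynomial.X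
    simp_rw [mul_comm (Polynomial.X)] at h1
    exact h1
  obtain ⟨ψ, ⟨i, hi⟩, -, htan⟩ := exists_tangent_point h.conical (d := m + 1) h.trdeg_eq.ge ⊥
    (coordFun I) (by
      rw [eq_top_iff, ← adjoin_range_coordFun I]
      exact Algebra.adjoin_mono subset_union_right) (isZeroOf_coordFun I) hz.lift
    (fun i => hz.lift_coordFun i) (ρ := 0) (N := m + 1) (by
      have h0 : Algebra.trdeg ℂ (⊥ : Subalgebra ℂ (MvPolynomial (Fin n) ℂ ⧸ I)) = 0 := by
        rw [(Algebra.botEquiv ℂ (MvPolynomial (Fin n) ℂ ⧸ I)).trdeg_eq]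
        exact trdeg_eq_zero
      rw [h0]; simp) h.trdeg_eq.ge (by omega) hx.lift hy (k := k)
    (by rw [hx.lift_coordFun]; exact sub_ne_zero.2 hk) (g := 1) (by simp) (by simp)
  simp only [hx.lift_coordFun] at htan
  exact ⟨fun i => ψ (coordFun I i), fun h0 => hi (congrFun h0 i), (isZeroOf_coordFun I).map ψ, htan⟩

/-- The homogenization of `b` with respect to the variable `δ`. -/
def homogenizedEval {B : Type} [CommRing B] [Algebra ℂ B] (b : MvPolynomial (Fin n) ℂ) (δ : B)
    (w : Fin n → B) : B :=
  ∑ d ∈ Finset.range (b.totalDegree + 1),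
    δ ^ (b.totalDegree - d) * aeval w (homogeneousComponent d b)

theorem map_homogenizedEval {B B' : Type} [CommRing B] [Algebra ℂ B] [CommRing B'] [Algebra ℂ B']
    (f : B →ₐ[ℂ] B') (b : MvPolynomial (Fin n) ℂ) (δ : B) (w : Fin n → B) :
    f (homogenizedEval b δ w) = homogenizedEval b (f δ) (fun i => f (w i)) := by
  simp [homogenizedEval, comp_aeval_apply]

theorem homogenizedEval_mul {B : Type} [CommRing B] [Algebra ℂ B] (b : MvPolynomial (Fin n) ℂ)
    (δ : B) (w : Fin n → B) :
    homogenizedEval b δ (fun i => δ * w i) = δ ^ b.totalDegree * aeval w b := by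
  have h1 : aeval w b = ∑ d ∈ Finset.range (b.totalDegree + 1),
      aeval w (homogeneousComponent d b) := by
    rw [← map_sum, sum_homogeneousComponent]
  rw [homogenizedEval, h1, Finset.mul_sum]
  refine Finset.sum_congr rfl fun d hd => ?_
  rw [aeval_smul_homogeneous (homogeneousComponent_isHomogeneous d b), ← mul_assoc, ← pow_add,
    Nat.sub_add_cancel (by simpa [Nat.lt_succ_iff] using hd)]

theorem IsFrame.det_smul_eq {G : Matrix (Fin n) (Fin n) (MvPolynomial (Fin n) ℂ)}
    {J : Finset (Fin n)} (hG : IsFrame I m G J) {B : Type} [CommRing B] [Algebra ℂ B]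
    {x z : Fin n → B} (hz : ∀ F ∈ I, dirDeriv F x z = 0) (l : Fin n) :
    aeval x G.det * z l = ∑ i : {i // i ∉ J},
      (∑ k, aeval x (G i k) * z k) * aeval x (G.adjugate l i) := by
  classical
  set N := (aeval x : _ →ₐ[ℂ] B).mapMatrix G with hN
  have h3 : ∀ i, aeval x (G.adjugate l i) = N.adjugate l i := by
    intro i
    have := AlgHom.map_adjugate (aeval x : _ →ₐ[ℂ] B) G
    rw [← hN] at this
    rw [← this]; rfl
  have h5 : N.adjugate.mulVec (N.mulVec z) = N.det • z := by
    rw [Matrix.mulVec_mulVec, Matrix.adjugate_mul, Matrix.smul_mulVec, Matrix.one_mulVec]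
  have h6 : ∑ i, N.adjugate l i * (∑ k, N i k * z k) = N.det * z l := congrFun h5 l
  rw [AlgHom.map_det, ← hN, ← h6]
  have h7 : ∑ i, N.adjugate l i * (∑ k, N i k * z k) =
      ∑ i ∈ Finset.univ.filter (· ∉ J), N.adjugate l i * (∑ k, N i k * z k) := by
    rw [Finset.sum_filter_of_ne]
    intro i _ hne hi
    obtain ⟨F, hF, hFi⟩ := hG.grad i hi
    apply hne
    have h8 := hz F hF
    simp only [dirDeriv, ← hFi] at h8
    have h9 : ∑ k, N i k * z k = 0 := h8
    rw [h9, mul_zero]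
  rw [h7, Finset.sum_subtype (p := (· ∉ J)) _ (by simp)]
  refine Finset.sum_congr rfl fun i _ => ?_
  rw [h3, mul_comm]
  rfl

variable {D : Type} [CommRing D] [Algebra ℂ D] {x z : Fin n → D}

/-- A homomorphism to a domain algebraic over the image, of large transcendence degree, is
injective. -/
theorem AlgHom.injective_of_trdeg {A' : Type} [CommRing A'] [IsDomain A'] [Algebra ℂ A']
    [IsDomain D] (f : A' →ₐ[ℂ] D) [Algebra.IsAlgebraic f.range D] {N : ℕ}
    (hA : Algebra.trdeg ℂ A' = N) (hD : (N : Cardinal) ≤ Algebra.trdeg ℂ D) :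
    Function.Injective f := by
  have hP : (RingHom.ker f).IsPrime := RingHom.ker_isPrime _
  by_contra hinj
  have hne : RingHom.ker f ≠ ⊥ := fun h0 => hinj ((RingHom.injective_iff_ker_eq_bot f).2 h0)
  have e : (A' ⧸ RingHom.ker f) ≃ₐ[ℂ] f.range := Ideal.quotientKerEquivRange f
  rw [← Subalgebra.trdeg_eq_of_isAlgebraic f.range, ← e.trdeg_eq] at hD
  have h1 := succ_le_trdeg_of_le_trdeg_quotient hne hD
  rw [hA] at h1
  exact absurd (by exact_mod_cast h1) (Nat.lt_succ_self N).not_ge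

theorem IsSmoothCone.trdeg_mvPolynomial_eq (h : IsSmoothCone I m) {τ : Type} [Fintype τ] :
    Algebra.trdeg ℂ (MvPolynomial τ (MvPolynomial (Fin n) ℂ ⧸ I)) =
      (m + 1 + Fintype.card τ : ℕ) := by
  have := h.prime
  rw [← trdeg_add_eq ℂ (MvPolynomial (Fin n) ℂ ⧸ I), h.trdeg_eq, MvPolynomial.trdeg_of_isDomain]
  simp

theorem IsSmoothCone.exists_universal (h : IsSmoothCone I m) (τ : Type) [Fintype τ] :
    ∃ (A' : Type) (_ : CommRing A') (_ : IsDomain A') (_ : Algebra ℂ A') (ξ : Fin n → A')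
      (T : τ → A'), Algebra.trdeg ℂ A' = (m + 1 + Fintype.card τ : ℕ) ∧
      ∀ (B : Type) [CommRing B] [Algebra ℂ B] (u : Fin n → B) (t : τ → B), IsZeroOf I u →
        ∃ f : A' →ₐ[ℂ] B, (∀ i, f (ξ i) = u i) ∧ ∀ i, f (T i) = t i := by
  have := h.prime
  refine ⟨MvPolynomial τ (MvPolynomial (Fin n) ℂ ⧸ I), inferInstance, inferInstance,
    inferInstance, fun i => C (coordFun I i), X, h.trdeg_mvPolynomial_eq, ?_⟩
  intro B _ _ u t hu
  exact ⟨aevalTower hu.lift t, fun i => by simp [hu.lift_coordFun], fun i => by simp⟩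

theorem Subalgebra.isAlgebraic_trans {T : Type} [CommRing T] [IsDomain T] [Algebra ℂ T]
    (S : Subalgebra ℂ T) {s : Set T} (hs : ∀ t ∈ s, IsAlgebraic S t) {q : T}
    (hq : IsAlgebraic (Algebra.adjoin ℂ s) q) : IsAlgebraic S q := by
  have h1 : IsAlgebraic (Algebra.adjoin ℂ ((S : Set T) ∪ s)) q :=
    Subalgebra.isAlgebraic_map (AlgHom.id ℂ T) Function.injective_id
      (fun t ht => Algebra.adjoin_mono subset_union_right ht) hq
  have h2 : Algebra.adjoin ℂ (S : Set T) = S := Algebra.adjoin_eq S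
  rw [← h2]
  refine IsAlgebraic.adjoin_of_forall_isAlgebraic ?_ h1
  rintro t ⟨ht | ht, ht'⟩
  · exact absurd ht ht'
  · rw [h2]; exact hs t ht

theorem IsSmoothCone.aeval_eq_zero_of_mem_tangentSpace [IsDomain D] [Algebra.FiniteType ℂ D]
    (h : IsSmoothCone I m) (hnum : n ≤ 2 * m + 2) (hx : IsZeroOf I x)
    (hz : ∀ F ∈ I, dirDeriv F x z = 0)
    {Ω : Set D} (hΩ : Algebra.adjoin ℂ (range x ∪ range z ∪ Ω) = ⊤)
    (hΩalg : ∀ q ∈ Ω, IsAlgebraic (Algebra.adjoin ℂ (range z)) q)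
    (htr : ((2 * m + 2 : ℕ) : Cardinal) ≤ Algebra.trdeg ℂ D)
    {b : MvPolynomial (Fin n) ℂ} (hb : b ≠ 0) (hbz : aeval z b = 0)
    {v : Fin n → ℂ} (hv : v ≠ 0) (hvI : IsZeroOf I v) {p : Fin n → ℂ}
    (hp : p ∈ tangentSpace I v) : aeval p b = 0 := by
  classical
  have := h.prime
  have hx0 : ∃ i, x i ≠ 0 := by
    by_contra! hcon
    have h1 : Algebra.IsAlgebraic (Algebra.adjoin ℂ (range z)) D := by
      refine Subalgebra.isAlgebraic_of_adjoin_eq_top _ hΩ ?_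
      rintro _ ((⟨i, rfl⟩ | ⟨i, rfl⟩) | hq)
      · rw [hcon]; exact isAlgebraic_zero
      · exact isAlgebraic_algebraMap
          (⟨z i, Algebra.subset_adjoin ⟨i, rfl⟩⟩ : Algebra.adjoin ℂ (range z))
      · exact hΩalg _ hq
    rw [← Subalgebra.trdeg_eq_of_isAlgebraic (Algebra.adjoin ℂ (range z))] at htr
    exact not_le_trdeg_adjoin_range hb hbz (le_trans (by exact_mod_cast hnum) htr)
  obtain ⟨i₀, hi₀⟩ := hx0
  obtain ⟨ψ, hψ⟩ := exists_algHom_apply_ne_zero (k := ℂ) hi₀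
  obtain ⟨G, J, hG, hD⟩ := h.exists_frame (v := fun i => ψ (x i))
    (fun h0 => hψ (congrFun h0 i₀)) (hx.map ψ)
  have hdet : G.det ∉ I := fun hm => hD (hx.map ψ _ hm)
  have hδ : aeval x G.det ≠ 0 := by
    intro h0
    apply hD
    rw [← comp_aeval_apply, h0, map_zero]
  let t : {i // i ∉ J} → D := fun i => ∑ k, aeval x (G i k) * z k
  obtain ⟨A', _, _, _, ξ, T, hA', hlift⟩ := h.exists_universal {i // i ∉ J}
  obtain ⟨Θ, hΘξ, hΘt⟩ := hlift D x t hx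
  have hΘx : ∀ f : MvPolynomial (Fin n) ℂ, Θ (aeval ξ f) = aeval x f := by
    intro f
    rw [comp_aeval_apply]
    simp only [hΘξ]
  have hcard : Fintype.card {i // i ∉ J} = m + 1 := by
    have := hG.card
    have h2 := Fintype.card_subtype_compl (· ∈ J)
    simp at h2 ⊢
    omega
  have hx_mem : ∀ f : MvPolynomial (Fin n) ℂ, aeval x f ∈ Θ.range := fun f => ⟨_, hΘx f⟩
  have hz_alg : ∀ l, IsAlgebraic Θ.range (z l) := by
    intro l
    refine IsAlgebraic.of_mul (mem_nonZeroDivisors_of_ne_zero hδ)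
      (isAlgebraic_algebraMap (⟨_, hx_mem G.det⟩ : Θ.range)) ?_
    have h1 : aeval x G.det * z l ∈ Θ.range := by
      rw [hG.det_smul_eq hz l]
      exact sum_mem fun i _ => mul_mem ⟨_, hΘt i⟩ (hx_mem _)
    exact isAlgebraic_algebraMap (⟨_, h1⟩ : Θ.range)
  have hAlg : Algebra.IsAlgebraic Θ.range D := by
    refine Subalgebra.isAlgebraic_of_adjoin_eq_top _ hΩ ?_
    rintro _ ((⟨i, rfl⟩ | ⟨i, rfl⟩) | hq)
    · have h1 := hx_mem (X i)
      rw [aeval_X] at h1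
      exact isAlgebraic_algebraMap (⟨_, h1⟩ : Θ.range)
    · exact hz_alg i
    · refine Subalgebra.isAlgebraic_trans _ ?_ (hΩalg _ hq)
      rintro _ ⟨i, rfl⟩
      exact hz_alg i
  have hinj : Function.Injective Θ := by
    refine Θ.injective_of_trdeg (N := 2 * m + 2) ?_ htr
    rw [hA', hcard]
    congr 1; omega
  have hB : homogenizedEval b (aeval ξ G.det)
      (fun l => ∑ i : {i // i ∉ J}, T i * aeval ξ (G.adjugate l i)) = 0 := by
    apply hinj
    rw [map_homogenizedEval, hΘx, map_zero]
    have h1 : (fun l => Θ (∑ i : {i // i ∉ J}, T i * aeval ξ (G.adjugate l i))) =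
        fun l => aeval x G.det * z l := by
      funext l
      rw [hG.det_smul_eq hz l, map_sum]
      exact Finset.sum_congr rfl fun i _ => by rw [map_mul, hΘt, hΘx]
    rw [h1, homogenizedEval_mul, hbz, mul_zero]
  have key : ∀ w : Fin n → ℂ, IsZeroOf I w → aeval w G.det ≠ 0 → ∀ q ∈ tangentSpace I w,
      aeval q b = 0 := by
    intro w hw hwd q hq
    obtain ⟨Ψ, hΨξ, hΨt⟩ := hlift ℂ w (fun i => ∑ k, aeval w (G i k) * q k) hw
    have hΨx : ∀ f : MvPolynomial (Fin n) ℂ, Ψ (aeval ξ f) = aeval w f := by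
      intro f
      rw [comp_aeval_apply]
      simp only [hΨξ]
    have h1 := congrArg Ψ hB
    rw [map_homogenizedEval, hΨx, map_zero] at h1
    have h2 : (fun l => Ψ (∑ i : {i // i ∉ J}, T i * aeval ξ (G.adjugate l i))) =
        fun l => aeval w G.det * q l := by
      funext l
      rw [hG.det_smul_eq hq l, map_sum]
      exact Finset.sum_congr rfl fun i _ => by rw [map_mul, hΨt, hΨx]
    rw [h2, homogenizedEval_mul] at h1
    exact (mul_eq_zero.1 h1).resolve_left (pow_ne_zero _ hwd)
  obtain ⟨W, hW, hWp⟩ := h.exists_vectorField hv hvI hp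
  have hbW : aeval W b ∈ I := by
    refine (h.prime.mem_or_mem (x := G.det) ?_).resolve_left hdet
    refine h.mem_of_vanish _ fun w hw hwI => ?_
    rw [map_mul]
    by_cases hwd : aeval w G.det = 0
    · rw [hwd, zero_mul]
    · rw [comp_aeval_apply]
      rw [key w hwI hwd _ (IsTangentField.mem_tangentSpace hW hwI), mul_zero]
  have h3 := hvI _ hbW
  rw [comp_aeval_apply] at h3
  simpa only [hWp] using h3

end RamificationAtInfinity

section IntegralOver

variable {n : ℕ} {B B' : Type} [CommRing B] [Algebra ℂ B] [CommRing B'] [Algebra ℂ B']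

/-- `q` is integral over the subalgebra generated by the entries of `z`. -/
def IsIntegralOver (z : Fin n → B) (q : B) : Prop :=
  (aeval z : MvPolynomial (Fin n) ℂ →ₐ[ℂ] B).toRingHom.IsIntegralElem q

theorem IsIntegralOver.map {z : Fin n → B} {q : B} (hq : IsIntegralOver z q) (f : B →ₐ[ℂ] B') :
    IsIntegralOver (fun i => f (z i)) (f q) := by
  obtain ⟨p, hp, hpq⟩ := hq
  refine ⟨p, hp, ?_⟩
  have h1 := congrArg f hpq
  rw [map_zero] at h1
  rw [← h1]
  change _ = (f : B →+* B') _
  rw [Polynomial.hom_eval₂]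
  congr 1
  apply MvPolynomial.ringHom_ext
  · intro r; simp
  · intro i; simp

theorem IsIntegralOver.of_map {z : Fin n → B} {q : B} (f : B →ₐ[ℂ] B') (hf : Function.Injective f)
    (hq : IsIntegralOver (fun i => f (z i)) (f q)) : IsIntegralOver z q := by
  obtain ⟨p, hp, hpq⟩ := hq
  refine ⟨p, hp, hf ?_⟩
  rw [map_zero, ← hpq]
  change (f : B →+* B') _ = _
  rw [Polynomial.hom_eval₂]
  congr 1
  apply MvPolynomial.ringHom_ext
  · intro r; simp
  · intro i; simp

theorem isIntegralOver_iff [Algebra (MvPolynomial (Fin n) ℂ) B]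
    [IsScalarTower ℂ (MvPolynomial (Fin n) ℂ) B] {q : B} :
    IsIntegralOver (fun i => algebraMap (MvPolynomial (Fin n) ℂ) B (X i)) q ↔
      IsIntegral (MvPolynomial (Fin n) ℂ) q := by
  have h : (aeval (fun i => algebraMap (MvPolynomial (Fin n) ℂ) B (X i)) :
      MvPolynomial (Fin n) ℂ →ₐ[ℂ] B).toRingHom = algebraMap (MvPolynomial (Fin n) ℂ) B := by
    apply MvPolynomial.ringHom_ext
    · intro r; simp [IsScalarTower.algebraMap_apply ℂ (MvPolynomial (Fin n) ℂ) B]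
    · intro i; simp
  unfold IsIntegralOver
  rw [h]
  rfl

theorem IsIntegralOver.isIntegral {z : Fin n → B} {q : B} (hq : IsIntegralOver z q)
    {S : Subalgebra ℂ B} (hS : ∀ i, z i ∈ S) : IsIntegral S q := by
  obtain ⟨p, hp, hpq⟩ := hq
  let f : MvPolynomial (Fin n) ℂ →+* S := (aeval (fun i => (⟨z i, hS i⟩ : S)) : _ →ₐ[ℂ] S).toRingHom
  refine ⟨p.map f, hp.map f, ?_⟩
  rw [Polynomial.eval₂_map, ← hpq]
  congr 1
  apply MvPolynomial.ringHom_ext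
  · intro r; simp [f]
  · intro i; simp [f]

theorem IsIntegralOver.isAlgebraic [Nontrivial B] {z : Fin n → B} {q : B}
    (hq : IsIntegralOver z q) : IsAlgebraic (Algebra.adjoin ℂ (range z)) q :=
  (hq.isIntegral (S := Algebra.adjoin ℂ (range z)) fun i =>
    Algebra.subset_adjoin (mem_range_self i)).isAlgebraic

theorem aeval_mem_adjoin_range (z : Fin n → B) (F : MvPolynomial (Fin n) ℂ) :
    aeval z F ∈ Algebra.adjoin ℂ (range z) := by
  rw [Algebra.adjoin_range_eq_range_aeval]
  exact ⟨F, rfl⟩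

theorem aeval_mem_subalgebra {z : Fin n → B} {S : Subalgebra ℂ B} (hS : ∀ i, z i ∈ S)
    (F : MvPolynomial (Fin n) ℂ) : aeval z F ∈ S :=
  (Algebra.adjoin_le_iff.2 (by rintro _ ⟨i, rfl⟩; exact hS i)) (aeval_mem_adjoin_range z F)

theorem IsAlgebraic.of_mul_eq_one [IsDomain B] {S : Subalgebra ℂ B} {q t : B} (ht : t ∈ S)
    (h : q * t = 1) : IsAlgebraic S q := by
  refine IsAlgebraic.of_mul (y := t) ?_ (isAlgebraic_algebraMap (⟨t, ht⟩ : S)) ?_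
  · exact mem_nonZeroDivisors_of_ne_zero (right_ne_zero_of_mul_eq_one h)
  · rw [mul_comm, h]; exact isAlgebraic_one

/-- A nonunit of a domain of finite type vanishes in a quotient domain of large dimension. -/
theorem exists_domain_quotient {S : Type} [CommRing S] [IsDomain S] [Algebra ℂ S]
    [Algebra.FiniteType ℂ S] {N : ℕ} (hN : ((N + 1 : ℕ) : Cardinal) ≤ Algebra.trdeg ℂ S) {p : S}
    (hp : ¬ IsUnit p) : ∃ (D : Type) (_ : CommRing D) (_ : IsDomain D) (_ : Algebra ℂ D)
      (_ : Algebra.FiniteType ℂ D) (f : S →ₐ[ℂ] D), Function.Surjective f ∧ f p = 0 ∧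
      (N : Cardinal) ≤ Algebra.trdeg ℂ D := by
  obtain ⟨M, hM, hpM⟩ := exists_max_ideal_of_mem_nonunits hp
  obtain ⟨q, hq, hpq, -, hqN⟩ := exists_prime_le_trdeg_quotient hpM hN
  exact ⟨S ⧸ q, inferInstance, inferInstance, inferInstance, inferInstance,
    Ideal.Quotient.mkₐ ℂ q, Ideal.Quotient.mk_surjective, Ideal.Quotient.eq_zero_iff_mem.2 hpq, hqN⟩

/-- If `π` vanishes in a domain quotient of `S`, so does every element of `S` which is a multiple of
`π` by an element integral over `S`. -/
theorem AlgHom.apply_eq_zero_of_isIntegral {S D T : Type} [CommRing S] [CommRing T] [CommRing D]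
    [IsDomain D] [Algebra ℂ S] [Algebra ℂ D] [Algebra S T]
    (hST : Function.Injective (algebraMap S T)) (f : S →ₐ[ℂ] D) {π q : S} (hπ : f π = 0) {ρ : T}
    (hρ : IsIntegral S ρ) (hq : algebraMap S T q = algebraMap S T π * ρ) : f q = 0 := by
  obtain ⟨p, hp, hpρ⟩ := hρ
  have h1 := Polynomial.scaleRoots_eval₂_eq_zero (s := π) (algebraMap S T) hpρ
  rw [← hq, Polynomial.eval₂_at_apply] at h1
  have h2 := hST (h1.trans (map_zero _).symm)
  have h3 := congrArg (f : S →+* D) h2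
  rw [← Polynomial.eval₂_at_apply, Polynomial.eval₂_eq_eval_map, Polynomial.map_scaleRoots _ _ _ (by
    rw [hp.leadingCoeff]; simp)] at h3
  have h4 : (f : S →+* D) π = 0 := hπ
  rw [h4, Polynomial.scaleRoots_zero] at h3
  have h5 : (p.map (f : S →+* D)).leadingCoeff = 1 := (hp.map _).leadingCoeff
  rw [h5, one_smul, Polynomial.eval_pow, Polynomial.eval_X] at h3
  exact eq_zero_of_pow_eq_zero (h3.trans (map_zero f))

theorem Algebra.adjoin_image_eq_top {S D : Type} [CommRing S] [CommRing D] [Algebra ℂ S]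
    [Algebra ℂ D] (f : S →ₐ[ℂ] D) (hf : Function.Surjective f) {s : Set S}
    (hs : Algebra.adjoin ℂ s = ⊤) : Algebra.adjoin ℂ (f '' s) = ⊤ := by
  rw [← AlgHom.map_adjoin, hs, Algebra.map_top, (AlgHom.range_eq_top f).2 hf]

theorem Algebra.adjoin_val_preimage {T : Type} [CommRing T] [Algebra ℂ T] {s : Set T}
    {S : Subalgebra ℂ T} (hS : S = Algebra.adjoin ℂ s) :
    Algebra.adjoin ℂ ((Subtype.val : S → T) ⁻¹' s) = ⊤ := by
  subst hS
  exact Algebra.adjoin_adjoin_coe_preimage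

end IntegralOver

section ConePairs

variable {n : ℕ} {L : Type} [Field L] [Algebra ℂ L]

/-- `(x, y)` is a generic point of the square of the zero set of `I`, and `L` is its function
field. -/
structure IsConePair (I : Ideal (MvPolynomial (Fin n) ℂ)) (m : ℕ) (x y : Fin n → L) : Prop where
  left : IsZeroOf I x
  right : IsZeroOf I y
  isFractionRing : IsFractionRing (Algebra.adjoin ℂ (range x ∪ range y)) L
  le_trdeg : ((2 * m + 2 : ℕ) : Cardinal) ≤ Algebra.trdeg ℂ L
  exists_lift : ∀ (B : Type) [CommRing B] [Algebra ℂ B] (u v : Fin n → B), IsZeroOf I u →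
    IsZeroOf I v → ∃ f : Algebra.adjoin ℂ (range x ∪ range y) →ₐ[ℂ] B,
      (∀ i, f ⟨x i, Algebra.subset_adjoin (Or.inl ⟨i, rfl⟩)⟩ = u i) ∧
      ∀ i, f ⟨y i, Algebra.subset_adjoin (Or.inr ⟨i, rfl⟩)⟩ = v i

variable {I : Ideal (MvPolynomial (Fin n) ℂ)} {m : ℕ} {x y : Fin n → L}

theorem finiteType_adjoin_of_finite {T : Type} [CommRing T] [Algebra ℂ T] {s : Set T}
    (hs : s.Finite) : Algebra.FiniteType ℂ (Algebra.adjoin ℂ s) := by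
  rw [← Subalgebra.fg_iff_finiteType]
  exact Subalgebra.fg_def.2 ⟨_, hs, rfl⟩

/-- A tangent field of the first factor induces a derivation of the function field preserving the
coordinate ring. -/
theorem IsConePair.exists_derivation (hp : IsConePair I m x y)
    {W : Fin n → MvPolynomial (Fin n) ℂ} (hW : IsTangentField I W) :
    ∃ D : Derivation ℂ L L, (∀ i, D (x i) = aeval x (W i)) ∧ (∀ i, D (y i) = 0) ∧
      ∀ g, IsIntegral (Algebra.adjoin ℂ (range x ∪ range y)) g →
        IsIntegral (Algebra.adjoin ℂ (range x ∪ range y)) (D g) := by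
  have hfr := hp.isFractionRing
  have hx1 : ∀ F ∈ I, dirDeriv F x (fun i => aeval x (W i)) = 0 := by
    intro F hF
    have h1 := hp.left _ (hW F hF)
    simpa [dirDeriv, mul_comm] using h1
  have hy1 : ∀ F ∈ I, dirDeriv F y (fun _ => (0 : L)) = 0 := by
    intro F hF; simp [dirDeriv]
  obtain ⟨f, hfx, hfy⟩ := hp.exists_lift _ _ _ (hp.left.dual hx1) (hp.right.dual hy1)
  have h3 : (TrivSqZeroExt.fstHom ℂ L L).comp f =
      IsScalarTower.toAlgHom ℂ (Algebra.adjoin ℂ (range x ∪ range y)) L := by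
    refine AlgHom.ext_of_adjoin_eq_top Algebra.adjoin_adjoin_coe_preimage ?_
    rintro ⟨q, hq⟩ (⟨i, rfl⟩ | ⟨i, rfl⟩)
    · simp [hfx]
    · simp [hfy]
  let D₀ := Derivation.ofDualNumber f fun a => DFunLike.congr_fun h3 a
  have hD₀ : ∀ a, D₀ a = TrivSqZeroExt.snd (f a) := fun a => rfl
  have : FaithfulSMul (Algebra.adjoin ℂ (range x ∪ range y)) L :=
    (faithfulSMul_iff_algebraMap_injective _ _).2 (IsFractionRing.injective _ _)
  have : Algebra.IsAlgebraic (Algebra.adjoin ℂ (range x ∪ range y)) L :=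
    IsLocalization.isAlgebraic _ (nonZeroDivisors _)
  obtain ⟨D, hD⟩ := D₀.exists_extend
  have hDx : ∀ i, D (x i) = aeval x (W i) := fun i => by
    have := hD ⟨x i, Algebra.subset_adjoin (Or.inl ⟨i, rfl⟩)⟩
    rw [hD₀, hfx] at this
    simpa using this
  have hDy : ∀ i, D (y i) = 0 := fun i => by
    have := hD ⟨y i, Algebra.subset_adjoin (Or.inr ⟨i, rfl⟩)⟩
    rw [hD₀, hfy] at this
    simpa using this
  have : Algebra.FiniteType ℂ (Algebra.adjoin ℂ (range x ∪ range y)) :=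
    finiteType_adjoin_of_finite ((finite_range x).union (finite_range y))
  have : IsNoetherianRing (Algebra.adjoin ℂ (range x ∪ range y)) :=
    Algebra.FiniteType.isNoetherianRing ℂ _
  refine ⟨D, hDx, hDy, fun g hg => D.isIntegral_apply (fun a => ?_) hg⟩
  obtain ⟨a, ha⟩ := a
  suffices h : D a ∈ Algebra.adjoin ℂ (range x ∪ range y) from ⟨⟨_, h⟩, rfl⟩
  induction ha using Algebra.adjoin_induction with
  | mem q hq =>
    rcases hq with ⟨i, rfl⟩ | ⟨i, rfl⟩
    · rw [hDx]
      exact aeval_mem_subalgebra (S := Algebra.adjoin ℂ (range x ∪ range y))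
        (fun i => Algebra.subset_adjoin (Or.inl (mem_range_self i))) _
    · rw [hDy]; exact zero_mem _
  | algebraMap r => rw [Derivation.map_algebraMap]; exact zero_mem _
  | add a b _ _ ha hb => rw [map_add]; exact add_mem ha hb
  | mul a b ha' hb' ha hb =>
    rw [Derivation.leibniz, smul_eq_mul, smul_eq_mul]
    exact add_mem (mul_mem ha' hb) (mul_mem hb' ha)

theorem IsConePair.isAlgebraic (hp : IsConePair I m x y) {S : Subalgebra ℂ L}
    (hx : ∀ i, x i ∈ S) (hy : ∀ i, y i ∈ S) : Algebra.IsAlgebraic S L := by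
  have hfr := hp.isFractionRing
  have h1 : Algebra.IsAlgebraic (Algebra.adjoin ℂ (range x ∪ range y)) L :=
    IsLocalization.isAlgebraic _ (nonZeroDivisors _)
  refine ⟨fun q => Subalgebra.isAlgebraic_map (AlgHom.id ℂ L) Function.injective_id ?_
    (h1.isAlgebraic q)⟩
  refine Algebra.adjoin_le_iff.2 ?_
  rintro _ (⟨i, rfl⟩ | ⟨i, rfl⟩)
  · exact hx i
  · exact hy i

theorem IsConePair.nondegenerate (h : IsSmoothCone I m) (hp : IsConePair I m x y)
    (hinj : Function.Injective (aeval (fun i => x i + y i) : MvPolynomial (Fin n) ℂ →ₐ[ℂ] L))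
    (ℓ : Fin n → ℂ) (hℓ : ∀ v, IsZeroOf I v → ∑ i, ℓ i * v i = 0) : ℓ = 0 := by
  classical
  let F : MvPolynomial (Fin n) ℂ := ∑ i, C (ℓ i) * X i
  have hF : F ∈ I := h.mem_of_vanish F fun v _ hv => by
    simp only [F, map_sum, map_mul, aeval_X]
    simpa using hℓ v hv
  have h0 : F = 0 := by
    apply hinj
    have h1 := hp.left F hF
    have h2 := hp.right F hF
    simp only [F, map_sum, map_mul, aeval_X, map_zero, aeval_C] at h1 h2 ⊢
    simp only [mul_add, Finset.sum_add_distrib, h1, h2, add_zero]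
  funext i
  have h1 := congrArg (fun G => aeval (Pi.single i (1 : ℂ)) G) h0
  simpa [F, Pi.single_apply] using h1

end ConePairs

section NoRamification

variable {n : ℕ} {L : Type} [Field L] [Algebra ℂ L] {I : Ideal (MvPolynomial (Fin n) ℂ)} {m : ℕ}
  {x y : Fin n → L}

theorem IsConePair.false_of_not_isUnit (h : IsSmoothCone I m) (hp : IsConePair I m x y)
    (hnum : 2 * n ≤ 3 * m + 3) {z : Fin n → L} (hz : ∀ i, z i = x i + y i)
    (hinj : Function.Injective (aeval z : MvPolynomial (Fin n) ℂ →ₐ[ℂ] L))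
    {b s₀ s F : MvPolynomial (Fin n) ℂ} (hb : b ≠ 0) (hs₀ : s₀ ∣ s) {j : Fin n}
    (hj : pderiv j b ∣ s) (hF : F ∈ I) {e : ℕ} (hFe : F.IsHomogeneous e) (hFs : F ∣ s)
    {π w σ : L} (hσ : σ * aeval z s = 1) (hπ : IsIntegralOver z π) (hw : IsIntegralOver z w)
    (hπw : π ^ 2 * w = aeval z (s₀ ^ 3 * b))
    (hunit : ∀ c ∈ Algebra.adjoin ℂ (range x ∪ range z ∪ {π, w, σ}), π * c ≠ 1) : False := by
  obtain ⟨S, hS⟩ : ∃ S : Subalgebra ℂ L,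
    S = Algebra.adjoin ℂ (range x ∪ range z ∪ {π, w, σ}) := ⟨_, rfl⟩
  have hsub : range x ∪ range z ∪ {π, w, σ} ⊆ (S : Set L) := by
    rw [hS]; exact Algebra.subset_adjoin
  have hxS : ∀ i, x i ∈ S := fun i => hsub (Or.inl (Or.inl ⟨i, rfl⟩))
  have hzS : ∀ i, z i ∈ S := fun i => hsub (Or.inl (Or.inr ⟨i, rfl⟩))
  have hπS : π ∈ S := hsub (Or.inr (Or.inl rfl))
  have hwS : w ∈ S := hsub (Or.inr (Or.inr (Or.inl rfl)))
  have hσS : σ ∈ S := hsub (Or.inr (Or.inr (Or.inr rfl)))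
  have hyS : ∀ i, y i ∈ S := fun i => by
    rw [show y i = z i - x i by rw [hz]; ring]
    exact sub_mem (hzS i) (hxS i)
  have : Algebra.FiniteType ℂ S := by
    rw [hS]
    exact finiteType_adjoin_of_finite (((finite_range x).union (finite_range z)).union (by simp))
  have hSalg := hp.isAlgebraic hxS hyS
  have hpu : ¬ IsUnit (⟨π, hπS⟩ : S) := by
    intro hu
    obtain ⟨c, hc⟩ := isUnit_iff_exists_inv.1 hu
    exact hunit c (hS ▸ c.2) (congrArg Subtype.val hc)
  obtain ⟨D, _, _, _, _, f, hf, hfπ, hfD⟩ := exists_domain_quotient (S := S) (N := 2 * m + 1)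
    (by rw [S.trdeg_eq_of_isAlgebraic]; exact hp.le_trdeg) hpu
  let xS : Fin n → S := fun i => ⟨x i, hxS i⟩
  let zS : Fin n → S := fun i => ⟨z i, hzS i⟩
  have hzval : ∀ G : MvPolynomial (Fin n) ℂ, (aeval zS G : S) = aeval z G := fun G =>
    comp_aeval_apply zS S.val G
  have hxval : ∀ G : MvPolynomial (Fin n) ℂ, (aeval xS G : S) = aeval x G := fun G =>
    comp_aeval_apply xS S.val G
  have hfz : ∀ G : MvPolynomial (Fin n) ℂ, f (aeval zS G) = aeval (fun i => f (zS i)) G :=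
    fun G => comp_aeval_apply zS f G
  have hfx : ∀ G : MvPolynomial (Fin n) ℂ, f (aeval xS G) = aeval (fun i => f (xS i)) G :=
    fun G => comp_aeval_apply xS f G
  have hσf : f ⟨σ, hσS⟩ * aeval (fun i => f (zS i)) s = 1 := by
    rw [← hfz, ← map_mul, ← map_one f]
    congr 1
    exact Subtype.val_injective (by simpa [hzval] using hσ)
  have hsf : aeval (fun i => f (zS i)) s ≠ 0 := right_ne_zero_of_mul_eq_one hσf
  have hdvd : ∀ t, t ∣ s → aeval (fun i => f (zS i)) t ≠ 0 := by
    rintro t ⟨t', rfl⟩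
    rw [map_mul] at hsf
    exact left_ne_zero_of_mul hsf
  have hbz : aeval (fun i => f (zS i)) b = 0 := by
    have h1 : (⟨π, hπS⟩ : S) ^ 2 * ⟨w, hwS⟩ = aeval zS (s₀ ^ 3 * b) :=
      Subtype.val_injective (by rw [hzval]; exact hπw)
    have h2 := congrArg f h1
    rw [map_mul, map_pow, hfπ, hfz, map_mul, map_pow, zero_pow two_ne_zero, zero_mul] at h2
    exact (mul_eq_zero.1 h2.symm).resolve_left (pow_ne_zero _ (hdvd _ hs₀))
  refine h.false_of_sum_pderiv_mul_eq_zero (D := D) (x := fun i => f (xS i))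
    (z := fun i => f (zS i)) (hp.nondegenerate h (by simpa only [← hz] using hinj)) hnum ?_ ?_
    (Ω := {f ⟨π, hπS⟩, f ⟨w, hwS⟩, f ⟨σ, hσS⟩}) ?_ ?_ hfD hb hbz (hdvd _ hj) hF hFe (hdvd _ hFs) ?_
  · refine IsZeroOf.map (fun G hG => Subtype.val_injective ?_) f
    rw [hxval]; exact hp.left G hG
  · have h1 : IsZeroOf I (fun i => (⟨y i, hyS i⟩ : S)) := by
      intro G hG
      apply Subtype.val_injective
      rw [show ((aeval (fun i => (⟨y i, hyS i⟩ : S)) G : S) : L) = aeval y G from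
        comp_aeval_apply _ S.val G]
      exact hp.right G hG
    have h2 := h1.map f
    convert h2 using 2 with i
    rw [← map_sub]
    congr 1
    apply Subtype.val_injective
    change z i - x i = y i
    rw [hz]; ring
  · rw [eq_top_iff, ← Algebra.adjoin_image_eq_top f hf (Algebra.adjoin_val_preimage hS)]
    apply Algebra.adjoin_mono
    rintro _ ⟨⟨q, hq⟩, (⟨i, hi⟩ | ⟨i, hi⟩) | hq', rfl⟩
    · exact Or.inl (Or.inl ⟨i, congrArg f (Subtype.val_injective hi)⟩)
    · exact Or.inl (Or.inr ⟨i, congrArg f (Subtype.val_injective hi)⟩)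
    · right
      rcases hq' with hq' | hq' | hq'
      · exact Or.inl (congrArg f (Subtype.val_injective hq'))
      · exact Or.inr (Or.inl (congrArg f (Subtype.val_injective hq')))
      · exact Or.inr (Or.inr (congrArg f (Subtype.val_injective hq')))
  · rintro _ (rfl | rfl | rfl)
    · exact ((IsIntegralOver.of_map S.val Subtype.val_injective (z := zS)
        (q := ⟨π, hπS⟩) hπ).map f).isAlgebraic
    · exact ((IsIntegralOver.of_map S.val Subtype.val_injective (z := zS)
        (q := ⟨w, hwS⟩) hw).map f).isAlgebraic
    · exact IsAlgebraic.of_mul_eq_one (aeval_mem_adjoin_range _ _) hσf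
  · intro W hW
    obtain ⟨δ, hδx, hδy, hδ⟩ := hp.exists_derivation hW
    obtain ⟨R, hR⟩ : ∃ R : Subalgebra ℂ L, R = Algebra.adjoin ℂ (range x ∪ range y) := ⟨_, rfl⟩
    rw [← hR] at hδ
    have hxR : ∀ i, x i ∈ R := fun i => hR ▸ Algebra.subset_adjoin (Or.inl ⟨i, rfl⟩)
    have hyR : ∀ i, y i ∈ R := fun i => hR ▸ Algebra.subset_adjoin (Or.inr ⟨i, rfl⟩)
    have hzR : ∀ i, z i ∈ R := fun i => by rw [hz]; exact add_mem (hxR i) (hyR i)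
    have hRS : R ≤ S := by
      rw [hR]
      refine Algebra.adjoin_le_iff.2 ?_
      rintro _ (⟨i, rfl⟩ | ⟨i, rfl⟩)
      · exact hxS i
      · exact hyS i
    have hRint : ∀ q ∈ R, IsIntegral R q := fun q hq =>
      isIntegral_algebraMap (R := R) (x := (⟨q, hq⟩ : R))
    have hδz : ∀ G : MvPolynomial (Fin n) ℂ, δ (aeval z G) =
        ∑ l, aeval z (pderiv l G) * aeval x (W l) := by
      intro G
      rw [δ.apply_aeval]
      refine Finset.sum_congr rfl fun l _ => ?_
      change aeval z _ * δ (z l) = _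
      rw [hz l, map_add, hδx, hδy, add_zero]
    have hδR : ∀ G : MvPolynomial (Fin n) ℂ, δ (aeval z G) ∈ R := fun G => by
      rw [hδz]
      exact sum_mem fun l _ => mul_mem (aeval_mem_subalgebra hzR _) (aeval_mem_subalgebra hxR _)
    have hπR : IsIntegral R π := hπ.isIntegral hzR
    have hwR : IsIntegral R w := hw.isIntegral hzR
    let t : L := aeval z s₀
    let ρ : L := t * (2 * (w * δ π) + π * δ w) - 3 * (δ t * (π * w))
    have htR : IsIntegral R t := hRint _ (aeval_mem_subalgebra hzR _)
    have hintg : ∀ k : ℕ, IsIntegral R (k : L) := fun k => hRint _ (natCast_mem R k)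
    have hρ : IsIntegral R ρ := by
      refine IsIntegral.sub (htR.mul (IsIntegral.add ((hintg 2).mul (hwR.mul (hδ _ hπR)))
        (hπR.mul (hδ _ hwR)))) ((hintg 3).mul ((hRint _ (hδR s₀)).mul (hπR.mul hwR)))
    have hkey : t ^ 4 * δ (aeval z b) = π * ρ := by
      have h1 : π ^ 2 * w = t ^ 3 * aeval z b := by rw [hπw, map_mul, map_pow]
      have h2 := congrArg δ h1
      simp only [Derivation.leibniz, Derivation.leibniz_pow, smul_eq_mul, nsmul_eq_mul] at h2
      push_cast at h2
      norm_num at h2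
      linear_combination (-t) * h2 + 3 * δ t * h1
    have hρS : IsIntegral S ρ := by
      obtain ⟨P, hP, hPρ⟩ := hρ
      refine ⟨P.map (Subalgebra.inclusion hRS).toRingHom, hP.map _, ?_⟩
      rw [Polynomial.eval₂_map]
      exact hPρ
    have hqeq : (aeval zS s₀ ^ 4 * ∑ l, aeval zS (pderiv l b) * aeval xS (W l) : S) =
        t ^ 4 * δ (aeval z b) := by
      rw [hδz]
      push_cast
      simp only [hzval, hxval, t]
    have h3 := f.apply_eq_zero_of_isIntegral (T := L) Subtype.val_injective hfπ hρS
      (q := aeval zS s₀ ^ 4 * ∑ l, aeval zS (pderiv l b) * aeval xS (W l)) (by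
        change ((aeval zS s₀ ^ 4 * ∑ l, aeval zS (pderiv l b) * aeval xS (W l) : S) : L) = π * ρ
        rw [hqeq, hkey])
    rw [map_mul, map_pow, hfz, map_sum] at h3
    have h4 := (mul_eq_zero.1 h3).resolve_left (pow_ne_zero _ (hdvd _ hs₀))
    simpa only [map_mul, hfz, hfx] using h4

theorem IsConePair.false_of_isUnit (h : IsSmoothCone I m) (hp : IsConePair I m x y)
    (hn : 0 < n) (hnum : n + 1 ≤ 2 * m + 2) {z : Fin n → L} (hz : ∀ i, z i = x i + y i)
    (hinj : Function.Injective (aeval z : MvPolynomial (Fin n) ℂ →ₐ[ℂ] L))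
    {b s₀ s : MvPolynomial (Fin n) ℂ} (hb : Prime b) (hs₀ : s₀ ∣ s) (hbs : ¬ b ∣ s)
    {π w σ : L} (hσ : σ * aeval z s = 1) (hπ : IsIntegralOver z π) (hw : IsIntegralOver z w)
    (hπw : π ^ 2 * w = aeval z (s₀ ^ 3 * b))
    (hnon : ∀ t, ¬ b ∣ t → ∀ c, IsIntegralOver z c → π * c ≠ aeval z t)
    {ε : L} (hε : ε ∈ Algebra.adjoin ℂ (range x ∪ range z ∪ {π, w, σ})) (hπε : π * ε = 1) :
    False := by
  let xT : Fin n → Polynomial L := fun i => Polynomial.X * Polynomial.C (x i)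
  let zT : Fin n → Polynomial L := fun i => Polynomial.C (z i)
  have hzT : ∀ G : MvPolynomial (Fin n) ℂ, aeval zT G = Polynomial.C (aeval z G) := fun G =>
    (comp_aeval_apply z (Polynomial.CAlgHom (R := ℂ)) G).symm
  let Ω : Set (Polynomial L) := {Polynomial.C π, Polynomial.C w, Polynomial.C σ, Polynomial.X}
  obtain ⟨S, hS⟩ : ∃ S : Subalgebra ℂ (Polynomial L),
    S = Algebra.adjoin ℂ (range xT ∪ range zT ∪ Ω) := ⟨_, rfl⟩
  have hsub : range xT ∪ range zT ∪ Ω ⊆ (S : Set (Polynomial L)) := by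
    rw [hS]; exact Algebra.subset_adjoin
  have hxS : ∀ i, xT i ∈ S := fun i => hsub (Or.inl (Or.inl ⟨i, rfl⟩))
  have hzS : ∀ i, zT i ∈ S := fun i => hsub (Or.inl (Or.inr ⟨i, rfl⟩))
  have hπS : Polynomial.C π ∈ S := hsub (Or.inr (Or.inl rfl))
  have hwS : Polynomial.C w ∈ S := hsub (Or.inr (Or.inr (Or.inl rfl)))
  have hσS : Polynomial.C σ ∈ S := hsub (Or.inr (Or.inr (Or.inr (Or.inl rfl))))
  have hTS : Polynomial.X ∈ S := hsub (Or.inr (Or.inr (Or.inr (Or.inr rfl))))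
  have : Algebra.FiniteType ℂ S := by
    rw [hS]
    exact finiteType_adjoin_of_finite
      (((finite_range xT).union (finite_range zT)).union (by simp [Ω]))
  have hzint : ∀ i, IsIntegralOver z (z i) := fun i => ⟨Polynomial.X - Polynomial.C (X i),
    Polynomial.monic_X_sub_C _, by simp⟩
  have hAint : ∀ G, IsIntegralOver z (aeval z G) := fun G => ⟨Polynomial.X - Polynomial.C G,
    Polynomial.monic_X_sub_C _, by simp⟩
  have hpu : ¬ IsUnit (⟨Polynomial.C π, hπS⟩ : S) := by
    intro hu
    obtain ⟨⟨c, hcS⟩, hc⟩ := isUnit_iff_exists_inv.1 hu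
    have hc' : Polynomial.C π * c = 1 := congrArg Subtype.val hc
    have h1 : ∃ N : ℕ, IsIntegralOver z (aeval z (s ^ N) * c.eval 0) := by
      have hcS' : c ∈ Algebra.adjoin ℂ (range xT ∪ range zT ∪ Ω) := hS ▸ hcS
      clear hc' hc hcS
      induction hcS' using Algebra.adjoin_induction with
      | mem q hq =>
        rcases hq with (⟨i, rfl⟩ | ⟨i, rfl⟩) | (rfl | rfl | rfl | rfl)
        · exact ⟨0, by simpa [xT] using hAint 0⟩
        · exact ⟨0, by simpa [zT] using hzint i⟩
        · exact ⟨0, by simpa using hπ⟩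
        · exact ⟨0, by simpa using hw⟩
        · refine ⟨1, ?_⟩
          rw [pow_one, Polynomial.eval_C, mul_comm, hσ]
          simpa using hAint 1
        · exact ⟨0, by simpa using hAint 0⟩
      | algebraMap r =>
        refine ⟨0, ?_⟩
        have : (algebraMap ℂ (Polynomial L) r).eval 0 = algebraMap ℂ L r := by
          rw [Polynomial.algebraMap_apply, Polynomial.eval_C]
        rw [this]
        simpa using hAint (C r)
      | add p q _ _ hp hq =>
        obtain ⟨N, hN⟩ := hp
        obtain ⟨M, hM⟩ := hq
        refine ⟨N + M, ?_⟩
        have h2 := RingHom.IsIntegralElem.add _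
          (RingHom.IsIntegralElem.mul _ (hAint (s ^ M)) hN)
          (RingHom.IsIntegralElem.mul _ (hAint (s ^ N)) hM)
        unfold IsIntegralOver
        convert h2 using 1
        simp only [pow_add, map_mul, Polynomial.eval_add]; ring
      | mul p q _ _ hp hq =>
        obtain ⟨N, hN⟩ := hp
        obtain ⟨M, hM⟩ := hq
        refine ⟨N + M, ?_⟩
        have h2 := RingHom.IsIntegralElem.mul _ hN hM
        unfold IsIntegralOver
        convert h2 using 1
        simp only [pow_add, map_mul, Polynomial.eval_mul]; ring
    obtain ⟨N, hN⟩ := h1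
    refine hnon (s ^ N) (fun hd => hbs (hb.dvd_of_dvd_pow hd)) _ hN ?_
    have h2 := congrArg (Polynomial.eval 0) hc'
    simp only [Polynomial.eval_mul, Polynomial.eval_C, Polynomial.eval_one] at h2
    linear_combination (aeval z (s ^ N)) * h2
  have hSalg : Algebra.IsAlgebraic S (Polynomial L) := by
    have hX : IsAlgebraic S (Polynomial.X : Polynomial L) :=
      isAlgebraic_algebraMap (⟨Polynomial.X, hTS⟩ : S)
    have hCx : ∀ i, IsAlgebraic S (Polynomial.C (x i)) := fun i =>
      IsAlgebraic.of_mul (mem_nonZeroDivisors_of_ne_zero Polynomial.X_ne_zero) hX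
        (isAlgebraic_algebraMap (⟨_, hxS i⟩ : S))
    have hCy : ∀ i, IsAlgebraic S (Polynomial.C (y i)) := fun i => by
      rw [show y i = z i - x i by rw [hz]; ring, map_sub]
      exact (isAlgebraic_algebraMap (⟨_, hzS i⟩ : S)).sub (hCx i)
    have hR : Algebra.adjoin ℂ (range x ∪ range y) ≤
        ((Subalgebra.algebraicClosure S (Polynomial L)).restrictScalars ℂ).comap
          (Polynomial.CAlgHom (R := ℂ) (A := L)) := by
      refine Algebra.adjoin_le_iff.2 ?_
      rintro _ (⟨i, rfl⟩ | ⟨i, rfl⟩)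
      · exact hCx i
      · exact hCy i
    have hCL : ∀ l : L, IsAlgebraic S (Polynomial.C l) := by
      intro l
      have hfr := hp.isFractionRing
      obtain ⟨a, c, hc, rfl⟩ := IsFractionRing.div_surjective
        (A := Algebra.adjoin ℂ (range x ∪ range y)) l
      have hc0 : (c : L) ≠ 0 := fun h0 => nonZeroDivisors.ne_zero hc (Subtype.val_injective h0)
      refine IsAlgebraic.of_mul (y := Polynomial.C (c : L))
        (mem_nonZeroDivisors_of_ne_zero (Polynomial.C_ne_zero.2 hc0)) (hR c.2) ?_
      rw [← Polynomial.C_mul]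
      change IsAlgebraic S (Polynomial.C ((c : L) * ((a : L) / (c : L))))
      rw [mul_div_cancel₀ _ hc0]
      exact hR a.2
    refine ⟨fun q => ?_⟩
    induction q using Polynomial.induction_on' with
    | add p q hp hq => exact hp.add hq
    | monomial k a =>
      rw [← Polynomial.C_mul_X_pow_eq_monomial]
      exact (hCL a).mul (hX.pow k)
  obtain ⟨D, _, _, _, _, f, hf, hfπ, hfD⟩ := exists_domain_quotient (S := S) (N := 2 * m + 2)
    (by rw [S.trdeg_eq_of_isAlgebraic]; exact succ_le_trdeg_polynomial hp.le_trdeg) hpu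
  let xS : Fin n → S := fun i => ⟨xT i, hxS i⟩
  let zS : Fin n → S := fun i => ⟨zT i, hzS i⟩
  let T : S := ⟨Polynomial.X, hTS⟩
  have hzval : ∀ G : MvPolynomial (Fin n) ℂ, (aeval zS G : S) = aeval zT G := fun G =>
    comp_aeval_apply zS S.val G
  have hfz : ∀ G : MvPolynomial (Fin n) ℂ, f (aeval zS G) = aeval (fun i => f (zS i)) G :=
    fun G => comp_aeval_apply zS f G
  have hσf : f ⟨Polynomial.C σ, hσS⟩ * aeval (fun i => f (zS i)) s = 1 := by
    rw [← hfz, ← map_mul, ← map_one f]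
    congr 1
    refine Subtype.val_injective ?_
    change Polynomial.C σ * (aeval zS s : S) = 1
    rw [hzval, hzT, ← Polynomial.C_mul, hσ, Polynomial.C_1]
  have hs₀f : aeval (fun i => f (zS i)) s₀ ≠ 0 := by
    obtain ⟨t', rfl⟩ := hs₀
    have hsf := right_ne_zero_of_mul_eq_one hσf
    rw [map_mul] at hsf
    exact left_ne_zero_of_mul hsf
  have hbz : aeval (fun i => f (zS i)) b = 0 := by
    have h1 : (⟨Polynomial.C π, hπS⟩ : S) ^ 2 * ⟨Polynomial.C w, hwS⟩ = aeval zS (s₀ ^ 3 * b) := by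
      refine Subtype.val_injective ?_
      rw [hzval, hzT, ← hπw, Polynomial.C_mul, Polynomial.C_pow]
      rfl
    have h2 := congrArg f h1
    rw [map_mul, map_pow, hfπ, hfz, map_mul, map_pow, zero_pow two_ne_zero, zero_mul] at h2
    exact (mul_eq_zero.1 h2.symm).resolve_left (pow_ne_zero _ hs₀f)
  have hfT : f T = 0 := by
    have h1 : ∃ N : ℕ, Polynomial.X ^ N * Polynomial.C ε ∈ S := by
      clear hπε
      induction hε using Algebra.adjoin_induction with
      | mem q hq =>
        rcases hq with (⟨i, rfl⟩ | ⟨i, rfl⟩) | (rfl | rfl | rfl)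
        · exact ⟨1, by rw [pow_one]; exact hxS i⟩
        · exact ⟨0, by rw [pow_zero, one_mul]; exact hzS i⟩
        · exact ⟨0, by rw [pow_zero, one_mul]; exact hπS⟩
        · exact ⟨0, by rw [pow_zero, one_mul]; exact hwS⟩
        · exact ⟨0, by rw [pow_zero, one_mul]; exact hσS⟩
      | algebraMap r => exact ⟨0, by rw [pow_zero, one_mul]; exact S.algebraMap_mem r⟩
      | add p q _ _ hp hq =>
        obtain ⟨N, hN⟩ := hp
        obtain ⟨M, hM⟩ := hq
        refine ⟨N + M, ?_⟩
        have h2 := add_mem (mul_mem (pow_mem hTS M) hN) (mul_mem (pow_mem hTS N) hM)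
        convert h2 using 1
        rw [Polynomial.C_add]; ring
      | mul p q _ _ hp hq =>
        obtain ⟨N, hN⟩ := hp
        obtain ⟨M, hM⟩ := hq
        refine ⟨N + M, ?_⟩
        have h2 := mul_mem hN hM
        convert h2 using 1
        rw [Polynomial.C_mul]; ring
    obtain ⟨N, hN⟩ := h1
    have h2 : T ^ N = ⟨Polynomial.C π, hπS⟩ * ⟨_, hN⟩ := by
      apply Subtype.val_injective
      change (Polynomial.X : Polynomial L) ^ N = Polynomial.C π * (Polynomial.X ^ N * Polynomial.C ε)
      rw [mul_left_comm, ← Polynomial.C_mul, hπε, Polynomial.C_1, mul_one]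
    have h3 := congrArg f h2
    rw [map_pow, map_mul, hfπ, zero_mul] at h3
    exact eq_zero_of_pow_eq_zero h3
  have hxI : IsZeroOf I xS := by
    intro G hG
    refine Subtype.val_injective ?_
    have h1 : ((aeval xS G : S) : Polynomial L) = aeval xT G := comp_aeval_apply xS S.val G
    rw [h1]
    exact ((hp.left.map (Polynomial.CAlgHom (R := ℂ))).smul h.conical Polynomial.X) G hG
  have hzd : ∀ G ∈ I, dirDeriv G (fun i => f (xS i)) (fun i => f (zS i)) = 0 := by
    intro G hG
    obtain ⟨H, hH⟩ := exists_taylor G xS zS (-T)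
    have h1 : aeval (fun i => xS i + -T * zS i) G = 0 := by
      refine Subtype.val_injective ?_
      have h2 : ((aeval (fun i => xS i + -T * zS i) G : S) : Polynomial L) =
          aeval (fun i => (-Polynomial.X : Polynomial L) * Polynomial.C (y i)) G := by
        rw [show ((aeval (fun i => xS i + -T * zS i) G : S) : Polynomial L) =
          aeval (fun i => ((xS i + -T * zS i : S) : Polynomial L)) G from
            comp_aeval_apply _ S.val G]
        congr 2
        funext i
        change Polynomial.X * Polynomial.C (x i) + (-Polynomial.X) * Polynomial.C (z i) = _
        rw [hz, Polynomial.C_add]; ring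
      rw [h2]
      exact ((hp.right.map (Polynomial.CAlgHom (R := ℂ))).smul h.conical (-Polynomial.X)) G hG
    rw [h1, hxI G hG] at hH
    have hT0 : T ≠ 0 := fun h0 => Polynomial.X_ne_zero (congrArg Subtype.val h0)
    have h3 : dirDeriv G xS zS = T * H := by
      apply mul_left_cancel₀ hT0
      linear_combination hH
    rw [← map_dirDeriv, h3, map_mul, hfT, zero_mul]
  have htan : ∀ v : Fin n → ℂ, v ≠ 0 → IsZeroOf I v → ∀ p ∈ tangentSpace I v, aeval p b = 0 := by
    intro v hv hvI p hpv
    refine h.aeval_eq_zero_of_mem_tangentSpace (D := D) (by omega) (hxI.map f) hzd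
      (Ω := {f ⟨_, hπS⟩, f ⟨_, hwS⟩, f ⟨_, hσS⟩, f T}) ?_ ?_ hfD hb.ne_zero hbz hv hvI hpv
    · rw [eq_top_iff, ← Algebra.adjoin_image_eq_top f hf (Algebra.adjoin_val_preimage hS)]
      apply Algebra.adjoin_mono
      rintro _ ⟨⟨q, hq⟩, (⟨i, hi⟩ | ⟨i, hi⟩) | hq', rfl⟩
      · exact Or.inl (Or.inl ⟨i, congrArg f (Subtype.val_injective hi)⟩)
      · exact Or.inl (Or.inr ⟨i, congrArg f (Subtype.val_injective hi)⟩)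
      · right
        rcases hq' with hq' | hq' | hq' | hq'
        · exact Or.inl (congrArg f (Subtype.val_injective hq'))
        · exact Or.inr (Or.inl (congrArg f (Subtype.val_injective hq')))
        · exact Or.inr (Or.inr (Or.inl (congrArg f (Subtype.val_injective hq'))))
        · exact Or.inr (Or.inr (Or.inr (congrArg f (Subtype.val_injective hq'))))
    · have hπT : IsIntegralOver zT (Polynomial.C π) := hπ.map (Polynomial.CAlgHom (R := ℂ))
      have hwT : IsIntegralOver zT (Polynomial.C w) := hw.map (Polynomial.CAlgHom (R := ℂ))
      rintro _ (rfl | rfl | rfl | rfl)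
      · exact ((IsIntegralOver.of_map S.val Subtype.val_injective (z := zS)
          (q := ⟨_, hπS⟩) hπT).map f).isAlgebraic
      · exact ((IsIntegralOver.of_map S.val Subtype.val_injective (z := zS)
          (q := ⟨_, hwS⟩) hwT).map f).isAlgebraic
      · exact IsAlgebraic.of_mul_eq_one (aeval_mem_adjoin_range _ _) hσf
      · rw [hfT]; exact isAlgebraic_zero
  have : Algebra.FiniteType ℂ (Algebra.adjoin ℂ (range x ∪ range y)) :=
    finiteType_adjoin_of_finite ((finite_range x).union (finite_range y))
  let xR : Fin n → Algebra.adjoin ℂ (range x ∪ range y) := fun i =>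
    ⟨x i, Algebra.subset_adjoin (Or.inl ⟨i, rfl⟩)⟩
  let yR : Fin n → Algebra.adjoin ℂ (range x ∪ range y) := fun i =>
    ⟨y i, Algebra.subset_adjoin (Or.inr ⟨i, rfl⟩)⟩
  have hxR : IsZeroOf I xR := fun G hG => Subtype.val_injective
    ((comp_aeval_apply xR (Algebra.adjoin ℂ (range x ∪ range y)).val G).trans (hp.left G hG))
  have hyR : IsZeroOf I yR := fun G hG => Subtype.val_injective
    ((comp_aeval_apply yR (Algebra.adjoin ℂ (range x ∪ range y)).val G).trans (hp.right G hG))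
  have hne : aeval (fun i => xR i + yR i) (b * X ⟨0, hn⟩) ≠ 0 := by
    intro h0
    have h1 := congrArg (Algebra.adjoin ℂ (range x ∪ range y)).val h0
    rw [comp_aeval_apply, map_zero] at h1
    have h2 : (fun i => (Algebra.adjoin ℂ (range x ∪ range y)).val (xR i + yR i)) = z := by
      funext i; rw [hz]; rfl
    rw [h2] at h1
    have h3 := hinj (h1.trans (map_zero (aeval z)).symm)
    exact mul_ne_zero hb.ne_zero (X_ne_zero _) h3
  obtain ⟨φ, hφ⟩ := exists_algHom_apply_ne_zero (k := ℂ) hne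
  rw [comp_aeval_apply, map_mul, aeval_X] at hφ
  have hy' : IsZeroOf I (fun i => (-1 : ℂ) * φ (yR i)) := (hyR.map φ).smul h.conical (-1)
  obtain ⟨v, hv, hvI, hmem⟩ := h.exists_sub_mem_tangentSpace hnum (hxR.map φ) hy' (fun h0 => by
    have h1 := congrFun h0 ⟨0, hn⟩
    apply right_ne_zero_of_mul hφ
    rw [map_add, h1]; ring)
  refine left_ne_zero_of_mul hφ ?_
  rw [← htan v hv hvI _ hmem]
  congr 2
  funext i
  rw [map_add]; ring

end NoRamification

section PolynomialFacts

variable {n : ℕ}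

theorem MvPolynomial.exists_pderiv_not_dvd {b : MvPolynomial (Fin n) ℂ} (hb : Prime b) :
    ∃ j, ¬ b ∣ pderiv j b := by
  obtain ⟨μ, hμ, hμ0⟩ : ∃ μ ∈ b.support, μ ≠ 0 := by
    by_contra! hcon
    have h1 : b = C (coeff 0 b) := by
      ext μ
      rw [coeff_C]
      split_ifs with h
      · rw [← h]
      · by_contra h2
        exact h (hcon μ (mem_support_iff.2 h2)).symm
    have h2 : coeff 0 b ≠ 0 := fun h0 => hb.ne_zero (by rw [h1, h0, C_0])
    exact hb.not_isUnit (by rw [h1]; exact (isUnit_iff_ne_zero.2 h2).map C)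
  obtain ⟨j, hj⟩ := Finsupp.ne_iff.1 hμ0
  have hj' : μ j ≠ 0 := hj
  have hle : Finsupp.single j 1 ≤ μ := by
    rw [Finsupp.single_le_iff]; omega
  have hne : pderiv j b ≠ 0 := by
    intro h0
    have h1 := congrArg (coeff (μ - Finsupp.single j 1)) h0
    rw [coeff_pderiv, tsub_add_cancel_of_le hle, coeff_zero] at h1
    rcases mul_eq_zero.1 h1 with h2 | h2
    · exact mem_support_iff.1 hμ h2
    · exact Nat.cast_add_one_ne_zero _ h2
  have hpos : 0 < b.totalDegree := by
    have h1 := le_totalDegree hμ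
    refine lt_of_lt_of_le ?_ h1
    exact lt_of_lt_of_le (Nat.pos_of_ne_zero hj')
      (Finset.single_le_sum (f := fun i => μ i) (fun _ _ => Nat.zero_le _)
        (Finsupp.mem_support_iff.2 hj'))
  refine ⟨j, fun hd => ?_⟩
  have h1 := totalDegree_le_of_dvd_of_isDomain hd hne
  have h2 : (pderiv j b).totalDegree < b.totalDegree := by
    refine (Finset.sup_lt_iff hpos).2 fun ν hν => ?_
    rw [mem_support_iff, coeff_pderiv] at hν
    have h3 := le_totalDegree (mem_support_iff.2 (left_ne_zero_of_mul hν))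
    rw [Finsupp.sum_add_index' (by simp) (by simp)] at h3
    simp at h3
    omega
  omega

theorem IsSmoothCone.exists_homogeneous_not_dvd {I : Ideal (MvPolynomial (Fin n) ℂ)} {m : ℕ}
    (h : IsSmoothCone I m) (hmn : m + 3 ≤ n) {b : MvPolynomial (Fin n) ℂ} (hb : Prime b) :
    ∃ F ∈ I, ∃ e, F.IsHomogeneous e ∧ ¬ b ∣ F := by
  by_contra! hcon
  have := h.prime
  have hP : (Ideal.span {b}).IsPrime := (Ideal.span_singleton_prime hb.ne_zero).2 hb
  have hle : I ≤ Ideal.span {b} := by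
    intro F hF
    rw [← sum_homogeneousComponent F]
    refine sum_mem fun d _ => Ideal.mem_span_singleton.2 ?_
    exact hcon _ (h.conical F hF d) d (homogeneousComponent_isHomogeneous d F)
  obtain ⟨q, hq, hbq, hqb, hqn⟩ := exists_prime_le_trdeg_quotient (k := ℂ)
    (Ideal.mem_span_singleton_self b) (n := n - 1) (by
      rw [MvPolynomial.trdeg_of_isDomain]
      simp
      omega)
  have h1 : q = Ideal.span {b} := le_antisymm hqb ((Ideal.span_singleton_le_iff_mem _).2 hbq)
  subst h1
  have h2 := trdeg_le_of_surjective (Ideal.Quotient.factorₐ ℂ hle)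
    (Ideal.Quotient.factor_surjective hle)
  have h3 := hqn.trans h2
  rw [h.trdeg_eq] at h3
  have h4 : n - 1 ≤ m + 1 := by exact_mod_cast h3
  omega

end PolynomialFacts

section Unramified

variable {n : ℕ} {L : Type} [Field L] [Algebra ℂ L] {I : Ideal (MvPolynomial (Fin n) ℂ)} {m : ℕ}
  {x y z : Fin n → L}

theorem IsConePair.not_ramified (h : IsSmoothCone I m) (hp : IsConePair I m x y)
    (hmn : m + 3 ≤ n) (hnum : 2 * n ≤ 3 * m + 3) (hz : ∀ i, z i = x i + y i)
    (hinj : Function.Injective (aeval z : MvPolynomial (Fin n) ℂ →ₐ[ℂ] L))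
    {b s₀ : MvPolynomial (Fin n) ℂ} (hb : Prime b) (hs₀ : ¬ b ∣ s₀) {π w : L}
    (hπ : IsIntegralOver z π) (hw : IsIntegralOver z w)
    (hπw : π ^ 2 * w = aeval z (s₀ ^ 3 * b)) :
    ∃ t, ¬ b ∣ t ∧ ∃ c, IsIntegralOver z c ∧ π * c = aeval z t := by
  by_contra! hnon
  obtain ⟨j, hj⟩ := exists_pderiv_not_dvd hb
  obtain ⟨F, hF, e, hFe, hFb⟩ := h.exists_homogeneous_not_dvd hmn hb
  have hbs : ¬ b ∣ s₀ * pderiv j b * F := fun hd =>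
    (hb.dvd_or_dvd hd).elim (fun hd' => (hb.dvd_or_dvd hd').elim hs₀ hj) hFb
  have hs0 : s₀ * pderiv j b * F ≠ 0 := fun h0 => hbs (h0 ▸ dvd_zero b)
  have hσ : (aeval z (s₀ * pderiv j b * F))⁻¹ * aeval z (s₀ * pderiv j b * F) = 1 :=
    inv_mul_cancel₀ fun h0 => hs0 (hinj (h0.trans (map_zero (aeval z)).symm))
  by_cases hu : ∃ c ∈ Algebra.adjoin ℂ (range x ∪ range z ∪
      {π, w, (aeval z (s₀ * pderiv j b * F))⁻¹}), π * c = 1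
  · obtain ⟨c, hc, hc1⟩ := hu
    exact hp.false_of_isUnit h (by omega) (by omega) hz hinj hb
      (Dvd.intro _ (by rw [mul_assoc])) hbs hσ hπ hw hπw hnon hc hc1
  · push Not at hu
    exact hp.false_of_not_isUnit h hnum hz hinj hb.ne_zero (Dvd.intro _ (by rw [mul_assoc]))
      (Dvd.intro (s₀ * F) (by ring)) hF hFe (Dvd.intro_left _ rfl) hσ hπ hw hπw hu

/-- Derivations preserve integrality over the polynomial ring in subextensions of `L`. -/
theorem IsConePair.isIntegral_derivation (h : IsSmoothCone I m) (hp : IsConePair I m x y)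
    (hmn : m + 3 ≤ n) (hnum : 2 * n ≤ 3 * m + 3) (hz : ∀ i, z i = x i + y i)
    (hinj : Function.Injective (aeval z : MvPolynomial (Fin n) ℂ →ₐ[ℂ] L))
    (K : Type) {K₁ : Type} [Field K] [Field K₁] [Algebra (MvPolynomial (Fin n) ℂ) K]
    [IsFractionRing (MvPolynomial (Fin n) ℂ) K] [Algebra ℂ K₁]
    [Algebra (MvPolynomial (Fin n) ℂ) K₁] [Algebra K K₁]
    [IsScalarTower (MvPolynomial (Fin n) ℂ) K K₁] [IsScalarTower ℂ (MvPolynomial (Fin n) ℂ) K₁]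
    [FiniteDimensional K K₁] (j : K₁ →ₐ[ℂ] L)
    (hj : ∀ i, j (algebraMap (MvPolynomial (Fin n) ℂ) K₁ (X i)) = z i)
    (D : Derivation ℂ K₁ K₁) (hD : ∀ a : MvPolynomial (Fin n) ℂ,
      D (algebraMap _ K₁ a) ∈ (algebraMap (MvPolynomial (Fin n) ℂ) K₁).range) {α : K₁}
    (hα : IsIntegral (MvPolynomial (Fin n) ℂ) α) : IsIntegral (MvPolynomial (Fin n) ℂ) (D α) := by
  by_contra hDα
  obtain ⟨b, hb, s, hs, π, w, hπ, hw, hπw, hnon⟩ := exists_ramified_prime K D hD hα hDα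
  have hjz : (fun i => j (algebraMap (MvPolynomial (Fin n) ℂ) K₁ (X i))) = z := funext hj
  have hintg : ∀ q : K₁, IsIntegralOver z (j q) ↔ IsIntegral (MvPolynomial (Fin n) ℂ) q := by
    intro q
    rw [← isIntegralOver_iff]
    refine ⟨fun hq => IsIntegralOver.of_map j j.injective (by rw [hjz]; exact hq), fun hq => ?_⟩
    have h1 := hq.map j
    rwa [hjz] at h1
  have hjA : ∀ a : MvPolynomial (Fin n) ℂ, j (algebraMap _ K₁ a) = aeval z a := by
    intro a
    have h1 : j.comp (IsScalarTower.toAlgHom ℂ (MvPolynomial (Fin n) ℂ) K₁) = aeval z := by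
      apply MvPolynomial.algHom_ext
      intro i
      simp [hj]
    exact DFunLike.congr_fun h1 a
  obtain ⟨t, ht, c, hc, hct⟩ := hp.not_ramified h hmn hnum hz hinj hb hs ((hintg π).2 hπ)
    ((hintg w).2 hw) (by rw [← hjA, ← hπw, map_mul, map_pow])
  have hπ0 : π ≠ 0 := by
    rintro rfl
    rw [map_zero, zero_mul] at hct
    have := hinj (hct.symm.trans (map_zero (aeval z)).symm)
    exact ht (this ▸ dvd_zero b)
  have hjπ0 : j π ≠ 0 := fun h0 => hπ0 (j.injective (h0.trans (map_zero j).symm))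
  have hc' : c = j (algebraMap _ K₁ t / π) := by
    rw [map_div₀, hjA, ← hct, mul_div_cancel_left₀ _ hjπ0]
  rw [hc', hintg] at hc
  exact hnon t ht _ hc (mul_div_cancel₀ _ hπ0)

end Unramified

section EulerGrading

variable {n : ℕ} {K₁ : Type} [Field K₁] [Algebra ℂ K₁] [Algebra (MvPolynomial (Fin n) ℂ) K₁]
  [IsScalarTower ℂ (MvPolynomial (Fin n) ℂ) K₁]

theorem Derivation.apply_algebraMap_mvPolynomial (D : Derivation ℂ K₁ K₁)
    (G : MvPolynomial (Fin n) ℂ) : D (algebraMap (MvPolynomial (Fin n) ℂ) K₁ G) =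
      ∑ l, algebraMap (MvPolynomial (Fin n) ℂ) K₁ (pderiv l G) * D (algebraMap (MvPolynomial (Fin n) ℂ) K₁ (X l)) := by
  have h1 : ∀ G : MvPolynomial (Fin n) ℂ, aeval (fun i => algebraMap (MvPolynomial (Fin n) ℂ) K₁ (X i)) G =
      algebraMap (MvPolynomial (Fin n) ℂ) K₁ G := by
    intro G
    have : (aeval (fun i => algebraMap (MvPolynomial (Fin n) ℂ) K₁ (X i)) : MvPolynomial (Fin n) ℂ →ₐ[ℂ] K₁) =
        IsScalarTower.toAlgHom ℂ (MvPolynomial (Fin n) ℂ) K₁ := by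
      apply MvPolynomial.algHom_ext
      intro i
      simp
    exact DFunLike.congr_fun this G
  rw [← h1 G, D.apply_aeval]
  exact Finset.sum_congr rfl fun l _ => by rw [← h1 (pderiv l G)]; rfl

theorem MvPolynomial.eq_C_of_euler_eq_zero {G : MvPolynomial (Fin n) ℂ}
    (hG : ∑ l, X l * pderiv l G = 0) : G = C (coeff 0 G) := by
  have h1 : ∀ d, ∑ l, X l * pderiv l (homogeneousComponent d G) =
      d • homogeneousComponent d G := fun d =>
    (homogeneousComponent_isHomogeneous d G).sum_X_mul_pderiv
  have h2 : ∑ d ∈ Finset.range (G.totalDegree + 1), d • homogeneousComponent d G = 0 := by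
    rw [← hG]
    conv_rhs => rw [← sum_homogeneousComponent G]
    simp only [map_sum, Finset.mul_sum]
    rw [Finset.sum_comm]
    exact Finset.sum_congr rfl fun d _ => (h1 d).symm
  ext μ
  rw [coeff_C]
  split_ifs with h
  · rw [← h]
  have h3 := congrArg (homogeneousComponent μ.degree) h2
  rw [map_sum, map_zero] at h3
  have h4 : ∀ d ∈ Finset.range (G.totalDegree + 1), d ≠ μ.degree →
      homogeneousComponent μ.degree (d • homogeneousComponent d G) = 0 := by
    intro d _ hd
    rw [map_nsmul, homogeneousComponent_of_mem (homogeneousComponent_mem d G), if_neg hd.symm,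
      smul_zero]
  by_contra hc
  have hmem : μ.degree ∈ Finset.range (G.totalDegree + 1) := by
    rw [Finset.mem_range, Nat.lt_succ_iff]
    exact le_totalDegree (mem_support_iff.2 hc)
  rw [Finset.sum_eq_single_of_mem _ hmem h4, map_nsmul,
    homogeneousComponent_of_mem (homogeneousComponent_mem _ G), if_pos rfl] at h3
  have h5 := congrArg (coeff μ) h3
  rw [coeff_smul, coeff_homogeneousComponent, if_pos rfl, coeff_zero, nsmul_eq_mul] at h5
  have h6 : μ.degree ≠ 0 := fun h0 => h (by rw [eq_comm, ← Finsupp.degree_eq_zero_iff]; exact h0)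
  exact hc ((mul_eq_zero.1 h5).resolve_left (Nat.cast_ne_zero.2 h6))

theorem IsIntegral.mem_range_of_isAlgClosed {β : K₁} (hβ : IsIntegral ℂ β) :
    β ∈ (algebraMap ℂ K₁).range :=
  minpoly.mem_range_of_degree_eq_one ℂ β
    (IsAlgClosed.degree_eq_one_of_irreducible ℂ (minpoly.irreducible hβ))

/-- An integral element killed by the Euler derivation is a constant. -/
theorem Derivation.exists_eq_algebraMap_of_euler
    (hinj : Function.Injective (algebraMap (MvPolynomial (Fin n) ℂ) K₁)) (E : Derivation ℂ K₁ K₁)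
    (hE : ∀ i, E (algebraMap (MvPolynomial (Fin n) ℂ) K₁ (X i : MvPolynomial (Fin n) ℂ)) = algebraMap (MvPolynomial (Fin n) ℂ) K₁ (X i))
    {β : K₁} (hβ : IsIntegral (MvPolynomial (Fin n) ℂ) β) (hEβ : E β = 0) :
    β ∈ (algebraMap ℂ K₁).range := by
  have : FaithfulSMul (MvPolynomial (Fin n) ℂ) K₁ :=
    (faithfulSMul_iff_algebraMap_injective _ _).2 hinj
  have : Module.IsTorsionFree (MvPolynomial (Fin n) ℂ) K₁ := inferInstance
  let p := minpoly (MvPolynomial (Fin n) ℂ) β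
  let e : MvPolynomial (Fin n) ℂ → MvPolynomial (Fin n) ℂ := fun G => ∑ l, X l * pderiv l G
  have he : ∀ G, E (algebraMap (MvPolynomial (Fin n) ℂ) K₁ G) = algebraMap (MvPolynomial (Fin n) ℂ) K₁ (e G) := by
    intro G
    rw [E.apply_algebraMap_mvPolynomial]
    simp only [e, map_sum, map_mul, hE]
    exact Finset.sum_congr rfl fun l _ => mul_comm _ _
  let q : Polynomial (MvPolynomial (Fin n) ℂ) :=
    ∑ i ∈ Finset.range p.natDegree, Polynomial.monomial i (e (p.coeff i))
  have hp : p.Monic := minpoly.monic hβ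
  have hq : Polynomial.aeval β q = 0 := by
    have h1 : Polynomial.aeval β p = 0 := minpoly.aeval _ _
    rw [Polynomial.aeval_eq_sum_range, Finset.sum_range_succ, hp.coeff_natDegree, one_smul] at h1
    have h2 := congrArg E h1
    rw [map_add, map_sum, map_zero, Derivation.leibniz_pow, hEβ, smul_zero, smul_zero,
      add_zero] at h2
    rw [map_sum, ← h2]
    refine Finset.sum_congr rfl fun i _ => ?_
    rw [Polynomial.aeval_monomial, Algebra.smul_def, Derivation.leibniz, Derivation.leibniz_pow,
      hEβ, he]
    simp [mul_comm]
  have hq0 : q = 0 := by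
    by_contra hne
    have h1 := minpoly.isIntegrallyClosed_dvd hβ hq
    have h2 : p.natDegree ≤ q.natDegree := Polynomial.natDegree_le_of_dvd h1 hne
    have h3 : q.degree < p.natDegree := by
      refine (Polynomial.degree_sum_le _ _).trans_lt ?_
      rw [Finset.sup_lt_iff (WithBot.bot_lt_coe _)]
      intro i hi
      refine (Polynomial.degree_monomial_le _ _).trans_lt ?_
      exact_mod_cast Finset.mem_range.1 hi
    rw [Polynomial.degree_eq_natDegree hne] at h3
    have h4 : q.natDegree < p.natDegree := by exact_mod_cast h3
    omega
  have hcoeff : ∀ i, p.coeff i = C (coeff 0 (p.coeff i)) := by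
    intro i
    rcases lt_trichotomy i p.natDegree with hi | hi | hi
    · apply MvPolynomial.eq_C_of_euler_eq_zero
      have h1 := congrArg (fun r => r.coeff i) hq0
      simp only [q, Polynomial.finsetSum_coeff, Polynomial.coeff_monomial, Polynomial.coeff_zero] at h1
      rw [Finset.sum_eq_single_of_mem i (Finset.mem_range.2 hi) (fun j _ hj => if_neg hj),
        if_pos rfl] at h1
      exact h1
    · rw [hi, hp.coeff_natDegree]; simp
    · rw [Polynomial.coeff_eq_zero_of_natDegree_lt hi]; simp
  apply IsIntegral.mem_range_of_isAlgClosed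
  let p₀ : Polynomial ℂ := p.map constantCoeff
  have hp₀ : p₀.map (algebraMap ℂ (MvPolynomial (Fin n) ℂ)) = p := by
    ext1 i
    rw [Polynomial.coeff_map, Polynomial.coeff_map]
    exact (hcoeff i).symm
  refine ⟨p₀, hp.map _, ?_⟩
  have h1 : Polynomial.aeval β p = 0 := minpoly.aeval _ _
  rw [← hp₀, Polynomial.aeval_def, Polynomial.eval₂_map,
    ← IsScalarTower.algebraMap_eq] at h1
  exact h1

/-- Integral eigenvectors of the Euler derivation are homogeneous polynomials, provided the partial
derivatives preserve integrality. -/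
theorem Derivation.exists_homogeneous_of_euler
    (hinj : Function.Injective (algebraMap (MvPolynomial (Fin n) ℂ) K₁))
    [Algebra.IsAlgebraic (MvPolynomial (Fin n) ℂ) K₁] (D : Fin n → Derivation ℂ K₁ K₁)
    (hD : ∀ i j, D i (algebraMap (MvPolynomial (Fin n) ℂ) K₁ (X j : MvPolynomial (Fin n) ℂ)) = if i = j then 1 else 0)
    (hintg : ∀ i β, IsIntegral (MvPolynomial (Fin n) ℂ) β →
      IsIntegral (MvPolynomial (Fin n) ℂ) (D i β)) (e : ℕ) {β : K₁}
    (hβ : IsIntegral (MvPolynomial (Fin n) ℂ) β)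
    (hEβ : ∑ i, algebraMap (MvPolynomial (Fin n) ℂ) K₁ (X i : MvPolynomial (Fin n) ℂ) * D i β = e * β) :
    ∃ G : MvPolynomial (Fin n) ℂ, G.IsHomogeneous e ∧ β = algebraMap (MvPolynomial (Fin n) ℂ) K₁ G := by
  have : FaithfulSMul (MvPolynomial (Fin n) ℂ) K₁ :=
    (faithfulSMul_iff_algebraMap_injective _ _).2 hinj
  let E : Derivation ℂ K₁ K₁ := ∑ i, algebraMap (MvPolynomial (Fin n) ℂ) K₁ (X i : MvPolynomial (Fin n) ℂ) • D i
  have hE : ∀ β, E β = ∑ i, algebraMap (MvPolynomial (Fin n) ℂ) K₁ (X i : MvPolynomial (Fin n) ℂ) * D i β := by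
    intro β
    change Derivation.coeFnAddMonoidHom E β = _
    rw [map_sum, Finset.sum_apply]
    rfl
  have hEX : ∀ i, E (algebraMap (MvPolynomial (Fin n) ℂ) K₁ (X i : MvPolynomial (Fin n) ℂ)) = algebraMap (MvPolynomial (Fin n) ℂ) K₁ (X i) := by
    intro i
    rw [hE]
    simp [hD]
  have hcomm : ∀ i, ⁅E, D i⁆ = - D i := by
    intro i
    refine Derivation.ext_of_isAlgebraic (A := MvPolynomial (Fin n) ℂ) fun a => ?_
    rw [Derivation.apply_algebraMap_mvPolynomial, Derivation.apply_algebraMap_mvPolynomial]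
    refine Finset.sum_congr rfl fun j _ => ?_
    rw [Derivation.commutator_apply, hEX, hD]
    congr 1
    split_ifs with h
    · simp [hD, h]
    · simp [hD, h]
  induction e generalizing β with
  | zero =>
    obtain ⟨c, hc⟩ := Derivation.exists_eq_algebraMap_of_euler hinj E hEX hβ
      (by rw [hE, hEβ]; simp)
    refine ⟨C c, isHomogeneous_C _ _, ?_⟩
    rw [← hc, IsScalarTower.algebraMap_apply ℂ (MvPolynomial (Fin n) ℂ) K₁]
    rfl
  | succ e ih =>
    have h1 : ∀ i, ∃ G : MvPolynomial (Fin n) ℂ, G.IsHomogeneous e ∧ D i β = algebraMap (MvPolynomial (Fin n) ℂ) K₁ G := by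
      intro i
      refine ih (hintg i β hβ) ?_
      rw [← hE]
      have h2 := DFunLike.congr_fun (hcomm i) β
      rw [Derivation.commutator_apply, hE β, hEβ] at h2
      simp at h2
      linear_combination h2
    choose G hG hGD using h1
    have hc : ((e + 1 : ℕ) : K₁) ≠ 0 := by
      have : CharZero K₁ := charZero_of_injective_algebraMap (algebraMap ℂ K₁).injective
      exact Nat.cast_ne_zero.2 (Nat.succ_ne_zero e)
    refine ⟨C ((e + 1 : ℕ) : ℂ)⁻¹ * ∑ i, X i * G i, ?_, ?_⟩
    · rw [← zero_add (e + 1)]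
      refine (isHomogeneous_C _ _).mul (IsHomogeneous.sum _ _ _ fun i _ => ?_)
      rw [add_comm e]
      exact (isHomogeneous_X _ _).mul (hG i)
    · have h3 : algebraMap (MvPolynomial (Fin n) ℂ) K₁ (C ((e + 1 : ℕ) : ℂ)⁻¹) =
          ((e + 1 : ℕ) : K₁)⁻¹ := by
        have : algebraMap (MvPolynomial (Fin n) ℂ) K₁ (C ((e + 1 : ℕ) : ℂ)⁻¹) =
            algebraMap ℂ K₁ ((e + 1 : ℕ) : ℂ)⁻¹ := by
          rw [IsScalarTower.algebraMap_apply ℂ (MvPolynomial (Fin n) ℂ) K₁]; rfl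
        rw [this, map_inv₀, _root_.map_natCast]
      rw [map_mul, h3, map_sum, eq_inv_mul_iff_mul_eq₀ hc, ← hEβ]
      exact Finset.sum_congr rfl fun i _ => by rw [map_mul, hGD]

end EulerGrading

section AlgebraicallyClosed

variable {n : ℕ} {L : Type} [Field L] [Algebra ℂ L]

theorem exists_homogeneous_numerator {z : Fin n → L} {k : Fin n} (hk : z k ≠ 0) {a : L}
    (ha : a ∈ Algebra.adjoin ℂ (range fun i => z i / z k)) :
    ∃ N, ∀ M, N ≤ M → ∃ G : MvPolynomial (Fin n) ℂ, G.IsHomogeneous M ∧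
      z k ^ M * a = aeval z G := by
  have hX : ∀ M, (X k ^ M : MvPolynomial (Fin n) ℂ).IsHomogeneous M := fun M => by
    simpa using (isHomogeneous_X ℂ k).pow M
  induction ha using Algebra.adjoin_induction with
  | mem q hq =>
    obtain ⟨i, rfl⟩ := hq
    refine ⟨1, fun M hM => ⟨X i * X k ^ (M - 1), ?_, ?_⟩⟩
    · have := (isHomogeneous_X ℂ i).mul (hX (M - 1))
      rwa [add_tsub_cancel_of_le hM] at this
    · obtain ⟨M, rfl⟩ := Nat.exists_eq_add_of_le' hM
      simp only [map_mul, map_pow, aeval_X, add_tsub_cancel_right, pow_succ]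
      field_simp
  | algebraMap r =>
    refine ⟨0, fun M _ => ⟨C r * X k ^ M, ?_, ?_⟩⟩
    · simpa using (isHomogeneous_C _ r).mul (hX M)
    · simp [mul_comm]
  | add p q _ _ hp hq =>
    obtain ⟨N, hN⟩ := hp
    obtain ⟨N', hN'⟩ := hq
    refine ⟨max N N', fun M hM => ?_⟩
    obtain ⟨G, hG, hGp⟩ := hN M (le_of_max_le_left hM)
    obtain ⟨G', hG', hGq⟩ := hN' M (le_of_max_le_right hM)
    exact ⟨G + G', hG.add hG', by rw [mul_add, hGp, hGq, map_add]⟩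
  | mul p q _ _ hp hq =>
    obtain ⟨N, hN⟩ := hp
    obtain ⟨N', hN'⟩ := hq
    refine ⟨N + N', fun M hM => ?_⟩
    obtain ⟨G, hG, hGp⟩ := hN N le_rfl
    obtain ⟨G', hG', hGq⟩ := hN' (M - N) (by omega)
    refine ⟨G * G', ?_, ?_⟩
    · have := hG.mul hG'
      rwa [add_tsub_cancel_of_le (by omega)] at this
    · rw [map_mul, ← hGp, ← hGq]
      have : M = N + (M - N) := by omega
      rw [this, pow_add, add_tsub_cancel_left]
      ring

/-- An element algebraic over the field of ratios satisfies an equation with homogeneous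
coefficients of the same degree. -/
theorem exists_homogeneous_relation {z : Fin n → L} {k : Fin n} (hk : z k ≠ 0) {α : L}
    (hα : IsAlgebraic (Algebra.adjoin ℂ (range fun i => z i / z k)) α) :
    ∃ (N : ℕ) (P : Polynomial (MvPolynomial (Fin n) ℂ)), (∀ i, (P.coeff i).IsHomogeneous N) ∧
      P.map (aeval z : MvPolynomial (Fin n) ℂ →ₐ[ℂ] L).toRingHom ≠ 0 ∧
      P.eval₂ (aeval z : MvPolynomial (Fin n) ℂ →ₐ[ℂ] L).toRingHom α = 0 := by
  obtain ⟨p, hp, hpα⟩ := hα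
  choose N hN using fun i => exists_homogeneous_numerator hk (p.coeff i).2
  let M := ∑ i ∈ Finset.range (p.natDegree + 1), N i
  have hM : ∀ i ∈ Finset.range (p.natDegree + 1), N i ≤ M := fun i hi =>
    Finset.single_le_sum (f := N) (fun _ _ => Nat.zero_le _) hi
  have hG : ∀ i, ∃ G : MvPolynomial (Fin n) ℂ, G.IsHomogeneous M ∧
      z k ^ M * (p.coeff i : L) = aeval z G := by
    intro i
    by_cases hi : i ∈ Finset.range (p.natDegree + 1)
    · exact hN i M (hM i hi)
    · refine ⟨0, isHomogeneous_zero _ _ _, ?_⟩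
      rw [Polynomial.coeff_eq_zero_of_natDegree_lt (by simpa using hi)]
      simp
  choose G hGh hG using hG
  let P : Polynomial (MvPolynomial (Fin n) ℂ) :=
    ∑ i ∈ Finset.range (p.natDegree + 1), Polynomial.monomial i (G i)
  have hPc : ∀ i, P.coeff i = if i ∈ Finset.range (p.natDegree + 1) then G i else 0 := by
    intro i
    simp only [P, Polynomial.finsetSum_coeff, Polynomial.coeff_monomial]
    rw [Finset.sum_ite_eq' (Finset.range (p.natDegree + 1)) i G]
  refine ⟨M, P, fun i => ?_, fun h0 => ?_, ?_⟩
  · rw [hPc]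
    split_ifs
    · exact hGh i
    · exact isHomogeneous_zero _ _ _
  · have h1 := congrArg (fun q => q.coeff p.natDegree) h0
    simp only [Polynomial.coeff_map, hPc, Polynomial.coeff_zero] at h1
    rw [if_pos (by simp)] at h1
    have h2 : aeval z (G p.natDegree) = 0 := h1
    rw [← hG] at h2
    rcases mul_eq_zero.1 h2 with h3 | h3
    · exact hk (eq_zero_of_pow_eq_zero h3)
    · exact hp (Polynomial.leadingCoeff_eq_zero.1 (Subtype.val_injective h3))
  · rw [Polynomial.aeval_eq_sum_range] at hpα
    simp only [P, Polynomial.eval₂_finsetSum, Polynomial.eval₂_monomial]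
    have h1 : ∀ i, (aeval z : MvPolynomial (Fin n) ℂ →ₐ[ℂ] L).toRingHom (G i) * α ^ i =
        z k ^ M * (p.coeff i • α ^ i) := by
      intro i
      change aeval z (G i) * α ^ i = z k ^ M * ((p.coeff i : L) * α ^ i)
      rw [← hG, mul_assoc]
    simp only [h1]
    rw [← Finset.mul_sum, hpα, mul_zero]

/-- The relation can be chosen separable at the given element. -/
theorem exists_separable_relation {A : Type} [CommRing A] [Algebra ℂ A] (V : Submodule ℂ A)
    (φ : A →+* L) {α : L} (P : Polynomial A) (hP : ∀ i, P.coeff i ∈ V) (hP0 : P.map φ ≠ 0)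
    (hPα : P.eval₂ φ α = 0) : ∃ Q : Polynomial A, (∀ i, Q.coeff i ∈ V) ∧ Q.eval₂ φ α = 0 ∧
      Q.derivative.eval₂ φ α ≠ 0 := by
  have : CharZero L := charZero_of_injective_algebraMap (algebraMap ℂ L).injective
  induction h : (P.map φ).natDegree using Nat.strong_induction_on generalizing P with
  | _ d ih =>
  by_cases hd : P.derivative.eval₂ φ α = 0
  · have hdeg : (P.map φ).natDegree ≠ 0 := by
      intro h0
      rw [Polynomial.natDegree_eq_zero] at h0
      obtain ⟨c, hc⟩ := h0
      rw [Polynomial.eval₂_eq_eval_map, ← hc, Polynomial.eval_C] at hPα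
      rw [← hc, hPα, Polynomial.C_0] at hP0
      exact hP0 rfl
    refine ih _ ?_ P.derivative (fun i => ?_) ?_ hd rfl
    · rw [← Polynomial.derivative_map, ← h]
      exact Polynomial.natDegree_derivative_lt hdeg
    · rw [Polynomial.coeff_derivative]
      have h1 : P.coeff (i + 1) * ((i : A) + 1) = ((i + 1 : ℕ) : ℂ) • P.coeff (i + 1) := by
        rw [Nat.cast_smul_eq_nsmul, nsmul_eq_mul, mul_comm]
        push_cast; rfl
      rw [h1]
      exact V.smul_mem _ (hP _)
    · rw [← Polynomial.derivative_map]
      intro h0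
      exact hdeg (Polynomial.derivative_eq_zero.1 h0)
  · exact ⟨P, hP, hPα, hd⟩

end AlgebraicallyClosed

section FieldOfRatios

variable {n : ℕ} {L : Type} [Field L] [Algebra ℂ L] {I : Ideal (MvPolynomial (Fin n) ℂ)} {m : ℕ}
  {x y z : Fin n → L}

theorem Derivation.apply_aeval_polynomial {A K₁ : Type} [CommRing A] [Field K₁] [Algebra ℂ K₁]
    [Algebra A K₁] (E : Derivation ℂ K₁ K₁) (α : K₁) (Q : Polynomial A) :
    E (Polynomial.aeval α Q) = Q.sum (fun i a => E (algebraMap A K₁ a) * α ^ i) +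
      Polynomial.aeval α Q.derivative * E α := by
  induction Q using Polynomial.induction_on' with
  | add p q hp hq =>
    rw [map_add, map_add, hp, hq, Polynomial.sum_add_index _ _ _ (by simp) (by simp [add_mul]),
      Polynomial.derivative_add, map_add]
    ring
  | monomial k a =>
    rw [Polynomial.sum_monomial_index _ _ (by simp), Polynomial.aeval_monomial,
      Derivation.leibniz, Derivation.leibniz_pow, Polynomial.derivative_monomial,
      Polynomial.aeval_monomial]
    simp only [smul_eq_mul, nsmul_eq_mul, map_mul, _root_.map_natCast]
    ring

theorem IsConePair.exists_homogeneous_of_relation (h : IsSmoothCone I m) (hp : IsConePair I m x y)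
    (hmn : m + 3 ≤ n) (hnum : 2 * n ≤ 3 * m + 3) (hz : ∀ i, z i = x i + y i)
    (hinj : Function.Injective (aeval z : MvPolynomial (Fin n) ℂ →ₐ[ℂ] L))
    (K : Type) {K₁ : Type} [Field K] [Field K₁] [Algebra (MvPolynomial (Fin n) ℂ) K]
    [IsFractionRing (MvPolynomial (Fin n) ℂ) K] [Algebra ℂ K₁]
    [Algebra (MvPolynomial (Fin n) ℂ) K₁] [Algebra K K₁]
    [IsScalarTower (MvPolynomial (Fin n) ℂ) K K₁] [IsScalarTower ℂ (MvPolynomial (Fin n) ℂ) K₁]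
    [FiniteDimensional K K₁] (j : K₁ →ₐ[ℂ] L)
    (hj : ∀ i, j (algebraMap (MvPolynomial (Fin n) ℂ) K₁ (X i)) = z i) {α : K₁} {N : ℕ}
    {P : Polynomial (MvPolynomial (Fin n) ℂ)} (hP : ∀ i, (P.coeff i).IsHomogeneous N)
    (hPα : Polynomial.aeval α P = 0) (hPα' : Polynomial.aeval α P.derivative ≠ 0) :
    ∃ G H : MvPolynomial (Fin n) ℂ, G.IsHomogeneous N ∧ H.IsHomogeneous N ∧ H ≠ 0 ∧
      α * algebraMap _ K₁ H = algebraMap _ K₁ G := by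
  have hinj₁ : Function.Injective (algebraMap (MvPolynomial (Fin n) ℂ) K₁) := by
    rw [IsScalarTower.algebraMap_eq (MvPolynomial (Fin n) ℂ) K K₁]
    exact (algebraMap K K₁).injective.comp (IsFractionRing.injective _ K)
  have hfs : FaithfulSMul (MvPolynomial (Fin n) ℂ) K₁ :=
    (faithfulSMul_iff_algebraMap_injective _ _).2 hinj₁
  have halg : Algebra.IsAlgebraic (MvPolynomial (Fin n) ℂ) K₁ :=
    (IsFractionRing.comap_isAlgebraic_iff (A := MvPolynomial (Fin n) ℂ) (K := K)).2 inferInstance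
  have hex : ∀ i : Fin n, ∃ D : Derivation ℂ K₁ K₁, ∀ a : MvPolynomial (Fin n) ℂ,
      D (algebraMap _ K₁ a) = algebraMap _ K₁ (pderiv i a) := fun i =>
    Derivation.exists_extend ((Algebra.linearMap (MvPolynomial (Fin n) ℂ) K₁).compDer (pderiv i))
  choose D hD using hex
  have hintg : ∀ i β, IsIntegral (MvPolynomial (Fin n) ℂ) β →
      IsIntegral (MvPolynomial (Fin n) ℂ) (D i β) := fun i β hβ =>
    hp.isIntegral_derivation h hmn hnum hz hinj K j hj (D i) (fun a => ⟨_, (hD i a).symm⟩) hβ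
  let E : Derivation ℂ K₁ K₁ := ∑ i, algebraMap (MvPolynomial (Fin n) ℂ) K₁ (X i) • D i
  have hE : ∀ β, E β = ∑ i, algebraMap (MvPolynomial (Fin n) ℂ) K₁ (X i) * D i β := by
    intro β
    change Derivation.coeFnAddMonoidHom E β = _
    rw [map_sum, Finset.sum_apply]
    rfl
  have hEhom : ∀ G : MvPolynomial (Fin n) ℂ, G.IsHomogeneous N →
      E (algebraMap _ K₁ G) = N * algebraMap _ K₁ G := by
    intro G hG
    rw [hE]
    simp only [hD, ← map_mul, ← map_sum]
    rw [hG.sum_X_mul_pderiv, map_nsmul, nsmul_eq_mul]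
  have hEα : E α = 0 := by
    have h1 : E (Polynomial.aeval α P) =
        N * Polynomial.aeval α P + Polynomial.aeval α P.derivative * E α := by
      rw [E.apply_aeval_polynomial, Polynomial.aeval_def α P, Polynomial.eval₂_eq_sum,
        Polynomial.sum_def, Polynomial.sum_def, Finset.mul_sum]
      congr 1
      exact Finset.sum_congr rfl fun i _ => by rw [hEhom _ (hP i), mul_assoc]
    rw [hPα, map_zero, mul_zero, zero_add] at h1
    exact (mul_eq_zero.1 h1.symm).resolve_left hPα'
  have hlc : IsIntegral (MvPolynomial (Fin n) ℂ) (P.leadingCoeff • α) :=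
    isIntegral_leadingCoeff_smul P α hPα
  have hP0 : P ≠ 0 := by rintro rfl; simp at hPα'
  obtain ⟨G, hG, hGα⟩ := Derivation.exists_homogeneous_of_euler hinj₁ D (fun i j => by
      rw [hD, pderiv_X, Pi.single_apply]
      split_ifs with h1 h2 h2
      · simp
      · exact absurd h1.symm h2
      · exact absurd h2.symm h1
      · simp) hintg N hlc (by
    rw [← hE, Algebra.smul_def, Derivation.leibniz, hEα, smul_zero, zero_add, smul_eq_mul,
      hEhom P.leadingCoeff (hP _)]
    ring)
  refine ⟨G, P.leadingCoeff, hG, hP _, Polynomial.leadingCoeff_ne_zero.2 hP0, ?_⟩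
  rw [← hGα, Algebra.smul_def, mul_comm]

/-- The field of ratios of the sums `z = x + y` is algebraically closed in the function field. -/
theorem IsConePair.exists_ratio (h : IsSmoothCone I m) (hp : IsConePair I m x y)
    (hmn : m + 3 ≤ n) (hnum : 2 * n ≤ 3 * m + 3) (hz : ∀ i, z i = x i + y i)
    (hinj : Function.Injective (aeval z : MvPolynomial (Fin n) ℂ →ₐ[ℂ] L)) {k : Fin n} {α : L}
    (hα : IsAlgebraic (Algebra.adjoin ℂ (range fun i => z i / z k)) α) :
    ∃ N, ∃ G H : MvPolynomial (Fin n) ℂ, G.IsHomogeneous N ∧ H.IsHomogeneous N ∧ H ≠ 0 ∧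
      α * aeval z H = aeval z G := by
  have hk : z k ≠ 0 := fun h0 => X_ne_zero (R := ℂ) k (hinj (by simpa using h0))
  obtain ⟨N, P₀, hP₀, hP₀0, hP₀α⟩ := exists_homogeneous_relation hk hα
  obtain ⟨P, hP, hPα, hPα'⟩ := exists_separable_relation (homogeneousSubmodule (Fin n) ℂ N) _ P₀
    hP₀ hP₀0 hP₀α
  let _ : Algebra (MvPolynomial (Fin n) ℂ) L :=
    (aeval z : MvPolynomial (Fin n) ℂ →ₐ[ℂ] L).toRingHom.toAlgebra
  have hAL : ∀ a, algebraMap (MvPolynomial (Fin n) ℂ) L a = aeval z a := fun a => rfl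
  have : IsScalarTower ℂ (MvPolynomial (Fin n) ℂ) L := IsScalarTower.of_algebraMap_eq fun r => by
    rw [hAL]; simp
  have : FaithfulSMul (MvPolynomial (Fin n) ℂ) L :=
    (faithfulSMul_iff_algebraMap_injective _ _).2 hinj
  let _ := FractionRing.liftAlgebra (MvPolynomial (Fin n) ℂ) L
  have := FractionRing.isScalarTower_liftAlgebra (MvPolynomial (Fin n) ℂ) L
  have hPα1 : Polynomial.aeval α P = 0 := hPα
  have hP0 : P ≠ 0 := by rintro rfl; simp at hPα'
  have hαint : IsIntegral (FractionRing (MvPolynomial (Fin n) ℂ)) α := by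
    have h1 : IsAlgebraic (MvPolynomial (Fin n) ℂ) α := ⟨P, hP0, hPα1⟩
    exact (h1.extendScalars (IsFractionRing.injective _ _)).isIntegral
  let K₁ := IntermediateField.adjoin (FractionRing (MvPolynomial (Fin n) ℂ)) {α}
  have : FiniteDimensional (FractionRing (MvPolynomial (Fin n) ℂ)) K₁ :=
    IntermediateField.adjoin.finiteDimensional hαint
  have : IsScalarTower ℂ (FractionRing (MvPolynomial (Fin n) ℂ)) L :=
    IsScalarTower.of_algebraMap_eq fun r => by
      rw [IsScalarTower.algebraMap_apply ℂ (MvPolynomial (Fin n) ℂ) L,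
        IsScalarTower.algebraMap_apply (MvPolynomial (Fin n) ℂ)
          (FractionRing (MvPolynomial (Fin n) ℂ)) L]
      rfl
  have : IsScalarTower ℂ (MvPolynomial (Fin n) ℂ) K₁ :=
    IsScalarTower.of_algebraMap_eq fun r => Subtype.val_injective
      (IsScalarTower.algebraMap_apply ℂ (MvPolynomial (Fin n) ℂ) L r)
  let j : K₁ →ₐ[ℂ] L := K₁.val.restrictScalars ℂ
  let α₁ : K₁ := ⟨α, IntermediateField.mem_adjoin_simple_self _ α⟩
  have hev : ∀ Q : Polynomial (MvPolynomial (Fin n) ℂ), j (Polynomial.aeval α₁ Q) =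
      Polynomial.aeval α Q := fun Q => by
    exact (Polynomial.aeval_algHom_apply (K₁.val.restrictScalars (MvPolynomial (Fin n) ℂ)) α₁ Q).symm
  obtain ⟨G, H, hG, hH, hH0, hGH⟩ := hp.exists_homogeneous_of_relation h hmn hnum hz hinj
    (FractionRing (MvPolynomial (Fin n) ℂ)) (K₁ := K₁) j (fun i => by
      change algebraMap (MvPolynomial (Fin n) ℂ) L (X i) = z i
      rw [hAL, aeval_X]) (α := α₁) hP
    (Subtype.val_injective ((hev P).trans hPα1)) (fun h0 => hPα' (by
      have := congrArg j h0
      rw [hev, map_zero] at this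
      exact this))
  exact ⟨N, G, H, hG, hH, hH0, congrArg j hGH⟩

end FieldOfRatios

section Spreading

/-- A system of polynomial equations over a domain without solutions in finite extensions of its
fraction field has no solutions over the generic complex point. -/
theorem exists_solution_or_exists_ne_zero {A : Type} (K : Type) [CommRing A] [IsDomain A] [Field K]
    [Algebra A K] [IsFractionRing A K] {σ : Type} [Finite σ] (S : Set (MvPolynomial σ A)) :
    (∃ (E : Type) (_ : Field E) (_ : Algebra K E), FiniteDimensional K E ∧
      ∃ s : σ → E, ∀ f ∈ S, eval₂ ((algebraMap K E).comp (algebraMap A K)) s f = 0) ∨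
    ∃ e : A, e ≠ 0 ∧ ∀ φ : A →+* ℂ, φ e ≠ 0 → ∀ s : σ → ℂ, ∃ f ∈ S, eval₂ φ s f ≠ 0 := by
  let _ : Algebra (MvPolynomial σ A) (MvPolynomial σ K) := algebraMvPolynomial
  by_cases hJ : ∃ e : A, e ≠ 0 ∧ C e ∈ Ideal.span S
  · obtain ⟨e, he, heJ⟩ := hJ
    refine Or.inr ⟨e, he, fun φ hφ s => ?_⟩
    by_contra! hcon
    have h1 : Ideal.span S ≤ RingHom.ker (eval₂Hom φ s) := Ideal.span_le.2 hcon
    have h2 := h1 heJ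
    rw [RingHom.mem_ker, eval₂Hom_C] at h2
    exact hφ h2
  · left
    push Not at hJ
    have hne : (Ideal.span S).map (algebraMap (MvPolynomial σ A) (MvPolynomial σ K)) ≠ ⊤ := by
      rw [IsLocalization.map_algebraMap_ne_top_iff_disjoint
        ((nonZeroDivisors A).map (C (σ := σ) (R := A))) (MvPolynomial σ K)]
      rw [Set.disjoint_left]
      rintro _ ⟨e, he, rfl⟩ hmem
      exact hJ e (nonZeroDivisors.ne_zero he) hmem
    obtain ⟨M, hM, hle⟩ := Ideal.exists_le_maximal _ hne
    let fM := Ideal.Quotient.field M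
    have hfin : Module.Finite K (MvPolynomial σ K ⧸ M) :=
      finite_of_finite_type_of_isJacobsonRing K (MvPolynomial σ K ⧸ M)
    refine ⟨MvPolynomial σ K ⧸ M, fM, inferInstance, hfin,
      fun i => Ideal.Quotient.mk M (X i), fun f hf => ?_⟩
    have h1 : eval₂Hom ((algebraMap K (MvPolynomial σ K ⧸ M)).comp (algebraMap A K))
        (fun i => Ideal.Quotient.mk M (X i)) =
        (Ideal.Quotient.mk M).comp (algebraMap (MvPolynomial σ A) (MvPolynomial σ K)) := by
      apply MvPolynomial.ringHom_ext
      · intro r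
        simp
        rfl
      · intro i
        simp
    refine (DFunLike.congr_fun h1 f).trans ?_
    exact Ideal.Quotient.eq_zero_iff_mem.2 (hle (Ideal.mem_map_of_mem _ (Ideal.subset_span hf)))

variable {N : ℕ}

/-- Exponents bounded by `M` in each variable. -/
def boundedExponents (N M : ℕ) : Finset (Fin N →₀ ℕ) :=
  Finset.Iic (Finsupp.equivFunOnFinite.symm fun _ => M)

theorem support_subset_boundedExponents {R : Type} [CommRing R] {Q : MvPolynomial (Fin N) R} {M : ℕ}
    (hQ : Q.totalDegree ≤ M) : Q.support ⊆ boundedExponents N M := by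
  intro μ hμ
  rw [boundedExponents, Finset.mem_Iic]
  intro i
  refine le_trans ?_ ((le_totalDegree hμ).trans hQ)
  by_cases hi : μ i = 0
  · rw [hi]; exact Nat.zero_le _
  · exact Finset.single_le_sum (f := fun i => μ i) (fun _ _ => Nat.zero_le _)
      (Finsupp.mem_support_iff.2 hi)

theorem totalDegree_map_le_totalDegree {R R' : Type} [CommRing R] [CommRing R'] (φ : R →+* R')
    (P : MvPolynomial (Fin N) R) : (map φ P).totalDegree ≤ P.totalDegree :=
  Finset.sup_mono (support_map_subset φ P)

theorem exists_finset_support_subset (N M : ℕ) : ∃ T : Finset (Fin N →₀ ℕ),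
    ∀ Q : MvPolynomial (Fin N) ℂ, Q.totalDegree ≤ M → Q.support ⊆ T :=
  ⟨boundedExponents N M, fun _ hQ => support_subset_boundedExponents hQ⟩

/-- The polynomial with prescribed coefficients. -/
def polyOfCoeffs {R : Type} [CommRing R] {T : Finset (Fin N →₀ ℕ)} (c : T → R) :
    MvPolynomial (Fin N) R := ∑ μ : T, monomial (μ : Fin N →₀ ℕ) (c μ)

theorem map_polyOfCoeffs {R R' : Type} [CommRing R] [CommRing R'] {T : Finset (Fin N →₀ ℕ)}
    (f : R →+* R') (c : T → R) :
    map f (polyOfCoeffs c) = polyOfCoeffs fun μ => f (c μ) := by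
  simp [polyOfCoeffs, map_monomial]

theorem coeff_polyOfCoeffs {R : Type} [CommRing R] {T : Finset (Fin N →₀ ℕ)} (c : T → R) (μ : T) :
    coeff (μ : Fin N →₀ ℕ) (polyOfCoeffs c) = c μ := by
  classical
  rw [polyOfCoeffs, coeff_sum, Finset.sum_eq_single μ]
  · simp
  · intro ν _ hν
    rw [coeff_monomial, if_neg fun h => hν (Subtype.val_injective h)]
  · simp

theorem polyOfCoeffs_coeff {R : Type} [CommRing R] {T : Finset (Fin N →₀ ℕ)}
    {Q : MvPolynomial (Fin N) R} (hQ : Q.support ⊆ T) :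
    polyOfCoeffs (fun μ : T => coeff (μ : Fin N →₀ ℕ) Q) = Q := by
  rw [polyOfCoeffs, Finset.sum_coe_sort T (fun μ => monomial μ (coeff μ Q))]
  conv_rhs => rw [Q.as_sum]
  refine (Finset.sum_subset hQ fun μ _ hμ => ?_).symm
  rw [notMem_support_iff.1 hμ, monomial_zero]

theorem coeff_map_eq_eval₂ {A E : Type} [CommRing A] [CommRing E] {σ : Type} (φ : A →+* E)
    (s : σ → E) (Q : MvPolynomial (Fin N) (MvPolynomial σ A)) (ν : Fin N →₀ ℕ) :
    eval₂ φ s (coeff ν Q) = coeff ν (map (eval₂Hom φ s) Q) := by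
  rw [coeff_map]; rfl

theorem map_eval₂Hom_map_C {A E : Type} [CommRing A] [CommRing E] {σ : Type} (φ : A →+* E)
    (s : σ → E) (P : MvPolynomial (Fin N) A) :
    map (eval₂Hom φ s) (map (C : A →+* MvPolynomial σ A) P) = map φ P := by
  rw [map_map]
  congr 2
  ext r
  simp

variable {A : Type} (K : Type) [CommRing A] [IsDomain A] [Field K] [Algebra A K]
  [IsFractionRing A K]

/-- Factorizations with prescribed nonzero coefficients do not appear generically unless they exist
over a finite extension. -/
theorem exists_ne_zero_of_no_factorization (P : MvPolynomial (Fin N) A)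
    {T : Finset (Fin N →₀ ℕ)} (μ₁ μ₂ : T)
    (hP : ∀ (E : Type) [Field E] [Algebra K E] [FiniteDimensional K E]
      (Q₁ Q₂ : MvPolynomial (Fin N) E),
      Q₁ * Q₂ = map ((algebraMap K E).comp (algebraMap A K)) P →
      coeff (μ₁ : Fin N →₀ ℕ) Q₁ = 0 ∨ coeff (μ₂ : Fin N →₀ ℕ) Q₂ = 0) :
    ∃ e : A, e ≠ 0 ∧ ∀ φ : A →+* ℂ, φ e ≠ 0 → ∀ Q₁ Q₂ : MvPolynomial (Fin N) ℂ,
      Q₁.support ⊆ T → Q₂.support ⊆ T → Q₁ * Q₂ = map φ P →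
      coeff (μ₁ : Fin N →₀ ℕ) Q₁ = 0 ∨ coeff (μ₂ : Fin N →₀ ℕ) Q₂ = 0 := by
  let σ := (T ⊕ T) ⊕ Bool
  let G₁ : MvPolynomial (Fin N) (MvPolynomial σ A) := polyOfCoeffs fun μ : T => X (Sum.inl (Sum.inl μ))
  let G₂ : MvPolynomial (Fin N) (MvPolynomial σ A) := polyOfCoeffs fun μ : T => X (Sum.inl (Sum.inr μ))
  let w₁ : MvPolynomial σ A := X (Sum.inl (Sum.inl μ₁)) * X (Sum.inr true) - 1
  let w₂ : MvPolynomial σ A := X (Sum.inl (Sum.inr μ₂)) * X (Sum.inr false) - 1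
  let S : Set (MvPolynomial σ A) := range (fun ν => coeff ν (G₁ * G₂ - map C P)) ∪ {w₁, w₂}
  have hmap : ∀ {E : Type} [CommRing E] (φ : A →+* E) (s : σ → E),
      map (eval₂Hom φ s) (G₁ * G₂ - map C P) =
        polyOfCoeffs (fun μ : T => s (Sum.inl (Sum.inl μ))) *
          polyOfCoeffs (fun μ : T => s (Sum.inl (Sum.inr μ))) - map φ P := by
    intro E _ φ s
    rw [map_sub, map_mul, map_eval₂Hom_map_C, map_polyOfCoeffs, map_polyOfCoeffs]
    simp only [eval₂Hom_X']
  rcases exists_solution_or_exists_ne_zero K S with ⟨E, _, _, _, s, hs⟩ | ⟨e, he, hes⟩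
  · exfalso
    have h1 := hmap ((algebraMap K E).comp (algebraMap A K)) s
    have h2 : map (eval₂Hom ((algebraMap K E).comp (algebraMap A K)) s) (G₁ * G₂ - map C P) = 0 := by
      ext ν
      rw [← coeff_map_eq_eval₂, coeff_zero]
      exact hs _ (Or.inl ⟨ν, rfl⟩)
    rw [h2] at h1
    have hw₁ := hs w₁ (Or.inr (Or.inl rfl))
    have hw₂ := hs w₂ (Or.inr (Or.inr rfl))
    simp only [w₁, w₂, eval₂_sub, eval₂_mul, eval₂_X, eval₂_one, sub_eq_zero] at hw₁ hw₂
    rcases hP E _ _ (sub_eq_zero.1 h1.symm) with h3 | h3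
    · rw [coeff_polyOfCoeffs] at h3
      rw [h3, zero_mul] at hw₁
      exact zero_ne_one hw₁
    · rw [coeff_polyOfCoeffs] at h3
      rw [h3, zero_mul] at hw₂
      exact zero_ne_one hw₂
  · refine ⟨e, he, fun φ hφ Q₁ Q₂ hQ₁ hQ₂ hQ => ?_⟩
    by_contra! hcon
    let s : σ → ℂ := Sum.elim (Sum.elim (fun μ => coeff (μ : Fin N →₀ ℕ) Q₁)
      (fun μ => coeff (μ : Fin N →₀ ℕ) Q₂))
      (fun b => if b then (coeff (μ₁ : Fin N →₀ ℕ) Q₁)⁻¹ else (coeff (μ₂ : Fin N →₀ ℕ) Q₂)⁻¹)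
    obtain ⟨f, hf, hfs⟩ := hes φ hφ s
    apply hfs
    rcases hf with ⟨ν, rfl⟩ | rfl | rfl
    · change eval₂ φ s (coeff ν (G₁ * G₂ - map C P)) = 0
      rw [coeff_map_eq_eval₂, hmap]
      simp only [s, Sum.elim_inl, Sum.elim_inr]
      rw [polyOfCoeffs_coeff hQ₁, polyOfCoeffs_coeff hQ₂, hQ, sub_self, coeff_zero]
    · simp [w₁, s, hcon.1]
    · simp [w₂, s, hcon.2]

theorem MvPolynomial.exists_coeff_ne_zero_of_not_isUnit {F : Type} [Field F]
    {Q : MvPolynomial (Fin N) F} (hQ0 : Q ≠ 0) (hQ : ¬ IsUnit Q) : ∃ μ, μ ≠ 0 ∧ coeff μ Q ≠ 0 := by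
  classical
  by_contra! hcon
  have h1 : Q = C (coeff 0 Q) := by
    ext μ
    rw [coeff_C]
    split_ifs with h
    · rw [← h]
    · exact hcon μ (Ne.symm h)
  have h2 : coeff 0 Q ≠ 0 := fun h0 => hQ0 (by rw [h1, h0, C_0])
  exact hQ (by rw [h1]; exact (isUnit_iff_ne_zero.2 h2).map C)

/-- Generic irreducibility of the specializations of an absolutely irreducible polynomial. -/
theorem exists_irreducible_specialization (P : MvPolynomial (Fin N) A)
    (hP0 : ∃ μ, μ ≠ 0 ∧ coeff μ P ≠ 0)
    (hP : ∀ (E : Type) [Field E] [Algebra K E] [FiniteDimensional K E]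
      (Q₁ Q₂ : MvPolynomial (Fin N) E),
      Q₁ * Q₂ = map ((algebraMap K E).comp (algebraMap A K)) P → IsUnit Q₁ ∨ IsUnit Q₂) :
    ∃ e : A, e ≠ 0 ∧ ∀ φ : A →+* ℂ, φ e ≠ 0 → Irreducible (map φ P) := by
  classical
  obtain ⟨μ₀, hμ₀, hcμ₀⟩ := hP0
  obtain ⟨T, hT⟩ := exists_finset_support_subset N P.totalDegree
  have hunit : ∀ {F : Type} [Field F] {Q : MvPolynomial (Fin N) F} {μ : Fin N →₀ ℕ}, μ ≠ 0 →
      IsUnit Q → coeff μ Q = 0 := by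
    intro F _ Q μ hμ hQ
    obtain ⟨r, -, hr⟩ := MvPolynomial.isUnit_iff_eq_C_of_isReduced.1 hQ
    rw [hr, coeff_C, if_neg hμ.symm]
  have hpair : ∀ μ : T × T, ∃ e : A, e ≠ 0 ∧ ((μ.1 : Fin N →₀ ℕ) ≠ 0 → (μ.2 : Fin N →₀ ℕ) ≠ 0 →
      ∀ φ : A →+* ℂ, φ e ≠ 0 → ∀ Q₁ Q₂ : MvPolynomial (Fin N) ℂ,
      Q₁.support ⊆ T → Q₂.support ⊆ T → Q₁ * Q₂ = map φ P →
      coeff (μ.1 : Fin N →₀ ℕ) Q₁ = 0 ∨ coeff (μ.2 : Fin N →₀ ℕ) Q₂ = 0) := by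
    intro μ
    by_cases h : (μ.1 : Fin N →₀ ℕ) ≠ 0 ∧ (μ.2 : Fin N →₀ ℕ) ≠ 0
    · obtain ⟨e, he, h2⟩ := exists_ne_zero_of_no_factorization K P μ.1 μ.2
        (fun E _ _ _ Q₁ Q₂ hQ => (hP E Q₁ Q₂ hQ).imp (hunit h.1) (hunit h.2))
      exact ⟨e, he, fun _ _ => h2⟩
    · exact ⟨1, one_ne_zero, fun h1 h2 => absurd ⟨h1, h2⟩ h⟩
  choose e he hes using hpair
  refine ⟨coeff μ₀ P * ∏ μ, e μ, mul_ne_zero hcμ₀ (Finset.prod_ne_zero_iff.2 fun μ _ => he μ),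
    fun φ hφ => ?_⟩
  rw [map_mul, map_prod] at hφ
  have hcoef : coeff μ₀ (map φ P) ≠ 0 := by rw [coeff_map]; exact left_ne_zero_of_mul hφ
  have hne : map φ P ≠ 0 := fun h0 => hcoef (by rw [h0, coeff_zero])
  refine ⟨fun hu => hcoef (hunit hμ₀ hu), fun Q₁ Q₂ hQ => ?_⟩
  by_contra! hcon
  have hQ₁ : Q₁ ≠ 0 := by rintro rfl; exact hne (by rw [hQ, zero_mul])
  have hQ₂ : Q₂ ≠ 0 := by rintro rfl; exact hne (by rw [hQ, mul_zero])
  obtain ⟨μ₁, hμ₁, hc₁⟩ := exists_coeff_ne_zero_of_not_isUnit hQ₁ hcon.1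
  obtain ⟨μ₂, hμ₂, hc₂⟩ := exists_coeff_ne_zero_of_not_isUnit hQ₂ hcon.2
  have hdeg : (map φ P).totalDegree ≤ P.totalDegree := totalDegree_map_le_totalDegree φ P
  have hs₁ : Q₁.support ⊆ T := hT _
    ((totalDegree_le_of_dvd_of_isDomain ⟨Q₂, hQ⟩ hne).trans hdeg)
  have hs₂ : Q₂.support ⊆ T := hT _
    ((totalDegree_le_of_dvd_of_isDomain ⟨Q₁, by rw [hQ, mul_comm]⟩ hne).trans hdeg)
  have h1 := hes (⟨μ₁, hs₁ (mem_support_iff.2 hc₁)⟩, ⟨μ₂, hs₂ (mem_support_iff.2 hc₂)⟩) hμ₁ hμ₂ φ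
    (Finset.prod_ne_zero_iff.1 (right_ne_zero_of_mul hφ) _ (Finset.mem_univ _)) Q₁ Q₂ hs₁ hs₂ hQ.symm
  exact h1.elim hc₁ hc₂

/-- Generic persistence of non-divisibility. -/
theorem exists_not_dvd_specialization (P c : MvPolynomial (Fin N) A)
    (hP : ∀ (E : Type) [Field E] [Algebra K E] [FiniteDimensional K E],
      ¬ map ((algebraMap K E).comp (algebraMap A K)) P ∣
        map ((algebraMap K E).comp (algebraMap A K)) c) :
    ∃ e : A, e ≠ 0 ∧ ∀ φ : A →+* ℂ, φ e ≠ 0 → ¬ map φ P ∣ map φ c := by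
  classical
  obtain ⟨T, hT⟩ := exists_finset_support_subset N c.totalDegree
  let G : MvPolynomial (Fin N) (MvPolynomial T A) := polyOfCoeffs fun μ : T => X μ
  let S : Set (MvPolynomial T A) := range (fun ν => coeff ν (map C P * G - map C c))
  have hmap : ∀ {E : Type} [CommRing E] (φ : A →+* E) (s : T → E),
      map (eval₂Hom φ s) (map C P * G - map C c) = map φ P * polyOfCoeffs s - map φ c := by
    intro E _ φ s
    rw [map_sub, map_mul, map_eval₂Hom_map_C, map_eval₂Hom_map_C, map_polyOfCoeffs]
    simp only [eval₂Hom_X']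
  have hc0 : c ≠ 0 := by
    rintro rfl
    exact hP K (by rw [map_zero]; exact dvd_zero _)
  obtain ⟨μ₀, hμ₀⟩ := MvPolynomial.ne_zero_iff.1 hc0
  rcases exists_solution_or_exists_ne_zero K S with ⟨E, _, _, _, s, hs⟩ | ⟨e, he, hes⟩
  · exfalso
    refine hP E ⟨polyOfCoeffs s, ?_⟩
    rw [eq_comm, ← sub_eq_zero, ← hmap]
    ext ν
    rw [← coeff_map_eq_eval₂, coeff_zero]
    exact hs _ ⟨ν, rfl⟩
  · refine ⟨e * coeff μ₀ c, mul_ne_zero he hμ₀, fun φ hφ => ?_⟩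
    rintro ⟨Q, hQ⟩
    rw [map_mul] at hφ
    have hne : map φ c ≠ 0 := fun h0 => right_ne_zero_of_mul hφ (by rw [← coeff_map, h0, coeff_zero])
    have hs : Q.support ⊆ T := hT _
      ((totalDegree_le_of_dvd_of_isDomain ⟨map φ P, by rw [hQ, mul_comm]⟩ hne).trans
        (totalDegree_map_le_totalDegree φ c))
    obtain ⟨f, ⟨ν, rfl⟩, hfs⟩ := hes φ (left_ne_zero_of_mul hφ)
      (fun μ => coeff (μ : Fin N →₀ ℕ) Q)
    apply hfs
    change eval₂ φ _ (coeff ν (map C P * G - map C c)) = 0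
    rw [coeff_map_eq_eval₂, hmap, polyOfCoeffs_coeff hs, hQ, sub_self, coeff_zero]

end Spreading

section AbsoluteIrreducibility

variable {K L : Type} [Field K] [Field L] [Algebra K L]

/-- If `K` is algebraically closed in `L`, finite extensions of `K` are linearly disjoint from
`L`. -/
theorem linearIndependent_powerBasis_of_algebraicallyClosed
    (hcl : ∀ α : L, IsIntegral K α → α ∈ (algebraMap K L).range) {E Ω : Type} [Field E] [Algebra K E]
    [Field Ω] [Algebra K Ω] [Algebra L Ω] [IsScalarTower K L Ω] (pb : PowerBasis K E)
    (j : E →ₐ[K] Ω) : LinearIndependent L fun i => j (pb.basis i) := by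
  have hintg : IsIntegral K (j pb.gen) := pb.isIntegral_gen.map j
  have hdvd : minpoly L (j pb.gen) ∣ (minpoly K (j pb.gen)).map (algebraMap K L) :=
    minpoly.dvd_map_of_isScalarTower K L _
  have hcoeff : ∀ i, (minpoly L (j pb.gen)).coeff i ∈ (algebraMap K L).range := fun i =>
    hcl _ (Polynomial.isIntegral_coeff_of_dvd _ _ (minpoly.monic hintg)
      (minpoly.monic hintg.tower_top) hdvd i)
  obtain ⟨q, hq⟩ : ∃ q : Polynomial K, q.map (algebraMap K L) = minpoly L (j pb.gen) :=
    (Polynomial.mem_lifts _).1 ((Polynomial.lifts_iff_coeff_lifts _).2 hcoeff)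
  have hq0 : Polynomial.aeval (j pb.gen) q = 0 := by
    rw [← Polynomial.aeval_map_algebraMap L, hq, minpoly.aeval]
  have hqne : q ≠ 0 := by
    rintro rfl
    rw [Polynomial.map_zero] at hq
    exact minpoly.ne_zero hintg.tower_top hq.symm
  have hle : (minpoly K (j pb.gen)).natDegree ≤ (minpoly L (j pb.gen)).natDegree := by
    rw [← hq, Polynomial.natDegree_map]
    exact Polynomial.natDegree_le_of_dvd (minpoly.dvd K _ hq0) hqne
  have hdim : pb.dim ≤ (minpoly L (j pb.gen)).natDegree := by
    rw [← pb.natDegree_minpoly, ← minpoly.algHom_eq j j.injective pb.gen]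
    exact hle
  have h1 := (linearIndependent_pow (K := L) (j pb.gen)).comp (Fin.castLE hdim)
    (Fin.castLE_injective hdim)
  convert h1 using 2 with i
  simp [pb.basis_eq_pow]

theorem MvPolynomial.exists_eq_sum_basis {E ι σ : Type} [Field E] [Algebra K E] [Fintype ι]
    (b : Module.Basis ι K E) (Q : MvPolynomial σ E) :
    ∃ q : ι → MvPolynomial σ K, Q = ∑ i, C (b i) * map (algebraMap K E) (q i) := by
  induction Q using MvPolynomial.induction_on with
  | C a =>
    refine ⟨fun i => C (b.repr a i), ?_⟩
    conv_lhs => rw [← b.sum_repr a]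
    simp only [map_sum, Algebra.smul_def, map_mul, map_C, mul_comm]
  | add p q hp hq =>
    obtain ⟨p', hp'⟩ := hp
    obtain ⟨q', hq'⟩ := hq
    refine ⟨fun i => p' i + q' i, ?_⟩
    conv_lhs => rw [hp', hq']
    simp only [map_add, mul_add, Finset.sum_add_distrib]
  | mul_X p i hp =>
    obtain ⟨p', hp'⟩ := hp
    refine ⟨fun k => p' k * X i, ?_⟩
    conv_lhs => rw [hp']
    simp only [map_mul, map_X, Finset.sum_mul, mul_assoc]

variable {N : ℕ} {u : Fin N → L} {P : MvPolynomial (Fin N) K}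

theorem map_dvd_of_eval₂_eq_zero [CharZero K]
    (hcl : ∀ α : L, IsIntegral K α → α ∈ (algebraMap K L).range)
    (hP : ∀ Q, aeval u Q = 0 → P ∣ Q) {E Ω : Type} [Field E] [Algebra K E] [FiniteDimensional K E]
    [Field Ω] [Algebra K Ω] [Algebra L Ω] [IsScalarTower K L Ω] (j : E →ₐ[K] Ω)
    {Q : MvPolynomial (Fin N) E}
    (hQ : eval₂ (j : E →+* Ω) (fun i => algebraMap L Ω (u i)) Q = 0) :
    map (algebraMap K E) P ∣ Q := by
  let pb := Field.powerBasisOfFiniteOfSeparable K E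
  obtain ⟨q, hq⟩ := MvPolynomial.exists_eq_sum_basis pb.basis Q
  have hev : ∀ i, eval₂ (j : E →+* Ω) (fun i => algebraMap L Ω (u i)) (map (algebraMap K E) (q i)) =
      algebraMap L Ω (aeval u (q i)) := by
    intro i
    rw [eval₂_map, ← IsScalarTower.toAlgHom_apply K L Ω, comp_aeval_apply, aeval_def]
    congr 1
    ext r
    simp
  have h1 : ∑ i, aeval u (q i) • j (pb.basis i) = 0 := by
    rw [← hQ]
    conv_rhs => rw [hq]
    rw [eval₂_sum]
    refine Finset.sum_congr rfl fun i _ => ?_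
    rw [eval₂_mul, eval₂_C, hev, Algebra.smul_def, mul_comm]
    rfl
  have h2 := Fintype.linearIndependent_iff.1
    (linearIndependent_powerBasis_of_algebraicallyClosed hcl pb j) _ h1
  rw [hq]
  refine Finset.dvd_sum fun i _ => Dvd.dvd.mul_left ?_ _
  exact _root_.map_dvd (map (algebraMap K E)) (hP _ (h2 i))

/-- The polynomial relation of a system of generators of `L` is absolutely irreducible if `K` is
algebraically closed in `L`. -/
theorem isUnit_or_isUnit_of_mul_eq_map [CharZero K]
    (hcl : ∀ α : L, IsIntegral K α → α ∈ (algebraMap K L).range) (hP0 : P ≠ 0)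
    (hPu : aeval u P = 0) (hP : ∀ Q, aeval u Q = 0 → P ∣ Q) {E : Type} [Field E] [Algebra K E]
    [FiniteDimensional K E] {Q₁ Q₂ : MvPolynomial (Fin N) E}
    (hQ : Q₁ * Q₂ = map (algebraMap K E) P) : IsUnit Q₁ ∨ IsUnit Q₂ := by
  let j : E →ₐ[K] AlgebraicClosure L := IsAlgClosed.lift
  have hmul : eval₂ (j : E →+* AlgebraicClosure L) (fun i => algebraMap L _ (u i)) (Q₁ * Q₂) = 0 := by
    rw [hQ, eval₂_map]
    have h1 : algebraMap L (AlgebraicClosure L) (aeval u P) = 0 := by rw [hPu, map_zero]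
    rw [← h1, ← IsScalarTower.toAlgHom_apply K L (AlgebraicClosure L), comp_aeval_apply, aeval_def]
    congr 1
    ext r
    simp
  have hPE : map (algebraMap K E) P ≠ 0 := fun h0 =>
    hP0 (MvPolynomial.map_injective _ (algebraMap K E).injective (by rw [h0, map_zero]))
  rw [eval₂_mul] at hmul
  rcases mul_eq_zero.1 hmul with h | h
  · obtain ⟨R, hR⟩ := map_dvd_of_eval₂_eq_zero hcl hP j h
    right
    refine IsUnit.of_mul_eq_one R (mul_left_cancel₀ hPE ?_)
    linear_combination hQ - Q₂ * hR
  · obtain ⟨R, hR⟩ := map_dvd_of_eval₂_eq_zero hcl hP j h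
    left
    refine IsUnit.of_mul_eq_one R (mul_left_cancel₀ hPE ?_)
    linear_combination hQ - Q₁ * hR

theorem not_map_dvd_map {c : MvPolynomial (Fin N) K} (hPu : aeval u P = 0) (hc : aeval u c ≠ 0)
    {E : Type} [Field E] [Algebra K E] [FiniteDimensional K E] :
    ¬ map (algebraMap K E) P ∣ map (algebraMap K E) c := by
  let j : E →ₐ[K] AlgebraicClosure L := IsAlgClosed.lift
  have hev : ∀ Q : MvPolynomial (Fin N) K, eval₂ (j : E →+* AlgebraicClosure L)
      (fun i => algebraMap L _ (u i)) (map (algebraMap K E) Q) =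
      algebraMap L (AlgebraicClosure L) (aeval u Q) := by
    intro Q
    rw [eval₂_map, ← IsScalarTower.toAlgHom_apply K L (AlgebraicClosure L), comp_aeval_apply,
      aeval_def]
    congr 1
    ext r
    simp
  rintro ⟨R, hR⟩
  have h1 := congrArg (eval₂ (j : E →+* AlgebraicClosure L) (fun i => algebraMap L _ (u i))) hR
  rw [eval₂_mul, hev, hev, hPu, map_zero, zero_mul] at h1
  exact hc ((algebraMap L (AlgebraicClosure L)).injective (by rw [h1, map_zero]))

end AbsoluteIrreducibility

section PrimitiveGenerators

variable {K L : Type} [Field K] [Field L] [Algebra K L]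

/-- A finitely generated field extension of transcendence degree `d` is generated by `d + 1`
elements. -/
theorem exists_generators_of_trdeg [CharZero K] {M : ℕ} {r : Fin M → L}
    (hr : IntermediateField.adjoin K (range r) = ⊤) :
    ∃ (d : ℕ) (u : Fin (d + 1) → L), Algebra.trdeg K L = d ∧
      IntermediateField.adjoin K (range u) = ⊤ := by
  have halg : Algebra.IsAlgebraic (Algebra.adjoin K (range r)) L := by
    refine ⟨fun l => ?_⟩
    have hl : l ∈ IntermediateField.adjoin K (range r) := hr ▸ IntermediateField.mem_top
    rw [IntermediateField.mem_adjoin_iff_div] at hl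
    obtain ⟨a, ha, b, hb, rfl⟩ := hl
    rw [div_eq_mul_inv]
    exact (isAlgebraic_algebraMap (⟨a, ha⟩ : Algebra.adjoin K (range r))).mul
      (isAlgebraic_algebraMap (⟨b, hb⟩ : Algebra.adjoin K (range r))).inv
  obtain ⟨t, htr, ht⟩ := exists_isTranscendenceBasis_subset (R := K) (range r)
  have hfin : t.Finite := (finite_range r).subset htr
  have := hfin.to_subtype
  let F := IntermediateField.adjoin K (range ((↑) : t → L))
  have hF : Algebra.IsAlgebraic F L := ht.isAlgebraic_field
  have htop : IntermediateField.adjoin F (range r) = ⊤ := by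
    rw [eq_top_iff]
    intro l _
    have hl : l ∈ IntermediateField.adjoin K (range r) := hr ▸ IntermediateField.mem_top
    have hle : IntermediateField.adjoin K (range r) ≤
        (IntermediateField.adjoin F (range r)).restrictScalars K :=
      IntermediateField.adjoin_le_iff.2 (IntermediateField.subset_adjoin F (range r))
    exact hle hl
  have hFD : FiniteDimensional F L := by
    have h1 : FiniteDimensional F (IntermediateField.adjoin F (range r)) :=
      IntermediateField.finiteDimensional_adjoin fun x _ => (hF.isAlgebraic x).isIntegral
    rw [htop] at h1
    exact Module.Finite.equiv IntermediateField.topEquiv.toLinearEquiv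
  obtain ⟨θ, hθ⟩ := Field.exists_primitive_element F L
  obtain ⟨d, ⟨e⟩⟩ := Finite.exists_equiv_fin t
  refine ⟨d, Fin.cons θ fun i => ((e.symm i : t) : L), ?_, ?_⟩
  · rw [← ht.cardinalMk_eq_trdeg, Cardinal.mk_congr e]
    simp
  · rw [eq_top_iff]
    intro l _
    have hl : l ∈ IntermediateField.adjoin F {θ} := hθ ▸ IntermediateField.mem_top
    have hFle : F ≤ IntermediateField.adjoin K
        (range (Fin.cons θ fun i => ((e.symm i : t) : L) : Fin (d + 1) → L)) := by
      refine IntermediateField.adjoin_le_iff.2 ?_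
      rintro _ ⟨a, rfl⟩
      exact IntermediateField.subset_adjoin K _ ⟨(e a).succ, by simp⟩
    have hle : IntermediateField.adjoin F {θ} ≤ IntermediateField.extendScalars hFle := by
      refine IntermediateField.adjoin_le_iff.2 ?_
      rintro _ rfl
      exact IntermediateField.subset_adjoin K _ ⟨0, by simp⟩
    exact hle hl

/-- The ideal of relations of `d + 1` generators of a field of transcendence degree `d` is
principal. -/
theorem exists_principal_relation {d : ℕ} {u : Fin (d + 1) → L} (hd : Algebra.trdeg K L = d)
    (hu : IntermediateField.adjoin K (range u) = ⊤) :
    ∃ P : MvPolynomial (Fin (d + 1)) K, Prime P ∧ aeval u P = 0 ∧ ∀ Q, aeval u Q = 0 → P ∣ Q := by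
  let f : MvPolynomial (Fin (d + 1)) K →ₐ[K] L := aeval u
  have hJ : (RingHom.ker f).IsPrime := RingHom.ker_isPrime _
  have halg : Algebra.IsAlgebraic f.range L := by
    refine ⟨fun l => ?_⟩
    have hl : l ∈ IntermediateField.adjoin K (range u) := hu ▸ IntermediateField.mem_top
    rw [IntermediateField.mem_adjoin_range_iff] at hl
    obtain ⟨a, b, rfl⟩ := hl
    rw [div_eq_mul_inv]
    exact (isAlgebraic_algebraMap (⟨_, a, rfl⟩ : f.range)).mul
      (isAlgebraic_algebraMap (⟨_, b, rfl⟩ : f.range)).inv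
  have hquot : (d : Cardinal) ≤ Algebra.trdeg K (MvPolynomial (Fin (d + 1)) K ⧸ RingHom.ker f) := by
    rw [(Ideal.quotientKerEquivRange f).trdeg_eq, f.range.trdeg_eq_of_isAlgebraic, hd]
  have hpoly : Algebra.trdeg K (MvPolynomial (Fin (d + 1)) K) = (d + 1 : ℕ) := by
    rw [MvPolynomial.trdeg_of_isDomain]; simp
  have hne : RingHom.ker f ≠ ⊥ := by
    intro h0
    have hinj : Function.Injective f := (RingHom.injective_iff_ker_eq_bot f).2 h0
    have h1 : (d + 1 : ℕ) ≤ Algebra.trdeg K L := by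
      rw [← hpoly]; exact trdeg_le_of_injective f hinj
    rw [hd] at h1
    exact absurd (by exact_mod_cast h1) (Nat.lt_succ_self d).not_ge
  obtain ⟨P, hPJ, hP⟩ := Ideal.IsPrime.exists_mem_prime_of_ne_bot hJ hne
  refine ⟨P, hP, hPJ, fun Q hQ => ?_⟩
  have hspan : (Ideal.span {P}).IsPrime := (Ideal.span_singleton_prime hP.ne_zero).2 hP
  have hle : Ideal.span {P} ≤ RingHom.ker f := (Ideal.span_singleton_le_iff_mem _).2 hPJ
  by_contra hdvd
  let J' := (RingHom.ker f).map (Ideal.Quotient.mk (Ideal.span {P}))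
  have hJ' : J'.IsPrime := Ideal.map_isPrime_of_surjective Ideal.Quotient.mk_surjective (by
    rw [Ideal.mk_ker]; exact hle)
  have hJ'ne : J' ≠ ⊥ := by
    intro h0
    have h1 : Ideal.Quotient.mk (Ideal.span {P}) Q ∈ J' := Ideal.mem_map_of_mem _ hQ
    rw [h0, Ideal.mem_bot, Ideal.Quotient.eq_zero_iff_mem, Ideal.mem_span_singleton] at h1
    exact hdvd h1
  have e : ((MvPolynomial (Fin (d + 1)) K ⧸ Ideal.span {P}) ⧸ J') ≃ₐ[K]
      (MvPolynomial (Fin (d + 1)) K ⧸ RingHom.ker f) := DoubleQuot.quotQuotEquivQuotOfLEₐ K hle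
  have h1 := succ_le_trdeg_of_le_trdeg_quotient hJ'ne
    (hquot.trans (trdeg_le_of_surjective e.toAlgHom e.surjective))
  have h2 := succ_le_trdeg_of_le_trdeg_quotient
    (fun h0 => hP.ne_zero (Ideal.span_singleton_eq_bot.1 h0)) h1
  rw [hpoly] at h2
  have h3 : d + 1 + 1 ≤ d + 1 := by exact_mod_cast h2
  omega

end PrimitiveGenerators

/-! ### Generic fibres -/

section Moving

variable {A R : Type} [CommRing A] [IsDomain A] [CommRing R] [IsDomain R] [Algebra A R]

/-- A nonzero element divides a nonzero polynomial in any `trdeg` many elements. -/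
theorem exists_dvd_aeval {d : ℕ} (hd : Algebra.trdeg A R = d) {g : R} (hg : g ≠ 0)
    (s : Fin d → R) : ∃ P : MvPolynomial (Fin d) A, P ≠ 0 ∧ g ∣ aeval s P := by
  by_cases hs : AlgebraicIndependent A s
  · have hb : IsTranscendenceBasis A s :=
      hs.isTranscendenceBasis_of_trdeg_le_of_finite (by rw [hd]; simp)
    have halg := hb.isAlgebraic
    obtain ⟨c, hc, hdvd⟩ := (halg.isAlgebraic g).exists_nonzero_dvd
      (mem_nonZeroDivisors_of_ne_zero hg)
    have hc' : (c : R) ∈ (aeval s : MvPolynomial (Fin d) A →ₐ[A] R).range := by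
      rw [← Algebra.adjoin_range_eq_range_aeval]; exact c.2
    obtain ⟨P, hP⟩ := hc'
    refine ⟨P, ?_, ?_⟩
    · rintro rfl
      exact hc (Subtype.ext (by simpa using hP.symm))
    · have h1 : aeval s P = (c : R) := hP
      rw [h1]; exact hdvd
  · rw [algebraicIndependent_iff] at hs
    push Not at hs
    obtain ⟨P, hP, hP0⟩ := hs
    exact ⟨P, hP0, by rw [hP]; exact dvd_zero g⟩

/-- Over a generic point of the base, points of the fibre can be moved off a given hypersurface. -/
theorem exists_moving [Algebra ℂ A] [Algebra ℂ R] [IsScalarTower ℂ A R] [Algebra.FiniteType ℂ R]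
    [FaithfulSMul A R] {ι : Type} [Fintype ι] {a : ι → A} (hgen : Algebra.adjoin ℂ (range a) = ⊤)
    (ha : AlgebraicIndependent ℂ a) {d : ℕ} (hd : Algebra.trdeg A R = d) {g : R} (hg : g ≠ 0) :
    ∃ e : A, e ≠ 0 ∧ ∀ φ₀ : A →ₐ[ℂ] ℂ, φ₀ e ≠ 0 → ∀ φ : R →ₐ[ℂ] ℂ,
      (∀ b, φ (algebraMap A R b) = φ₀ b) → ∀ f, φ f ≠ 0 →
      ∃ ψ : R →ₐ[ℂ] ℂ, (∀ b, ψ (algebraMap A R b) = φ₀ b) ∧ ψ f ≠ 0 ∧ ψ g ≠ 0 := by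
  classical
  obtain ⟨G, hG⟩ := (inferInstance : Algebra.FiniteType ℂ R).out
  choose P hP hPg using fun s : Fin d → G => exists_dvd_aeval hd hg (fun i => (s i : R))
  choose μ hμ using fun s => MvPolynomial.ne_zero_iff.1 (hP s)
  refine ⟨∏ s, coeff (μ s) (P s), Finset.prod_ne_zero_iff.2 fun s _ => hμ s, ?_⟩
  intro φ₀ he φ hφ f hf
  rw [map_prod, Finset.prod_ne_zero_iff] at he
  have hker : (RingHom.ker φ).IsPrime := RingHom.ker_isPrime _
  have htr : ((d + (Finset.univ : Finset ι).card : ℕ) : Cardinal) ≤ Algebra.trdeg ℂ R := by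
    have h1 := trdeg_add_eq ℂ A (A := R)
    have h2 := card_le_trdeg ha
    rw [← h1, hd, Nat.cast_add, add_comm]
    exact add_le_add_left h2 _
  obtain ⟨q, hq, hqa, hqφ, hqd⟩ := exists_prime_le_trdeg_quotient_of_finset
    (fun i => algebraMap A R (a i - algebraMap ℂ A (φ₀ (a i)))) Finset.univ
    (P := RingHom.ker φ) (fun i _ => by simp [RingHom.mem_ker, hφ]) (n := d) htr
  have hbase : ∀ b : A, Ideal.Quotient.mk q (algebraMap A R b) = algebraMap ℂ (R ⧸ q) (φ₀ b) := by
    have h1 : ((Ideal.Quotient.mkₐ ℂ q).comp (IsScalarTower.toAlgHom ℂ A R)) =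
        (Algebra.ofId ℂ (R ⧸ q)).comp φ₀ := by
      refine AlgHom.ext_of_adjoin_eq_top hgen ?_
      rintro _ ⟨i, rfl⟩
      have h2 := Ideal.Quotient.eq_zero_iff_mem.2 (hqa i (Finset.mem_univ i))
      rw [map_sub, map_sub, sub_eq_zero] at h2
      refine h2.trans ?_
      rw [← IsScalarTower.algebraMap_apply ℂ A R]
      rfl
    exact fun b => DFunLike.congr_fun h1 b
  have hgq : g ∉ q := by
    intro hgq
    have htop : Algebra.adjoin ℂ (Ideal.Quotient.mk q '' (G : Set R)) = ⊤ := by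
      have h1 := congrArg (Subalgebra.map (Ideal.Quotient.mkₐ ℂ q)) hG
      rw [AlgHom.map_adjoin, Algebra.map_top] at h1
      exact h1.trans ((AlgHom.range_eq_top _).2 Ideal.Quotient.mk_surjective)
    have : Algebra.IsAlgebraic (Algebra.adjoin ℂ (Ideal.Quotient.mk q '' (G : Set R))) (R ⧸ q) := by
      rw [htop]
      exact ⟨fun r => isAlgebraic_algebraMap (⟨r, trivial⟩ : (⊤ : Subalgebra ℂ (R ⧸ q)))⟩
    have : FaithfulSMul ℂ (R ⧸ q) :=
      (faithfulSMul_iff_algebraMap_injective _ _).2 (algebraMap ℂ (R ⧸ q)).injective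
    obtain ⟨t, ht, hbt⟩ := exists_isTranscendenceBasis_subset
      (R := ℂ) (Ideal.Quotient.mk q '' (G : Set R))
    rw [← hbt.cardinalMk_eq_trdeg] at hqd
    have h2 : Cardinal.mk (Fin d) ≤ Cardinal.mk t := by simpa using hqd
    obtain ⟨j⟩ := h2
    choose s hs hsj using fun i => ht (j i).2
    have hind : AlgebraicIndependent ℂ (fun i => Ideal.Quotient.mk q (s i)) := by
      rw [show (fun i => Ideal.Quotient.mk q (s i)) = Subtype.val ∘ j from funext hsj]
      exact hbt.1.comp j j.injective
    let s' : Fin d → G := fun i => ⟨s i, hs i⟩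
    have h3 : aeval (fun i => Ideal.Quotient.mk q (s i)) (map (φ₀ : A →+* ℂ) (P s')) = 0 := by
      obtain ⟨c, hc⟩ := hPg s'
      have h4 : Ideal.Quotient.mk q (aeval (fun i => (s' i : R)) (P s')) = 0 := by
        rw [hc, map_mul, Ideal.Quotient.eq_zero_iff_mem.2 hgq, zero_mul]
      rw [← h4, aeval_def, eval₂_map, aeval_def, hom_eval₂]
      congr 1
      exact RingHom.ext fun b => (hbase b).symm
    have h5 := (algebraicIndependent_iff.1 hind) _ h3
    refine he s' (Finset.mem_univ _) ?_
    have h6 := congrArg (coeff (μ s')) h5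
    rw [coeff_map, coeff_zero] at h6
    exact h6
  have hfq : f ∉ q := fun h => hf (hqφ h)
  obtain ⟨ψ, hψ⟩ := exists_algHom_apply_ne_zero (k := ℂ) (S := R ⧸ q)
    (f := Ideal.Quotient.mk q (f * g)) (by
      rw [Ne, Ideal.Quotient.eq_zero_iff_mem]
      exact fun h => (hq.mem_or_mem h).elim hfq hgq)
  rw [map_mul, map_mul] at hψ
  refine ⟨ψ.comp (Ideal.Quotient.mkₐ ℂ q), fun b => ?_, left_ne_zero_of_mul hψ,
    right_ne_zero_of_mul hψ⟩
  have h7 : ψ (Ideal.Quotient.mk q (algebraMap A R b)) = φ₀ b := by rw [hbase b]; simp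
  exact h7

end Moving

/-- A ring homomorphism from a subring of a field to `ℂ` extends along a localization at an
element on which it does not vanish. -/
theorem exists_extend_localization {A L : Type} [CommRing A] [Field L] [Algebra A L]
    (B B' : Subalgebra A L) {c : B} (β : B →+* ℂ) (hβ : β c ≠ 0)
    (h : ∀ x ∈ B', ∃ N : ℕ, (c : L) ^ N * x ∈ B) :
    ∃ β' : B' →+* ℂ, ∀ (x : B') (N : ℕ) (y : B), (c : L) ^ N * x = y → β c ^ N * β' x = β y := by
  have hc0 : (c : L) ≠ 0 := fun h0 => hβ (by rw [show c = 0 from Subtype.ext h0, map_zero])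
  choose N hN using fun x : B' => h x x.2
  have key : ∀ (x : B') (M : ℕ) (y : B), (c : L) ^ M * x = y →
      β c ^ M * (β ⟨_, hN x⟩ / β c ^ N x) = β y := by
    intro x M y hy
    rw [← mul_div_assoc, div_eq_iff (pow_ne_zero _ hβ), ← map_pow, ← map_pow, ← map_mul, ← map_mul]
    congr 1
    refine Subtype.ext ?_
    push_cast
    rw [← hy]
    ring
  have uniq : ∀ (x : B') (w : ℂ) (M : ℕ) (y : B), (c : L) ^ M * x = y → β c ^ M * w = β y →
      β ⟨_, hN x⟩ / β c ^ N x = w := fun x w M y hy hw =>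
    mul_left_cancel₀ (pow_ne_zero M hβ) ((key x M y hy).trans hw.symm)
  let β' : B' →+* ℂ :=
    { toFun := fun x => β ⟨_, hN x⟩ / β c ^ N x
      map_one' := uniq 1 1 0 1 (by simp) (by simp)
      map_zero' := uniq 0 0 0 0 (by simp) (by simp)
      map_mul' := fun x x' => by
        refine uniq _ _ (N x + N x') (⟨_, hN x⟩ * ⟨_, hN x'⟩) (by push_cast; ring) ?_
        rw [map_mul, pow_add]
        field_simp
      map_add' := fun x x' => by
        refine uniq _ _ (N x + N x') (c ^ N x' * ⟨_, hN x⟩ + c ^ N x * ⟨_, hN x'⟩)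
          (by push_cast; ring) ?_
        rw [map_add, map_mul, map_mul, map_pow, map_pow, pow_add]
        field_simp }
  exact ⟨β', key⟩

/-- Clearing denominators of a finite family of elements, uniformly on the algebra they
generate. -/
theorem exists_pow_mul_mem {A L : Type} [CommRing A] [Field L] [Algebra A L]
    {B : Subalgebra A L} {c : L} (hc : c ∈ B) {s : Set L} (h : ∀ x ∈ s, ∃ N : ℕ, c ^ N * x ∈ B)
    {x : L} (hx : x ∈ Algebra.adjoin A s) : ∃ N : ℕ, c ^ N * x ∈ B := by
  induction hx using Algebra.adjoin_induction with
  | mem x hx => exact h x hx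
  | algebraMap r => exact ⟨0, by simp⟩
  | add x y _ _ hx hy =>
    obtain ⟨M, hM⟩ := hx
    obtain ⟨N, hN⟩ := hy
    refine ⟨M + N, ?_⟩
    have := B.add_mem (B.mul_mem (B.pow_mem hc N) hM) (B.mul_mem (B.pow_mem hc M) hN)
    convert this using 1; ring
  | mul x y _ _ hx hy =>
    obtain ⟨M, hM⟩ := hx
    obtain ⟨N, hN⟩ := hy
    refine ⟨M + N, ?_⟩
    have := B.mul_mem hM hN
    convert this using 1; ring

section Denominators

variable {A K L : Type} [CommRing A] [IsDomain A] [Field K] [Algebra A K] [IsFractionRing A K]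
  [Field L] [Algebra A L] [Algebra K L] [IsScalarTower A K L] {N : ℕ}

/-- Clearing the denominators of the coefficients of a polynomial. -/
theorem exists_map_eq_C_mul (Q : MvPolynomial (Fin N) K) :
    ∃ (b : A) (Q' : MvPolynomial (Fin N) A), b ≠ 0 ∧
      map (algebraMap A K) Q' = C (algebraMap A K b) * Q := by
  let _ : Algebra (MvPolynomial (Fin N) A) (MvPolynomial (Fin N) K) := algebraMvPolynomial
  have : IsLocalization ((nonZeroDivisors A).map (C : A →+* MvPolynomial (Fin N) A))
    (MvPolynomial (Fin N) K) := MvPolynomial.isLocalization (nonZeroDivisors A) K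
  obtain ⟨⟨Q', ⟨_, b, hb, rfl⟩⟩, h⟩ := IsLocalization.surj
    ((nonZeroDivisors A).map (C : A →+* MvPolynomial (Fin N) A)) Q
  refine ⟨b, Q', nonZeroDivisors.ne_zero hb, ?_⟩
  rw [mul_comm]
  have h2 : Q * map (algebraMap A K) (C b) = map (algebraMap A K) Q' := h
  rw [map_C] at h2
  exact h2.symm

/-- The relations over `A` among elements of `L`, given a principal generator over the fraction
field. -/
theorem exists_ne_zero_dvd_C_mul [IsNoetherianRing A] {u : Fin N → L} {P : MvPolynomial (Fin N) A}
    (hP : ∀ Q : MvPolynomial (Fin N) K, aeval u Q = 0 → map (algebraMap A K) P ∣ Q) :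
    ∃ e : A, e ≠ 0 ∧ ∀ Q : MvPolynomial (Fin N) A, aeval u Q = 0 → P ∣ C e * Q := by
  classical
  have hone : ∀ Q : MvPolynomial (Fin N) A, aeval u Q = 0 → ∃ e : A, e ≠ 0 ∧ P ∣ C e * Q := by
    intro Q hQ
    obtain ⟨T, hT⟩ := hP (map (algebraMap A K) Q) (by rw [aeval_map_algebraMap, hQ])
    obtain ⟨b, T', hb, hT'⟩ := exists_map_eq_C_mul (A := A) T
    refine ⟨b, hb, T', ?_⟩
    apply map_injective _ (IsFractionRing.injective A K)
    rw [map_mul, map_mul, map_C, hT, hT']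
    ring
  obtain ⟨T, hT⟩ := (IsNoetherian.noetherian
    (RingHom.ker (aeval u : MvPolynomial (Fin N) A →ₐ[A] L)) : Submodule.FG _)
  have hmem : ∀ Q ∈ T, aeval u Q = 0 := fun Q hQ => by
    have : Q ∈ RingHom.ker (aeval u : MvPolynomial (Fin N) A →ₐ[A] L) := by
      rw [← hT]; exact Submodule.subset_span hQ
    exact this
  choose! b hb0 hb using hone
  refine ⟨∏ Q ∈ T, b Q, Finset.prod_ne_zero_iff.2 fun Q hQ => hb0 Q (hmem Q hQ), fun Q hQ => ?_⟩
  have hQT : Q ∈ Submodule.span (MvPolynomial (Fin N) A) (T : Set (MvPolynomial (Fin N) A)) := by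
    rw [hT]; exact hQ
  induction hQT using Submodule.span_induction with
  | mem Q hQT =>
    obtain ⟨S, hS⟩ := hb Q (hmem Q hQT)
    rw [← Finset.mul_prod_erase T b hQT, map_mul, mul_right_comm, hS, mul_assoc]
    exact dvd_mul_right _ _
  | zero => simp
  | add Q₁ Q₂ h₁ h₂ ih₁ ih₂ =>
    have hz : ∀ Q ∈ Submodule.span (MvPolynomial (Fin N) A) (T : Set (MvPolynomial (Fin N) A)),
        aeval u Q = 0 := fun Q h => by rw [hT] at h; exact h
    rw [mul_add]
    exact dvd_add (ih₁ (hz _ h₁)) (ih₂ (hz _ h₂))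
  | smul S Q h ih =>
    have hz : aeval u Q = 0 := by rw [hT] at h; exact h
    rw [smul_eq_mul, mul_left_comm]
    exact (ih hz).mul_left S

end Denominators

/-- The common denominators of finitely many elements of a field of fractions. -/
theorem exists_common_denominator {A L : Type} [CommRing A] [IsDomain A] [Field L] [Algebra A L]
    [IsFractionRing A L] {ι : Type} [Finite ι] (f : ι → L) :
    ∃ b : A, b ≠ 0 ∧ ∀ i, ∃ a : A, algebraMap A L b * f i = algebraMap A L a := by
  obtain ⟨b, hb⟩ := IsLocalization.exist_integer_multiples_of_finite (nonZeroDivisors A) f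
  refine ⟨b, nonZeroDivisors.ne_zero b.2, fun i => ?_⟩
  obtain ⟨a, ha⟩ := hb i
  exact ⟨a, by rw [ha, Algebra.smul_def]⟩

section Fibre

variable {A R L : Type} [CommRing A] [CommRing R] [Algebra A R]
  [Field L] [Algebra A L] [Algebra R L] [IsScalarTower A R L] {N : ℕ} {u : Fin N → L}

/-- The homomorphism on `A[u]` defined by a point satisfying all relations. -/
theorem exists_hom_adjoin {s : Fin N → ℂ} {φ₀ : A →+* ℂ}
    (hs : ∀ Q : MvPolynomial (Fin N) A, aeval u Q = 0 → eval s (map φ₀ Q) = 0) :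
    ∃ β : (aeval u : MvPolynomial (Fin N) A →ₐ[A] L).range →+* ℂ,
      ∀ Q, β ⟨aeval u Q, Q, rfl⟩ = eval s (map φ₀ Q) := by
  let f : MvPolynomial (Fin N) A →+* (aeval u : MvPolynomial (Fin N) A →ₐ[A] L).range :=
    ((aeval u : MvPolynomial (Fin N) A →ₐ[A] L).rangeRestrict : _ →+* _)
  have hf : Function.Surjective f := AlgHom.rangeRestrict_surjective _
  let g : MvPolynomial (Fin N) A →+* ℂ := (eval s).comp (map φ₀)
  have hker : RingHom.ker f ≤ RingHom.ker g := fun Q hQ => by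
    refine hs Q ?_
    have h1 : f Q = 0 := hQ
    exact congrArg Subtype.val h1
  refine ⟨RingHom.liftOfSurjective f hf ⟨g, hker⟩, fun Q => ?_⟩
  exact RingHom.liftOfRightInverse_comp_apply f _ _ ⟨g, hker⟩ Q

variable {c : MvPolynomial (Fin N) A}

/-- A point of a birational model lifts to a point of the fibre. -/
theorem exists_point_of_model
    (hR : ∀ r : R, ∃ (M : ℕ) (F : MvPolynomial (Fin N) A),
      aeval u c ^ M * algebraMap R L r = aeval u F)
    {s : Fin N → ℂ} {φ₀ : A →+* ℂ}
    (hs : ∀ Q : MvPolynomial (Fin N) A, aeval u Q = 0 → eval s (map φ₀ Q) = 0)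
    (hc : eval s (map φ₀ c) ≠ 0) :
    ∃ χ : R →+* ℂ, (∀ b, χ (algebraMap A R b) = φ₀ b) ∧
      ∀ (r : R) (M : ℕ) (F : MvPolynomial (Fin N) A),
        aeval u c ^ M * algebraMap R L r = aeval u F →
        eval s (map φ₀ c) ^ M * χ r = eval s (map φ₀ F) := by
  obtain ⟨β, hβ⟩ := exists_hom_adjoin hs
  obtain ⟨β', hβ'⟩ := exists_extend_localization
    (aeval u : MvPolynomial (Fin N) A →ₐ[A] L).range (IsScalarTower.toAlgHom A R L).range
    (c := ⟨aeval u c, c, rfl⟩) β (by rw [hβ]; exact hc) (by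
      rintro _ ⟨r, rfl⟩
      obtain ⟨M, F, h⟩ := hR r
      exact ⟨M, F, h.symm⟩)
  let χ : R →+* ℂ := β'.comp ((IsScalarTower.toAlgHom A R L).rangeRestrict : R →+* _)
  have hχ : ∀ (r : R) (M : ℕ) (F : MvPolynomial (Fin N) A),
        aeval u c ^ M * algebraMap R L r = aeval u F →
        eval s (map φ₀ c) ^ M * χ r = eval s (map φ₀ F) := by
    intro r M F h
    have := hβ' ⟨algebraMap R L r, r, rfl⟩ M ⟨aeval u F, F, rfl⟩ h
    rwa [hβ, hβ] at this
  refine ⟨χ, fun b => ?_, hχ⟩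
  have := hχ (algebraMap A R b) 0 (C b) (by
    rw [pow_zero, one_mul, aeval_C, ← IsScalarTower.algebraMap_apply])
  simpa using this

/-- A point of the fibre off the exceptional locus gives a point of a birational model. -/
theorem exists_model_point_of_point [FaithfulSMul R L] (hcu : aeval u c ≠ 0) {g : R}
    (hg : ∀ i, ∃ r : R, algebraMap R L g * u i = algebraMap R L r)
    (hgc : ∃ r : R, algebraMap R L g * (aeval u c)⁻¹ = algebraMap R L r)
    {φ₀ : A →+* ℂ} {φ : R →+* ℂ} (hφ : ∀ b, φ (algebraMap A R b) = φ₀ b) (hφg : φ g ≠ 0) :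
    ∃ s : Fin N → ℂ,
      (∀ Q : MvPolynomial (Fin N) A, aeval u Q = 0 → eval s (map φ₀ Q) = 0) ∧
      eval s (map φ₀ c) ≠ 0 ∧ ∀ (r : R) (M : ℕ) (F : MvPolynomial (Fin N) A),
        aeval u c ^ M * algebraMap R L r = aeval u F →
        eval s (map φ₀ c) ^ M * φ r = eval s (map φ₀ F) := by
  let j : R →ₐ[A] L := IsScalarTower.toAlgHom A R L
  have hj : Function.Injective j := FaithfulSMul.algebraMap_injective R L
  let e : R ≃ₐ[A] j.range := AlgEquiv.ofInjective j hj
  let β : j.range →+* ℂ := φ.comp (e.symm : j.range →+* R)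
  have hβ : ∀ r, β (e r) = φ r := fun r => by simp [β]
  obtain ⟨T, huT, hciT, hT⟩ : ∃ T : Subalgebra A L, (∀ i, u i ∈ T) ∧ (aeval u c)⁻¹ ∈ T ∧
      ∀ x ∈ T, ∃ M : ℕ, (e g : L) ^ M * x ∈ j.range := by
    refine ⟨Algebra.adjoin A (range u ∪ {(aeval u c)⁻¹}),
      fun i => Algebra.subset_adjoin (Or.inl ⟨i, rfl⟩), Algebra.subset_adjoin (Or.inr rfl),
      fun x hx => exists_pow_mul_mem (e g).2 ?_ hx⟩
    rintro _ (⟨i, rfl⟩ | rfl)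
    · obtain ⟨r, hr⟩ := hg i
      exact ⟨1, r, by rw [pow_one]; exact hr.symm⟩
    · obtain ⟨r, hr⟩ := hgc
      exact ⟨1, r, by rw [pow_one]; exact hr.symm⟩
  obtain ⟨β', hβ'⟩ := exists_extend_localization j.range T (c := e g) β
    (by rw [hβ]; exact hφg) hT
  let w : Fin N → T := fun i => ⟨u i, huT i⟩
  have hw : ∀ F : MvPolynomial (Fin N) A, ((aeval w F : T) : L) = aeval u F := fun F => by
    have := comp_aeval_apply T.val (f := w) F
    exact this
  have hbase : ∀ b : A, β' (algebraMap A T b) = φ₀ b := fun b => by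
    have h1 := hβ' (algebraMap A T b) 0 (e (algebraMap A R b)) (by
      rw [pow_zero, one_mul]
      exact IsScalarTower.algebraMap_apply A R L b)
    rwa [pow_zero, one_mul, hβ, hφ] at h1
  have hR : ∀ (r : R) (t : T), (t : L) = algebraMap R L r → β' t = φ r := fun r t ht => by
    have h1 := hβ' t 0 (e r) (by rw [pow_zero, one_mul, ht]; rfl)
    rwa [pow_zero, one_mul, hβ] at h1
  have hev : ∀ F : MvPolynomial (Fin N) A,
      β' (aeval w F) = eval (fun i => β' (w i)) (map φ₀ F) := fun F => by
    rw [eval_map, aeval_def, hom_eval₂]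
    congr 1
    exact RingHom.ext hbase
  refine ⟨fun i => β' (w i), fun Q hQ => ?_, ?_, fun r M F h => ?_⟩
  · rw [← hev, show aeval w Q = 0 from Subtype.ext (by rw [hw, hQ]; rfl), map_zero]
  · rw [← hev]
    let ci : T := ⟨(aeval u c)⁻¹, hciT⟩
    have h1 : aeval w c * ci = 1 := Subtype.ext (by
      change ((aeval w c : T) : L) * (aeval u c)⁻¹ = 1
      rw [hw, mul_inv_cancel₀ hcu])
    intro h0
    have h2 := congrArg β' h1
    rw [map_mul, h0, zero_mul, map_one] at h2
    exact zero_ne_one h2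
  · rw [← hev, ← hev]
    let ci : T := ⟨(aeval u c)⁻¹, hciT⟩
    let t : T := ci ^ M * aeval w F
    have ht : (t : L) = algebraMap R L r := by
      change (aeval u c)⁻¹ ^ M * ((aeval w F : T) : L) = _
      rw [hw, ← h, ← mul_assoc, ← mul_pow, inv_mul_cancel₀ hcu, one_pow, one_mul]
    rw [← hR r t ht, ← map_pow, ← map_mul]
    congr 1
    refine Subtype.ext ?_
    change ((aeval w c : T) : L) ^ M * ((aeval u c)⁻¹ ^ M * ((aeval w F : T) : L)) = _
    rw [hw, ← mul_assoc, ← mul_pow, mul_inv_cancel₀ hcu, one_pow, one_mul]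

end Fibre

/-- A prime polynomial has a zero off any polynomial it does not divide. -/
theorem Prime.exists_eval_eq_zero {N : ℕ} {p q : MvPolynomial (Fin N) ℂ} (hp : Prime p)
    (hq : ¬ p ∣ q) : ∃ s, eval s p = 0 ∧ eval s q ≠ 0 := by
  have hI : (Ideal.span {p}).IsPrime := (Ideal.span_singleton_prime hp.ne_zero).2 hp
  obtain ⟨φ, hφ⟩ := exists_algHom_apply_ne_zero (k := ℂ)
    (S := MvPolynomial (Fin N) ℂ ⧸ Ideal.span {p}) (f := Ideal.Quotient.mk _ q) (by
      rwa [Ne, Ideal.Quotient.eq_zero_iff_mem, Ideal.mem_span_singleton])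
  let ψ : MvPolynomial (Fin N) ℂ →ₐ[ℂ] ℂ := φ.comp (Ideal.Quotient.mkₐ ℂ _)
  have hψ : ∀ f, eval (fun i => ψ (X i)) f = ψ f := fun f => by
    rw [← coe_aeval_eq_eval]
    exact DFunLike.congr_fun (aeval_unique ψ).symm f
  refine ⟨fun i => ψ (X i), ?_, by rw [hψ]; exact hφ⟩
  rw [hψ]
  have h1 : Ideal.Quotient.mk (Ideal.span {p}) p = 0 :=
    Ideal.Quotient.eq_zero_iff_mem.2 (Ideal.mem_span_singleton_self p)
  have h2 : ψ p = φ (Ideal.Quotient.mk (Ideal.span {p}) p) := rfl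
  rw [h2, h1, map_zero]

theorem trdeg_eq_trdeg_of_isFractionRing {A R K L : Type} [CommRing A] [IsDomain A] [CommRing R]
    [IsDomain R] [Field K] [Field L] [Algebra A R] [Algebra A K] [IsFractionRing A K] [Algebra R L]
    [IsFractionRing R L] [Algebra K L] [Algebra A L] [IsScalarTower A K L] [IsScalarTower A R L]
    [FaithfulSMul A R] : Algebra.trdeg A R = Algebra.trdeg K L := by
  have : FaithfulSMul R L :=
    (faithfulSMul_iff_algebraMap_injective _ _).2 (IsFractionRing.injective R L)
  have : FaithfulSMul A K :=
    (faithfulSMul_iff_algebraMap_injective _ _).2 (IsFractionRing.injective A K)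
  have h1 := trdeg_add_eq A R (A := L)
  have h2 := trdeg_add_eq A K (A := L)
  have h3 : Algebra.trdeg R L = 0 := by
    rw [trdeg_eq_zero_iff]; exact IsLocalization.isAlgebraic L (nonZeroDivisors R)
  have h4 : Algebra.trdeg A K = 0 := by
    rw [trdeg_eq_zero_iff]; exact IsLocalization.isAlgebraic K (nonZeroDivisors A)
  rw [h3, add_zero] at h1
  rw [h4, zero_add] at h2
  exact h1.trans h2.symm

theorem exists_fraction_of_adjoin_eq_top {A K L : Type} [CommRing A] [IsDomain A] [Field K]
    [Algebra A K] [IsFractionRing A K] [Field L] [Algebra A L] [Algebra K L] [IsScalarTower A K L]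
    {N : ℕ} {u : Fin N → L} (hu : IntermediateField.adjoin K (range u) = ⊤) (l : L) :
    ∃ c F : MvPolynomial (Fin N) A, aeval u c ≠ 0 ∧ aeval u c * l = aeval u F := by
  have hl : l ∈ IntermediateField.adjoin K (range u) := hu ▸ IntermediateField.mem_top
  rw [IntermediateField.mem_adjoin_range_iff] at hl
  obtain ⟨p, q, rfl⟩ := hl
  by_cases hq : aeval u q = 0
  · exact ⟨1, 0, by simp, by simp [hq]⟩
  obtain ⟨b, p', hb, hp'⟩ := exists_map_eq_C_mul (A := A) p
  obtain ⟨b', q', hb', hq'⟩ := exists_map_eq_C_mul (A := A) q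
  have hAL : Function.Injective (algebraMap A L) := by
    rw [IsScalarTower.algebraMap_eq A K L]
    exact (algebraMap K L).injective.comp (IsFractionRing.injective A K)
  have hp2 : aeval u p' = algebraMap A L b * aeval u p := by
    rw [← aeval_map_algebraMap K, hp', map_mul, aeval_C, ← IsScalarTower.algebraMap_apply]
  have hq2 : aeval u q' = algebraMap A L b' * aeval u q := by
    rw [← aeval_map_algebraMap K, hq', map_mul, aeval_C, ← IsScalarTower.algebraMap_apply]
  have h0 : ∀ b : A, b ≠ 0 → algebraMap A L b ≠ 0 := fun b hb =>
    (map_ne_zero_iff _ hAL).2 hb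
  refine ⟨C b * q', C b' * p', ?_, ?_⟩
  · rw [map_mul, aeval_C, hq2]
    exact mul_ne_zero (h0 b hb) (mul_ne_zero (h0 b' hb') hq)
  · rw [map_mul, map_mul, aeval_C, aeval_C, hq2, hp2]
    field_simp

theorem exists_common_fraction {A K L : Type} [CommRing A] [IsDomain A] [Field K]
    [Algebra A K] [IsFractionRing A K] [Field L] [Algebra A L] [Algebra K L] [IsScalarTower A K L]
    {N : ℕ} {u : Fin N → L} (hu : IntermediateField.adjoin K (range u) = ⊤)
    {M : ℕ} (l : Fin M → L) :
    ∃ c : MvPolynomial (Fin N) A, aeval u c ≠ 0 ∧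
      ∀ i, ∃ F : MvPolynomial (Fin N) A, aeval u c * l i = aeval u F := by
  choose c F hc hF using fun i => exists_fraction_of_adjoin_eq_top (A := A) hu (l i)
  refine ⟨∏ i, c i, ?_, fun i => ⟨(∏ j ∈ Finset.univ.erase i, c j) * F i, ?_⟩⟩
  · rw [map_prod]
    exact Finset.prod_ne_zero_iff.2 fun g _ => hc g
  · rw [← Finset.mul_prod_erase Finset.univ c (Finset.mem_univ i), map_mul, map_mul, ← hF]
    ring

section Fibre

variable {A R L : Type} [CommRing A] [IsDomain A] [CommRing R] [IsDomain R] [Algebra A R]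
  [Field L] [Algebra A L] [Algebra R L] [IsScalarTower A R L] [IsFractionRing R L]
  [FaithfulSMul A R] [Algebra ℂ A] [Algebra ℂ R] [IsScalarTower ℂ A R] [Algebra.FiniteType ℂ R]

/-- A hypersurface model of the generic fibre. -/
theorem exists_model {K : Type} [Field K] [Algebra A K] [IsFractionRing A K] [Algebra K L]
    [IsScalarTower A K L] [CharZero K] : ∃ (d : ℕ) (u : Fin (d + 1) → L)
      (P c : MvPolynomial (Fin (d + 1)) A), Algebra.trdeg A R = d ∧ P ≠ 0 ∧ aeval u P = 0 ∧
      (∀ Q : MvPolynomial (Fin (d + 1)) K, aeval u Q = 0 → map (algebraMap A K) P ∣ Q) ∧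
      aeval u c ≠ 0 ∧ ∀ r : R, ∃ (M : ℕ) (F : MvPolynomial (Fin (d + 1)) A),
        aeval u c ^ M * algebraMap R L r = aeval u F := by
  classical
  obtain ⟨G, hG⟩ := (inferInstance : Algebra.FiniteType ℂ R).out
  have hR : ∀ (r : R), algebraMap R L r ∈ Algebra.adjoin A (algebraMap R L '' (G : Set R)) := by
    intro r
    have hr : r ∈ Algebra.adjoin ℂ (G : Set R) := hG ▸ trivial
    induction hr using Algebra.adjoin_induction with
    | mem r hr => exact Algebra.subset_adjoin ⟨r, hr, rfl⟩
    | algebraMap t =>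
      rw [IsScalarTower.algebraMap_apply ℂ A R, ← IsScalarTower.algebraMap_apply A R L]
      exact Subalgebra.algebraMap_mem _ _
    | add x y _ _ hx hy => rw [map_add]; exact Subalgebra.add_mem _ hx hy
    | mul x y _ _ hx hy => rw [map_mul]; exact Subalgebra.mul_mem _ hx hy
  let e : Fin (Fintype.card G) ≃ G := (Fintype.equivFin G).symm
  have htop : IntermediateField.adjoin K (range fun i => algebraMap R L (e i)) = ⊤ := by
    rw [eq_top_iff]
    intro l _
    have hRK : ∀ r : R, algebraMap R L r ∈
        IntermediateField.adjoin K (range fun i => algebraMap R L (e i)) := by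
      intro r
      refine Algebra.adjoin_induction (fun x hx => ?_) (fun t => ?_)
        (fun x y _ _ hx hy => add_mem hx hy) (fun x y _ _ hx hy => mul_mem hx hy) (hR r)
      · obtain ⟨g, hg, rfl⟩ := hx
        exact IntermediateField.subset_adjoin K _ ⟨e.symm ⟨g, hg⟩, by simp⟩
      · rw [IsScalarTower.algebraMap_apply A K L]
        exact IntermediateField.algebraMap_mem _ _
    obtain ⟨a, b, hb, rfl⟩ := IsFractionRing.div_surjective (A := R) l
    exact div_mem (hRK a) (hRK b)
  obtain ⟨d, u, hd, hu⟩ := exists_generators_of_trdeg htop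
  obtain ⟨P₀, hP₀, hPu, hP⟩ := exists_principal_relation hd hu
  obtain ⟨b, P, hb, hbP⟩ := exists_map_eq_C_mul (A := A) P₀
  have hb' : algebraMap A K b ≠ 0 :=
    (map_ne_zero_iff _ (IsFractionRing.injective A K)).2 hb
  obtain ⟨c, hc, hcG⟩ := exists_common_fraction (A := A) hu
    (fun i => algebraMap R L (e i))
  refine ⟨d, u, P, c, ?_, ?_, ?_, ?_, hc, ?_⟩
  · rw [trdeg_eq_trdeg_of_isFractionRing (K := K) (L := L), hd]
  · rintro rfl
    rw [map_zero] at hbP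
    exact (mul_ne_zero (C_ne_zero.2 hb') hP₀.ne_zero) hbP.symm
  · rw [← aeval_map_algebraMap K, hbP, map_mul, hPu, mul_zero]
  · intro Q hQ
    rw [hbP]
    obtain ⟨T, rfl⟩ := hP Q hQ
    refine ⟨C (algebraMap A K b)⁻¹ * T, ?_⟩
    rw [mul_mul_mul_comm, ← C_mul, mul_inv_cancel₀ hb', C_1, one_mul]
  · intro r
    obtain ⟨M, F, h⟩ := exists_pow_mul_mem
      (B := (aeval u : MvPolynomial (Fin (d + 1)) A →ₐ[A] L).range)
      (c := aeval u c) ⟨_, rfl⟩ (s := algebraMap R L '' (G : Set R)) (by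
        rintro _ ⟨g, hg, rfl⟩
        obtain ⟨F, hF⟩ := hcG (e.symm ⟨g, hg⟩)
        refine ⟨1, F, ?_⟩
        rw [Equiv.apply_symm_apply] at hF
        rw [pow_one]
        exact hF.symm) (hR r)
    exact ⟨M, F, h.symm⟩

/-- If the base field is algebraically closed in the function field of the total space, generic
fibres are irreducible. -/
theorem exists_irreducible_fibre {ι : Type} [Fintype ι] {a : ι → A}
    (hgen : Algebra.adjoin ℂ (range a) = ⊤) (ha : AlgebraicIndependent ℂ a)
    (hcl : ∀ α : L, IsAlgebraic A α → ∃ p q : A, q ≠ 0 ∧ α * algebraMap A L q = algebraMap A L p) :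
    ∃ e : A, e ≠ 0 ∧ ∀ φ₀ : A →ₐ[ℂ] ℂ, φ₀ e ≠ 0 →
      (∃ φ : R →ₐ[ℂ] ℂ, ∀ b, φ (algebraMap A R b) = φ₀ b) ∧
      ∀ f g : R, (∃ φ : R →ₐ[ℂ] ℂ, (∀ b, φ (algebraMap A R b) = φ₀ b) ∧ φ f ≠ 0) →
        (∃ φ : R →ₐ[ℂ] ℂ, (∀ b, φ (algebraMap A R b) = φ₀ b) ∧ φ g ≠ 0) →
        ∃ φ : R →ₐ[ℂ] ℂ, (∀ b, φ (algebraMap A R b) = φ₀ b) ∧ φ f ≠ 0 ∧ φ g ≠ 0 := by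
  have : Algebra.FiniteType ℂ A := ⟨(Subalgebra.fg_def).2 ⟨range a, finite_range a, hgen⟩⟩
  have : IsNoetherianRing A := Algebra.FiniteType.isNoetherianRing ℂ A
  have : FaithfulSMul R L :=
    (faithfulSMul_iff_algebraMap_injective _ _).2 (IsFractionRing.injective R L)
  have : FaithfulSMul A L := by
    rw [faithfulSMul_iff_algebraMap_injective, IsScalarTower.algebraMap_eq A R L]
    exact (FaithfulSMul.algebraMap_injective R L).comp (FaithfulSMul.algebraMap_injective A R)
  let _ : Algebra (FractionRing A) L := FractionRing.liftAlgebra A L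
  have : IsScalarTower A (FractionRing A) L := FractionRing.isScalarTower_liftAlgebra A L
  have : CharZero A := charZero_of_injective_algebraMap (algebraMap ℂ A).injective
  have : CharZero (FractionRing A) :=
    charZero_of_injective_algebraMap (IsFractionRing.injective A (FractionRing A))
  obtain ⟨d, u, P, c, hd, hP0, hPu, hP, hc, hR⟩ := exists_model (A := A) (R := R) (L := L)
    (K := FractionRing A)
  have hP0' : map (algebraMap A (FractionRing A)) P ≠ 0 :=
    (map_ne_zero_iff _ (map_injective _ (IsFractionRing.injective A (FractionRing A)))).2 hP0
  have hPu' : aeval u (map (algebraMap A (FractionRing A)) P) = 0 := by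
    rw [aeval_map_algebraMap, hPu]
  have hcl' : ∀ α : L, IsIntegral (FractionRing A) α → α ∈ (algebraMap (FractionRing A) L).range := by
    intro α hα
    obtain ⟨p, q, hq, h⟩ := hcl α
      ((IsFractionRing.isAlgebraic_iff A (FractionRing A) L).2 hα.isAlgebraic)
    have hq' : algebraMap A L q ≠ 0 :=
      (map_ne_zero_iff _ (FaithfulSMul.algebraMap_injective A L)).2 hq
    refine ⟨algebraMap A _ p / algebraMap A _ q, ?_⟩
    rw [map_div₀, ← IsScalarTower.algebraMap_apply, ← IsScalarTower.algebraMap_apply,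
      div_eq_iff hq', h]
  obtain ⟨e₁, he₁, hirr⟩ := exists_irreducible_specialization (FractionRing A) P (by
    by_contra hcon
    push Not at hcon
    have h1 : P = C (coeff 0 P) := by
      ext μ
      rw [coeff_C]
      split_ifs with h
      · rw [h]
      · exact hcon μ (Ne.symm h)
    rw [h1, aeval_C, map_eq_zero_iff _ (FaithfulSMul.algebraMap_injective A L)] at hPu
    rw [hPu, map_zero] at h1
    exact hP0 h1) (fun E _ _ _ Q₁ Q₂ hQ => by
      rw [← map_map] at hQ
      exact isUnit_or_isUnit_of_mul_eq_map hcl' hP0' hPu' hP hQ)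
  obtain ⟨e₂, he₂, hndvd⟩ := exists_not_dvd_specialization (FractionRing A) P c
    (fun E _ _ _ => by
      rw [← map_map, ← map_map]
      exact not_map_dvd_map hPu' (by rwa [aeval_map_algebraMap]))
  obtain ⟨e₃, he₃, hrel⟩ := exists_ne_zero_dvd_C_mul hP
  obtain ⟨g₀, hg₀, hden⟩ := exists_common_denominator (A := R)
    (fun i : Option (Fin (d + 1)) => i.elim (aeval u c)⁻¹ u)
  obtain ⟨e₄, he₄, hmov⟩ := exists_moving hgen ha hd hg₀
  refine ⟨e₁ * e₂ * e₃ * e₄,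
    mul_ne_zero (mul_ne_zero (mul_ne_zero he₁ he₂) he₃) he₄, fun φ₀ hφ₀ => ?_⟩
  rw [map_mul, map_mul, map_mul] at hφ₀
  have h4 := right_ne_zero_of_mul hφ₀
  have h3 := right_ne_zero_of_mul (left_ne_zero_of_mul hφ₀)
  have h2 := right_ne_zero_of_mul (left_ne_zero_of_mul (left_ne_zero_of_mul hφ₀))
  have h1 := left_ne_zero_of_mul (left_ne_zero_of_mul (left_ne_zero_of_mul hφ₀))
  have hprime : Prime (map (φ₀ : A →+* ℂ) P) := (hirr φ₀ h1).prime
  have hcdvd : ¬ map (φ₀ : A →+* ℂ) P ∣ map (φ₀ : A →+* ℂ) c := hndvd φ₀ h2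
  have hlift : ∀ q : MvPolynomial (Fin (d + 1)) ℂ, ¬ map (φ₀ : A →+* ℂ) P ∣ q →
      ∃ s, eval s q ≠ 0 ∧ ∃ χ : R →ₐ[ℂ] ℂ, (∀ b, χ (algebraMap A R b) = φ₀ b) ∧
        ∀ (r : R) (M : ℕ) (F : MvPolynomial (Fin (d + 1)) A),
        aeval u c ^ M * algebraMap R L r = aeval u F → eval s (map (φ₀ : A →+* ℂ) F) ≠ 0 →
        χ r ≠ 0 := by
    intro q hq
    obtain ⟨s, hs, hsq⟩ := hprime.exists_eval_eq_zero
      (fun h => (hprime.dvd_or_dvd h).elim hq hcdvd :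
        ¬ map (φ₀ : A →+* ℂ) P ∣ q * map (φ₀ : A →+* ℂ) c)
    rw [map_mul] at hsq
    obtain ⟨χ, hχ, hχF⟩ := exists_point_of_model hR (φ₀ := (φ₀ : A →+* ℂ)) (s := s)
      (fun Q hQ => by
        obtain ⟨T, hT⟩ := hrel Q hQ
        have h5 := congrArg (fun F => eval s (map (φ₀ : A →+* ℂ) F)) hT
        simp only [map_mul, map_C, eval_C, hs, zero_mul] at h5
        exact (mul_eq_zero.1 h5).resolve_left h3) (right_ne_zero_of_mul hsq)
    refine ⟨s, left_ne_zero_of_mul hsq, { χ with commutes' := fun t => ?_ }, hχ, ?_⟩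
    · have h6 := hχ (algebraMap ℂ A t)
      rw [← IsScalarTower.algebraMap_apply] at h6
      exact h6.trans (φ₀.commutes t)
    · intro r M F hF hne h0
      have h7 := hχF r M F hF
      rw [show χ r = 0 from h0, mul_zero] at h7
      exact hne h7.symm
  refine ⟨?_, ?_⟩
  · obtain ⟨s, -, χ, hχ, -⟩ := hlift _ hcdvd
    exact ⟨χ, hχ⟩
  · have hdown : ∀ f : R, (∃ φ : R →ₐ[ℂ] ℂ, (∀ b, φ (algebraMap A R b) = φ₀ b) ∧ φ f ≠ 0) →
        ∀ (M : ℕ) (F : MvPolynomial (Fin (d + 1)) A),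
        aeval u c ^ M * algebraMap R L f = aeval u F →
        ¬ map (φ₀ : A →+* ℂ) P ∣ map (φ₀ : A →+* ℂ) F := by
      rintro f ⟨φ, hφ, hφf⟩ M F hF ⟨T, hT⟩
      obtain ⟨ψ, hψ, hψf, hψg⟩ := hmov φ₀ h4 φ hφ f hφf
      obtain ⟨s, hsrel, hsc, hsF⟩ := exists_model_point_of_point hc
        (fun i => hden (some i)) (hden none) (φ₀ := (φ₀ : A →+* ℂ)) (φ := (ψ : R →+* ℂ)) hψ hψg
      have h5 := hsF f M F hF
      rw [hT, map_mul, hsrel P hPu, zero_mul] at h5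
      exact mul_ne_zero (pow_ne_zero M hsc) hψf h5
    intro f g hf hg
    obtain ⟨M, F, hF⟩ := hR f
    obtain ⟨M', G, hG⟩ := hR g
    obtain ⟨s, hs, χ, hχ, hχF⟩ := hlift
      (map (φ₀ : A →+* ℂ) F * map (φ₀ : A →+* ℂ) G)
      (fun h => (hprime.dvd_or_dvd h).elim (hdown f hf M F hF) (hdown g hg M' G hG))
    rw [map_mul] at hs
    exact ⟨χ, hχ, hχF f M F hF (left_ne_zero_of_mul hs), hχF g M' G hG (right_ne_zero_of_mul hs)⟩

end Fibre

/-! ### The Zariski topology of projective space -/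

section Topology

variable {n : ℕ}

/-- The restriction of a polynomial to the line through the origin and `v`. -/
def radial (f : MvPolynomial (Fin n) ℂ) (v : Fin n → ℂ) : Polynomial ℂ :=
  aeval (fun i => Polynomial.C (v i) * Polynomial.X) f

theorem eval_radial (f : MvPolynomial (Fin n) ℂ) (v : Fin n → ℂ) (t : ℂ) :
    (radial f v).eval t = eval (t • v) f := by
  have h := comp_aeval_apply (f := fun i => Polynomial.C (v i) * Polynomial.X)
    (Polynomial.aeval t : Polynomial ℂ →ₐ[ℂ] ℂ) f
  rw [radial, ← Polynomial.coe_aeval_eq_eval]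
  refine h.trans ?_
  rw [show (fun i => Polynomial.aeval t (Polynomial.C (v i) * Polynomial.X)) = t • v from
    funext fun i => by
      rw [map_mul, Polynomial.aeval_C, Polynomial.aeval_X, mul_comm]; rfl]
  rfl

/-- A univariate complex polynomial with no nonzero value off the origin vanishes. -/
theorem Polynomial.eq_zero_of_forall_ne_zero {p : Polynomial ℂ}
    (h : ∀ t : ℂ, t ≠ 0 → p.eval t = 0) : p = 0 := by
  have h1 : p * Polynomial.X = 0 := Polynomial.funext fun t => by
    by_cases ht : t = 0
    · simp [ht]
    · simp [h t ht]
  exact (mul_eq_zero.1 h1).resolve_right Polynomial.X_ne_zero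

theorem mk_mem_pZero_iff {f : MvPolynomial (Fin n) ℂ} {v : Fin n → ℂ} (hv : v ≠ 0) :
    Projectivization.mk ℂ v hv ∈ pZero f ↔ radial f v = 0 := by
  constructor
  · intro h
    refine Polynomial.eq_zero_of_forall_ne_zero fun t ht => ?_
    rw [eval_radial]
    refine h (t • v) (smul_ne_zero ht hv) ?_
    rw [Projectivization.mk_eq_mk_iff']
    exact ⟨t, rfl⟩
  · intro h w hw hwv
    rw [Projectivization.mk_eq_mk_iff'] at hwv
    obtain ⟨t, rfl⟩ := hwv
    rw [← eval_radial, h, Polynomial.eval_zero]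

theorem pZero_mul (f g : MvPolynomial (Fin n) ℂ) : pZero (f * g) = pZero f ∪ pZero g := by
  ext x
  induction x using Projectivization.ind with
  | h v hv =>
    rw [Set.mem_union, mk_mem_pZero_iff, mk_mem_pZero_iff, mk_mem_pZero_iff, radial, map_mul,
      mul_eq_zero]
    rfl

theorem mk_notMem_pZero {f : MvPolynomial (Fin n) ℂ} {v : Fin n → ℂ} (hv : v ≠ 0)
    (hf : eval v f ≠ 0) : Projectivization.mk ℂ v hv ∉ pZero f := fun h => hf (h v hv rfl)

theorem exists_lift_of_notMem_pZero {f : MvPolynomial (Fin n) ℂ} {x : PrV n} (hx : x ∉ pZero f) :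
    ∃ (v : Fin n → ℂ) (hv : v ≠ 0), Projectivization.mk ℂ v hv = x ∧ eval v f ≠ 0 := by
  simp only [pZero, mem_ofPred_eq, not_forall] at hx
  obtain ⟨v, hv, h, hf⟩ := hx
  exact ⟨v, hv, h, hf⟩

theorem isTopologicalBasis_pZero_compl :
    TopologicalSpace.IsTopologicalBasis {U | ∃ f : MvPolynomial (Fin n) ℂ, U = (pZero f)ᶜ} where
  exists_subset_inter := by
    rintro _ ⟨f, rfl⟩ _ ⟨g, rfl⟩ x hx
    refine ⟨(pZero (f * g))ᶜ, ⟨_, rfl⟩, ?_, ?_⟩ <;> rw [pZero_mul, compl_union]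
    exact hx
  sUnion_eq := by
    refine eq_univ_of_forall fun x => ⟨(pZero 1)ᶜ, ⟨1, rfl⟩, fun h => ?_⟩
    have := h x.rep x.rep_nonzero x.mk_rep
    simp at this
  eq_generateFrom := rfl

theorem isClosed_pZero (f : MvPolynomial (Fin n) ℂ) : IsClosed (pZero f) :=
  ⟨TopologicalSpace.isOpen_generateFrom_of_mem ⟨f, rfl⟩⟩

theorem mem_closure_iff_pZero {S : Set (PrV n)} {x : PrV n} :
    x ∈ closure S ↔ ∀ f : MvPolynomial (Fin n) ℂ, S ⊆ pZero f → x ∈ pZero f := by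
  constructor
  · intro h f hf
    exact closure_minimal hf (isClosed_pZero f) h
  · intro h
    rw [isTopologicalBasis_pZero_compl.mem_closure_iff]
    rintro _ ⟨f, rfl⟩ hx
    by_contra hne
    rw [Set.not_nonempty_iff_eq_empty] at hne
    exact hx (h f fun y hy => by
      by_contra hy'
      exact (hne ▸ (⟨hy', hy⟩ : y ∈ (pZero f)ᶜ ∩ S) : y ∈ (∅ : Set (PrV n))))

theorem isIrreducible_of_pZero {S : Set (PrV n)} (hne : S.Nonempty)
    (h : ∀ f g : MvPolynomial (Fin n) ℂ, (∃ x ∈ S, x ∉ pZero f) → (∃ x ∈ S, x ∉ pZero g) →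
      ∃ x ∈ S, x ∉ pZero f ∧ x ∉ pZero g) : IsIrreducible S := by
  refine ⟨hne, ?_⟩
  rintro U V hU hV ⟨x, hxS, hxU⟩ ⟨y, hyS, hyV⟩
  obtain ⟨_, ⟨f, rfl⟩, hxf, hfU⟩ := isTopologicalBasis_pZero_compl.exists_subset_of_mem_open hxU hU
  obtain ⟨_, ⟨g, rfl⟩, hyg, hgV⟩ := isTopologicalBasis_pZero_compl.exists_subset_of_mem_open hyV hV
  obtain ⟨z, hzS, hzf, hzg⟩ := h f g ⟨x, hxS, hxf⟩ ⟨y, hyS, hyg⟩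
  exact ⟨z, hzS, hfU hzf, hgV hzg⟩

theorem exists_ne_zero_eval_ne_zero (hn : 0 < n) {f : MvPolynomial (Fin n) ℂ} (hf : f ≠ 0) :
    ∃ v : Fin n → ℂ, v ≠ 0 ∧ eval v f ≠ 0 := by
  by_contra! hcon
  have h1 : f * X ⟨0, hn⟩ = 0 := MvPolynomial.funext fun v => by
    by_cases hv : v = 0
    · simp [hv]
    · simp [hcon v hv]
  exact (mul_ne_zero hf (X_ne_zero _)) h1

theorem dense_pZero_compl (hn : 0 < n) {f : MvPolynomial (Fin n) ℂ} (hf : f ≠ 0) :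
    Dense (pZero f)ᶜ := by
  intro x
  rw [mem_closure_iff_pZero]
  intro g hg
  by_contra hx
  have hg0 : g ≠ 0 := by
    rintro rfl
    exact hx fun v hv _ => by simp
  obtain ⟨v, hv, hfg⟩ := exists_ne_zero_eval_ne_zero hn (mul_ne_zero hf hg0)
  rw [map_mul] at hfg
  exact mk_notMem_pZero hv (right_ne_zero_of_mul hfg)
    (hg (mk_notMem_pZero hv (left_ne_zero_of_mul hfg)))

theorem isIrreducible_univ_prV (hn : 0 < n) : IsIrreducible (univ : Set (PrV n)) := by
  have : Nonempty (PrV n) := by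
    obtain ⟨v, hv, -⟩ := exists_ne_zero_eval_ne_zero hn (one_ne_zero : (1 : MvPolynomial (Fin n) ℂ) ≠ 0)
    exact ⟨Projectivization.mk ℂ v hv⟩
  refine isIrreducible_of_pZero univ_nonempty ?_
  have h0 : ∀ f : MvPolynomial (Fin n) ℂ, (∃ x ∈ univ, x ∉ pZero f) → f ≠ 0 := by
    rintro f ⟨x, -, hx⟩ rfl
    exact hx fun v hv _ => by simp
  intro f g hf hg
  obtain ⟨v, hv, hfg⟩ := exists_ne_zero_eval_ne_zero hn (mul_ne_zero (h0 f hf) (h0 g hg))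
  rw [map_mul] at hfg
  exact ⟨_, trivial, mk_notMem_pZero hv (left_ne_zero_of_mul hfg),
    mk_notMem_pZero hv (right_ne_zero_of_mul hfg)⟩

theorem mk_mem_lineThrough {x y w : Fin n → ℂ} (hx : x ≠ 0) (hy : y ≠ 0) (hw : w ≠ 0) :
    Projectivization.mk ℂ w hw ∈
      lineThrough (Projectivization.mk ℂ x hx) (Projectivization.mk ℂ y hy) ↔
    ∃ a b : ℂ, w = a • x + b • y := by
  obtain ⟨s, hs⟩ := Projectivization.exists_smul_eq_mk_rep ℂ x hx
  obtain ⟨t, ht⟩ := Projectivization.exists_smul_eq_mk_rep ℂ y hy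
  obtain ⟨q, hq⟩ := Projectivization.exists_smul_eq_mk_rep ℂ w hw
  rw [lineThrough, mem_ofPred_eq, Submodule.mem_span_pair, ← hs, ← ht, ← hq]
  constructor
  · rintro ⟨a, b, h⟩
    refine ⟨(q⁻¹ : ℂˣ) * (a * s), (q⁻¹ : ℂˣ) * (b * t), ?_⟩
    have h2 : w = (q⁻¹ : ℂˣ) • (q • w) := by simp
    rw [h2, ← h]
    simp only [Units.smul_def, smul_add, smul_smul]
  · rintro ⟨a, b, rfl⟩
    refine ⟨q * a * (s⁻¹ : ℂˣ), q * b * (t⁻¹ : ℂˣ), ?_⟩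
    simp only [Units.smul_def, smul_add, smul_smul]
    simp [mul_assoc]

end Topology

section Cone

theorem radial_coeff {n : ℕ} (f : MvPolynomial (Fin n) ℂ) (v : Fin n → ℂ) (d : ℕ) :
    (radial f v).coeff d = eval v (homogeneousComponent d f) := by
  have h1 : ∀ e, radial (homogeneousComponent e f) v =
      Polynomial.C (eval v (homogeneousComponent e f)) * Polynomial.X ^ e := by
    intro e
    refine Polynomial.funext fun t => ?_
    rw [eval_radial]
    have h2 : eval (t • v) (homogeneousComponent e f) = t ^ e * eval v (homogeneousComponent e f) :=
      aeval_smul_homogeneous (homogeneousComponent_isHomogeneous e f) t v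
    rw [h2, Polynomial.eval_mul, Polynomial.eval_C, Polynomial.eval_pow, Polynomial.eval_X,
      mul_comm]
  have h4 : radial f v = ∑ e ∈ Finset.range (f.totalDegree + 1),
      Polynomial.C (eval v (homogeneousComponent e f)) * Polynomial.X ^ e := by
    conv_lhs => rw [← sum_homogeneousComponent f]
    simp_rw [← h1]
    exact map_sum _ _ _
  rw [h4, Polynomial.finsetSum_coeff]
  simp only [Polynomial.coeff_C_mul_X_pow]
  rw [Finset.sum_ite_eq]
  split_ifs with h
  · rfl
  · rw [homogeneousComponent_eq_zero _ _ (by simpa [Nat.lt_succ_iff] using h), map_zero]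

theorem isConical_idealOf {n : ℕ} (Y : Set (PrV n)) : IsConical (idealOf Y) := by
  intro F hF d x hx
  induction x using Projectivization.ind with
  | h v hv =>
    have h1 := (mk_mem_pZero_iff hv).1 (hF hx)
    rw [mk_mem_pZero_iff]
    ext e
    rw [radial_coeff, homogeneousComponent_of_mem (homogeneousComponent_mem d F)]
    split_ifs with h
    · have h2 := congrArg (fun p => Polynomial.coeff p d) h1
      simp only [radial_coeff] at h2
      simpa using h2
    · simp

theorem isZeroOf_idealOf_iff {n : ℕ} {Y : Set (PrV n)} (hY : IsClosed Y) {v : Fin n → ℂ}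
    (hv : v ≠ 0) : IsZeroOf (idealOf Y) v ↔ Projectivization.mk ℂ v hv ∈ Y := by
  constructor
  · intro h
    rw [← hY.closure_eq, mem_closure_iff_pZero]
    intro f hf w hw hwv
    rw [Projectivization.mk_eq_mk_iff'] at hwv
    obtain ⟨t, rfl⟩ := hwv
    exact h.smul (isConical_idealOf Y) t f hf
  · intro h F hF
    exact hF h v hv rfl

theorem isPrime_idealOf {n : ℕ} {Y : Set (PrV n)} (hY : IsIrreducible Y) : (idealOf Y).IsPrime := by
  constructor
  · rw [Ideal.ne_top_iff_one]
    intro h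
    obtain ⟨x, hx⟩ := hY.1
    have := h hx x.rep x.rep_nonzero x.mk_rep
    simp at this
  · intro f g hfg
    have h1 : Y ⊆ pZero f ∪ pZero g := by rw [← pZero_mul]; exact hfg
    exact (isPreirreducible_iff_isClosed_union_isClosed.1 hY.2) _ _ (isClosed_pZero f)
      (isClosed_pZero g) h1

theorem tangentSpace_smul {n : ℕ} {I : Ideal (MvPolynomial (Fin n) ℂ)} (hI : IsConical I)
    {t : ℂ} (ht : t ≠ 0) (v : Fin n → ℂ) : tangentSpace I (t • v) = tangentSpace I v := by
  refine le_antisymm (fun p hp => mem_tangentSpace_of_smul hI ht hp) fun p hp =>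
    mem_tangentSpace_of_smul hI (inv_ne_zero ht) ?_
  rwa [show (fun i => t⁻¹ * (t • v) i) = v from funext fun i => inv_mul_cancel_left₀ ht (v i)]

theorem affTangent_eq_tangentSpace {n : ℕ} (Y : Set (PrV n)) (v : Fin n → ℂ) :
    affTangent Y v = tangentSpace (idealOf Y) v := by
  ext p
  simp only [affTangent, Submodule.mem_iInf, LinearMap.mem_ker]
  refine forall₂_congr fun F hF => ?_
  simp [jacLin, dirDeriv]

theorem isSmoothCone_idealOf {n m : ℕ} {Y : Set (PrV n)} (hcl : IsClosed Y) (hirr : IsIrreducible Y)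
    (hsm : IsSmoothSet Y) (hdim : pdim Y = ((m : ℕ∞) : WithBot ℕ∞)) :
    IsSmoothCone (idealOf Y) m where
  prime := isPrime_idealOf hirr
  conical := isConical_idealOf Y
  mem_of_vanish := by
    intro F hF x hx v hv hvx
    subst hvx
    exact hF v hv ((isZeroOf_idealOf_iff hcl hv).2 hx)
  finrank_tangentSpace := by
    intro v hv hz
    have hx := (isZeroOf_idealOf_iff hcl hv).1 hz
    have h1 := hsm _ hx
    rw [IsSmoothPt, hdim, affTangent_eq_tangentSpace] at h1
    obtain ⟨t, ht⟩ := Projectivization.exists_smul_eq_mk_rep ℂ v hv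
    rw [← ht, Units.smul_def, tangentSpace_smul (isConical_idealOf Y) t.ne_zero] at h1
    exact_mod_cast h1

end Cone

open TensorProduct in
/-- The function field of the product of a smooth cone with itself. -/
theorem IsSmoothCone.exists_isConePair {n m : ℕ} {I : Ideal (MvPolynomial (Fin n) ℂ)}
    (h : IsSmoothCone I m) :
    ∃ (L : Type) (_ : Field L) (_ : Algebra ℂ L) (x y : Fin n → L), IsConePair I m x y := by
  have := h.prime
  have hdom : IsDomain ((MvPolynomial (Fin n) ℂ ⧸ I) ⊗[ℂ] (MvPolynomial (Fin n) ℂ ⧸ I)) :=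
    TensorProduct.isDomain_of_isAlgClosed
  obtain ⟨RY, _, _, c, hc, hcadj, hclift, hdomS, htr⟩ : ∃ (RY : Type) (_ : CommRing RY)
      (_ : Algebra ℂ RY) (c : Fin n → RY), IsZeroOf I c ∧ Algebra.adjoin ℂ (range c) = ⊤ ∧
      (∀ (B : Type) [CommRing B] [Algebra ℂ B] (u : Fin n → B), IsZeroOf I u →
        ∃ f : RY →ₐ[ℂ] B, ∀ i, f (c i) = u i) ∧ IsDomain (RY ⊗[ℂ] RY) ∧
      (((m + 1) + (m + 1) : ℕ) : Cardinal) ≤ Algebra.trdeg ℂ (RY ⊗[ℂ] RY) :=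
    ⟨MvPolynomial (Fin n) ℂ ⧸ I, inferInstance, inferInstance, coordFun I, isZeroOf_coordFun I,
      adjoin_range_coordFun I, fun B _ _ u hu => ⟨hu.lift, hu.lift_coordFun⟩, hdom,
      TensorProduct.add_le_trdeg h.trdeg_eq.ge h.trdeg_eq.ge⟩
  let S := RY ⊗[ℂ] RY
  let L := FractionRing S
  let j : S →ₐ[ℂ] L := IsScalarTower.toAlgHom ℂ S L
  have hj : Function.Injective j := IsFractionRing.injective S L
  let x : Fin n → L := fun i => j (c i ⊗ₜ 1)
  let y : Fin n → L := fun i => j (1 ⊗ₜ c i)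
  have hT : Algebra.adjoin ℂ (range x ∪ range y) = j.range := by
    refine le_antisymm (Algebra.adjoin_le ?_) ?_
    · rintro _ (⟨i, rfl⟩ | ⟨i, rfl⟩)
      · exact ⟨_, rfl⟩
      · exact ⟨_, rfl⟩
    · rintro _ ⟨s, rfl⟩
      change j s ∈ _
      have hl : ∀ a : RY, j (a ⊗ₜ 1) ∈ Algebra.adjoin ℂ (range x ∪ range y) := fun a => by
        have ha : a ∈ Algebra.adjoin ℂ (range c) := hcadj ▸ trivial
        have h1 : (j.comp Algebra.TensorProduct.includeLeft) a ∈
            (Algebra.adjoin ℂ (range c)).map (j.comp Algebra.TensorProduct.includeLeft) :=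
          ⟨a, ha, rfl⟩
        rw [AlgHom.map_adjoin] at h1
        refine Algebra.adjoin_mono ?_ h1
        rintro _ ⟨_, ⟨i, rfl⟩, rfl⟩
        exact Or.inl ⟨i, rfl⟩
      have hr : ∀ a : RY, j (1 ⊗ₜ a) ∈ Algebra.adjoin ℂ (range x ∪ range y) := fun a => by
        have ha : a ∈ Algebra.adjoin ℂ (range c) := hcadj ▸ trivial
        have h1 : (j.comp Algebra.TensorProduct.includeRight) a ∈
            (Algebra.adjoin ℂ (range c)).map (j.comp Algebra.TensorProduct.includeRight) :=
          ⟨a, ha, rfl⟩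
        rw [AlgHom.map_adjoin] at h1
        refine Algebra.adjoin_mono ?_ h1
        rintro _ ⟨_, ⟨i, rfl⟩, rfl⟩
        exact Or.inr ⟨i, rfl⟩
      induction s using TensorProduct.induction_on with
      | zero => rw [map_zero]; exact zero_mem _
      | tmul a b =>
        have h1 : a ⊗ₜ[ℂ] b = (a ⊗ₜ 1) * (1 ⊗ₜ b) := by simp
        rw [h1, map_mul]
        exact mul_mem (hl a) (hr b)
      | add s t hs ht => rw [map_add]; exact add_mem hs ht
  refine ⟨L, inferInstance, inferInstance, x, y, ?_, ?_, ?_, ?_, ?_⟩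
  · exact hc.map (j.comp Algebra.TensorProduct.includeLeft)
  · exact hc.map (j.comp Algebra.TensorProduct.includeRight)
  · rw [hT]
    refine IsFractionRing.of_field _ _ fun l => ?_
    obtain ⟨a, b, -, rfl⟩ := IsFractionRing.div_surjective (A := S) l
    exact ⟨⟨_, a, rfl⟩, ⟨_, b, rfl⟩, rfl⟩
  · refine le_trans ?_ (htr.trans (trdeg_le_of_injective j hj))
    exact_mod_cast (by omega : 2 * m + 2 ≤ (m + 1) + (m + 1))
  · intro B _ _ u v hu hv
    obtain ⟨fu, hfu⟩ := hclift B u hu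
    obtain ⟨fv, hfv⟩ := hclift B v hv
    let e : S ≃ₐ[ℂ] j.range := AlgEquiv.ofInjective j hj
    let f : j.range →ₐ[ℂ] B :=
      (Algebra.TensorProduct.lift fu fv fun _ _ => Commute.all _ _).comp e.symm.toAlgHom
    have hf : ∀ s, f (e s) = Algebra.TensorProduct.lift fu fv (fun _ _ => Commute.all _ _) s :=
      fun s => by simp [f]
    refine ⟨f.comp (Subalgebra.equivOfEq _ _ hT).toAlgHom, fun i => ?_, fun i => ?_⟩
    · refine (hf (c i ⊗ₜ 1)).trans ?_
      rw [Algebra.TensorProduct.lift_tmul, hfu, map_one, mul_one]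
    · refine (hf (1 ⊗ₜ c i)).trans ?_
      rw [Algebra.TensorProduct.lift_tmul, hfv, map_one, one_mul]

section Homogenization

variable {n : ℕ} {k : Fin n}

/-- Homogenization with respect to the variable `X k`. -/
def homogenizeAt (k : Fin n) (F : MvPolynomial {i // i ≠ k} ℂ) : MvPolynomial (Fin n) ℂ :=
  homogenizedEval (rename Subtype.val F) (X k) X

theorem aeval_homogenizeAt (F : MvPolynomial {i // i ≠ k} ℂ) {B : Type} [CommRing B] [Algebra ℂ B]
    {v u : Fin n → B} (huv : ∀ i, v i = v k * u i) :
    aeval v (homogenizeAt k F) =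
      v k ^ (rename (Subtype.val : {i // i ≠ k} → Fin n) F).totalDegree *
        aeval (fun i : {i // i ≠ k} => u i) F := by
  rw [homogenizeAt, map_homogenizedEval]
  simp only [aeval_X]
  have h1 : (fun i => v i) = fun i => v k * u i := funext huv
  rw [h1, homogenizedEval_mul, aeval_rename]
  rfl

theorem homogenizeAt_ne_zero {F : MvPolynomial {i // i ≠ k} ℂ} (hF : F ≠ 0) :
    homogenizeAt k F ≠ 0 := by
  classical
  intro h0
  refine hF (MvPolynomial.funext fun s => ?_)
  let v : Fin n → ℂ := fun i => if hi : i ≠ k then s ⟨i, hi⟩ else 1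
  have hk : v k = 1 := by simp [v]
  have h1 := aeval_homogenizeAt F (v := v) (u := v) (fun i => by rw [hk, one_mul])
  rw [h0, map_zero, hk, one_pow, one_mul] at h1
  have h2 : (fun i : {i // i ≠ k} => v i) = s := by
    funext i
    simp [v, i.2]
  rw [h2] at h1
  rw [map_zero]
  exact h1.symm

/-- Dehomogenization with respect to the variable `X k`. -/
theorem exists_dehomogenize {N : ℕ} {G : MvPolynomial (Fin n) ℂ} (hG : G.IsHomogeneous N) :
    ∃ F : MvPolynomial {i // i ≠ k} ℂ, ∀ (L : Type) [Field L] [Algebra ℂ L] (z : Fin n → L),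
      z k ≠ 0 → aeval z G = z k ^ N * aeval (fun i : {i // i ≠ k} => z i / z k) F := by
  classical
  refine ⟨aeval (fun i => if hi : i ≠ k then X ⟨i, hi⟩ else 1) G, fun L _ _ z hz => ?_⟩
  rw [comp_aeval_apply]
  have h1 : (fun i => aeval (fun i : {i // i ≠ k} => z i / z k)
      (if hi : i ≠ k then X ⟨i, hi⟩ else 1 : MvPolynomial {i // i ≠ k} ℂ)) =
      fun i => z i / z k := by
    funext i
    split_ifs with hi
    · rw [aeval_X]
    · rw [map_one, not_not.1 hi, div_self hz]
  rw [h1, ← aeval_smul_homogeneous hG]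
  congr 2
  funext i
  field_simp

end Homogenization

/-- Pairs of points of the cone whose sum is a nonzero multiple of `v`. -/
def IsSecantPair {n : ℕ} (I : Ideal (MvPolynomial (Fin n) ℂ)) (v p q : Fin n → ℂ) : Prop :=
  IsZeroOf I p ∧ IsZeroOf I q ∧ ∃ t : ℂ, t ≠ 0 ∧ p + q = t • v

section ConePair

variable {n m : ℕ} {I : Ideal (MvPolynomial (Fin n) ℂ)} {L : Type} [Field L] [Algebra ℂ L]
  {x y z : Fin n → L} {k : Fin n}

/-- The field of homogeneous fractions of `z` is algebraically closed in `L`. -/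
theorem IsConePair.exists_fraction (h : IsSmoothCone I m) (hp : IsConePair I m x y)
    (hmn : m + 3 ≤ n) (hnum : 2 * n ≤ 3 * m + 3) (hz : ∀ i, z i = x i + y i)
    (hinj : Function.Injective (aeval z : MvPolynomial (Fin n) ℂ →ₐ[ℂ] L)) {α : L}
    {Q : Polynomial (MvPolynomial {i // i ≠ k} ℂ)} (hQ : Q ≠ 0)
    (hw : Function.Injective (aeval (fun i : {i // i ≠ k} => z i / z k) :
      MvPolynomial {i // i ≠ k} ℂ →ₐ[ℂ] L))
    (hα : Q.eval₂ ((aeval (fun i : {i // i ≠ k} => z i / z k) :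
      MvPolynomial {i // i ≠ k} ℂ →ₐ[ℂ] L) : MvPolynomial {i // i ≠ k} ℂ →+* L) α = 0) :
    ∃ p q : MvPolynomial {i // i ≠ k} ℂ, q ≠ 0 ∧
      α * aeval (fun i : {i // i ≠ k} => z i / z k) q =
        aeval (fun i : {i // i ≠ k} => z i / z k) p := by
  have hzk : z k ≠ 0 := by
    intro h0
    exact X_ne_zero (R := ℂ) k (hinj (by rw [aeval_X, h0, map_zero]))
  let B := Algebra.adjoin ℂ (range fun i => z i / z k)
  let w' : {i // i ≠ k} → B := fun i => ⟨z i / z k, Algebra.subset_adjoin ⟨i, rfl⟩⟩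
  let ρ : MvPolynomial {i // i ≠ k} ℂ →ₐ[ℂ] B := aeval w'
  have hρ : ∀ F, ((ρ F : B) : L) = aeval (fun i : {i // i ≠ k} => z i / z k) F := fun F => by
    exact comp_aeval_apply B.val (f := w') F
  have hρinj : Function.Injective ρ := fun F G hFG => hw (by rw [← hρ, ← hρ, hFG])
  have halg : IsAlgebraic B α := by
    refine ⟨Q.map (ρ : _ →+* B), (Polynomial.map_ne_zero_iff hρinj).2 hQ, ?_⟩
    rw [Polynomial.aeval_def, Polynomial.eval₂_map, ← hα]
    congr 1
    exact RingHom.ext hρ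
  obtain ⟨N, G, H, hG, hH, hH0, hGH⟩ := hp.exists_ratio h hmn hnum hz hinj halg
  obtain ⟨p, hpG⟩ := exists_dehomogenize (k := k) hG
  obtain ⟨q, hqH⟩ := exists_dehomogenize (k := k) hH
  refine ⟨p, q, ?_, ?_⟩
  · rintro rfl
    have h1 := hqH L z hzk
    rw [map_zero, mul_zero] at h1
    exact hH0 (hinj (by rw [h1, map_zero]))
  · rw [hpG L z hzk, hqH L z hzk, mul_left_comm] at hGH
    exact mul_left_cancel₀ (pow_ne_zero N hzk) hGH

/-- Irreducibility of the space of secant pairs through a generic point. -/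
theorem IsConePair.exists_irreducible_secantPairs (h : IsSmoothCone I m)
    (hp : IsConePair I m x y) (hmn : m + 3 ≤ n) (hnum : 2 * n ≤ 3 * m + 3)
    (hz : ∀ i, z i = x i + y i)
    (hinj : Function.Injective (aeval z : MvPolynomial (Fin n) ℂ →ₐ[ℂ] L)) :
    ∃ E : MvPolynomial (Fin n) ℂ, E ≠ 0 ∧ ∀ v, eval v E ≠ 0 →
      (∃ p q, IsSecantPair I v p q) ∧ ∀ f g : MvPolynomial (Fin n ⊕ Fin n) ℂ,
        (∃ p q, IsSecantPair I v p q ∧ eval (Sum.elim p q) f ≠ 0) →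
        (∃ p q, IsSecantPair I v p q ∧ eval (Sum.elim p q) g ≠ 0) →
        ∃ p q, IsSecantPair I v p q ∧ eval (Sum.elim p q) f ≠ 0 ∧ eval (Sum.elim p q) g ≠ 0 := by
  classical
  let k : Fin n := ⟨0, by omega⟩
  have hzk : z k ≠ 0 := by
    intro h0
    exact X_ne_zero (R := ℂ) k (hinj (by rw [aeval_X, h0, map_zero]))
  have hw : Function.Injective (aeval (fun i : {i // i ≠ k} => z i / z k) :
      MvPolynomial {i // i ≠ k} ℂ →ₐ[ℂ] L) := by
    rw [injective_iff_map_eq_zero]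
    intro F hF
    by_contra hF0
    refine homogenizeAt_ne_zero hF0 (hinj ?_)
    rw [aeval_homogenizeAt F (v := z) (u := fun i => z i / z k) (fun i => by field_simp), hF,
      mul_zero, map_zero]
  obtain ⟨B₀, hB₀⟩ : ∃ B : Subalgebra ℂ L, B = Algebra.adjoin ℂ (range x ∪ range y) := ⟨_, rfl⟩
  have hx₀ : ∀ i, x i ∈ B₀ := fun i => hB₀ ▸ Algebra.subset_adjoin (Or.inl ⟨i, rfl⟩)
  have hy₀ : ∀ i, y i ∈ B₀ := fun i => hB₀ ▸ Algebra.subset_adjoin (Or.inr ⟨i, rfl⟩)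
  have hz₀ : ∀ i, z i ∈ B₀ := fun i => hz i ▸ B₀.add_mem (hx₀ i) (hy₀ i)
  have hlift : ∀ p q : Fin n → ℂ, IsZeroOf I p → IsZeroOf I q → ∃ f : B₀ →ₐ[ℂ] ℂ,
      (∀ i, f ⟨x i, hx₀ i⟩ = p i) ∧ ∀ i, f ⟨y i, hy₀ i⟩ = q i := by
    subst hB₀
    exact hp.exists_lift ℂ
  obtain ⟨T, hT⟩ : ∃ T : Subalgebra ℂ L,
    T = Algebra.adjoin ℂ (range x ∪ range y ∪ {(z k)⁻¹}) := ⟨_, rfl⟩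
  have hBT : B₀ ≤ T := by
    rw [hB₀, hT]
    exact Algebra.adjoin_mono subset_union_left
  have hkT : (z k)⁻¹ ∈ T := hT ▸ Algebra.subset_adjoin (Or.inr rfl)
  have hpow : ∀ l ∈ T, ∃ N : ℕ, z k ^ N * l ∈ B₀ := by
    intro l hl
    rw [hT] at hl
    refine exists_pow_mul_mem (hz₀ k) ?_ hl
    rintro _ ((⟨i, rfl⟩ | ⟨i, rfl⟩) | rfl)
    · exact ⟨0, by simpa using hx₀ i⟩
    · exact ⟨0, by simpa using hy₀ i⟩
    · exact ⟨1, by rw [pow_one, mul_inv_cancel₀ hzk]; exact B₀.one_mem⟩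
  have hft : Algebra.FiniteType ℂ T := by
    rw [hT]
    exact finiteType_adjoin_of_finite
      (((finite_range x).union (finite_range y)).union (finite_singleton _))
  have hfrac : IsFractionRing T L := by
    have h0 := hp.isFractionRing
    rw [← hB₀] at h0
    refine IsFractionRing.of_field _ _ fun l => ?_
    obtain ⟨a, b, -, rfl⟩ := IsFractionRing.div_surjective (A := B₀) l
    exact ⟨⟨a, hBT a.2⟩, ⟨b, hBT b.2⟩, rfl⟩
  let w' : {i // i ≠ k} → T := fun i => ⟨z i / z k, by
    rw [div_eq_mul_inv]; exact T.mul_mem (hBT (hz₀ i)) hkT⟩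
  let _ : Algebra (MvPolynomial {i // i ≠ k} ℂ) T :=
    ((aeval w' : MvPolynomial {i // i ≠ k} ℂ →ₐ[ℂ] T) : _ →+* T).toAlgebra
  let _ : Algebra (MvPolynomial {i // i ≠ k} ℂ) L :=
    ((aeval (fun i : {i // i ≠ k} => z i / z k) : MvPolynomial {i // i ≠ k} ℂ →ₐ[ℂ] L) :
      _ →+* L).toAlgebra
  have hval : ∀ F, ((aeval w' F : T) : L) = aeval (fun i : {i // i ≠ k} => z i / z k) F :=
    fun F => comp_aeval_apply T.val (f := w') F
  have : IsScalarTower (MvPolynomial {i // i ≠ k} ℂ) T L :=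
    IsScalarTower.of_algebraMap_eq fun F => (hval F).symm
  have : IsScalarTower ℂ (MvPolynomial {i // i ≠ k} ℂ) T :=
    IsScalarTower.of_algebraMap_eq fun c =>
      ((aeval w' : MvPolynomial {i // i ≠ k} ℂ →ₐ[ℂ] T).commutes c).symm
  have : FaithfulSMul (MvPolynomial {i // i ≠ k} ℂ) T := by
    rw [faithfulSMul_iff_algebraMap_injective]
    intro F G hFG
    refine hw ?_
    rw [← hval, ← hval]
    exact congrArg Subtype.val hFG
  obtain ⟨e, he, hfib⟩ := exists_irreducible_fibre (A := MvPolynomial {i // i ≠ k} ℂ) (R := T)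
    (L := L) (a := X) (by simp [adjoin_range_X]) (algebraicIndependent_X _ _) (by
      rintro α ⟨Q, hQ, hQα⟩
      exact hp.exists_fraction h hmn hnum hz hinj hQ hw hQα)
  refine ⟨X k * homogenizeAt k e, mul_ne_zero (X_ne_zero k) (homogenizeAt_ne_zero he), ?_⟩
  intro v hv
  rw [map_mul, eval_X] at hv
  have hvk : v k ≠ 0 := left_ne_zero_of_mul hv
  have hve : aeval (fun i : {i // i ≠ k} => v i / v k) e ≠ 0 := by
    intro h0
    have h1 : eval v (homogenizeAt k e) = _ :=
      aeval_homogenizeAt e (v := v) (u := fun i => v i / v k) (fun i => by field_simp)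
    rw [h0, mul_zero] at h1
    exact right_ne_zero_of_mul hv h1
  have hbasept : ∀ φ : T →ₐ[ℂ] ℂ,
      (∀ b, φ (algebraMap (MvPolynomial {i // i ≠ k} ℂ) T b) =
        (aeval (fun i : {i // i ≠ k} => v i / v k) : _ →ₐ[ℂ] ℂ) b) ↔
      ∀ i : {i // i ≠ k}, φ (w' i) = v i / v k := by
    intro φ
    constructor
    · intro hφ i
      have h1 := hφ (X i)
      rw [aeval_X] at h1
      rw [← h1]
      congr 1
      exact (aeval_X w' i).symm
    · intro hφ b
      have h1 := comp_aeval_apply (f := w') φ b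
      refine h1.trans ?_
      rw [show (fun i => φ (w' i)) = fun i : {i // i ≠ k} => v i / v k from funext hφ]
  let x' : Fin n → T := fun i => ⟨x i, hBT (hx₀ i)⟩
  let y' : Fin n → T := fun i => ⟨y i, hBT (hy₀ i)⟩
  have hdown : ∀ φ : T →ₐ[ℂ] ℂ,
      (∀ b, φ (algebraMap (MvPolynomial {i // i ≠ k} ℂ) T b) =
        (aeval (fun i : {i // i ≠ k} => v i / v k) : _ →ₐ[ℂ] ℂ) b) →
      IsSecantPair I v (fun i => φ (x' i)) (fun i => φ (y' i)) := by
    intro φ hφ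
    rw [hbasept] at hφ
    have hx' : IsZeroOf I x' := fun F hF => Subtype.ext
      ((comp_aeval_apply T.val (f := x') F).trans (hp.left F hF))
    have hy' : IsZeroOf I y' := fun F hF => Subtype.ext
      ((comp_aeval_apply T.val (f := y') F).trans (hp.right F hF))
    have hk1 : (x' k + y' k) * (⟨(z k)⁻¹, hkT⟩ : T) = 1 := Subtype.ext (by
      change (x k + y k) * (z k)⁻¹ = 1
      rw [← hz, mul_inv_cancel₀ hzk])
    have hk2 : φ (x' k + y' k) ≠ 0 := by
      intro h0
      have h1 := congrArg φ hk1
      rw [map_mul, h0, zero_mul, map_one] at h1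
      exact zero_ne_one h1
    refine ⟨hx'.map φ, hy'.map φ, φ (x' k + y' k) / v k, div_ne_zero hk2 hvk, ?_⟩
    funext i
    change φ (x' i) + φ (y' i) = φ (x' k + y' k) / v k * v i
    rw [← map_add]
    by_cases hi : i = k
    · rw [hi, div_mul_cancel₀ _ hvk]
    · have h1 : x' i + y' i = (x' k + y' k) * w' ⟨i, hi⟩ := Subtype.ext (by
        change x i + y i = (x k + y k) * (z i / z k)
        rw [← hz, ← hz]
        field_simp)
      rw [h1, map_mul, hφ ⟨i, hi⟩]
      ring
  have hup : ∀ p q, IsSecantPair I v p q → ∃ φ : T →ₐ[ℂ] ℂ,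
      (∀ b, φ (algebraMap (MvPolynomial {i // i ≠ k} ℂ) T b) =
        (aeval (fun i : {i // i ≠ k} => v i / v k) : _ →ₐ[ℂ] ℂ) b) ∧
      (∀ i, φ (x' i) = p i) ∧ ∀ i, φ (y' i) = q i := by
    rintro p q ⟨hpI, hqI, t, ht, hpq⟩
    obtain ⟨f, hfx, hfy⟩ := hlift p q hpI hqI
    have hfz : ∀ i, f ⟨z i, hz₀ i⟩ = t * v i := fun i => by
      have h1 : (⟨z i, hz₀ i⟩ : B₀) = ⟨x i, hx₀ i⟩ + ⟨y i, hy₀ i⟩ := Subtype.ext (hz i)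
      rw [h1, map_add, hfx, hfy]
      exact congrFun hpq i
    obtain ⟨β, hβ⟩ := exists_extend_localization B₀ T (c := ⟨z k, hz₀ k⟩) (f : B₀ →+* ℂ)
      (by
        change f ⟨z k, hz₀ k⟩ ≠ 0
        rw [hfz]
        exact mul_ne_zero ht hvk) hpow
    have hβ₀ : ∀ (l : T) (b : B₀), (l : L) = b → β l = f b := fun l b hlb => by
      have h1 := hβ l 0 b (by rw [pow_zero, one_mul, hlb])
      rwa [pow_zero, one_mul] at h1
    let φ : T →ₐ[ℂ] ℂ := { β with
      commutes' := fun c => (hβ₀ (algebraMap ℂ T c) (algebraMap ℂ B₀ c) rfl).trans (f.commutes c) }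
    refine ⟨φ, (hbasept φ).2 fun i => ?_, fun i => (hβ₀ (x' i) _ rfl).trans (hfx i),
      fun i => (hβ₀ (y' i) _ rfl).trans (hfy i)⟩
    have h2 := hβ (w' i) 1 ⟨z i, hz₀ i⟩ (by
      change z k ^ 1 * (z i / z k) = z i
      field_simp)
    have h3 : f ⟨z k, hz₀ k⟩ ^ 1 * β (w' i) = f ⟨z i, hz₀ i⟩ := h2
    rw [hfz, hfz, pow_one] at h3
    change β (w' i) = v i / v k
    rw [eq_div_iff hvk]
    apply mul_left_cancel₀ ht
    linear_combination h3
  have hev : ∀ (φ : T →ₐ[ℂ] ℂ) (f : MvPolynomial (Fin n ⊕ Fin n) ℂ),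
      φ (aeval (Sum.elim x' y') f) =
        eval (Sum.elim (fun i => φ (x' i)) (fun i => φ (y' i))) f := by
    intro φ f
    refine (comp_aeval_apply (f := Sum.elim x' y') φ f).trans ?_
    rw [show (fun i => φ (Sum.elim x' y' i)) =
      Sum.elim (fun i => φ (x' i)) (fun i => φ (y' i)) from by funext i; cases i <;> rfl]
    rfl
  obtain ⟨⟨φ, hφ⟩, hpair⟩ := hfib _ hve
  refine ⟨⟨_, _, hdown φ hφ⟩, fun f g hf hg => ?_⟩
  have hpt : ∀ f : MvPolynomial (Fin n ⊕ Fin n) ℂ,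
      (∃ p q, IsSecantPair I v p q ∧ eval (Sum.elim p q) f ≠ 0) → ∃ φ : T →ₐ[ℂ] ℂ,
      (∀ b, φ (algebraMap (MvPolynomial {i // i ≠ k} ℂ) T b) =
        (aeval (fun i : {i // i ≠ k} => v i / v k) : _ →ₐ[ℂ] ℂ) b) ∧
      φ (aeval (Sum.elim x' y') f) ≠ 0 := by
    rintro f ⟨p, q, hpq, hne⟩
    obtain ⟨φ, hφ, hφx, hφy⟩ := hup p q hpq
    refine ⟨φ, hφ, ?_⟩
    rwa [hev, funext hφx, funext hφy]
  obtain ⟨χ, hχ, hχf, hχg⟩ := hpair _ _ (hpt f hf) (hpt g hg)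
  rw [hev] at hχf hχg
  exact ⟨_, _, hdown χ hχ, hχf, hχg⟩

end ConePair

section Secants

variable {r : ℕ} {Y : Set (Pr r)}

/-- The union of the secant lines of `Y` through `z`. -/
def secantLines (Y : Set (Pr r)) (z : Pr r) : Set (Pr r) :=
  ⋃ x ∈ Y, ⋃ y ∈ Y, ⋃ _ : x ≠ y, ⋃ _ : z ∈ lineThrough x y, lineThrough x y

theorem mem_secantLines {z w : Pr r} : w ∈ secantLines Y z ↔
    ∃ x ∈ Y, ∃ y ∈ Y, x ≠ y ∧ z ∈ lineThrough x y ∧ w ∈ lineThrough x y := by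
  simp only [secantLines, mem_iUnion, exists_prop]

theorem exists_ne_of_secantVariety_eq_univ (hY : secantVariety Y = univ) :
    ∃ x ∈ Y, ∃ y ∈ Y, x ≠ y := by
  by_contra! hcon
  have h1 : (⋃ x ∈ Y, ⋃ y ∈ Y, ⋃ _ : x ≠ y, lineThrough x y) = ∅ := by
    simp only [iUnion_eq_empty]
    exact fun x hx y hy hxy => absurd (hcon x hx y hy) hxy
  rw [secantVariety, h1, closure_empty] at hY
  obtain ⟨x, hx⟩ := (isIrreducible_univ_prV (n := r + 1) r.succ_pos).1
  rw [← hY] at hx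
  exact hx

/-- Sums of pairs of points of the cone are dense if the secant variety is the whole space. -/
theorem injective_aeval_add (hY : secantVariety Y = univ) (hcl : IsClosed Y) {m : ℕ} {L : Type}
    [Field L] [Algebra ℂ L] {x y z : Fin (r + 1) → L} (hp : IsConePair (idealOf Y) m x y)
    (hz : ∀ i, z i = x i + y i) :
    Function.Injective (aeval z : MvPolynomial (Fin (r + 1)) ℂ →ₐ[ℂ] L) := by
  rw [injective_iff_map_eq_zero]
  intro F hF
  by_contra hF0
  have hadd : ∀ p q : Fin (r + 1) → ℂ, IsZeroOf (idealOf Y) p → IsZeroOf (idealOf Y) q →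
      eval (p + q) F = 0 := by
    intro p q hpI hqI
    obtain ⟨f, hfx, hfy⟩ := hp.exists_lift ℂ p q hpI hqI
    let z' : Fin (r + 1) → Algebra.adjoin ℂ (range x ∪ range y) := fun i =>
      ⟨x i, Algebra.subset_adjoin (Or.inl ⟨i, rfl⟩)⟩ + ⟨y i, Algebra.subset_adjoin (Or.inr ⟨i, rfl⟩)⟩
    have h1 : aeval z' F = 0 := by
      refine Subtype.ext ((comp_aeval_apply (Subalgebra.val _) (f := z') F).trans ?_)
      rw [show (fun i => (Subalgebra.val _) (z' i)) = z from funext fun i => (hz i).symm, hF]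
      rfl
    have h2 := comp_aeval_apply (f := z') f F
    rw [h1, map_zero, show (fun i => f (z' i)) = p + q from funext fun i => by
      change f (_ + _) = _
      rw [map_add, hfx, hfy]; rfl] at h2
    exact h2.symm
  have hsub : (⋃ x ∈ Y, ⋃ y ∈ Y, ⋃ _ : x ≠ y, lineThrough x y) ⊆ pZero F := by
    intro w hw
    simp only [mem_iUnion, exists_prop] at hw
    obtain ⟨x, hx, y, hy, -, hw⟩ := hw
    intro v hv hvw
    subst hvw
    induction x using Projectivization.ind with
    | h x hx0 =>
      induction y using Projectivization.ind with
      | h y hy0 =>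
        rw [mk_mem_lineThrough] at hw
        obtain ⟨a, b, rfl⟩ := hw
        exact hadd _ _ (((isZeroOf_idealOf_iff hcl hx0).2 hx).smul (isConical_idealOf Y) a)
          (((isZeroOf_idealOf_iff hcl hy0).2 hy).smul (isConical_idealOf Y) b)
  have h3 := closure_minimal hsub (isClosed_pZero F)
  rw [show closure _ = secantVariety Y from rfl, hY] at h3
  obtain ⟨v, hv, hvF⟩ := exists_ne_zero_eval_ne_zero r.succ_pos hF0
  exact mk_notMem_pZero hv hvF (h3 trivial)

/-- A polynomial in two sets of variables computing `f (a p + b q)`. -/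
theorem exists_eval_sumElim {n : ℕ} (f : MvPolynomial (Fin n) ℂ) (a b : ℂ) :
    ∃ F : MvPolynomial (Fin n ⊕ Fin n) ℂ, ∀ p q : Fin n → ℂ,
      eval (Sum.elim p q) F = eval (a • p + b • q) f := by
  refine ⟨aeval (fun i => C a * X (Sum.inl i) + C b * X (Sum.inr i)) f, fun p q => ?_⟩
  refine (comp_aeval_apply (aeval (Sum.elim p q) : _ →ₐ[ℂ] ℂ)
    (f := fun i => C a * X (Sum.inl i) + C b * X (Sum.inr i)) f).trans ?_
  rw [show (fun i => aeval (Sum.elim p q) (C a * X (Sum.inl i) + C b * X (Sum.inr i) :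
    MvPolynomial (Fin n ⊕ Fin n) ℂ)) = a • p + b • q from funext fun i => by simp]
  rfl

/-- Two polynomials, neither vanishing identically on a plane, have a common nonvanishing
combination. -/
theorem exists_common_combination {n : ℕ} {f g : MvPolynomial (Fin n) ℂ} {p q : Fin n → ℂ}
    (hpq : LinearIndependent ℂ ![p, q]) {a b a' b' : ℂ} (hf : eval (a • p + b • q) f ≠ 0)
    (hg : eval (a' • p + b' • q) g ≠ 0) :
    ∃ c d : ℂ, c • p + d • q ≠ 0 ∧ eval (c • p + d • q) f ≠ 0 ∧ eval (c • p + d • q) g ≠ 0 := by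
  let ℓ : Fin n → MvPolynomial (Fin 2) ℂ := fun i => C (p i) * X 0 + C (q i) * X 1
  have hℓ : ∀ (f : MvPolynomial (Fin n) ℂ) (c : Fin 2 → ℂ),
      eval c (aeval ℓ f) = eval (c 0 • p + c 1 • q) f := by
    intro f c
    refine (comp_aeval_apply (aeval c : _ →ₐ[ℂ] ℂ) (f := ℓ) f).trans ?_
    rw [show (fun i => aeval c (ℓ i)) = c 0 • p + c 1 • q from funext fun i => by
      simp [ℓ, mul_comm]]
    rfl
  have hf0 : aeval ℓ f ≠ 0 := fun h0 => hf (by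
    have := hℓ f ![a, b]
    rw [h0, map_zero] at this
    exact this.symm)
  have hg0 : aeval ℓ g ≠ 0 := fun h0 => hg (by
    have := hℓ g ![a', b']
    rw [h0, map_zero] at this
    exact this.symm)
  obtain ⟨c, hc, hcfg⟩ := exists_ne_zero_eval_ne_zero two_pos (mul_ne_zero hf0 hg0)
  rw [map_mul, hℓ, hℓ] at hcfg
  refine ⟨c 0, c 1, fun h0 => hc ?_, left_ne_zero_of_mul hcfg, right_ne_zero_of_mul hcfg⟩
  have := LinearIndependent.pair_iff.1 hpq (c 0) (c 1) h0
  funext i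
  fin_cases i
  · exact this.1
  · exact this.2

theorem linearIndependent_of_isSecantPair {n : ℕ} {I : Ideal (MvPolynomial (Fin n) ℂ)}
    (hI : IsConical I) {v p q : Fin n → ℂ} (hv : ¬ IsZeroOf I v) (h : IsSecantPair I v p q) :
    LinearIndependent ℂ ![p, q] := by
  obtain ⟨hp, hq, t, ht, hpq⟩ := h
  have hv' : v = t⁻¹ • (p + q) := by rw [hpq, smul_smul, inv_mul_cancel₀ ht, one_smul]
  by_contra hdep
  refine hv ?_
  rw [LinearIndependent.pair_iff] at hdep
  push Not at hdep
  obtain ⟨a, b, hab, hne⟩ := hdep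
  by_cases ha : a = 0
  · have hb : b ≠ 0 := hne ha
    rw [ha, zero_smul, zero_add] at hab
    have hq0 : q = 0 := (smul_eq_zero.1 hab).resolve_left hb
    rw [hv', hq0, add_zero]
    exact hp.smul hI _
  · have hp' : p = (-(b / a)) • q := by
      have h1 : a • p = -(b • q) := eq_neg_of_add_eq_zero_left hab
      rw [← inv_smul_smul₀ ha p, h1, smul_neg, smul_smul, neg_smul, div_eq_inv_mul]
    rw [hv', hp', show (-(b / a)) • q + q = (-(b / a) + 1) • q by rw [add_smul, one_smul],
      smul_smul]
    exact hq.smul hI _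

theorem isIrreducible_secantCone_of_pairs (hcl : IsClosed Y) {v : Fin (r + 1) → ℂ} (hv : v ≠ 0)
    (hvY : ¬ IsZeroOf (idealOf Y) v) (hne : ∃ p q, IsSecantPair (idealOf Y) v p q)
    (hirr : ∀ f g : MvPolynomial (Fin (r + 1) ⊕ Fin (r + 1)) ℂ,
        (∃ p q, IsSecantPair (idealOf Y) v p q ∧ eval (Sum.elim p q) f ≠ 0) →
        (∃ p q, IsSecantPair (idealOf Y) v p q ∧ eval (Sum.elim p q) g ≠ 0) →
        ∃ p q, IsSecantPair (idealOf Y) v p q ∧ eval (Sum.elim p q) f ≠ 0 ∧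
          eval (Sum.elim p q) g ≠ 0) :
    IsIrreducible (secantCone Y (Projectivization.mk ℂ v hv)) := by
  have hI := isConical_idealOf Y
  rw [show secantCone Y (Projectivization.mk ℂ v hv) =
    closure (secantLines Y (Projectivization.mk ℂ v hv)) from rfl, isIrreducible_iff_closure]
  have hline : ∀ p q, IsSecantPair (idealOf Y) v p q → ∀ (c d : ℂ) (hw : c • p + d • q ≠ 0),
      Projectivization.mk ℂ _ hw ∈ secantLines Y (Projectivization.mk ℂ v hv) := by
    intro p q h c d hw
    have hli := linearIndependent_of_isSecantPair hI hvY h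
    obtain ⟨hp, hq, t, ht, hpq⟩ := h
    have hp0 : p ≠ 0 := hli.ne_zero 0
    have hq0 : q ≠ 0 := hli.ne_zero 1
    rw [mem_secantLines]
    refine ⟨_, (isZeroOf_idealOf_iff hcl hp0).1 hp, _, (isZeroOf_idealOf_iff hcl hq0).1 hq,
      fun heq => ?_, (mk_mem_lineThrough hp0 hq0 hv).2 ⟨t⁻¹, t⁻¹, ?_⟩,
      (mk_mem_lineThrough hp0 hq0 hw).2 ⟨c, d, rfl⟩⟩
    · rw [Projectivization.mk_eq_mk_iff'] at heq
      obtain ⟨s, hs⟩ := heq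
      have := LinearIndependent.pair_iff.1 hli 1 (-s) (by rw [one_smul, neg_smul, hs, add_neg_cancel])
      exact one_ne_zero this.1
    · rw [← smul_add, hpq, smul_smul, inv_mul_cancel₀ ht, one_smul]
  have hpair : ∀ w ∈ secantLines Y (Projectivization.mk ℂ v hv), ∀ (w' : Fin (r + 1) → ℂ)
      (hw' : w' ≠ 0), Projectivization.mk ℂ w' hw' = w →
      ∃ p q, IsSecantPair (idealOf Y) v p q ∧ ∃ a b : ℂ, w' = a • p + b • q := by
    rintro _ hw w hw0 rfl
    rw [mem_secantLines] at hw
    obtain ⟨x, hx, y, hy, -, hzl, hwl⟩ := hw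
    induction x using Projectivization.ind with
    | h x hx0 =>
      induction y using Projectivization.ind with
      | h y hy0 =>
        rw [mk_mem_lineThrough] at hzl hwl
        obtain ⟨a, b, hab⟩ := hzl
        obtain ⟨c, d, hcd⟩ := hwl
        have hxI := (isZeroOf_idealOf_iff hcl hx0).2 hx
        have hyI := (isZeroOf_idealOf_iff hcl hy0).2 hy
        have ha : a ≠ 0 := by
          rintro rfl
          rw [zero_smul, zero_add] at hab
          exact hvY (hab ▸ hyI.smul hI b)
        have hb : b ≠ 0 := by
          rintro rfl
          rw [zero_smul, add_zero] at hab
          exact hvY (hab ▸ hxI.smul hI a)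
        refine ⟨a • x, b • y, ⟨hxI.smul hI a, hyI.smul hI b, 1, one_ne_zero, by
          rw [one_smul, hab]⟩, c / a, d / b, ?_⟩
        rw [smul_smul, smul_smul, div_mul_cancel₀ _ ha, div_mul_cancel₀ _ hb, hcd]
  have hnv : ∀ f, (∃ x ∈ secantLines Y (Projectivization.mk ℂ v hv), x ∉ pZero f) →
      ∃ (a b : ℂ) (p q : Fin (r + 1) → ℂ), IsSecantPair (idealOf Y) v p q ∧
        eval (a • p + b • q) f ≠ 0 := by
    rintro f ⟨w, hw, hwf⟩
    obtain ⟨w', hw', rfl, hf⟩ := exists_lift_of_notMem_pZero hwf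
    obtain ⟨p, q, hpq, a, b, rfl⟩ := hpair _ hw w' hw' rfl
    exact ⟨a, b, p, q, hpq, hf⟩
  refine isIrreducible_of_pZero ?_ ?_
  · obtain ⟨p, q, hpq⟩ := hne
    have hp0 := (linearIndependent_of_isSecantPair hI hvY hpq).ne_zero 0
    exact ⟨_, hline p q hpq 1 0 (by simpa using hp0)⟩
  · intro f g hf hg
    obtain ⟨a, b, p, q, hpq, hpqf⟩ := hnv f hf
    obtain ⟨a', b', p', q', hpq', hpqg⟩ := hnv g hg
    obtain ⟨F, hF⟩ := exists_eval_sumElim f a b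
    obtain ⟨G, hG⟩ := exists_eval_sumElim g a' b'
    obtain ⟨P, Q, hPQ, hPF, hPG⟩ := hirr F G ⟨p, q, hpq, by rwa [hF]⟩ ⟨p', q', hpq', by rwa [hG]⟩
    rw [hF] at hPF
    rw [hG] at hPG
    obtain ⟨c, d, hcd, hcf, hcg⟩ := exists_common_combination
      (linearIndependent_of_isSecantPair hI hvY hPQ) hPF hPG
    exact ⟨_, hline P Q hPQ c d hcd, mk_notMem_pZero hcd hcf, mk_notMem_pZero hcd hcg⟩

/-- The case of codimension at least two. -/
theorem isc_of_codim_ge_two {m : ℕ} (hcl : IsClosed Y) (h : IsSmoothCone (idealOf Y) m)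
    (hY : secantVariety Y = univ) (hI0 : idealOf Y ≠ ⊥) (hmn : m + 3 ≤ r + 1)
    (hnum : 2 * (r + 1) ≤ 3 * m + 3) : ISC Y := by
  obtain ⟨L, _, _, x, y, hp⟩ := h.exists_isConePair
  obtain ⟨E, hE, hfib⟩ := hp.exists_irreducible_secantPairs h hmn hnum
    (z := fun i => x i + y i) (fun i => rfl) (injective_aeval_add hY hcl hp fun i => rfl)
  obtain ⟨F, hF, hF0⟩ := Submodule.exists_mem_ne_zero_of_ne_bot hI0
  refine ⟨(pZero (E * F))ᶜ, (isClosed_pZero _).isOpen_compl,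
    dense_pZero_compl r.succ_pos (mul_ne_zero hE hF0), fun z hz => ?_⟩
  obtain ⟨v, hv, rfl, hEF⟩ := exists_lift_of_notMem_pZero hz
  rw [map_mul] at hEF
  obtain ⟨hne, hirr⟩ := hfib v (left_ne_zero_of_mul hEF)
  exact isIrreducible_secantCone_of_pairs hcl hv
    (fun hvI => right_ne_zero_of_mul hEF (hvI F hF)) hne hirr

end Secants

section Hypersurface

variable {n : ℕ}

/-- The restriction of `F` to the line `y + τ v`. -/
def restrictLine (F : MvPolynomial (Fin n) ℂ) (y v : Fin n → ℂ) : Polynomial ℂ :=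
  aeval (fun i => Polynomial.C (y i) + Polynomial.X * Polynomial.C (v i)) F

theorem eval_restrictLine (F : MvPolynomial (Fin n) ℂ) (y v : Fin n → ℂ) (t : ℂ) :
    (restrictLine F y v).eval t = eval (y + t • v) F := by
  have h := comp_aeval_apply (f := fun i => Polynomial.C (y i) + Polynomial.X * Polynomial.C (v i))
    (Polynomial.aeval t : Polynomial ℂ →ₐ[ℂ] ℂ) F
  rw [restrictLine, ← Polynomial.coe_aeval_eq_eval]
  refine h.trans ?_
  rw [show (fun i => Polynomial.aeval t (Polynomial.C (y i) + Polynomial.X * Polynomial.C (v i))) =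
    y + t • v from funext fun i => by
      rw [map_add, map_mul, Polynomial.aeval_C, Polynomial.aeval_C, Polynomial.aeval_X]; rfl]
  rfl

/-- A homogeneous polynomial whose restriction to a line in direction `v` is a monomial of lower
degree vanishes at `v`. -/
theorem eval_eq_zero_of_restrictLine {F : MvPolynomial (Fin n) ℂ} {d : ℕ} (hF : F.IsHomogeneous d)
    {y v : Fin n → ℂ} {a : ℂ} {j : ℕ} (hj : j < d)
    (h : ∀ t, eval (y + t • v) F = a * t ^ j) : eval v F = 0 := by
  have h1 : restrictLine F v y - Polynomial.C a * Polynomial.X ^ (d - j) = 0 := by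
    refine Polynomial.eq_zero_of_forall_ne_zero fun s hs => ?_
    rw [Polynomial.eval_sub, eval_restrictLine, Polynomial.eval_mul, Polynomial.eval_C,
      Polynomial.eval_pow, Polynomial.eval_X, sub_eq_zero]
    have h2 : eval (s • (y + s⁻¹ • v)) F = s ^ d * eval (y + s⁻¹ • v) F :=
      aeval_smul_homogeneous hF s (y + s⁻¹ • v)
    rw [smul_add, smul_smul, mul_inv_cancel₀ hs, one_smul, add_comm, h] at h2
    rw [h2, ← Nat.sub_add_cancel hj.le, pow_add, Nat.add_sub_cancel, inv_pow]
    field_simp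
  have h3 := congrArg (Polynomial.eval 0) h1
  rw [Polynomial.eval_sub, eval_restrictLine, Polynomial.eval_mul, Polynomial.eval_pow,
    Polynomial.eval_X, zero_pow (Nat.sub_ne_zero_of_lt hj), zero_smul, add_zero] at h3
  simpa using h3

theorem exists_root_restrictLine {F : MvPolynomial (Fin n) ℂ} {d : ℕ} (hF : F.IsHomogeneous d)
    (hd : 0 < d) {v : Fin n → ℂ} (hv : eval v F ≠ 0) (y : Fin n → ℂ) :
    ∃ t : ℂ, eval (y + t • v) F = 0 := by
  by_cases hdeg : (restrictLine F y v).degree = 0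
  · refine absurd (eval_eq_zero_of_restrictLine (y := y)
      (a := (restrictLine F y v).coeff 0) hF hd
      fun t => ?_) hv
    rw [← eval_restrictLine, Polynomial.eq_C_of_degree_eq_zero hdeg]
    simp
  · obtain ⟨t, ht⟩ := IsAlgClosed.exists_root _ hdeg
    exact ⟨t, by rw [← eval_restrictLine]; exact ht⟩

/-- A line transversal to a hypersurface of degree at least two at some point meets it in a second
point. -/
theorem exists_second_root {F : MvPolynomial (Fin n) ℂ} {d : ℕ} (hF : F.IsHomogeneous d)
    (hd : 2 ≤ d) {y v : Fin n → ℂ} (hv : eval v F ≠ 0) (hy : eval y F = 0)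
    (hdir : dirDeriv F y v ≠ 0) : ∃ t : ℂ, t ≠ 0 ∧ eval (y + t • v) F = 0 := by
  obtain ⟨R, hR⟩ := exists_taylor F (fun i => Polynomial.C (y i)) (fun i => Polynomial.C (v i))
    Polynomial.X
  have h1 : aeval (fun i => Polynomial.C (y i)) F = (0 : Polynomial ℂ) := by
    have := comp_aeval_apply (f := y) (Algebra.ofId ℂ (Polynomial ℂ)) F
    rw [show aeval y F = 0 from hy, map_zero] at this
    exact this.symm
  have h2 : dirDeriv F (fun i => Polynomial.C (y i)) (fun i => Polynomial.C (v i)) =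
      Polynomial.C (dirDeriv F y v) :=
    (map_dirDeriv (Algebra.ofId ℂ (Polynomial ℂ)) F y v).symm
  rw [h1, h2, zero_add] at hR
  have hp : ∀ t, eval (y + t • v) F =
      t * (Polynomial.C (dirDeriv F y v) + Polynomial.X * R).eval t := by
    intro t
    rw [← eval_restrictLine, restrictLine, hR]
    simp only [Polynomial.eval_add, Polynomial.eval_mul, Polynomial.eval_pow, Polynomial.eval_X,
      Polynomial.eval_C]
    ring
  by_cases hdeg : (Polynomial.C (dirDeriv F y v) + Polynomial.X * R).degree = 0
  · refine absurd (eval_eq_zero_of_restrictLine (y := y) hF (by omega : 1 < d)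
      (a := (Polynomial.C (dirDeriv F y v) + Polynomial.X * R).coeff 0) fun t => ?_) hv
    rw [hp t]
    conv_lhs => rw [Polynomial.eq_C_of_degree_eq_zero hdeg]
    rw [Polynomial.eval_C, pow_one, mul_comm]
  · obtain ⟨t, ht⟩ := IsAlgClosed.exists_root _ hdeg
    refine ⟨t, ?_, by rw [hp, show Polynomial.eval t _ = 0 from ht, mul_zero]⟩
    rintro rfl
    refine hdir ?_
    simpa using ht

/-- A conical prime ideal of codimension one is generated by a homogeneous polynomial. -/
theorem IsSmoothCone.exists_homogeneous_generator {r m : ℕ}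
    {I : Ideal (MvPolynomial (Fin (r + 1)) ℂ)} (h : IsSmoothCone I m) (hm : m + 1 = r) :
    ∃ (d : ℕ) (F : MvPolynomial (Fin (r + 1)) ℂ), F ∈ I ∧ F ≠ 0 ∧ F.IsHomogeneous d ∧
      ∀ Q ∈ I, F ∣ Q := by
  have := h.prime
  let K := FractionRing (MvPolynomial (Fin (r + 1)) ℂ ⧸ I)
  let j : (MvPolynomial (Fin (r + 1)) ℂ ⧸ I) →ₐ[ℂ] K := IsScalarTower.toAlgHom ℂ _ K
  have hj : Function.Injective j := IsFractionRing.injective _ K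
  let u : Fin (r + 1) → K := fun i => j (coordFun I i)
  have haev : ∀ F : MvPolynomial (Fin (r + 1)) ℂ, aeval u F = j (Ideal.Quotient.mk I F) := by
    intro F
    rw [← aeval_coordFun, comp_aeval_apply]
  have hker : ∀ F : MvPolynomial (Fin (r + 1)) ℂ, aeval u F = 0 ↔ F ∈ I := by
    intro F
    rw [haev, map_eq_zero_iff j hj, Ideal.Quotient.eq_zero_iff_mem]
  have hd : Algebra.trdeg ℂ K = r := by
    rw [← trdeg_eq_trdeg_of_isFractionRing (A := ℂ) (R := MvPolynomial (Fin (r + 1)) ℂ ⧸ I) (K := ℂ),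
      h.trdeg_eq, hm]
  have hu : IntermediateField.adjoin ℂ (range u) = ⊤ := by
    rw [eq_top_iff]
    intro l _
    rw [IntermediateField.mem_adjoin_range_iff]
    obtain ⟨a, b, -, rfl⟩ := IsFractionRing.div_surjective (A := MvPolynomial (Fin (r + 1)) ℂ ⧸ I) l
    obtain ⟨a, rfl⟩ := Ideal.Quotient.mk_surjective a
    obtain ⟨b, rfl⟩ := Ideal.Quotient.mk_surjective b
    exact ⟨a, b, by rw [haev, haev]; rfl⟩
  obtain ⟨P, hP, hPu, hPdvd⟩ := exists_principal_relation hd hu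
  have hPI := (hker P).1 hPu
  obtain ⟨d, hd', hd0⟩ : ∃ d ≤ P.totalDegree, homogeneousComponent d P ≠ 0 := by
    by_contra! hcon
    refine hP.ne_zero ?_
    rw [← sum_homogeneousComponent P]
    exact Finset.sum_eq_zero fun d hd => hcon d (by simpa [Nat.lt_succ_iff] using hd)
  have hFI := h.conical P hPI d
  obtain ⟨T, hT⟩ := hPdvd _ ((hker _).2 hFI)
  have hT0 : T ≠ 0 := by rintro rfl; exact hd0 (by rw [hT, mul_zero])
  have hdeg : T.totalDegree = 0 := by
    have h1 := totalDegree_mul_of_isDomain hP.ne_zero hT0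
    have h2 := (homogeneousComponent_isHomogeneous d P).totalDegree_le
    rw [hT] at h2
    omega
  rw [totalDegree_eq_zero_iff_eq_C] at hdeg
  have hc : coeff 0 T ≠ 0 := fun h0 => hT0 (by rw [hdeg, h0, map_zero])
  refine ⟨d, homogeneousComponent d P, hFI, hd0, homogeneousComponent_isHomogeneous d P, ?_⟩
  intro Q hQ
  obtain ⟨S, rfl⟩ := hPdvd Q ((hker Q).2 hQ)
  refine ⟨C (coeff 0 T)⁻¹ * S, ?_⟩
  rw [hT, hdeg, coeff_C, if_pos rfl, mul_assoc, ← mul_assoc (C _) (C _) S, ← C_mul,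
    mul_inv_cancel₀ hc, C_1, one_mul]

end Hypersurface

section Cases

variable {r m : ℕ} {Y : Set (Pr r)}

theorem left_mem_lineThrough {n : ℕ} (x y : PrV n) : x ∈ lineThrough x y :=
  Submodule.subset_span (mem_insert _ _)

theorem right_mem_lineThrough {n : ℕ} (x y : PrV n) : y ∈ lineThrough x y :=
  Submodule.subset_span (mem_insert_of_mem _ rfl)

theorem isc_of_idealOf_eq_bot (hcl : IsClosed Y) (hY : secantVariety Y = univ)
    (hI : idealOf Y = ⊥) : ISC Y := by
  have hYuniv : ∀ x, x ∈ Y := by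
    intro x
    induction x using Projectivization.ind with
    | h v hv =>
      rw [← isZeroOf_idealOf_iff hcl hv, hI]
      intro F hF
      rw [(Submodule.mem_bot _).1 hF, map_zero]
  refine ⟨univ, isOpen_univ, dense_univ, fun z _ => ?_⟩
  have h1 : secantLines Y z = univ := by
    refine eq_univ_of_forall fun w => ?_
    rw [mem_secantLines]
    by_cases hzw : z = w
    · obtain ⟨y, hy⟩ : ∃ y, z ≠ y := by
        obtain ⟨x, -, y, -, hxy⟩ := exists_ne_of_secantVariety_eq_univ hY
        by_contra! hcon
        exact hxy ((hcon x).symm.trans (hcon y))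
      exact ⟨z, hYuniv z, y, hYuniv y, hy, left_mem_lineThrough _ _,
        hzw ▸ left_mem_lineThrough _ _⟩
    · exact ⟨z, hYuniv z, w, hYuniv w, hzw, left_mem_lineThrough _ _, right_mem_lineThrough _ _⟩
  rw [show secantCone Y z = closure (secantLines Y z) from rfl, h1, closure_univ]
  exact isIrreducible_univ_prV r.succ_pos

theorem isc_of_hypersurface (hcl : IsClosed Y) (h : IsSmoothCone (idealOf Y) m)
    (hY : secantVariety Y = univ) (hm : m + 1 = r) : ISC Y := by
  have hprime := h.prime
  obtain ⟨d, F, hFI, hF0, hF, hdvd⟩ := h.exists_homogeneous_generator hm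
  have hzero : ∀ y, eval y F = 0 → IsZeroOf (idealOf Y) y := by
    intro y hy Q hQ
    obtain ⟨T, rfl⟩ := hdvd Q hQ
    rw [map_mul, show aeval y F = 0 from hy, zero_mul]
  have hd2 : 2 ≤ d := by
    by_contra hlt
    have hconst : ∀ G : MvPolynomial (Fin (r + 1)) ℂ, G.IsHomogeneous 0 → G = C (coeff 0 G) :=
      fun G hG => totalDegree_eq_zero_iff_eq_C.1 (Nat.le_zero.1 hG.totalDegree_le)
    have hd : d = 0 ∨ d = 1 := by omega
    rcases hd with rfl | rfl
    · have h1 := hconst F hF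
      have hc : coeff 0 F ≠ 0 := fun h0 => hF0 (by rw [h1, h0, map_zero])
      rw [h1] at hFI
      exact hprime.ne_top (Ideal.eq_top_of_isUnit_mem _ hFI ((isUnit_iff_ne_zero.2 hc).map C))
    · obtain ⟨L, _, _, x, y, hp⟩ := h.exists_isConePair
      have hinj := injective_aeval_add hY hcl hp (z := fun i => x i + y i) fun i => rfl
      have hE := hF.sum_X_mul_pderiv
      have hpd : ∀ i, pderiv i F = C (coeff 0 (pderiv i F)) := fun i => hconst _ (hF.pderiv)
      have hℓ := hp.nondegenerate h hinj (fun i => coeff 0 (pderiv i F)) (fun v hv => by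
        have h1 := congrArg (aeval v) hE
        rw [map_sum, map_nsmul, hv F hFI, smul_zero] at h1
        rw [← h1]
        refine Finset.sum_congr rfl fun i _ => ?_
        conv_rhs => rw [hpd i]
        rw [map_mul, aeval_X, aeval_C, mul_comm]
        rfl)
      refine hF0 ?_
      rw [one_smul] at hE
      rw [← hE]
      refine Finset.sum_eq_zero fun i _ => ?_
      have h2 : coeff 0 (pderiv i F) = 0 := congrFun hℓ i
      rw [hpd i, h2, map_zero, mul_zero]
  refine ⟨(pZero F)ᶜ, (isClosed_pZero _).isOpen_compl, dense_pZero_compl r.succ_pos hF0,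
    fun z hz => ?_⟩
  obtain ⟨v, hv, rfl, hvF⟩ := exists_lift_of_notMem_pZero hz
  suffices huniv : closure (secantLines Y (Projectivization.mk ℂ v hv)) = univ by
    rw [show secantCone Y (Projectivization.mk ℂ v hv) =
      closure (secantLines Y (Projectivization.mk ℂ v hv)) from rfl, huniv]
    exact isIrreducible_univ_prV r.succ_pos
  have hmul : ∀ (y : Fin (r + 1) → ℂ) (s : ℂ), eval y F = 0 → s • y ≠ v := by
    rintro y s hy rfl
    have h1 : eval (s • y) F = s ^ d * eval y F := aeval_smul_homogeneous hF s y
    rw [hy, mul_zero] at h1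
    exact hvF h1
  have hne : ∀ (y : Fin (r + 1) → ℂ) (t : ℂ), y ≠ 0 → eval y F = 0 → y + t • v ≠ 0 := by
    intro y t hy0 hy h0
    by_cases ht : t = 0
    · rw [ht, zero_smul, add_zero] at h0
      exact hy0 h0
    · refine hmul y (-t⁻¹) hy ?_
      have h1 : y = -(t • v) := eq_neg_of_add_eq_zero_left h0
      rw [h1, neg_smul_neg, smul_smul, inv_mul_cancel₀ ht, one_smul]
  have hline : ∀ (y : Fin (r + 1) → ℂ) (hy0 : y ≠ 0) (hy : eval y F = 0), dirDeriv F y v ≠ 0 →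
      ∀ t : ℂ, Projectivization.mk ℂ (y + t • v) (hne y t hy0 hy) ∈
        secantLines Y (Projectivization.mk ℂ v hv) := by
    intro y hy0 hy hdir t
    obtain ⟨s, hs, hsF⟩ := exists_second_root hF hd2 hvF hy hdir
    have hv' : v = (-s⁻¹) • y + s⁻¹ • (y + s • v) := by
      rw [smul_add, smul_smul, inv_mul_cancel₀ hs, one_smul, neg_smul, neg_add_cancel_left]
    rw [mem_secantLines]
    refine ⟨_, (isZeroOf_idealOf_iff hcl hy0).1 (hzero y hy), _,
      (isZeroOf_idealOf_iff hcl (hne y s hy0 hy)).1 (hzero _ hsF), fun heq => ?_,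
      (mk_mem_lineThrough hy0 (hne y s hy0 hy) hv).2 ⟨_, _, hv'⟩,
      (mk_mem_lineThrough hy0 (hne y s hy0 hy) _).2 ⟨1 + t * (-s⁻¹), t * s⁻¹, ?_⟩⟩
    · rw [Projectivization.mk_eq_mk_iff'] at heq
      obtain ⟨c, hc⟩ := heq
      refine hmul (y + s • v) (-s⁻¹ * c + s⁻¹) hsF ?_
      rw [add_smul, mul_smul, hc]
      exact hv'.symm
    · conv_lhs => rw [hv']
      rw [smul_add, add_smul, one_smul, smul_smul, smul_smul, add_assoc]
  have hdirI : (∑ i, pderiv i F * C (v i)) ∉ idealOf Y := by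
    have hhom : (∑ i, pderiv i F * C (v i)).IsHomogeneous (d - 1) :=
      IsHomogeneous.sum _ _ _ fun i _ => by
        have := (hF.pderiv (i := i)).mul (isHomogeneous_C (Fin (r + 1)) (v i))
        rwa [add_zero] at this
    have hne0 : (∑ i, pderiv i F * C (v i)) ≠ 0 := by
      intro h0
      have h1 := congrArg (eval v) h0
      have h2 := congrArg (eval v) hF.sum_X_mul_pderiv
      rw [map_sum, map_zero] at h1
      rw [map_sum, map_nsmul] at h2
      simp only [map_mul, eval_X, eval_C] at h1 h2
      have h3 : d • eval v F = 0 := by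
        rw [← h2, ← h1]
        exact Finset.sum_congr rfl fun i _ => mul_comm _ _
      rw [nsmul_eq_mul] at h3
      exact mul_ne_zero (by exact_mod_cast (by omega : d ≠ 0)) hvF h3
    intro hmem
    obtain ⟨T, hT⟩ := hdvd _ hmem
    have hT0 : T ≠ 0 := by rintro rfl; exact hne0 (by rw [hT, mul_zero])
    have h1 := totalDegree_mul_of_isDomain hF0 hT0
    rw [← hT, hF.totalDegree hF0] at h1
    have h2 := hhom.totalDegree_le
    omega
  refine eq_univ_of_forall fun x => mem_closure_iff_pZero.2 fun G hG => ?_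
  have hshift : ∀ t : ℂ, aeval (fun i => X i + C (t * v i)) G ∈ idealOf Y := by
    intro t
    refine (hprime.mem_or_mem (h.mem_of_vanish
      ((∑ i, pderiv i F * C (v i)) * aeval (fun i => X i + C (t * v i)) G)
      fun y hy0 hyI => ?_)).resolve_left hdirI
    rw [map_mul]
    by_cases hdir : dirDeriv F y v = 0
    · have h1 : aeval y (∑ i, pderiv i F * C (v i)) = dirDeriv F y v := by
        rw [map_sum, dirDeriv]
        exact Finset.sum_congr rfl fun i _ => by rw [map_mul, aeval_C]; rfl
      rw [h1, hdir, zero_mul]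
    · have h1 := hG (hline y hy0 (hyI F hFI) hdir t) _ (hne y t hy0 (hyI F hFI)) rfl
      have h2 : aeval y (aeval (fun i => X i + C (t * v i)) G) = eval (y + t • v) G := by
        rw [comp_aeval_apply]
        rw [show (fun i => aeval y (X i + C (t * v i) : MvPolynomial (Fin (r + 1)) ℂ)) = y + t • v
          from funext fun i => by rw [map_add, aeval_X, aeval_C]; rfl]
        rfl
      rw [h2, h1, mul_zero]
  intro w hw _
  obtain ⟨t, ht⟩ := exists_root_restrictLine hF (by omega) hvF w
  have h1 := hzero _ ht _ (hshift (-t))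
  rw [comp_aeval_apply] at h1
  rw [show (fun i => aeval (w + t • v) (X i + C (-t * v i) : MvPolynomial (Fin (r + 1)) ℂ)) = w
    from funext fun i => by
      rw [map_add, aeval_X, aeval_C]
      change w i + t * v i + -t * v i = w i
      ring] at h1
  exact h1

theorem idealOf_eq_bot_iff (h : IsSmoothCone (idealOf Y) m) : idealOf Y = ⊥ ↔ m = r := by
  have := h.prime
  have hpoly : Algebra.trdeg ℂ (MvPolynomial (Fin (r + 1)) ℂ) = (r + 1 : ℕ) := by
    rw [MvPolynomial.trdeg_of_isDomain]; simp
  have htr := h.trdeg_eq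
  constructor
  · intro h0
    have hinj : Function.Injective (Ideal.Quotient.mkₐ ℂ (idealOf Y)) := by
      rw [injective_iff_map_eq_zero]
      intro F hF
      have : F ∈ idealOf Y := Ideal.Quotient.eq_zero_iff_mem.1 hF
      rw [h0] at this
      exact (Submodule.mem_bot _).1 this
    have h1 := trdeg_le_of_injective _ hinj
    have h2 := trdeg_le_of_surjective (Ideal.Quotient.mkₐ ℂ (idealOf Y))
      Ideal.Quotient.mk_surjective
    rw [htr, hpoly] at h1 h2
    have h3 : r + 1 ≤ m + 1 := by exact_mod_cast h1
    have h4 : m + 1 ≤ r + 1 := by exact_mod_cast h2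
    omega
  · rintro rfl
    by_contra h0
    have h1 := succ_le_trdeg_of_le_trdeg_quotient h0 htr.ge
    rw [hpoly] at h1
    have h2 : m + 1 + 1 ≤ m + 1 := by exact_mod_cast h1
    omega

theorem IsSmoothCone.le {n : ℕ} {I : Ideal (MvPolynomial (Fin n) ℂ)} (h : IsSmoothCone I m) :
    m + 1 ≤ n := by
  obtain ⟨v, hv, hvI⟩ := h.exists_ne_zero
  have h1 := Submodule.finrank_le (tangentSpace I v)
  rwa [h.finrank_tangentSpace v hv hvI, Module.finrank_fin_fun] at h1

end Cases

/-- **Corollary 3 (temp).**  Let `Y ⊆ ℙ^r` be a smooth, non-projectable subvariety with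
`dim Y > (2/3)(r-1)`.  Then `Y` has the irreducible secant cone (ISC) property: the
generic fibre of the natural map `f : I_Y → ℙ^r` (i.e. the secant cone of `Y` at a
generic point of `ℙ^r`) is irreducible. -/
theorem isc_of_smooth_large_dimension
    (r m : ℕ) (Y : Set (Pr r))
    (hcl : IsClosed Y) (hirr : IsIrreducible Y) (hsm : IsSmoothSet Y)
    (hdim : pdim Y = ((m : ℕ∞) : WithBot ℕ∞))
    (hnonproj : secantVariety Y = Set.univ)
    (hbig : 2 * (r - 1) < 3 * m) :
    ISC Y := by
  have h := isSmoothCone_idealOf hcl hirr hsm hdim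
  have hle := h.le
  by_cases hm : m = r
  · exact isc_of_idealOf_eq_bot hcl hnonproj ((idealOf_eq_bot_iff h).2 hm)
  by_cases hm' : m + 1 = r
  · exact isc_of_hypersurface hcl h hnonproj hm'
  · exact isc_of_codim_ge_two hcl h hnonproj (fun h0 => hm ((idealOf_eq_bot_iff h).1 h0))
      (by omega) (by omega)

end
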